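/- Let Ω be a bounded open connected subset of ℝ², let f ∈ BV_loc(Ω) ∩ C⁰(Ω) satisfy |f(x)| > 0 for every x ∈ Ω, and let u ∈ C⁰(Ω) be a viscosity solution of -Δ_∞ u = f in Ω. Then for every α > 3/2 the function |Du|^{2α-6} belongs to L¹_loc(Ω), and |Du|^{2α-6} ≤ (1/α) f^{-2} |D|Du|^α|² almost everywhere in Ω, where D|Du|^α denotes the weak gradient of |Du|^α (which exists in L²_loc(Ω;ℝ²)). -/

import Mathlib

open MeasureTheory Metric
open scoped ENNReal RealInnerProductSpace BigOperators

noncomputable section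

abbrev E2 : Type := EuclideanSpace ℝ (Fin 2)

/-- Partial derivative in the `i`-th coordinate direction. -/
def pd (i : Fin 2) (φ : E2 → ℝ) (x : E2) : ℝ :=
  fderiv ℝ φ x (EuclideanSpace.single i 1)

/-- Second partial derivative. -/
def pd2 (i j : Fin 2) (φ : E2 → ℝ) (x : E2) : ℝ :=
  pd i (pd j φ) x

/-- The ∞-Laplacian `Δ_∞ φ = Σ_{i,j} φ_i φ_j φ_{ij}`. -/
def infLap (φ : E2 → ℝ) (x : E2) : ℝ :=
  ∑ i : Fin 2, ∑ j : Fin 2, pd i φ x * pd j φ x * pd2 i j φ x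

/-- The ordinary Laplacian. -/
def lap (φ : E2 → ℝ) (x : E2) : ℝ := pd2 0 0 φ x + pd2 1 1 φ x

/-- `|Dφ|²`. -/
def gradSq (φ : E2 → ℝ) (x : E2) : ℝ := ∑ i : Fin 2, (pd i φ x) ^ 2

/-- `|D²φ Dφ|²`. -/
def hessGradSq (φ : E2 → ℝ) (x : E2) : ℝ :=
  ∑ i : Fin 2, (∑ j : Fin 2, pd2 i j φ x * pd j φ x) ^ 2

/-- Viscosity solution of `-Δ_∞ u = f` on `Ω`. -/
def IsViscositySol (Ω : Set E2) (f u : E2 → ℝ) : Prop :=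
  ∀ φ : E2 → ℝ, ContDiff ℝ 2 φ →
    (∀ x₀ ∈ Ω, IsLocalMaxOn (fun y => u y - φ y) Ω x₀ → -infLap φ x₀ ≤ f x₀) ∧
    (∀ x₀ ∈ Ω, IsLocalMinOn (fun y => u y - φ y) Ω x₀ → f x₀ ≤ -infLap φ x₀)

/-- `G` is a weak gradient of `v` on `Ω`. -/
def HasWeakGradOn (v : E2 → ℝ) (G : E2 → E2) (Ω : Set E2) : Prop :=
  LocallyIntegrableOn v Ω volume ∧ LocallyIntegrableOn (fun x => ‖G x‖) Ω volume ∧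
    ∀ φ : E2 → ℝ, ContDiff ℝ (⊤ : ℕ∞) φ → HasCompactSupport φ → tsupport φ ⊆ Ω →
      ∀ i : Fin 2, ∫ x in Ω, v x * pd i φ x = - ∫ x in Ω, G x i * φ x

/-- `G ∈ L^p_loc(Ω; ℝ²)`. -/
def MemLpLocOn (G : E2 → E2) (p : ℝ) (Ω : Set E2) : Prop :=
  ∀ K : Set E2, K ⊆ Ω → IsCompact K → IntegrableOn (fun x => ‖G x‖ ^ p) K volume

/-- `v ∈ W^{1,p}_loc(Ω)`: there is a weak gradient of `v` lying in `L^p_loc(Ω;ℝ²)`. -/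
def MemW1pLoc (v : E2 → ℝ) (p : ℝ) (Ω : Set E2) : Prop :=
  ∃ G : E2 → E2, HasWeakGradOn v G Ω ∧ MemLpLocOn G p Ω

/-- Divergence of a vector field. -/
def divg (Φ : E2 → E2) (x : E2) : ℝ := ∑ i : Fin 2, pd i (fun y => Φ y i) x

/-- The admissible pairings defining the BV norm of `f` on `U`. -/
def bvPairings (f : E2 → ℝ) (U : Set E2) : Set ℝ :=
  { r | ∃ Φ : E2 → E2, ContDiff ℝ 1 Φ ∧ HasCompactSupport Φ ∧ tsupport Φ ⊆ U ∧
      (∀ x, ‖Φ x‖ ≤ 1) ∧ r = ∫ x in U, f x * divg Φ x }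

/-- `‖f‖_{BV(U)}`. -/
def bvNorm (f : E2 → ℝ) (U : Set E2) : ℝ := sSup (bvPairings f U)

/-- `f ∈ BV_loc(Ω)`. -/
def BVloc (f : E2 → ℝ) (Ω : Set E2) : Prop :=
  ∀ U : Set E2, IsOpen U → IsCompact (closure U) → closure U ⊆ Ω →
    BddAbove (bvPairings f U)

/-- `sup_s |h|`. -/
def supAbsOn (h : E2 → ℝ) (s : Set E2) : ℝ := sSup ((fun y => |h y|) '' s)

/-! ### The algebra of smooth functions on the plane -/

/-- The algebra of smooth functions on the plane. -/
def smAlg : Subalgebra ℝ (E2 → ℝ) where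
  carrier := {v | ContDiff ℝ (⊤ : ℕ∞) v}
  mul_mem' {a b} ha hb := by
    simp only [Set.mem_ofPred_eq] at *; exact ContDiff.mul ha hb
  add_mem' {a b} ha hb := by
    simp only [Set.mem_ofPred_eq] at *; exact ContDiff.add ha hb
  algebraMap_mem' := fun r => (contDiff_const : ContDiff ℝ (⊤ : ℕ∞) fun _ : E2 => r)

abbrev Sm : Type := smAlg

instance : CoeFun Sm fun _ => E2 → ℝ := ⟨fun v => v.1⟩

/-- The `i`-th coordinate vector. -/
def ev (i : Fin 2) : E2 := EuclideanSpace.single i 1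

lemma Sm.contDiff (v : Sm) : ContDiff ℝ (⊤ : ℕ∞) v := v.2

lemma Sm.continuous (v : Sm) : Continuous v := v.contDiff.continuous

lemma Sm.differentiable (v : Sm) : Differentiable ℝ v :=
  v.contDiff.differentiable (by simp)

lemma Sm.ext {v w : Sm} (h : ∀ x, v x = w x) : v = w := Subtype.ext (funext h)

@[simp] lemma Sm.add_apply (v w : Sm) (x : E2) : (v + w) x = v x + w x := rfl
@[simp] lemma Sm.sub_apply (v w : Sm) (x : E2) : (v - w) x = v x - w x := rfl
@[simp] lemma Sm.neg_apply (v : Sm) (x : E2) : (-v) x = -v x := rfl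
@[simp] lemma Sm.mul_apply (v w : Sm) (x : E2) : (v * w) x = v x * w x := rfl
@[simp] lemma Sm.smul_apply (c : ℝ) (v : Sm) (x : E2) : (c • v) x = c * v x := rfl
@[simp] lemma Sm.zero_apply (x : E2) : (0 : Sm) x = 0 := rfl
@[simp] lemma Sm.one_apply (x : E2) : (1 : Sm) x = 1 := rfl
@[simp] lemma Sm.pow_apply (v : Sm) (n : ℕ) (x : E2) : (v ^ n) x = v x ^ n := rfl
@[simp] lemma Sm.natCast_apply (n : ℕ) (x : E2) : (n : Sm) x = n := rfl
@[simp] lemma Sm.ofNat_apply (n : ℕ) [n.AtLeastTwo] (x : E2) :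
    (OfNat.ofNat n : Sm) x = OfNat.ofNat n := rfl
@[simp] lemma Sm.two_apply (x : E2) : (2 : Sm) x = 2 := rfl
@[simp] lemma Sm.sum_apply {ι : Type*} (s : Finset ι) (v : ι → Sm) (x : E2) :
    (∑ i ∈ s, v i) x = ∑ i ∈ s, v i x := by
  classical
  induction s using Finset.induction_on with
  | empty => simp
  | insert a s ha ih => rw [Finset.sum_insert ha, Finset.sum_insert ha, ← ih]; rfl

lemma pd_smooth {v : E2 → ℝ} (hv : ContDiff ℝ (⊤ : ℕ∞) v) (i : Fin 2) :
    ContDiff ℝ (⊤ : ℕ∞) (pd i v) := by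
  unfold pd
  exact (hv.fderiv_right (m := ((⊤ : ℕ∞) : WithTop ℕ∞)) (by simp)).clm_apply contDiff_const

/-- Partial derivative as a linear endomorphism of the smooth functions. -/
def D (i : Fin 2) : Sm →ₗ[ℝ] Sm where
  toFun v := ⟨pd i v, pd_smooth v.2 i⟩
  map_add' v w := Sm.ext fun x => by
    change fderiv ℝ (fun y => v y + w y) x _ = fderiv ℝ v x _ + fderiv ℝ w x _
    rw [fderiv_fun_add v.differentiable.differentiableAt w.differentiable.differentiableAt]; rfl
  map_smul' c v := Sm.ext fun x => by
    change fderiv ℝ (fun y => c • v y) x _ = c * fderiv ℝ v x _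
    rw [fderiv_fun_const_smul v.differentiable.differentiableAt]; rfl

lemma D_apply (i : Fin 2) (v : Sm) (x : E2) : D i v x = pd i v x := rfl

lemma D_apply' (i : Fin 2) (v : Sm) (x : E2) : D i v x = fderiv ℝ v x (ev i) := rfl

@[simp] lemma D_mul (i : Fin 2) (v w : Sm) : D i (v * w) = D i v * w + v * D i w :=
  Sm.ext fun x => by
    change fderiv ℝ (fun y => v y * w y) x _ = fderiv ℝ v x _ * w x + v x * fderiv ℝ w x _
    rw [fderiv_fun_mul v.differentiable.differentiableAt w.differentiable.differentiableAt]
    simp; ring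

@[simp] lemma D_one (i : Fin 2) : D i 1 = 0 :=
  Sm.ext fun x => by
    change fderiv ℝ (fun _ : E2 => (1 : ℝ)) x _ = 0
    simp

/-- Constant functions. -/
def cst (c : ℝ) : Sm := algebraMap ℝ Sm c

@[simp] lemma cst_apply (c : ℝ) (x : E2) : cst c x = c := rfl

lemma smul_eq_cst (c : ℝ) (v : Sm) : c • v = cst c * v := Algebra.smul_def c v

lemma cst_eq (c : ℝ) : cst c = c • (1 : Sm) := by rw [smul_eq_cst, mul_one]

@[simp] lemma D_cst (i : Fin 2) (c : ℝ) : D i (cst c) = 0 := by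
  rw [cst_eq, map_smul, D_one, smul_zero]

@[simp] lemma D_two (i : Fin 2) : D i (2 : Sm) = 0 := by
  have : (2 : Sm) = cst 2 := Sm.ext fun x => rfl
  rw [this, D_cst]

@[simp] lemma D_sq (i : Fin 2) (v : Sm) : D i (v ^ 2) = 2 * v * D i v := by
  rw [sq, D_mul]; ring

lemma Sm.hasFDerivAt (v : Sm) (x : E2) : HasFDerivAt v (fderiv ℝ v x) x :=
  (v.differentiable x).hasFDerivAt

lemma D_comm (i j : Fin 2) (v : Sm) : D i (D j v) = D j (D i v) := by
  refine Sm.ext fun x => ?_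
  have h1 : ∀ k l : Fin 2, D k (D l v) x = fderiv ℝ (fderiv ℝ v) x (ev k) (ev l) := by
    intro k l
    rw [D_apply']
    have hd : DifferentiableAt ℝ (fderiv ℝ v) x :=
      (v.contDiff.fderiv_right (m := 1) (by norm_cast)).differentiable
        (by norm_num) x
    have : (fun y => D l v y) = fun y => fderiv ℝ v y (ev l) := rfl
    change fderiv ℝ (fun y => fderiv ℝ v y (ev l)) x (ev k) = _
    rw [fderiv_clm_apply hd (differentiableAt_const _)]
    simp
  rw [h1, h1]
  exact (v.contDiff.contDiffAt.isSymmSndFDerivAt (by simp; norm_cast)).eq _ _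

@[simp] lemma D_comm10 (v : Sm) : D 1 (D 0 v) = D 0 (D 1 v) := D_comm 1 0 v

/-- `Σ_{ij} X_i Y_j Z_ij`. -/
def Tri (X Y Z : Sm) : Sm :=
  D 0 X * D 0 Y * D 0 (D 0 Z) + D 0 X * D 1 Y * D 0 (D 1 Z) + D 1 X * D 0 Y * D 0 (D 1 Z)
    + D 1 X * D 1 Y * D 1 (D 1 Z)

/-- The Laplacian. -/
def Lap : Sm →ₗ[ℝ] Sm := D 0 ∘ₗ D 0 + D 1 ∘ₗ D 1

lemma Lap_def (v : Sm) : Lap v = D 0 (D 0 v) + D 1 (D 1 v) := rfl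

lemma infLap_eq (v : Sm) (x : E2) : infLap v x = Tri v v v x := by
  have h : ∀ i j, pd2 i j v x = D i (D j v) x := fun i j => rfl
  simp only [infLap, Fin.sum_univ_two, h, ← D_apply, Tri, D_comm10, Sm.add_apply, Sm.mul_apply]
  ring

lemma D_Lap (i : Fin 2) (v : Sm) : D i (Lap v) = Lap (D i v) := by
  simp only [Lap_def, map_add, D_comm i 0, D_comm i 1]

lemma Tri_symm (X Y Z : Sm) : Tri X Y Z = Tri Y X Z := by unfold Tri; ring

lemma D_Tri (i : Fin 2) (X Y Z : Sm) :
    D i (Tri X Y Z) = Tri (D i X) Y Z + Tri X (D i Y) Z + Tri X Y (D i Z) := by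
  simp only [Tri, map_add, D_mul, D_comm i 0, D_comm i 1]
  ring

lemma Tri_add₁ (X X' Y Z : Sm) : Tri (X + X') Y Z = Tri X Y Z + Tri X' Y Z := by
  simp only [Tri, map_add]; ring
lemma Tri_add₂ (X Y Y' Z : Sm) : Tri X (Y + Y') Z = Tri X Y Z + Tri X Y' Z := by
  simp only [Tri, map_add]; ring
lemma Tri_add₃ (X Y Z Z' : Sm) : Tri X Y (Z + Z') = Tri X Y Z + Tri X Y Z' := by
  simp only [Tri, map_add]; ring
lemma Tri_smul₁ (c : ℝ) (X Y Z : Sm) : Tri (c • X) Y Z = c • Tri X Y Z := by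
  simp only [Tri, smul_eq_cst, D_mul, D_cst, zero_mul, zero_add]; ring
lemma Tri_smul₂ (c : ℝ) (X Y Z : Sm) : Tri X (c • Y) Z = c • Tri X Y Z := by
  simp only [Tri, smul_eq_cst, D_mul, D_cst, zero_mul, zero_add]; ring
lemma Tri_smul₃ (c : ℝ) (X Y Z : Sm) : Tri X Y (c • Z) = c • Tri X Y Z := by
  simp only [Tri, smul_eq_cst, D_mul, D_cst, zero_mul, zero_add]; ring

lemma Lap_Tri (X Y Z : Sm) : Lap (Tri X Y Z) = Tri (Lap X) Y Z + Tri X (Lap Y) Z +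
    Tri X Y (Lap Z) + 2 * (Tri (D 0 X) (D 0 Y) Z + Tri (D 0 X) Y (D 0 Z) + Tri X (D 0 Y) (D 0 Z)
      + Tri (D 1 X) (D 1 Y) Z + Tri (D 1 X) Y (D 1 Z) + Tri X (D 1 Y) (D 1 Z)) := by
  simp only [Lap_def, D_Tri, map_add, Tri_add₁, Tri_add₂, Tri_add₃]
  ring

/-- `|D^k w|²`. -/
def dd : ℕ → Sm → Sm
  | 0, w => w ^ 2
  | k + 1, w => dd k (D 0 w) + dd k (D 1 w)

lemma dd_zero (w : Sm) : dd 0 w = w ^ 2 := rfl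
lemma dd_succ (k : ℕ) (w : Sm) : dd (k + 1) w = dd k (D 0 w) + dd k (D 1 w) := rfl
lemma dd_one (w : Sm) : dd 1 w = D 0 w ^ 2 + D 1 w ^ 2 := rfl
lemma dd_two (w : Sm) : dd 2 w = D 0 (D 0 w) ^ 2 + 2 * D 0 (D 1 w) ^ 2 + D 1 (D 1 w) ^ 2 := by
  simp only [dd_succ, dd_zero, D_comm10]; ring

lemma dd_nonneg (k : ℕ) (w : Sm) (x : E2) : 0 ≤ dd k w x := by
  induction k generalizing w with
  | zero => exact sq_nonneg (w x)
  | succ k ih => exact add_nonneg (ih _) (ih _)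

lemma dd_smul (k : ℕ) (c : ℝ) (w : Sm) : dd k (c • w) = c ^ 2 • dd k w := by
  induction k generalizing w with
  | zero => simp only [dd_zero]; exact Sm.ext fun x => by simp; ring
  | succ k ih => simp only [dd_succ, map_smul, ih, smul_add]

lemma dd_add_le {θ : ℝ} (hθ : 0 < θ) (k : ℕ) (v w : Sm) (x : E2) :
    dd k (v + w) x ≤ (1 + θ) * dd k v x + (1 + θ⁻¹) * dd k w x := by
  induction k generalizing v w with
  | zero =>
    simp only [dd_zero, Sm.pow_apply, Sm.add_apply]
    have h := sq_nonneg (θ * v x - w x)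
    have : θ⁻¹ * (θ * v x - w x) ^ 2 = θ * v x ^ 2 - 2 * v x * w x + θ⁻¹ * w x ^ 2 := by
      field_simp; ring
    have h2 : 0 ≤ θ⁻¹ * (θ * v x - w x) ^ 2 := by positivity
    nlinarith
  | succ k ih =>
    simp only [dd_succ, map_add, Sm.add_apply]
    linarith [ih (D 0 v) (D 0 w), ih (D 1 v) (D 1 w)]

lemma dd_add_le_two (k : ℕ) (v w : Sm) (x : E2) :
    dd k (v + w) x ≤ 2 * dd k v x + 2 * dd k w x := by
  have := dd_add_le one_pos k v w x
  norm_num at this; linarith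

lemma dd_sub_le_two (k : ℕ) (v w : Sm) (x : E2) :
    dd k (v - w) x ≤ 2 * dd k v x + 2 * dd k w x := by
  have h := dd_add_le_two k v ((-1 : ℝ) • w) x
  rw [dd_smul] at h
  have e : v + (-1 : ℝ) • w = v - w := by simp [sub_eq_add_neg]
  rw [e] at h
  simpa using h

lemma dd_Lap_le (k : ℕ) (w : Sm) (x : E2) : dd k (Lap w) x ≤ 2 * dd (k + 2) w x := by
  have h := dd_add_le_two k (D 0 (D 0 w)) (D 1 (D 1 w)) x
  simp only [dd_succ, Sm.add_apply, Lap_def]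
  linarith [dd_nonneg k (D 0 (D 1 w)) x, dd_nonneg k (D 1 (D 0 w)) x]

/-- Bound for derivatives of `Tri`. -/
def triB : ℕ → ℕ → ℕ → ℕ → Sm → Sm → Sm → Sm
  | 0, a, b, c, X, Y, Z => dd a X * dd b Y * dd c Z
  | k + 1, a, b, c, X, Y, Z => (3 : ℝ) • (triB k (a + 1) b c X Y Z + triB k a (b + 1) c X Y Z +
      triB k a b (c + 1) X Y Z)

lemma dd_add3_le (k : ℕ) (u v w : Sm) (x : E2) :
    dd k (u + v + w) x ≤ 3 * (dd k u x + dd k v x + dd k w x) := by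
  have h1 := dd_add_le (θ := 1 / 2) (by norm_num) k (u + v) w x
  have h2 := dd_add_le one_pos k u v x
  norm_num at h1 h2
  linarith

lemma Tri_sq_le (X Y Z : Sm) (x : E2) : (Tri X Y Z x) ^ 2 ≤ dd 1 X x * dd 1 Y x * dd 2 Z x := by
  simp only [Tri, dd_one, dd_two, Sm.add_apply, Sm.mul_apply, Sm.pow_apply, Sm.two_apply]
  generalize D 0 X x = a
  generalize D 1 X x = b
  generalize D 0 Y x = c
  generalize D 1 Y x = d
  generalize D 0 (D 0 Z) x = p
  generalize D 0 (D 1 Z) x = q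
  generalize D 1 (D 1 Z) x = r
  have h : (a * c * p + a * d * q + b * c * q + b * d * r) ^ 2 ≤
      ((a * c) ^ 2 + (a * d) ^ 2 + (b * c) ^ 2 + (b * d) ^ 2) * (p ^ 2 + q ^ 2 + q ^ 2 + r ^ 2) := by
    nlinarith [sq_nonneg (a * c * q - a * d * p), sq_nonneg (a * c * q - b * c * p),
      sq_nonneg (a * c * r - b * d * p), sq_nonneg (a * d * q - b * c * q),
      sq_nonneg (a * d * r - b * d * q), sq_nonneg (b * c * r - b * d * q)]
  linarith

lemma triB_eq (k a b c : ℕ) (X Y Z : Sm) :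
    triB k (a + 1) b c X Y Z = triB k a b c (D 0 X) Y Z + triB k a b c (D 1 X) Y Z ∧
    triB k a (b + 1) c X Y Z = triB k a b c X (D 0 Y) Z + triB k a b c X (D 1 Y) Z ∧
    triB k a b (c + 1) X Y Z = triB k a b c X Y (D 0 Z) + triB k a b c X Y (D 1 Z) := by
  induction k generalizing a b c X Y Z with
  | zero => simp only [triB, dd_succ]; refine ⟨?_, ?_, ?_⟩ <;> ring
  | succ k ih =>
    simp only [triB, ← smul_add]
    refine ⟨?_, ?_, ?_⟩ <;> congr 1
    · rw [(ih (a + 1) b c X Y Z).1, (ih a (b + 1) c X Y Z).1, (ih a b (c + 1) X Y Z).1]; ring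
    · rw [(ih (a + 1) b c X Y Z).2.1, (ih a (b + 1) c X Y Z).2.1, (ih a b (c + 1) X Y Z).2.1]; ring
    · rw [(ih (a + 1) b c X Y Z).2.2, (ih a (b + 1) c X Y Z).2.2, (ih a b (c + 1) X Y Z).2.2]; ring

lemma dd_Tri_le (k : ℕ) (X Y Z : Sm) (x : E2) : dd k (Tri X Y Z) x ≤ triB k 1 1 2 X Y Z x := by
  induction k generalizing X Y Z with
  | zero => exact Tri_sq_le X Y Z x
  | succ k ih =>
    simp only [dd_succ, triB, D_Tri, Sm.add_apply, Sm.smul_apply]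
    rw [(triB_eq k 1 1 2 X Y Z).1, (triB_eq k 1 1 2 X Y Z).2.1, (triB_eq k 1 1 2 X Y Z).2.2]
    simp only [Sm.add_apply]
    have h0 := dd_add3_le k (Tri (D 0 X) Y Z) (Tri X (D 0 Y) Z) (Tri X Y (D 0 Z)) x
    have h1 := dd_add3_le k (Tri (D 1 X) Y Z) (Tri X (D 1 Y) Z) (Tri X Y (D 1 Z)) x
    linarith [ih (D 0 X) Y Z, ih X (D 0 Y) Z, ih X Y (D 0 Z), ih (D 1 X) Y Z, ih X (D 1 Y) Z,
      ih X Y (D 1 Z)]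

section Periodic

/-! ### Periodic functions and integration over a cell -/

/-- The point with coordinates `s` and `t`. -/
def pt (s t : ℝ) : E2 := !₂[s, t]

@[simp] lemma pt_zero (s t : ℝ) : pt s t 0 = s := rfl
@[simp] lemma pt_one (s t : ℝ) : pt s t 1 = t := rfl

lemma E2.ext {x y : E2} (h0 : x 0 = y 0) (h1 : x 1 = y 1) : x = y := by
  ext i; fin_cases i <;> assumption

@[simp] lemma ev_zero_zero : ev 0 0 = 1 := by simp [ev]
@[simp] lemma ev_zero_one : ev 0 1 = 0 := by simp [ev]
@[simp] lemma ev_one_zero : ev 1 0 = 0 := by simp [ev]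
@[simp] lemma ev_one_one : ev 1 1 = 1 := by simp [ev]

lemma pt_eta (x : E2) : pt (x 0) (x 1) = x := E2.ext rfl rfl

lemma pt_add_ev0 (s t c : ℝ) : pt (s + c) t = pt s t + c • ev 0 := E2.ext (by simp) (by simp)
lemma pt_add_ev1 (s t c : ℝ) : pt s (t + c) = pt s t + c • ev 1 := E2.ext (by simp) (by simp)
lemma add_pt (x : E2) (s t : ℝ) : x + pt s t = pt (x 0 + s) (x 1 + t) :=
  E2.ext (by simp) (by simp)

lemma pt_linear (s t : ℝ) : pt s t = s • ev 0 + t • ev 1 := E2.ext (by simp) (by simp)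

@[fun_prop] lemma continuous_pt : Continuous fun p : ℝ × ℝ => pt p.1 p.2 := by
  simp only [pt_linear]; fun_prop

lemma continuous_pt' {X : Type*} [TopologicalSpace X] {f g : X → ℝ} (hf : Continuous f)
    (hg : Continuous g) : Continuous fun p => pt (f p) (g p) :=
  continuous_pt.comp (hf.prodMk hg)

/-- `v` is periodic with period `ℓ` in each variable. -/
def Per (ℓ : ℝ) (v : E2 → ℝ) : Prop := ∀ i x, v (x + ℓ • ev i) = v x

variable {ℓ : ℝ}

protected lemma Per.const (c : ℝ) : Per ℓ fun _ => c := fun _ _ => rfl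
protected lemma Per.cst (c : ℝ) : Per ℓ (cst c) := fun _ _ => rfl
protected lemma Per.two : Per ℓ (2 : Sm) := fun _ _ => rfl
protected lemma Per.zero : Per ℓ (0 : Sm) := fun _ _ => rfl
protected lemma Per.add {v w : Sm} (hv : Per ℓ v) (hw : Per ℓ w) : Per ℓ (v + w : Sm) := fun i x => by
  simp [hv i x, hw i x]
protected lemma Per.sub {v w : Sm} (hv : Per ℓ v) (hw : Per ℓ w) : Per ℓ (v - w : Sm) := fun i x => by
  simp [hv i x, hw i x]
protected lemma Per.mul {v w : Sm} (hv : Per ℓ v) (hw : Per ℓ w) : Per ℓ (v * w : Sm) := fun i x => by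
  simp [hv i x, hw i x]
protected lemma Per.smul (c : ℝ) {v : Sm} (hv : Per ℓ v) : Per ℓ (c • v : Sm) := fun i x => by
  simp [hv i x]
protected lemma Per.pow {v : Sm} (hv : Per ℓ v) (n : ℕ) : Per ℓ (v ^ n : Sm) := fun i x => by
  simp [hv i x]

protected lemma Per.D {v : Sm} (hv : Per ℓ v) (j : Fin 2) : Per ℓ (D j v) := fun i x => by
  have h : (fun y => v (y + ℓ • ev i)) = v := funext fun y => hv i y
  rw [D_apply', D_apply', ← fderiv_comp_add_right, h]

protected lemma Per.Lap {v : Sm} (hv : Per ℓ v) : Per ℓ (Lap v) := ((hv.D 0).D 0).add ((hv.D 1).D 1)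

protected lemma Per.Tri {X Y Z : Sm} (hX : Per ℓ X) (hY : Per ℓ Y) (hZ : Per ℓ Z) : Per ℓ (Tri X Y Z) :=
  (((((hX.D 0).mul (hY.D 0)).mul ((hZ.D 0).D 0)).add
    (((hX.D 0).mul (hY.D 1)).mul ((hZ.D 1).D 0))).add
    (((hX.D 1).mul (hY.D 0)).mul ((hZ.D 1).D 0))).add
    (((hX.D 1).mul (hY.D 1)).mul ((hZ.D 1).D 1))

protected lemma Per.dd {v : Sm} (hv : Per ℓ v) (k : ℕ) : Per ℓ (dd k v) := by
  induction k generalizing v with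
  | zero => exact hv.pow 2
  | succ k ih => exact (ih (hv.D 0)).add (ih (hv.D 1))

protected lemma Per.zsmul {v : E2 → ℝ} (hv : Per ℓ v) (i : Fin 2) (n : ℤ) (x : E2) :
    v (x + (n * ℓ) • ev i) = v x := by
  have hp : Function.Periodic (fun t : ℝ => v (x + t • ev i)) ℓ := fun t => by
    have := hv i (x + t • ev i)
    rwa [add_assoc, ← add_smul] at this
  have := hp.int_mul n 0
  simpa using this

/-- Each point is equivalent to one in the closed cell. -/
lemma Per.exists_rep (hℓ : 0 < ℓ) (x : E2) :
    ∃ y : E2, (∀ i, y i ∈ Set.Icc 0 ℓ) ∧ ∃ m n : ℤ, y = x + (m * ℓ) • ev 0 + (n * ℓ) • ev 1 := by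
  have key : ∀ a : ℝ, ∃ n : ℤ, a + n * ℓ ∈ Set.Icc 0 ℓ := fun a => by
    refine ⟨-⌊a / ℓ⌋, ?_, ?_⟩
    · have := Int.floor_le (a / ℓ); rw [le_div_iff₀ hℓ] at this; push_cast; linarith
    · have := (Int.lt_floor_add_one (a / ℓ)).le; rw [div_le_iff₀ hℓ] at this; push_cast; linarith
  obtain ⟨m, hm⟩ := key (x 0)
  obtain ⟨n, hn⟩ := key (x 1)
  refine ⟨_, ?_, m, n, rfl⟩
  intro i; fin_cases i
  · simpa using hm
  · simpa using hn

/-- The closed cell. -/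
def cell (ℓ : ℝ) : Set E2 := {x | ∀ i, x i ∈ Set.Icc 0 ℓ}

lemma isCompact_cell : IsCompact (cell ℓ) := by
  have : cell ℓ = (fun p : ℝ × ℝ => pt p.1 p.2) '' (Set.Icc 0 ℓ ×ˢ Set.Icc 0 ℓ) := by
    ext x; constructor
    · intro h; exact ⟨(x 0, x 1), ⟨h 0, h 1⟩, pt_eta x⟩
    · rintro ⟨p, ⟨h0, h1⟩, rfl⟩ i; fin_cases i
      · exact h0
      · exact h1
  rw [this]
  exact (isCompact_Icc.prod isCompact_Icc).image continuous_pt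

lemma measurableSet_cell : MeasurableSet (cell ℓ) := isCompact_cell.isClosed.measurableSet

lemma Per.exists_max (hℓ : 0 < ℓ) {v : E2 → ℝ} (hv : Per ℓ v) (hc : Continuous v) :
    ∃ x, ∀ y, v y ≤ v x := by
  obtain ⟨x, -, hx⟩ := (isCompact_cell (ℓ := ℓ)).exists_isMaxOn
    ⟨0, fun i => by simp [hℓ.le]⟩ hc.continuousOn
  refine ⟨x, fun y => ?_⟩
  obtain ⟨z, hz, m, n, rfl⟩ := Per.exists_rep hℓ y
  have := hx hz
  simp only [Set.mem_ofPred_eq] at this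
  rwa [hv.zsmul, hv.zsmul] at this

/-- Mean over the cell, not normalized. -/
def I (ℓ : ℝ) (g : E2 → ℝ) : ℝ := ∫ x in cell ℓ, g x

lemma integrableOn_cell {g : E2 → ℝ} (hg : Continuous g) : IntegrableOn g (cell ℓ) :=
  hg.continuousOn.integrableOn_compact isCompact_cell

lemma I_add {f g : E2 → ℝ} (hf : Continuous f) (hg : Continuous g) :
    I ℓ (fun x => f x + g x) = I ℓ f + I ℓ g :=
  integral_add (integrableOn_cell hf) (integrableOn_cell hg)

lemma I_smul (c : ℝ) (f : E2 → ℝ) : I ℓ (fun x => c * f x) = c * I ℓ f :=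
  integral_const_mul _ _

lemma I_mono {f g : E2 → ℝ} (hf : Continuous f) (hg : Continuous g) (h : ∀ x, f x ≤ g x) :
    I ℓ f ≤ I ℓ g :=
  integral_mono (integrableOn_cell hf) (integrableOn_cell hg) h

lemma I_nonneg {f : E2 → ℝ} (h : ∀ x, 0 ≤ f x) : 0 ≤ I ℓ f := integral_nonneg h

/-- Integration over the cell as a linear functional on smooth functions. -/
def IS (ℓ : ℝ) : Sm →ₗ[ℝ] ℝ where
  toFun v := I ℓ v
  map_add' v w := I_add v.continuous w.continuous
  map_smul' c v := I_smul c v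

lemma IS_def (v : Sm) : IS ℓ v = I ℓ v := rfl

lemma IS_mono {v w : Sm} (h : ∀ x, v x ≤ w x) : IS ℓ v ≤ IS ℓ w :=
  I_mono v.continuous w.continuous h

lemma IS_nonneg {v : Sm} (h : ∀ x, 0 ≤ v x) : 0 ≤ IS ℓ v := I_nonneg h

lemma measurePreserving_pt : MeasurePreserving (fun p : ℝ × ℝ => pt p.1 p.2) volume volume := by
  have e : (fun p : ℝ × ℝ => pt p.1 p.2) =
      (WithLp.toLp 2) ∘ (MeasurableEquiv.finTwoArrow (α := ℝ)).symm :=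
    funext fun p => E2.ext rfl rfl
  rw [e]
  exact (PiLp.volume_preserving_toLp (Fin 2)).comp (volume_preserving_finTwoArrow ℝ).symm

lemma measurableEmbedding_pt : MeasurableEmbedding (fun p : ℝ × ℝ => pt p.1 p.2) := by
  have h1 := (MeasurableEquiv.finTwoArrow (α := ℝ)).symm.measurableEmbedding
  have h2 := (MeasurableEquiv.toLp 2 (Fin 2 → ℝ)).measurableEmbedding
  convert h2.comp h1 using 1
  funext p
  exact E2.ext rfl rfl

lemma I_eq_prod (g : E2 → ℝ) :
    I ℓ g = ∫ p in Set.Icc (0 : ℝ) ℓ ×ˢ Set.Icc (0 : ℝ) ℓ, g (pt p.1 p.2) := by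
  rw [I, ← measurePreserving_pt.setIntegral_preimage_emb measurableEmbedding_pt]
  congr 2
  ext p
  simp [cell, Fin.forall_fin_two, Prod.le_def]
  tauto

lemma I_eq (hℓ : 0 ≤ ℓ) {g : E2 → ℝ} (hg : Continuous g) :
    I ℓ g = ∫ s in (0 : ℝ)..ℓ, ∫ t in (0 : ℝ)..ℓ, g (pt s t) := by
  have hc : Continuous fun p : ℝ × ℝ => g (pt p.1 p.2) := hg.comp continuous_pt
  rw [I_eq_prod, Measure.volume_eq_prod, setIntegral_prod _
    (hc.continuousOn.integrableOn_compact (isCompact_Icc.prod isCompact_Icc)),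
    intervalIntegral.integral_of_le hℓ, integral_Icc_eq_integral_Ioc]
  congr 1; ext s
  rw [intervalIntegral.integral_of_le hℓ, integral_Icc_eq_integral_Ioc]

lemma I_eq' (hℓ : 0 ≤ ℓ) {g : E2 → ℝ} (hg : Continuous g) :
    I ℓ g = ∫ t in (0 : ℝ)..ℓ, ∫ s in (0 : ℝ)..ℓ, g (pt s t) := by
  have hc : Continuous fun p : ℝ × ℝ => g (pt p.1 p.2) := hg.comp continuous_pt
  have hi := hc.continuousOn.integrableOn_compact (μ := volume) ((isCompact_Icc (a := (0 : ℝ))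
    (b := ℓ)).prod (isCompact_Icc (a := (0 : ℝ)) (b := ℓ)))
  rw [I_eq_prod, Measure.volume_eq_prod, setIntegral_prod _ hi]
  rw [integral_integral_swap (by rw [Measure.prod_restrict]; exact hi),
    intervalIntegral.integral_of_le hℓ, integral_Icc_eq_integral_Ioc]
  congr 1; ext s
  rw [intervalIntegral.integral_of_le hℓ, integral_Icc_eq_integral_Ioc]

lemma Per.I_translate (hℓ : 0 ≤ ℓ) {g : E2 → ℝ} (hg : Continuous g) (hp : Per ℓ g) (z : E2) :
    I ℓ (fun x => g (z + x)) = I ℓ g := by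
  rw [I_eq hℓ (by fun_prop), I_eq hℓ hg]
  have hp1 : ∀ s, Function.Periodic (fun t => g (pt s t)) ℓ := fun s t => by
    simp only [pt_add_ev1]; exact hp 1 _
  have hp0 : Function.Periodic (fun s => ∫ t in (0 : ℝ)..ℓ, g (pt s t)) ℓ := fun s => by
    simp only [pt_add_ev0]
    congr 1; ext t; exact hp 0 _
  have h1 : ∀ s, ∫ t in (0 : ℝ)..ℓ, g (z + pt s t) = ∫ t in (0 : ℝ)..ℓ, g (pt (z 0 + s) t) := by
    intro s
    simp only [add_pt]
    rw [intervalIntegral.integral_comp_add_left (fun t => g (pt (z 0 + s) t))]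
    have := (hp1 (z 0 + s)).intervalIntegral_add_eq (z 1) 0
    simpa using this
  simp only [h1]
  rw [intervalIntegral.integral_comp_add_left (fun s => ∫ t in (0 : ℝ)..ℓ, g (pt s t))]
  have := hp0.intervalIntegral_add_eq (z 0) 0
  simpa using this

lemma Sm.hasDerivAt_line (v : Sm) (x : E2) (i : Fin 2) (t : ℝ) :
    HasDerivAt (fun t : ℝ => v (x + t • ev i)) (D i v (x + t • ev i)) t := by
  have h := (v.hasFDerivAt (x + t • ev i)).comp_hasDerivAt t
    (((hasDerivAt_id t).smul_const (ev i)).const_add x)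
  rw [one_smul] at h
  exact h

lemma Sm.hasDerivAt_pt0 (v : Sm) (s t : ℝ) :
    HasDerivAt (fun s : ℝ => v (pt s t)) (D 0 v (pt s t)) s := by
  have h := v.hasDerivAt_line (pt 0 t) 0 s
  simpa only [← pt_add_ev0, zero_add] using h

lemma Sm.hasDerivAt_pt1 (v : Sm) (s t : ℝ) :
    HasDerivAt (fun t : ℝ => v (pt s t)) (D 1 v (pt s t)) t := by
  have h := v.hasDerivAt_line (pt s 0) 1 t
  simpa only [← pt_add_ev1, zero_add] using h

lemma Sm.continuous_pt0 (v : Sm) (t : ℝ) : Continuous fun s : ℝ => v (pt s t) :=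
  v.continuous.comp (continuous_pt' continuous_id continuous_const)

lemma Sm.continuous_pt1 (v : Sm) (s : ℝ) : Continuous fun t : ℝ => v (pt s t) :=
  v.continuous.comp (continuous_pt' continuous_const continuous_id)

lemma Per.IS_D (hℓ : 0 ≤ ℓ) {v : Sm} (hv : Per ℓ v) (i : Fin 2) : IS ℓ (D i v) = 0 := by
  rw [IS_def]
  fin_cases i
  · change I ℓ (D 0 v) = 0
    rw [I_eq' hℓ (D 0 v).continuous]
    rw [intervalIntegral.integral_congr (g := fun _ => (0 : ℝ)) fun t _ => ?_]
    · simp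
    · change ∫ s in (0 : ℝ)..ℓ, D 0 v (pt s t) = 0
      rw [intervalIntegral.integral_eq_sub_of_hasDerivAt (fun s _ => v.hasDerivAt_pt0 s t)
        (((D 0 v).continuous_pt0 t).intervalIntegrable _ _), sub_eq_zero]
      have := hv 0 (pt 0 t)
      rwa [← pt_add_ev0, zero_add] at this
  · change I ℓ (D 1 v) = 0
    rw [I_eq hℓ (D 1 v).continuous]
    rw [intervalIntegral.integral_congr (g := fun _ => (0 : ℝ)) fun t _ => ?_]
    · simp
    · change ∫ s in (0 : ℝ)..ℓ, D 1 v (pt t s) = 0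
      rw [intervalIntegral.integral_eq_sub_of_hasDerivAt (fun s _ => v.hasDerivAt_pt1 t s)
        (((D 1 v).continuous_pt1 t).intervalIntegrable _ _), sub_eq_zero]
      have := hv 1 (pt t 0)
      rwa [← pt_add_ev1, zero_add] at this

/-! ### Energies -/

/-- `∫ |D^k w|²` over the cell. -/
def En (ℓ : ℝ) (k : ℕ) (w : Sm) : ℝ := IS ℓ (dd k w)

lemma En_nonneg (k : ℕ) (w : Sm) : 0 ≤ En ℓ k w := IS_nonneg (dd_nonneg k w)

lemma En_succ (k : ℕ) (w : Sm) : En ℓ (k + 1) w = En ℓ k (D 0 w) + En ℓ k (D 1 w) := by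
  simp only [En, dd_succ, map_add]

lemma En_zero (w : Sm) : En ℓ 0 w = IS ℓ (w ^ 2) := rfl

lemma En_smul (k : ℕ) (c : ℝ) (w : Sm) : En ℓ k (c • w) = c ^ 2 * En ℓ k w := by
  simp only [En, dd_smul, map_smul, smul_eq_mul]

lemma IS_le_smul {f g : Sm} {c : ℝ} (h : ∀ x, f x ≤ c * g x) : IS ℓ f ≤ c * IS ℓ g := by
  rw [← smul_eq_mul, ← map_smul]; exact IS_mono h

lemma IS_le_smul_add {f g k : Sm} {c d : ℝ} (h : ∀ x, f x ≤ c * g x + d * k x) :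
    IS ℓ f ≤ c * IS ℓ g + d * IS ℓ k := by
  rw [← smul_eq_mul, ← map_smul, ← smul_eq_mul d, ← map_smul, ← map_add]; exact IS_mono h

lemma En_add_le {θ : ℝ} (hθ : 0 < θ) (k : ℕ) (v w : Sm) :
    En ℓ k (v + w) ≤ (1 + θ) * En ℓ k v + (1 + θ⁻¹) * En ℓ k w :=
  IS_le_smul_add (dd_add_le hθ k v w)

lemma En_add_le_two (k : ℕ) (v w : Sm) :
    En ℓ k (v + w) ≤ 2 * En ℓ k v + 2 * En ℓ k w := IS_le_smul_add (dd_add_le_two k v w)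

lemma En_sub_le_two (k : ℕ) (v w : Sm) :
    En ℓ k (v - w) ≤ 2 * En ℓ k v + 2 * En ℓ k w := IS_le_smul_add (dd_sub_le_two k v w)

lemma Per.IS_ibp (hℓ : 0 ≤ ℓ) {v w : Sm} (hv : Per ℓ v) (hw : Per ℓ w) (i : Fin 2) :
    IS ℓ (D i v * w) = - IS ℓ (v * D i w) := by
  have h := (hv.mul hw).IS_D hℓ i
  rw [D_mul, map_add] at h
  linarith

/-- `E_2` is the `L²` norm of the Laplacian. -/
lemma Per.En_two (hℓ : 0 ≤ ℓ) {w : Sm} (hw : Per ℓ w) : En ℓ 2 w = IS ℓ (Lap w ^ 2) := by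
  have e : Lap w ^ 2 = dd 2 w + (2 : ℝ) • (D 0 (D 0 w) * D 1 (D 1 w) - D 0 (D 1 w) ^ 2) := by
    rw [dd_two, smul_eq_cst, show cst 2 = (2 : Sm) from rfl, Lap_def]; ring
  have h1 := ((hw.D 0).mul ((hw.D 1).D 1)).IS_D hℓ 0
  have h2 := ((hw.D 0).mul ((hw.D 1).D 0)).IS_D hℓ 1
  have e2 : D 0 (D 0 w * D 1 (D 1 w)) - D 1 (D 0 w * D 0 (D 1 w)) =
      D 0 (D 0 w) * D 1 (D 1 w) - D 0 (D 1 w) ^ 2 := by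
    simp only [D_mul, D_comm10]; ring
  have : IS ℓ (D 0 (D 0 w) * D 1 (D 1 w) - D 0 (D 1 w) ^ 2) = 0 := by
    rw [← e2, map_sub, h1, h2, sub_zero]
  rw [e, map_add, map_smul, this, smul_zero, add_zero]; rfl

lemma Per.IS_det (hℓ : 0 ≤ ℓ) {w : Sm} (hw : Per ℓ w) :
    IS ℓ (D 0 (D 0 w) * D 1 (D 1 w) - D 0 (D 1 w) ^ 2) = 0 := by
  have h1 := ((hw.D 0).mul ((hw.D 1).D 1)).IS_D hℓ 0
  have h2 := ((hw.D 0).mul ((hw.D 1).D 0)).IS_D hℓ 1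
  have e2 : D 0 (D 0 w * D 1 (D 1 w)) - D 1 (D 0 w * D 0 (D 1 w)) =
      D 0 (D 0 w) * D 1 (D 1 w) - D 0 (D 1 w) ^ 2 := by
    simp only [D_mul, D_comm10]; ring
  rw [← e2, map_sub, h1, h2, sub_zero]

lemma Per.En_Lap (hℓ : 0 ≤ ℓ) {w : Sm} (hw : Per ℓ w) (k : ℕ) : En ℓ (k + 2) w = En ℓ k (Lap w) := by
  induction k generalizing w with
  | zero => exact hw.En_two hℓ
  | succ k ih => rw [En_succ (k + 2) w, En_succ k (Lap w), ih (hw.D 0), ih (hw.D 1), D_Lap, D_Lap]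

/-- Interpolation of energies. -/
lemma Per.En_interp (hℓ : 0 ≤ ℓ) {w : Sm} (hw : Per ℓ w) {κ : ℝ} (hκ : 0 < κ) (k : ℕ) :
    En ℓ (k + 1) w ≤ κ * En ℓ (k + 2) w + κ⁻¹ * En ℓ k w := by
  induction k generalizing w with
  | zero =>
    have h1 : En ℓ 1 w = - IS ℓ (w * Lap w) := by
      have a := hw.IS_ibp hℓ (hw.D 0) 0
      have b := hw.IS_ibp hℓ (hw.D 1) 1
      rw [En, dd_one, map_add, Lap_def, mul_add, map_add]
      rw [sq, sq]; linarith
    rw [zero_add, zero_add, h1, hw.En_two hℓ, En_zero, ← map_neg]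
    refine IS_le_smul_add fun x => ?_
    simp only [Sm.neg_apply, Sm.mul_apply, Sm.pow_apply]
    generalize Lap w x = b
    generalize w x = a
    have h := sq_nonneg (κ * b + a)
    have e : κ⁻¹ * (κ * b + a) ^ 2 = κ * b ^ 2 + 2 * (a * b) + κ⁻¹ * a ^ 2 := by field_simp; ring
    have h2 : 0 ≤ κ⁻¹ * (κ * b + a) ^ 2 := by positivity
    have h3 : 0 ≤ κ * b ^ 2 + κ⁻¹ * a ^ 2 := by positivity
    linarith
  | succ k ih =>
    rw [En_succ (k + 1) w, En_succ (k + 2) w, En_succ k w]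
    linarith [ih (hw.D 0), ih (hw.D 1)]

lemma interval_sup_sq {h h' : ℝ → ℝ} (hd : ∀ t, HasDerivAt h (h' t) t) (hc : Continuous h')
    {ρ : ℝ} (hρ : 0 < ρ) :
    h 0 ^ 2 ≤ ∫ t in (0 : ℝ)..ρ, (2 / ρ * h t ^ 2 + ρ * h' t ^ 2) := by
  have hch : Continuous h := continuous_iff_continuousAt.2 fun t => (hd t).continuousAt
  -- `d/dt [(ρ - t) h²] = - h² + 2 (ρ - t) h h'`
  have hF : ∀ t, HasDerivAt (fun t => (ρ - t) * h t ^ 2)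
      (-1 * h t ^ 2 + (ρ - t) * (2 * h t * h' t)) t := fun t => by
    have := ((hasDerivAt_id t).const_sub ρ).mul ((hd t).pow 2)
    refine this.congr_deriv ?_
    simp
  have hInt := intervalIntegral.integral_eq_sub_of_hasDerivAt (a := 0) (b := ρ)
    (fun t _ => hF t) (by apply Continuous.intervalIntegrable; fun_prop)
  have hle : ∫ t in (0 : ℝ)..ρ, -(-1 * h t ^ 2 + (ρ - t) * (2 * h t * h' t)) ≤
      ∫ t in (0 : ℝ)..ρ, ρ * (2 / ρ * h t ^ 2 + ρ * h' t ^ 2) := by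
    refine intervalIntegral.integral_mono_on hρ.le (by apply Continuous.intervalIntegrable; fun_prop)
      (by apply Continuous.intervalIntegrable; fun_prop) fun t ht => ?_
    have e : ρ * (2 / ρ * h t ^ 2 + ρ * h' t ^ 2) = 2 * h t ^ 2 + ρ ^ 2 * h' t ^ 2 := by
      field_simp
    rw [e]
    have h1 : (ρ - t) ^ 2 ≤ ρ ^ 2 := by
      have := ht.1; have := ht.2
      nlinarith
    nlinarith [sq_nonneg (h t + (ρ - t) * h' t), mul_le_mul_of_nonneg_right h1 (sq_nonneg (h' t))]
  rw [intervalIntegral.integral_neg, hInt, intervalIntegral.integral_const_mul] at hle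
  have : ρ * h 0 ^ 2 ≤ ρ * ∫ t in (0 : ℝ)..ρ, (2 / ρ * h t ^ 2 + ρ * h' t ^ 2) := by
    simpa using hle
  exact le_of_mul_le_mul_left this hρ

lemma intervalIntegral_le_of_nonneg {F : ℝ → ℝ} (hF : Continuous F) (h0 : ∀ t, 0 ≤ F t) {ρ L : ℝ}
    (hρ : 0 ≤ ρ) (hL : ρ ≤ L) : ∫ t in (0 : ℝ)..ρ, F t ≤ ∫ t in (0 : ℝ)..L, F t :=
  intervalIntegral.integral_mono_interval le_rfl hρ hL (Filter.Eventually.of_forall h0)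
    (hF.intervalIntegrable _ _)

/-- Sobolev inequality: supremum bound by second-order energies. -/
lemma Per.sup_sq_le {w : Sm} (hw : Per ℓ w) {ρ : ℝ} (hρ : 0 < ρ) (hρℓ : ρ ≤ ℓ) (x : E2) :
    w x ^ 2 ≤ ρ ^ 2 * En ℓ 2 w + 2 * En ℓ 1 w + 4 / ρ ^ 2 * En ℓ 0 w := by
  obtain ⟨T, hT⟩ : ∃ T : Sm, T = ((2 / ρ) ^ 2) • w ^ 2 + (2 : ℝ) • D 0 w ^ 2 + (2 : ℝ) • D 1 w ^ 2
    + (ρ ^ 2) • D 0 (D 1 w) ^ 2 := ⟨_, rfl⟩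
  have hTp : Per ℓ T := hT ▸ ((((hw.pow 2).smul _).add (((hw.D 0).pow 2).smul _)).add
    (((hw.D 1).pow 2).smul _)).add ((((hw.D 1).D 0).pow 2).smul _)
  have hT0 : ∀ y, 0 ≤ T y := fun y => by
    simp only [hT, Sm.add_apply, Sm.smul_apply, Sm.pow_apply]; positivity
  have hline : ∀ (v : Sm) (s t : ℝ), HasDerivAt (fun s : ℝ => v (x + pt s t))
      (D 0 v (x + pt s t)) s := fun v s t => by
    have := v.hasDerivAt_line (x + pt 0 t) 0 s
    simpa only [add_assoc, ← pt_add_ev0, zero_add] using this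
  have hline1 : ∀ (v : Sm) (s t : ℝ), HasDerivAt (fun t : ℝ => v (x + pt s t))
      (D 1 v (x + pt s t)) t := fun v s t => by
    have := v.hasDerivAt_line (x + pt s 0) 1 t
    simpa only [add_assoc, ← pt_add_ev1, zero_add] using this
  have hcont : ∀ v : Sm, Continuous fun p : ℝ × ℝ => v (x + pt p.1 p.2) := fun v =>
    v.continuous.comp (continuous_const.add continuous_pt)
  have hc2 : ∀ v : Sm, ∀ t : ℝ, Continuous fun s : ℝ => v (x + pt s t) := fun v t =>
    (hcont v).comp (continuous_id.prodMk continuous_const)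
  have hc3 : ∀ v : Sm, ∀ t : ℝ, Continuous fun s : ℝ => v (x + pt t s) := fun v t =>
    (hcont v).comp (continuous_const.prodMk continuous_id)
  have hq : ∀ {f : Sm → ℝ → ℝ → ℝ} (_ : ∀ v t, Continuous (f v t)) (v w : Sm) (a b c t : ℝ),
      Continuous fun s => a * (b * f v t s ^ 2 + c * f w t s ^ 2) := fun hf v w a b c t =>
    continuous_const.mul ((continuous_const.mul ((hf v t).pow 2)).add
      (continuous_const.mul ((hf w t).pow 2)))
  -- first in the direction `e_1`
  have h1 := interval_sup_sq (fun t => hline1 w 0 t) (hc3 (D 1 w) 0) hρ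
  -- then in the direction `e_0`
  have h2 : ∀ t, 2 / ρ * w (x + pt 0 t) ^ 2 + ρ * D 1 w (x + pt 0 t) ^ 2 ≤
      ∫ s in (0 : ℝ)..ρ, T (x + pt s t) := fun t => by
    have a := interval_sup_sq (fun s => hline w s t) (hc2 (D 0 w) t) hρ
    have b := interval_sup_sq (fun s => hline (D 1 w) s t) (hc2 (D 0 (D 1 w)) t) hρ
    have a' := mul_le_mul_of_nonneg_left a (by positivity : 0 ≤ 2 / ρ)
    have b' := mul_le_mul_of_nonneg_left b hρ.le
    rw [← intervalIntegral.integral_const_mul] at a' b'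
    refine (add_le_add a' b').trans (le_of_eq ?_)
    rw [← intervalIntegral.integral_add]
    · congr 1; ext s
      simp only [hT, Sm.add_apply, Sm.smul_apply, Sm.pow_apply]
      field_simp; ring
    · exact (hq hc2 w (D 0 w) _ _ _ t).intervalIntegrable _ _
    · exact (hq hc2 (D 1 w) (D 0 (D 1 w)) _ _ _ t).intervalIntegrable _ _
  have hTc : Continuous fun t : ℝ => ∫ s in (0 : ℝ)..ρ, T (x + pt s t) :=
    intervalIntegral.continuous_parametric_intervalIntegral_of_continuous'
      (f := fun t s => T (x + pt s t)) ((hcont T).comp continuous_swap) 0 ρ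
  have hTc' : Continuous fun t : ℝ => ∫ s in (0 : ℝ)..ℓ, T (x + pt s t) :=
    intervalIntegral.continuous_parametric_intervalIntegral_of_continuous'
      (f := fun t s => T (x + pt s t)) ((hcont T).comp continuous_swap) 0 ℓ
  have h3 : w (x + pt 0 0) ^ 2 ≤ ∫ t in (0 : ℝ)..ρ, ∫ s in (0 : ℝ)..ρ, T (x + pt s t) := by
    refine h1.trans (intervalIntegral.integral_mono_on hρ.le ?_ (hTc.intervalIntegrable _ _)
      fun t _ => h2 t)
    have := hq hc3 w (D 1 w) 1 (2 / ρ) ρ 0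
    simp only [one_mul] at this
    exact this.intervalIntegrable _ _
  have h4 : ∫ t in (0 : ℝ)..ρ, ∫ s in (0 : ℝ)..ρ, T (x + pt s t) ≤ I ℓ T := by
    rw [← hTp.I_translate (hρ.le.trans hρℓ) T.continuous x, I_eq' (hρ.le.trans hρℓ)
      (by have := T.continuous; fun_prop)]
    refine le_trans (intervalIntegral.integral_mono_on hρ.le (hTc.intervalIntegrable _ _)
      (hTc'.intervalIntegrable _ _) fun t _ =>
      intervalIntegral_le_of_nonneg (hc2 T t) (fun s => hT0 _) hρ.le hρℓ) ?_
    exact intervalIntegral_le_of_nonneg hTc' (fun t => intervalIntegral.integral_nonneg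
      (hρ.le.trans hρℓ) fun s _ => hT0 _) hρ.le hρℓ
  have h5 : I ℓ T ≤ ρ ^ 2 * En ℓ 2 w + 2 * En ℓ 1 w + 4 / ρ ^ 2 * En ℓ 0 w := by
    have e : ρ ^ 2 * En ℓ 2 w + 2 * En ℓ 1 w + 4 / ρ ^ 2 * En ℓ 0 w =
        IS ℓ ((ρ ^ 2) • dd 2 w + (2 : ℝ) • dd 1 w + (4 / ρ ^ 2) • dd 0 w) := by
      simp only [map_add, map_smul, smul_eq_mul, En]
    rw [e]
    refine IS_mono (v := T) fun y => ?_
    simp only [hT, dd_two, dd_one, dd_zero, Sm.add_apply, Sm.smul_apply, Sm.pow_apply,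
      Sm.mul_apply, Sm.two_apply]
    have e2 : (2 / ρ) ^ 2 = 4 / ρ ^ 2 := by rw [div_pow]; norm_num
    rw [e2]
    have : 0 ≤ ρ ^ 2 * (D 0 (D 0 w) y ^ 2 + D 0 (D 1 w) y ^ 2 + D 1 (D 1 w) y ^ 2) := by
      positivity
    linarith
  have hx : x + pt 0 0 = x := by simp [pt_linear]
  rw [hx] at h3
  linarith

end Periodic

section PeriodicEnergy

/-! ### Derivatives along lines and the second derivative test -/

/-- Directional derivative. -/
def Dp (p : E2) : Sm →ₗ[ℝ] Sm := p 0 • D 0 + p 1 • D 1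

lemma Dp_apply (p : E2) (v : Sm) (x : E2) : Dp p v x = p 0 * D 0 v x + p 1 * D 1 v x := rfl

lemma E2.eq_sum (p : E2) : p = p 0 • ev 0 + p 1 • ev 1 := E2.ext (by simp) (by simp)

lemma fderiv_eq_Dp (v : Sm) (x p : E2) : fderiv ℝ v x p = Dp p v x := by
  conv_lhs => rw [E2.eq_sum p]
  rw [map_add, map_smul, map_smul, Dp_apply, D_apply', D_apply', smul_eq_mul, smul_eq_mul]

lemma Sm.hasDerivAt_dir (v : Sm) (x p : E2) (t : ℝ) :
    HasDerivAt (fun t : ℝ => v (x + t • p)) (Dp p v (x + t • p)) t := by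
  have h := (v.hasFDerivAt (x + t • p)).comp_hasDerivAt t
    (((hasDerivAt_id t).smul_const p).const_add x)
  rw [one_smul, fderiv_eq_Dp] at h
  exact h

lemma Dp_Dp_apply (p : E2) (v : Sm) (x : E2) : Dp p (Dp p v) x =
    p 0 * p 0 * D 0 (D 0 v) x + 2 * (p 0 * p 1 * D 0 (D 1 v) x) + p 1 * p 1 * D 1 (D 1 v) x := by
  simp only [Dp, LinearMap.add_apply, LinearMap.smul_apply, map_add, map_smul, D_comm10,
    Sm.add_apply, Sm.smul_apply]
  ring

lemma second_deriv_nonpos {h h' : ℝ → ℝ} {c : ℝ} (hd : ∀ᶠ t in nhds 0, HasDerivAt h (h' t) t)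
    (hd2 : HasDerivAt h' c 0) (hmax : IsLocalMax h 0) : c ≤ 0 := by
  by_contra! hc
  have e : deriv h =ᶠ[nhds 0] h' := hd.mono fun t ht => ht.deriv
  have e2 : deriv (deriv h) 0 = c := by rw [e.deriv_eq, hd2.deriv]
  have hmin : IsLocalMin h 0 := isLocalMin_of_deriv_deriv_pos (by rw [e2]; exact hc)
    hmax.deriv_eq_zero hd.self_of_nhds.continuousAt
  have hconst : h =ᶠ[nhds 0] fun _ => h 0 := by
    filter_upwards [hmin, hmax] with t h1 h2 using le_antisymm h2 h1
  have h0 : deriv (deriv h) 0 = 0 := by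
    have := hconst.deriv.deriv_eq
    simpa using this
  linarith

lemma Sm.second_deriv_nonpos {w : Sm} {x : E2} (h : ∀ y, w y ≤ w x) (p : E2) :
    Dp p (Dp p w) x ≤ 0 := by
  have h1 := (Dp p w).hasDerivAt_dir x p 0
  rw [zero_smul, add_zero] at h1
  refine _root_.second_deriv_nonpos (Filter.Eventually.of_forall fun t => w.hasDerivAt_dir x p t) h1 ?_
  refine Filter.Eventually.of_forall fun t => ?_
  simpa using h (x + t • p)

lemma Sm.D_eq_zero {w : Sm} {x : E2} (h : ∀ y, w y ≤ w x) (i : Fin 2) : D i w x = 0 := by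
  have : IsLocalMax w x := Filter.Eventually.of_forall h
  rw [D_apply', this.fderiv_eq_zero]; rfl

lemma Tri_self_eq (v w : Sm) (x : E2) :
    Tri v v w x = Dp (pt (D 0 v x) (D 1 v x)) (Dp (pt (D 0 v x) (D 1 v x)) w) x := by
  rw [Dp_Dp_apply]
  simp only [Tri, Sm.add_apply, Sm.mul_apply, pt_zero, pt_one]; ring

lemma Sm.Lap_nonpos {w : Sm} {x : E2} (h : ∀ y, w y ≤ w x) : Lap w x ≤ 0 := by
  have h0 := w.second_deriv_nonpos h (ev 0)
  have h1 := w.second_deriv_nonpos h (ev 1)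
  rw [Dp_Dp_apply] at h0 h1
  simp at h0 h1
  rw [Lap_def, Sm.add_apply]; linarith

lemma Sm.Tri_nonpos {w : Sm} {x : E2} (h : ∀ y, w y ≤ w x) (v : Sm) : Tri v v w x ≤ 0 := by
  rw [Tri_self_eq]; exact w.second_deriv_nonpos h _

/-! ### The elliptic `L²` estimate -/

variable {ℓ : ℝ}

/-- `Δw + s Σ v_i v_j w_ij`. -/
def Aop (s : ℝ) (v w : Sm) : Sm := Lap w + s • Tri v v w

lemma elliptic_pointwise {s p q a b c T : ℝ} (hs : 0 ≤ s) (hs1 : s ≤ 1)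
    (hT : 2 + (p ^ 2 + q ^ 2) ≤ T) :
    a ^ 2 + 2 * b ^ 2 + c ^ 2 ≤ 2 * T * (b ^ 2 - a * c) +
      T * (a + c + s * (p * p * a + p * q * b + q * p * b + q * q * c)) ^ 2 := by
  set F := a + c + s * (p * p * a + p * q * b + q * p * b + q * q * c) with hF
  set t := 2 + s * (p ^ 2 + q ^ 2) with ht
  have hpq : 0 ≤ p ^ 2 + q ^ 2 := by positivity
  have ht2 : 2 ≤ t := by nlinarith
  have htT : t ≤ T := by nlinarith
  have key : t * (b ^ 2 - a * c) ≥ (a ^ 2 + 2 * b ^ 2 + c ^ 2) / 2 - F ^ 2 := by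
    have e : t * (b ^ 2 - a * c) = a ^ 2 + 2 * b ^ 2 + c ^ 2 + s * (p * a + q * b) ^ 2 +
        s * (p * b + q * c) ^ 2 - F * (a + c) := by
      rw [hF, ht]; ring
    have h1 : 0 ≤ s * (p * a + q * b) ^ 2 := by positivity
    have h2 : 0 ≤ s * (p * b + q * c) ^ 2 := by positivity
    nlinarith [sq_nonneg (F - (a + c) / 2), sq_nonneg (a - c)]
  have hT0 : 0 < T := by linarith
  -- divide by `t` and multiply by `2T`
  have h3 : T * ((a ^ 2 + 2 * b ^ 2 + c ^ 2) - 2 * F ^ 2) ≤ t * (2 * T * (b ^ 2 - a * c)) := by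
    nlinarith [mul_le_mul_of_nonneg_left key (by linarith : 0 ≤ 2 * T)]
  have h4 : t * (a ^ 2 + 2 * b ^ 2 + c ^ 2) ≤ T * (a ^ 2 + 2 * b ^ 2 + c ^ 2) :=
    mul_le_mul_of_nonneg_right htT (by positivity)
  have h5 : 2 * (T * F ^ 2) ≤ t * (T * F ^ 2) := mul_le_mul_of_nonneg_right ht2 (by positivity)
  have h6 : t * (a ^ 2 + 2 * b ^ 2 + c ^ 2) ≤ t * (2 * T * (b ^ 2 - a * c) + T * F ^ 2) := by
    linarith
  exact le_of_mul_le_mul_left h6 (by linarith)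

lemma elliptic_dd_two {s T : ℝ} (hs : 0 ≤ s) (hs1 : s ≤ 1) (v w : Sm) (x : E2)
    (hT : 2 + dd 1 v x ≤ T) :
    dd 2 w x ≤ 2 * T * (D 0 (D 1 w) ^ 2 - D 0 (D 0 w) * D 1 (D 1 w) : Sm) x +
      T * (Aop s v w x) ^ 2 := by
  have := elliptic_pointwise (a := D 0 (D 0 w) x) (b := D 0 (D 1 w) x) (c := D 1 (D 1 w) x)
    (p := D 0 v x) (q := D 1 v x) hs hs1 hT
  rw [dd_two]
  simpa only [Aop, Tri, Lap_def, Sm.add_apply, Sm.sub_apply, Sm.smul_apply, Sm.mul_apply,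
    Sm.pow_apply, Sm.two_apply] using this

lemma Per.elliptic {s T : ℝ} (hℓ : 0 ≤ ℓ) (hs : 0 ≤ s) (hs1 : s ≤ 1) {v w : Sm} (hw : Per ℓ w)
    (hT : ∀ x, 2 + dd 1 v x ≤ T) : En ℓ 2 w ≤ T * IS ℓ (Aop s v w ^ 2) := by
  have h : En ℓ 2 w ≤ 2 * T * IS ℓ (D 0 (D 1 w) ^ 2 - D 0 (D 0 w) * D 1 (D 1 w)) +
      T * IS ℓ (Aop s v w ^ 2) :=
    IS_le_smul_add fun x => elliptic_dd_two hs hs1 v w x (hT x)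
  have h2 := hw.IS_det hℓ
  rw [← neg_sub, map_neg, h2] at h
  linarith

/-! ### Interpolation -/

/-- Sum of the energies of order at most four. -/
def H4 (ℓ : ℝ) (w : Sm) : ℝ := En ℓ 0 w + En ℓ 1 w + En ℓ 2 w + En ℓ 3 w + En ℓ 4 w

/-- Sum of the energies of order at most two. -/
def N2 (ℓ : ℝ) (w : Sm) : ℝ := En ℓ 0 w + En ℓ 1 w + En ℓ 2 w

lemma N2_nonneg (w : Sm) : 0 ≤ N2 ℓ w := by
  have := En_nonneg (ℓ := ℓ) 0 w; have := En_nonneg (ℓ := ℓ) 1 w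
  have := En_nonneg (ℓ := ℓ) 2 w; unfold N2; linarith

lemma N2_add_le {θ : ℝ} (hθ : 0 < θ) (v w : Sm) :
    N2 ℓ (v + w) ≤ (1 + θ) * N2 ℓ v + (1 + θ⁻¹) * N2 ℓ w := by
  unfold N2
  linarith [En_add_le (ℓ := ℓ) hθ 0 v w, En_add_le (ℓ := ℓ) hθ 1 v w, En_add_le (ℓ := ℓ) hθ 2 v w]

lemma N2_add_le_two (v w : Sm) : N2 ℓ (v + w) ≤ 2 * N2 ℓ v + 2 * N2 ℓ w := by
  have := N2_add_le (ℓ := ℓ) one_pos v w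
  norm_num at this; linarith

lemma N2_smul (c : ℝ) (w : Sm) : N2 ℓ (c • w) = c ^ 2 * N2 ℓ w := by
  simp only [N2, En_smul]; ring

lemma N2_sub_le_two (v w : Sm) : N2 ℓ (v - w) ≤ 2 * N2 ℓ v + 2 * N2 ℓ w := by
  have h := N2_add_le_two (ℓ := ℓ) v ((-1 : ℝ) • w)
  rw [N2_smul] at h
  have e : v + (-1 : ℝ) • w = v - w := by simp [sub_eq_add_neg]
  rw [e] at h
  simpa using h

lemma H4_nonneg (w : Sm) : 0 ≤ H4 ℓ w := by
  have := En_nonneg (ℓ := ℓ) 0 w; have := En_nonneg (ℓ := ℓ) 1 w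
  have := En_nonneg (ℓ := ℓ) 2 w; have := En_nonneg (ℓ := ℓ) 3 w
  have := En_nonneg (ℓ := ℓ) 4 w; unfold H4; linarith

lemma En_le_H4 {k : ℕ} (hk : k ≤ 4) (w : Sm) : En ℓ k w ≤ H4 ℓ w := by
  have := En_nonneg (ℓ := ℓ) 0 w; have := En_nonneg (ℓ := ℓ) 1 w
  have := En_nonneg (ℓ := ℓ) 2 w; have := En_nonneg (ℓ := ℓ) 3 w
  have := En_nonneg (ℓ := ℓ) 4 w; unfold H4
  interval_cases k <;> linarith

lemma Per.sup_dd_le {w : Sm} (hw : Per ℓ w) {ρ : ℝ} (hρ : 0 < ρ) (hρℓ : ρ ≤ ℓ) (k : ℕ) (x : E2) :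
    dd k w x ≤ ρ ^ 2 * En ℓ (k + 2) w + 2 * En ℓ (k + 1) w + 4 / ρ ^ 2 * En ℓ k w := by
  induction k generalizing w with
  | zero => exact hw.sup_sq_le hρ hρℓ x
  | succ k ih =>
    rw [dd_succ, Sm.add_apply, En_succ (k + 2) w, En_succ (k + 1) w, En_succ k w]
    linarith [ih (hw.D 0), ih (hw.D 1)]

/-- The constant in the Sobolev inequality. -/
def cSob (ℓ : ℝ) : ℝ := ℓ ^ 2 + 2 + 4 / ℓ ^ 2

lemma cSob_pos : 0 < cSob ℓ := by unfold cSob; positivity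

lemma Per.sup_sq_le_N2 (hℓ : 0 < ℓ) {w : Sm} (hw : Per ℓ w) (x : E2) :
    w x ^ 2 ≤ cSob ℓ * N2 ℓ w := by
  have h := hw.sup_sq_le hℓ le_rfl x
  have h0 := En_nonneg (ℓ := ℓ) 0 w
  have h1 := En_nonneg (ℓ := ℓ) 1 w
  have h2 := En_nonneg (ℓ := ℓ) 2 w
  have : (0 : ℝ) ≤ 4 / ℓ ^ 2 := by positivity
  have : 0 ≤ ℓ ^ 2 := by positivity
  unfold cSob N2
  nlinarith [mul_nonneg ‹0 ≤ ℓ ^ 2› h0, mul_nonneg ‹0 ≤ ℓ ^ 2› h1,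
    mul_nonneg ‹(0 : ℝ) ≤ 4 / ℓ ^ 2› h1, mul_nonneg ‹(0 : ℝ) ≤ 4 / ℓ ^ 2› h2]

lemma Per.sup_dd_le_H4 (hℓ : 0 < ℓ) {w : Sm} (hw : Per ℓ w) {k : ℕ} (hk : k ≤ 2) (x : E2) :
    dd k w x ≤ cSob ℓ * H4 ℓ w := by
  have h := hw.sup_dd_le hℓ le_rfl k x
  have h0 := En_le_H4 (ℓ := ℓ) (show k ≤ 4 by omega) w
  have h1 := En_le_H4 (ℓ := ℓ) (show k + 1 ≤ 4 by omega) w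
  have h2 := En_le_H4 (ℓ := ℓ) (show k + 2 ≤ 4 by omega) w
  have a : (0 : ℝ) ≤ 4 / ℓ ^ 2 := by positivity
  have b : 0 ≤ ℓ ^ 2 := by positivity
  unfold cSob
  nlinarith [mul_le_mul_of_nonneg_left h0 a, mul_le_mul_of_nonneg_left h2 b]

lemma Per.ehrling_aux (hℓ : 0 ≤ ℓ) {w : Sm} (hw : Per ℓ w) {c : ℝ} (hc : 0 < c) :
    En ℓ 3 w ≤ c * En ℓ 4 w + 1024 / c ^ 3 * En ℓ 0 w ∧
    En ℓ 2 w ≤ En ℓ 3 w + 16 * En ℓ 0 w ∧ En ℓ 1 w ≤ En ℓ 2 w + En ℓ 0 w := by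
  have h2 : ∀ {a : ℝ}, 0 < a → En ℓ 2 w ≤ 2 * a * En ℓ 3 w + 4 / a ^ 2 * En ℓ 0 w := by
    intro a ha
    have e1 := hw.En_interp hℓ ha 1
    have e0 := hw.En_interp hℓ (half_pos ha) 0
    simp only [zero_add, Nat.reduceAdd] at e1 e0
    have := mul_le_mul_of_nonneg_left e0 (inv_pos.2 ha).le
    have e : a⁻¹ * (a / 2 * En ℓ 2 w + (a / 2)⁻¹ * En ℓ 0 w) =
      En ℓ 2 w / 2 + 2 / a ^ 2 * En ℓ 0 w := by field_simp
    rw [e] at this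
    have e' : 4 / a ^ 2 * En ℓ 0 w = 2 * (2 / a ^ 2 * En ℓ 0 w) := by ring
    rw [e']
    linarith
  refine ⟨?_, ?_, ?_⟩
  · have e3 := hw.En_interp hℓ (half_pos hc) 2
    simp only [Nat.reduceAdd] at e3
    have := mul_le_mul_of_nonneg_left (h2 (a := c / 8) (by positivity))
      (by positivity : 0 ≤ (c / 2)⁻¹)
    have e : (c / 2)⁻¹ * (2 * (c / 8) * En ℓ 3 w + 4 / (c / 8) ^ 2 * En ℓ 0 w) =
        En ℓ 3 w / 2 + 512 / c ^ 3 * En ℓ 0 w := by field_simp; ring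
    rw [e] at this
    have e' : 1024 / c ^ 3 * En ℓ 0 w = 2 * (512 / c ^ 3 * En ℓ 0 w) := by ring
    rw [e']
    linarith
  · have := h2 (a := 1 / 2) (by norm_num)
    norm_num at this; linarith
  · have := hw.En_interp hℓ one_pos 0
    simpa using this

lemma ehrling (hℓ : 0 < ℓ) {κ : ℝ} (hκ : 0 < κ) : ∃ C, 0 ≤ C ∧ ∀ w : Sm, Per ℓ w →
    En ℓ 1 w + En ℓ 2 w + En ℓ 3 w ≤ κ * En ℓ 4 w + C * En ℓ 0 w ∧
    ∀ x, dd 1 w x + dd 2 w x ≤ κ * En ℓ 4 w + C * En ℓ 0 w := by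
  obtain ⟨ρ, hρ, hρℓ, hρκ⟩ : ∃ ρ, 0 < ρ ∧ ρ ≤ ℓ ∧ ρ ^ 2 ≤ κ / 2 := by
    refine ⟨min ℓ (Real.sqrt (κ / 2)), lt_min hℓ (Real.sqrt_pos.2 (by positivity)),
      min_le_left _ _, ?_⟩
    calc _ ≤ Real.sqrt (κ / 2) ^ 2 := by
          gcongr
          exact min_le_right _ _
      _ = _ := Real.sq_sqrt (by positivity)
  obtain ⟨K, hK⟩ : ∃ K, K = ρ ^ 2 + 4 + 8 / ρ ^ 2 := ⟨_, rfl⟩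
  have hK0 : 4 ≤ K := by rw [hK]; have : 0 ≤ ρ ^ 2 + 8 / ρ ^ 2 := by positivity
                         linarith
  obtain ⟨c, hc⟩ : ∃ c, c = κ / (8 * K) := ⟨_, rfl⟩
  have hc0 : 0 < c := by rw [hc]; positivity
  have hcK : c * K = κ / 8 := by rw [hc]; field_simp
  refine ⟨K * (3 * (1024 / c ^ 3) + 50), by positivity, fun w hw => ?_⟩
  obtain ⟨h3, h2, h1⟩ := hw.ehrling_aux hℓ.le hc0
  have p0 := En_nonneg (ℓ := ℓ) 0 w
  have p1 := En_nonneg (ℓ := ℓ) 1 w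
  have p2 := En_nonneg (ℓ := ℓ) 2 w
  have p3 := En_nonneg (ℓ := ℓ) 3 w
  have p4 := En_nonneg (ℓ := ℓ) 4 w
  have key : K * (En ℓ 1 w + En ℓ 2 w + En ℓ 3 w) ≤ 3 * (κ / 8) * En ℓ 4 w +
      K * (3 * (1024 / c ^ 3) + 50) * En ℓ 0 w := by
    rw [← hcK]
    have : En ℓ 1 w + En ℓ 2 w + En ℓ 3 w ≤ 3 * c * En ℓ 4 w +
      (3 * (1024 / c ^ 3) + 50) * En ℓ 0 w := by linarith
    have := mul_le_mul_of_nonneg_left this (by linarith : 0 ≤ K)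
    linarith
  constructor
  · have : En ℓ 1 w + En ℓ 2 w + En ℓ 3 w ≤ K * (En ℓ 1 w + En ℓ 2 w + En ℓ 3 w) := by
      nlinarith
    nlinarith [mul_nonneg hκ.le p4]
  · intro x
    have s1 := hw.sup_dd_le hρ hρℓ 1 x
    have s2 := hw.sup_dd_le hρ hρℓ 2 x
    simp only [Nat.reduceAdd] at s1 s2
    have a1 : ρ ^ 2 * En ℓ 4 w ≤ κ / 2 * En ℓ 4 w := mul_le_mul_of_nonneg_right hρκ p4
    have a2 : ρ ^ 2 * En ℓ 3 w + 2 * En ℓ 2 w + 4 / ρ ^ 2 * En ℓ 1 w +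
        (2 * En ℓ 3 w + 4 / ρ ^ 2 * En ℓ 2 w) ≤ K * (En ℓ 1 w + En ℓ 2 w + En ℓ 3 w) := by
      have q : (0 : ℝ) ≤ 4 / ρ ^ 2 := by positivity
      have q2 : (0 : ℝ) ≤ ρ ^ 2 := by positivity
      have e : K = ρ ^ 2 + 4 + 2 * (4 / ρ ^ 2) := by rw [hK]; ring
      rw [e]
      nlinarith [mul_nonneg q p1, mul_nonneg q p2, mul_nonneg q p3, mul_nonneg q2 p1,
        mul_nonneg q2 p2, mul_nonneg q2 p3]
    nlinarith [mul_nonneg hκ.le p4]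

end PeriodicEnergy

section PeriodicEstimates

/-! ### Linear estimates -/

variable {ℓ : ℝ}

/-- Commutator of the Laplacian with `Tri v v`. -/
def cmm (v w : Sm) : Sm := Lap (Tri v v w) - Tri v v (Lap w)

lemma dd_one_D_le (v : Sm) (x : E2) (i : Fin 2) : dd 1 (D i v) x ≤ dd 2 v x := by
  have h0 := dd_nonneg 1 (D 0 v) x
  have h1 := dd_nonneg 1 (D 1 v) x
  fin_cases i <;> simp only [dd_succ 1 v, Sm.add_apply, Fin.zero_eta, Fin.mk_one] <;> linarith

lemma comm_sq_le (v w : Sm) (x : E2) : (cmm v w x) ^ 2 ≤ 160 * (dd 3 v * dd 1 v * dd 2 w +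
    dd 2 v * dd 2 v * dd 2 w + dd 2 v * dd 1 v * dd 3 w : Sm) x := by
  have e : cmm v w x = 2 * Tri (Lap v) v w x + 2 * Tri (D 0 v) (D 0 v) w x +
      2 * Tri (D 1 v) (D 1 v) w x + 4 * Tri (D 0 v) v (D 0 w) x + 4 * Tri (D 1 v) v (D 1 w) x := by
    rw [cmm, Lap_Tri, Tri_symm v (Lap v), Tri_symm v (D 0 v), Tri_symm v (D 1 v)]
    simp only [Sm.add_apply, Sm.sub_apply, Sm.mul_apply, Sm.two_apply]
    ring
  have t1 := Tri_sq_le (Lap v) v w x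
  have t2 := Tri_sq_le (D 0 v) (D 0 v) w x
  have t3 := Tri_sq_le (D 1 v) (D 1 v) w x
  have t4 := Tri_sq_le (D 0 v) v (D 0 w) x
  have t5 := Tri_sq_le (D 1 v) v (D 1 w) x
  have l := dd_Lap_le 1 v x
  have d0 := dd_one_D_le v x 0
  have d1 := dd_one_D_le v x 1
  have n0 := dd_nonneg 1 (D 0 v) x
  have n1 := dd_nonneg 1 (D 1 v) x
  have m1 := dd_nonneg 1 v x
  have m2 := dd_nonneg 2 w x
  have m3 := dd_nonneg 2 (D 0 w) x
  have m4 := dd_nonneg 2 (D 1 w) x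
  have m5 := dd_nonneg 2 v x
  simp only [Sm.add_apply, Sm.mul_apply, Nat.reduceAdd] at l ⊢
  have s1 : Tri (Lap v) v w x ^ 2 ≤ 2 * (dd 3 v x * dd 1 v x * dd 2 w x) :=
    t1.trans (by nlinarith [mul_le_mul_of_nonneg_right l (mul_nonneg m1 m2)])
  have s2 : Tri (D 0 v) (D 0 v) w x ^ 2 ≤ dd 2 v x * dd 2 v x * dd 2 w x :=
    t2.trans (by gcongr)
  have s3 : Tri (D 1 v) (D 1 v) w x ^ 2 ≤ dd 2 v x * dd 2 v x * dd 2 w x :=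
    t3.trans (by gcongr)
  have s4 : Tri (D 0 v) v (D 0 w) x ^ 2 + Tri (D 1 v) v (D 1 w) x ^ 2 ≤
      dd 2 v x * dd 1 v x * dd 3 w x := by
    have e4 := t4.trans (b := dd 1 (D 0 v) x * dd 1 v x * dd 2 (D 0 w) x) le_rfl
    have a4 : Tri (D 0 v) v (D 0 w) x ^ 2 ≤ dd 2 v x * dd 1 v x * dd 2 (D 0 w) x :=
      t4.trans (by gcongr)
    have a5 : Tri (D 1 v) v (D 1 w) x ^ 2 ≤ dd 2 v x * dd 1 v x * dd 2 (D 1 w) x :=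
      t5.trans (by gcongr)
    rw [dd_succ 2 w, Sm.add_apply, mul_add]; exact add_le_add a4 a5
  have q3 : 0 ≤ dd 3 v x * dd 1 v x * dd 2 w x := mul_nonneg (mul_nonneg (dd_nonneg 3 v x) m1) m2
  have q4 : 0 ≤ dd 2 v x * dd 2 v x * dd 2 w x := mul_nonneg (mul_nonneg m5 m5) m2
  have q5 : 0 ≤ dd 2 v x * dd 1 v x * dd 3 w x := mul_nonneg (mul_nonneg m5 m1) (dd_nonneg 3 w x)
  rw [e]
  generalize Tri (Lap v) v w x = A at *
  generalize Tri (D 0 v) (D 0 v) w x = B at *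
  generalize Tri (D 1 v) (D 1 v) w x = C at *
  generalize Tri (D 0 v) v (D 0 w) x = E at *
  generalize Tri (D 1 v) v (D 1 w) x = F at *
  have : (2 * A + 2 * B + 2 * C + 4 * E + 4 * F) ^ 2 ≤
      5 * (4 * A ^ 2 + 4 * B ^ 2 + 4 * C ^ 2 + 16 * E ^ 2 + 16 * F ^ 2) := by
    nlinarith [sq_nonneg (2 * A - 2 * B), sq_nonneg (2 * A - 2 * C), sq_nonneg (2 * A - 4 * E),
      sq_nonneg (2 * A - 4 * F), sq_nonneg (2 * B - 2 * C), sq_nonneg (2 * B - 4 * E),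
      sq_nonneg (2 * B - 4 * F), sq_nonneg (2 * C - 4 * E), sq_nonneg (2 * C - 4 * F),
      sq_nonneg (4 * E - 4 * F)]
  linarith

protected lemma Per.Aop {v w : Sm} (hv : Per ℓ v) (hw : Per ℓ w) (s : ℝ) : Per ℓ (Aop s v w) :=
  hw.Lap.add ((hv.Tri hv hw).smul s)

lemma Per.reg_four {s T : ℝ} (hℓ : 0 ≤ ℓ) (hs : 0 ≤ s) (hs1 : s ≤ 1) {v w : Sm} (hv : Per ℓ v)
    (hw : Per ℓ w) (hT : ∀ x, 2 + dd 1 v x ≤ T) :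
    En ℓ 4 w ≤ T * (2 * En ℓ 2 (Aop s v w) + 320 * IS ℓ (dd 3 v * dd 1 v * dd 2 w +
      dd 2 v * dd 2 v * dd 2 w + dd 2 v * dd 1 v * dd 3 w)) := by
  have hT0 : 0 ≤ T := by linarith [hT 0, dd_nonneg 1 v 0]
  have h1 := hw.Lap.elliptic hℓ hs hs1 hT
  rw [← hw.En_Lap hℓ 2] at h1
  refine h1.trans (mul_le_mul_of_nonneg_left ?_ hT0)
  rw [(hv.Aop hw s).En_two hℓ]
  refine IS_le_smul_add fun x => ?_
  have e : Aop s v (Lap w) x = Lap (Aop s v w) x - s * cmm v w x := by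
    simp only [Aop, cmm, map_add, map_smul, Sm.add_apply, Sm.sub_apply, Sm.smul_apply]
    ring
  have c := comm_sq_le v w x
  have hs2 : s ^ 2 ≤ 1 := pow_le_one₀ hs hs1
  have hc : s ^ 2 * cmm v w x ^ 2 ≤ cmm v w x ^ 2 := by nlinarith [sq_nonneg (cmm v w x)]
  simp only [Sm.pow_apply]
  rw [e]
  nlinarith [sq_nonneg (Lap (Aop s v w) x + s * cmm v w x)]

lemma IS_le_const_mul {f g : Sm} {c : ℝ} (h : ∀ x, f x ≤ c * g x) : IS ℓ f ≤ c * IS ℓ g :=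
  IS_le_smul h

lemma dd_two_mul_le (a w : Sm) (x : E2) : dd 2 (a * w) x ≤
    8 * (dd 0 a x + dd 1 a x + dd 2 a x) * (dd 0 w x + dd 1 w x + dd 2 w x) := by
  simp only [dd_two, dd_zero, dd_one, D_mul, map_add, Sm.add_apply, Sm.mul_apply, Sm.pow_apply,
    Sm.two_apply]
  generalize a x = a0
  generalize D 0 a x = a1
  generalize D 1 a x = a2
  generalize D 0 (D 0 a) x = a11
  generalize D 0 (D 1 a) x = a12
  generalize D 1 (D 1 a) x = a22
  generalize w x = w0
  generalize D 0 w x = w1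
  generalize D 1 w x = w2
  generalize D 0 (D 0 w) x = w11
  generalize D 0 (D 1 w) x = w12
  generalize D 1 (D 1 w) x = w22
  have four : ∀ p q r s : ℝ, (p + q + (r + s)) ^ 2 ≤ 4 * (p ^ 2 + q ^ 2 + r ^ 2 + s ^ 2) := by
    intro p q r s
    nlinarith [sq_nonneg (p - q), sq_nonneg (p - r), sq_nonneg (p - s), sq_nonneg (q - r),
      sq_nonneg (q - s), sq_nonneg (r - s)]
  have h1 := four (a11 * w0) (a1 * w1) (a1 * w1) (a0 * w11)
  have h2 := four (a12 * w0) (a2 * w1) (a1 * w2) (a0 * w12)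
  have h3 := four (a22 * w0) (a2 * w2) (a2 * w2) (a0 * w22)
  have e : 4 * ((a11 * w0) ^ 2 + (a1 * w1) ^ 2 + (a1 * w1) ^ 2 + (a0 * w11) ^ 2) +
      2 * (4 * ((a12 * w0) ^ 2 + (a2 * w1) ^ 2 + (a1 * w2) ^ 2 + (a0 * w12) ^ 2)) +
      4 * ((a22 * w0) ^ 2 + (a2 * w2) ^ 2 + (a2 * w2) ^ 2 + (a0 * w22) ^ 2) =
      4 * ((a11 ^ 2 + 2 * a12 ^ 2 + a22 ^ 2) * w0 ^ 2) +
      8 * ((a1 ^ 2 + a2 ^ 2) * (w1 ^ 2 + w2 ^ 2)) +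
      4 * (a0 ^ 2 * (w11 ^ 2 + 2 * w12 ^ 2 + w22 ^ 2)) := by ring
  have hA : 0 ≤ a11 ^ 2 + 2 * a12 ^ 2 + a22 ^ 2 := by positivity
  have hA1 : 0 ≤ a1 ^ 2 + a2 ^ 2 := by positivity
  have hW : 0 ≤ w11 ^ 2 + 2 * w12 ^ 2 + w22 ^ 2 := by positivity
  have hW1 : 0 ≤ w1 ^ 2 + w2 ^ 2 := by positivity
  have hA0 := sq_nonneg a0
  have hW0 := sq_nonneg w0
  have e2 : (a11 * w0 + a1 * w1 + (a1 * w1 + a0 * w11)) ^ 2 +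
      2 * (a12 * w0 + a2 * w1 + (a1 * w2 + a0 * w12)) ^ 2 +
      (a22 * w0 + a2 * w2 + (a2 * w2 + a0 * w22)) ^ 2 ≤
      4 * ((a11 ^ 2 + 2 * a12 ^ 2 + a22 ^ 2) * w0 ^ 2) +
      8 * ((a1 ^ 2 + a2 ^ 2) * (w1 ^ 2 + w2 ^ 2)) +
      4 * (a0 ^ 2 * (w11 ^ 2 + 2 * w12 ^ 2 + w22 ^ 2)) := by linarith
  generalize a11 ^ 2 + 2 * a12 ^ 2 + a22 ^ 2 = A2 at *
  generalize a1 ^ 2 + a2 ^ 2 = A1 at *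
  generalize w11 ^ 2 + 2 * w12 ^ 2 + w22 ^ 2 = W2 at *
  generalize w1 ^ 2 + w2 ^ 2 = W1 at *
  generalize a0 ^ 2 = A0 at *
  generalize w0 ^ 2 = W0 at *
  nlinarith [mul_nonneg hA hW, mul_nonneg hA hW1, mul_nonneg hA hW0, mul_nonneg hA1 hW,
    mul_nonneg hA1 hW1, mul_nonneg hA1 hW0, mul_nonneg hA0 hW, mul_nonneg hA0 hW1,
    mul_nonneg hA0 hW0]

/-- The zeroth order coefficient of `Lop`. -/
def aS (s : ℝ) (lam : Sm) : Sm := cst (1 - s) + s • lam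

lemma aS_apply (s : ℝ) (lam : Sm) (x : E2) : aS s lam x = 1 - s + s * lam x := rfl

/-- Linearised operators interpolating between `1 - Δ` and the linearisation of
`λ v - Δ v - Δ_∞ v`. -/
def Lop (s : ℝ) (lam v w : Sm) : Sm := aS s lam * w - Aop s v w - (2 * s) • Tri w v v

lemma Lop_add (s : ℝ) (lam v w z : Sm) : Lop s lam v (w + z) = Lop s lam v w + Lop s lam v z := by
  simp only [Lop, Aop, map_add, Tri_add₃, Tri_add₁, smul_add, mul_add]; abel

lemma Lop_smul (s : ℝ) (lam v w : Sm) (c : ℝ) : Lop s lam v (c • w) = c • Lop s lam v w := by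
  simp only [Lop, Aop, map_smul, Tri_smul₃, Tri_smul₁]; simp only [smul_eq_cst]; ring

lemma Lop_max {s c K : ℝ} (hℓ : 0 < ℓ) (hs : 0 ≤ s) (hs1 : s ≤ 1) (hc1 : c ≤ 1)
    {lam : Sm} (hlam : ∀ x, c ≤ lam x) {v w : Sm} (hw : Per ℓ w) (hK : 0 ≤ K)
    (h : ∀ x, Lop s lam v w x ≤ K) (x : E2) : c * w x ≤ K ∨ c < 0 := by
  by_cases hc : c < 0
  · exact Or.inr hc
  left
  obtain ⟨y, hy⟩ := hw.exists_max hℓ w.continuous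
  by_cases hwy : w y ≤ 0
  · nlinarith [hy x]
  have h1 := h y
  have l := w.Lap_nonpos hy
  have t := w.Tri_nonpos hy v
  have e : Tri w v v y = 0 := by
    simp only [Tri, Sm.add_apply, Sm.mul_apply, w.D_eq_zero hy]; ring
  simp only [Lop, Aop, Sm.sub_apply, Sm.mul_apply, Sm.add_apply, Sm.smul_apply, e, aS_apply] at h1
  have ha : c ≤ 1 - s + s * lam y := by nlinarith [hlam y]
  nlinarith [hy x, mul_nonneg hs (neg_nonneg.2 t)]

lemma Lop_sup {s c : ℝ} (hℓ : 0 < ℓ) (hs : 0 ≤ s) (hs1 : s ≤ 1) (hc0 : 0 < c) (hc1 : c ≤ 1)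
    {lam : Sm} (hlp : Per ℓ lam) (hlam : ∀ x, c ≤ lam x) {v w : Sm} (hv : Per ℓ v) (hw : Per ℓ w)
    (x : E2) : c ^ 2 * w x ^ 2 ≤ cSob ℓ * N2 ℓ (Lop s lam v w) := by
  have hp : Per ℓ (Lop s lam v w) := by
    have ha : Per ℓ (aS s lam) := (Per.const (ℓ := ℓ) (1 - s)).add (hlp.smul s)
    exact ((ha.mul hw).sub (hv.Aop hw s)).sub ((hw.Tri hv hv).smul _)
  have hb := hp.sup_sq_le_N2 hℓ
  obtain ⟨K, hK⟩ : ∃ K, K = Real.sqrt (cSob ℓ * N2 ℓ (Lop s lam v w)) := ⟨_, rfl⟩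
  have hN : 0 ≤ cSob ℓ * N2 ℓ (Lop s lam v w) := mul_nonneg cSob_pos.le (N2_nonneg _)
  have hK0 : 0 ≤ K := hK ▸ Real.sqrt_nonneg _
  have hK2 : K ^ 2 = cSob ℓ * N2 ℓ (Lop s lam v w) := by rw [hK, Real.sq_sqrt hN]
  have hab : ∀ y, |Lop s lam v w y| ≤ K := fun y => by
    rw [hK]; exact Real.abs_le_sqrt (hb y)
  have u1 := (Lop_max hℓ hs hs1 hc1 hlam hw hK0 (fun y => (abs_le.1 (hab y)).2) x).resolve_right
    (by linarith)
  have u2 := (Lop_max (w := (-1 : ℝ) • w) (v := v) hℓ hs hs1 hc1 hlam (hw.smul _) hK0 (fun y => by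
    rw [Lop_smul, Sm.smul_apply]; linarith [(abs_le.1 (hab y)).1]) x).resolve_right (by linarith)
  rw [← hK2, ← mul_pow]
  rw [Sm.smul_apply] at u2
  exact sq_le_sq' (by linarith) u1

lemma dd_two_Tri_le {v w : Sm} {x : E2} {S σ : ℝ} (h1 : dd 1 v x ≤ S) (h2 : dd 2 v x ≤ S)
    (hσ : dd 1 w x + dd 2 w x ≤ σ) : dd 2 (Tri w v v) x ≤
      45 * (S ^ 2 * (dd 2 w x + dd 3 w x) + S * σ * (dd 3 v x + dd 4 v x)) := by
  refine (dd_Tri_le 2 w v v x).trans ?_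
  simp only [triB, Sm.smul_apply, Sm.add_apply, Sm.mul_apply, Nat.reduceAdd]
  have a1 := dd_nonneg 1 v x
  have a2 := dd_nonneg 2 v x
  have a3 := dd_nonneg 3 v x
  have a4 := dd_nonneg 4 v x
  have b1 := dd_nonneg 1 w x
  have b2 := dd_nonneg 2 w x
  have b3 := dd_nonneg 3 w x
  generalize dd 1 v x = v1 at *
  generalize dd 2 v x = v2 at *
  generalize dd 3 v x = v3 at *
  generalize dd 4 v x = v4 at *
  generalize dd 1 w x = w1 at *
  generalize dd 2 w x = w2 at *
  generalize dd 3 w x = w3 at *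
  have hS : 0 ≤ S := a1.trans h1
  have hw1 : w1 ≤ σ := by linarith
  have hw2 : w2 ≤ σ := by linarith
  have hσ0 : 0 ≤ σ := b1.trans hw1
  have t1 : w3 * v1 * v2 ≤ S ^ 2 * w3 := by
    have : v1 * v2 ≤ S * S := mul_le_mul h1 h2 a2 hS
    linarith [mul_le_mul_of_nonneg_left this b3]
  have t2 : w2 * v2 * v2 ≤ S ^ 2 * w2 := by
    have : v2 * v2 ≤ S * S := mul_le_mul h2 h2 a2 hS
    linarith [mul_le_mul_of_nonneg_left this b2]
  have t3 : w2 * v1 * v3 ≤ S * σ * v3 := by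
    have : w2 * v1 ≤ σ * S := mul_le_mul hw2 h1 a1 hσ0
    linarith [mul_le_mul_of_nonneg_right this a3]
  have t4 : w1 * v3 * v2 ≤ S * σ * v3 := by
    have : w1 * v2 ≤ σ * S := mul_le_mul hw1 h2 a2 hσ0
    linarith [mul_le_mul_of_nonneg_right this a3]
  have t5 : w1 * v1 * v4 ≤ S * σ * v4 := by
    have : w1 * v1 ≤ σ * S := mul_le_mul hw1 h1 a1 hσ0
    linarith [mul_le_mul_of_nonneg_right this a4]
  have p1 : 0 ≤ S ^ 2 * w2 := by positivity
  have p2 : 0 ≤ S ^ 2 * w3 := by positivity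
  have p3 : 0 ≤ S * σ * v4 := by positivity
  have p4 : 0 ≤ S * σ * v3 := by positivity
  linarith

lemma En_le_N2 {k : ℕ} (hk : k ≤ 2) (w : Sm) : En ℓ k w ≤ N2 ℓ w := by
  have := En_nonneg (ℓ := ℓ) 0 w
  have := En_nonneg (ℓ := ℓ) 1 w
  have := En_nonneg (ℓ := ℓ) 2 w
  unfold N2
  interval_cases k <;> linarith

set_option maxHeartbeats 1000000 in
lemma lin_apriori (hℓ : 0 < ℓ) {c : ℝ} (hc0 : 0 < c) (hc1 : c ≤ 1) {lam : Sm} (hlp : Per ℓ lam)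
    (hlam : ∀ x, c ≤ lam x) (B : ℝ) : ∃ C, 0 ≤ C ∧ ∀ s : ℝ, 0 ≤ s → s ≤ 1 → ∀ v w : Sm,
      Per ℓ v → Per ℓ w → H4 ℓ v ≤ B → H4 ℓ w ≤ C * N2 ℓ (Lop s lam v w) := by
  by_cases hB : B < 0
  · exact ⟨0, le_rfl, fun s _ _ v w _ _ h => by linarith [H4_nonneg (ℓ := ℓ) v]⟩
  replace hB := not_lt.1 hB
  have hcS := cSob_pos (ℓ := ℓ)
  obtain ⟨S, hS⟩ : ∃ S, S = cSob ℓ * B := ⟨_, rfl⟩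
  have hS0 : 0 ≤ S := hS ▸ mul_nonneg hcS.le hB
  obtain ⟨Ca, hCa⟩ : ∃ Ca, Ca = 6 * (cSob ℓ * H4 ℓ lam) + 2 := ⟨_, rfl⟩
  have hCa0 : 0 ≤ Ca := by have := mul_nonneg hcS.le (H4_nonneg (ℓ := ℓ) lam); linarith
  obtain ⟨M, hM⟩ : ∃ M, M = (2 + S) * (64 * Ca + 8 + 1040 * (S ^ 2 + S * B)) := ⟨_, rfl⟩
  have hM0 : 0 < M := hM ▸ by positivity
  obtain ⟨Ce, hCe0, hCe⟩ := ehrling hℓ (κ := 1 / (4 * M)) (by positivity)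
  obtain ⟨V, hV⟩ : ∃ V, V = cSob ℓ / c ^ 2 * IS ℓ 1 := ⟨_, rfl⟩
  have hV0 : 0 ≤ V := hV ▸ mul_nonneg (by positivity) (IS_nonneg fun x => zero_le_one)
  refine ⟨2 * (2 * M * (V + 1 + 2 * Ce * V)) + V + Ce * V, by positivity, ?_⟩
  intro s hs hs1 v w hv hw hvB
  obtain ⟨N, hN⟩ : ∃ N, N = N2 ℓ (Lop s lam v w) := ⟨_, rfl⟩
  have hN0 : 0 ≤ N := hN ▸ N2_nonneg _
  rw [← hN]
  have h0 : En ℓ 0 w ≤ V * N := by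
    have : En ℓ 0 w ≤ (cSob ℓ / c ^ 2 * N) * IS ℓ 1 := by
      refine IS_le_smul fun x => ?_
      have := Lop_sup hℓ hs hs1 hc0 hc1 hlp hlam hv hw x
      rw [← hN] at this
      rw [Sm.one_apply, dd_zero, Sm.pow_apply, mul_one, div_mul_eq_mul_div, le_div_iff₀ (by positivity)]
      linarith
    rw [hV]; linarith
  obtain ⟨hX, hσ⟩ := hCe w hw
  obtain ⟨σ, hσe⟩ : ∃ σ, σ = 1 / (4 * M) * En ℓ 4 w + Ce * En ℓ 0 w := ⟨_, rfl⟩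
  rw [← hσe] at hX
  simp only [← hσe] at hσ
  have p0 := En_nonneg (ℓ := ℓ) 0 w
  have p1 := En_nonneg (ℓ := ℓ) 1 w
  have p2 := En_nonneg (ℓ := ℓ) 2 w
  have p3 := En_nonneg (ℓ := ℓ) 3 w
  have p4 := En_nonneg (ℓ := ℓ) 4 w
  have hσ0 : 0 ≤ σ := by rw [hσe]; positivity
  have v1 : ∀ x, dd 1 v x ≤ S := fun x => (hv.sup_dd_le_H4 hℓ (by norm_num) x).trans
    (hS ▸ mul_le_mul_of_nonneg_left hvB hcS.le)
  have v2 : ∀ x, dd 2 v x ≤ S := fun x => (hv.sup_dd_le_H4 hℓ le_rfl x).trans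
    (hS ▸ mul_le_mul_of_nonneg_left hvB hcS.le)
  have hvE : En ℓ 3 v + En ℓ 4 v ≤ B := by
    have := En_nonneg (ℓ := ℓ) 0 v; have := En_nonneg (ℓ := ℓ) 1 v
    have := En_nonneg (ℓ := ℓ) 2 v; unfold H4 at hvB; linarith
  have ev3 := En_nonneg (ℓ := ℓ) 3 v
  have ev4 := En_nonneg (ℓ := ℓ) 4 v
  have i1 : En ℓ 2 (aS s lam * w) ≤ 8 * Ca * (En ℓ 0 w + En ℓ 1 w + En ℓ 2 w) := by
    have : En ℓ 0 w + En ℓ 1 w + En ℓ 2 w = IS ℓ (dd 0 w + dd 1 w + dd 2 w) := by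
      simp only [map_add, En]
    rw [this]
    refine IS_le_smul fun x => (dd_two_mul_le _ _ x).trans ?_
    have hk : ∀ k ≤ 2, dd k (aS s lam) x ≤ 2 * dd k (cst (1 - s)) x + 2 * (cSob ℓ * H4 ℓ lam) := by
      intro k hk
      have h := dd_add_le_two k (cst (1 - s)) (s • lam) x
      rw [dd_smul, Sm.smul_apply] at h
      have h3 := hlp.sup_dd_le_H4 hℓ hk x
      have : s ^ 2 * dd k lam x ≤ 1 * (cSob ℓ * H4 ℓ lam) :=
        mul_le_mul (pow_le_one₀ hs hs1) h3 (dd_nonneg _ _ _) zero_le_one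
      unfold aS; linarith
    have e0 : dd 0 (cst (1 - s)) x ≤ 1 := by
      rw [dd_zero, Sm.pow_apply, cst_apply]; exact pow_le_one₀ (by linarith) (by linarith)
    have e1 : dd 1 (cst (1 - s)) x = 0 := by simp [dd_one]
    have e2 : dd 2 (cst (1 - s)) x = 0 := by simp [dd_two]
    have := hk 0 (by norm_num); have := hk 1 (by norm_num); have := hk 2 le_rfl
    simp only [Sm.add_apply]
    have q0 := dd_nonneg 0 w x
    have q1 := dd_nonneg 1 w x
    have q2 := dd_nonneg 2 w x
    refine mul_le_mul_of_nonneg_right ?_ (by linarith)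
    linarith
  have i2 : En ℓ 2 (Tri w v v) ≤ 45 * (S ^ 2 * σ + S * σ * B) := by
    have : En ℓ 2 (Tri w v v) ≤ 45 * S ^ 2 * IS ℓ (dd 2 w + dd 3 w) +
        45 * (S * σ) * IS ℓ (dd 3 v + dd 4 v) := by
      refine IS_le_smul_add fun x => (dd_two_Tri_le (v1 x) (v2 x) (hσ x)).trans ?_
      simp only [Sm.add_apply]; linarith
    simp only [map_add] at this
    change _ ≤ 45 * S ^ 2 * (En ℓ 2 w + En ℓ 3 w) + 45 * (S * σ) * (En ℓ 3 v + En ℓ 4 v) at this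
    have a1 : S ^ 2 * (En ℓ 2 w + En ℓ 3 w) ≤ S ^ 2 * σ :=
      mul_le_mul_of_nonneg_left (by linarith) (by positivity)
    have a2 : S * σ * (En ℓ 3 v + En ℓ 4 v) ≤ S * σ * B :=
      mul_le_mul_of_nonneg_left hvE (by positivity)
    linarith
  have i3 : IS ℓ (dd 3 v * dd 1 v * dd 2 w + dd 2 v * dd 2 v * dd 2 w + dd 2 v * dd 1 v * dd 3 w) ≤
      S ^ 2 * σ + S * σ * B := by
    have : IS ℓ (dd 3 v * dd 1 v * dd 2 w + dd 2 v * dd 2 v * dd 2 w + dd 2 v * dd 1 v * dd 3 w) ≤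
        S ^ 2 * IS ℓ (dd 2 w + dd 3 w) + S * σ * IS ℓ (dd 3 v) := by
      refine IS_le_smul_add fun x => ?_
      simp only [Sm.add_apply, Sm.mul_apply]
      have h1 := v1 x
      have h2 := v2 x
      have hw2 : dd 2 w x ≤ σ := by linarith [hσ x, dd_nonneg 1 w x]
      have a1 := dd_nonneg 1 v x
      have a2 := dd_nonneg 2 v x
      have a3 := dd_nonneg 3 v x
      have b2 := dd_nonneg 2 w x
      have b3 := dd_nonneg 3 w x
      have t1 : dd 3 v x * dd 1 v x * dd 2 w x ≤ S * σ * dd 3 v x := by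
        have : dd 1 v x * dd 2 w x ≤ S * σ := mul_le_mul h1 hw2 b2 hS0
        linarith [mul_le_mul_of_nonneg_left this a3]
      have t2 : dd 2 v x * dd 2 v x ≤ S * S := mul_le_mul h2 h2 a2 hS0
      have t3 : dd 2 v x * dd 1 v x ≤ S * S := mul_le_mul h2 h1 a1 hS0
      linarith [mul_le_mul_of_nonneg_right t2 b2, mul_le_mul_of_nonneg_right t3 b3]
    simp only [map_add] at this ⊢
    change _ ≤ S ^ 2 * (En ℓ 2 w + En ℓ 3 w) + (S * σ) * (En ℓ 3 v) at this
    have a1 : S ^ 2 * (En ℓ 2 w + En ℓ 3 w) ≤ S ^ 2 * σ :=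
      mul_le_mul_of_nonneg_left (by linarith) (by positivity)
    have a2 : S * σ * En ℓ 3 v ≤ S * σ * B :=
      mul_le_mul_of_nonneg_left (by linarith) (by positivity)
    linarith
  have i4 : En ℓ 2 (Aop s v w) ≤ 4 * En ℓ 2 (aS s lam * w) + 4 * N + 8 * En ℓ 2 (Tri w v v) := by
    have e : Aop s v w = aS s lam * w - Lop s lam v w - (2 * s) • Tri w v v := by
      unfold Lop; abel
    have a := En_sub_le_two (ℓ := ℓ) 2 (aS s lam * w - Lop s lam v w) ((2 * s) • Tri w v v)
    have b := En_sub_le_two (ℓ := ℓ) 2 (aS s lam * w) (Lop s lam v w)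
    rw [← e, En_smul] at a
    have hNN : En ℓ 2 (Lop s lam v w) ≤ N := hN ▸ En_le_N2 le_rfl _
    have : (2 * s) ^ 2 * En ℓ 2 (Tri w v v) ≤ 4 * En ℓ 2 (Tri w v v) :=
      mul_le_mul_of_nonneg_right (by nlinarith only [hs, hs1]) (En_nonneg _ _)
    linarith
  have r := hv.reg_four hℓ.le hs hs1 hw (T := 2 + S) fun x => by linarith [v1 x]
  have key : En ℓ 4 w ≤ M * (En ℓ 0 w + N + 2 * σ) := by
    refine r.trans ?_
    rw [hM, mul_assoc (2 + S)]
    refine mul_le_mul_of_nonneg_left ?_ (by linarith)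
    have q : 8 * Ca * (En ℓ 0 w + En ℓ 1 w + En ℓ 2 w) ≤ 8 * Ca * (En ℓ 0 w + σ) :=
      mul_le_mul_of_nonneg_left (by linarith) (by positivity)
    have q1 : 0 ≤ Ca * σ := by positivity
    have q2 : 0 ≤ Ca * N := by positivity
    have q3 : 0 ≤ (S ^ 2 + S * B) * (En ℓ 0 w + N + σ) := by positivity
    have e : S ^ 2 * σ + S * σ * B = (S ^ 2 + S * B) * σ := by ring
    rw [e] at i2 i3
    linarith
  have hMσ : M * (2 * σ) = En ℓ 4 w / 2 + 2 * Ce * M * En ℓ 0 w := by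
    rw [hσe]; field_simp; ring
  have k2 : En ℓ 4 w ≤ 2 * M * (V + 1 + 2 * Ce * V) * N := by
    have : En ℓ 4 w ≤ 2 * M * (En ℓ 0 w + N + 2 * Ce * En ℓ 0 w) := by linarith
    refine this.trans ?_
    have : En ℓ 0 w + N + 2 * Ce * En ℓ 0 w ≤ (V + 1 + 2 * Ce * V) * N := by
      linarith [mul_le_mul_of_nonneg_left h0 hCe0]
    linarith [mul_le_mul_of_nonneg_left this (by positivity : 0 ≤ 2 * M)]
  have hσ4 : σ ≤ En ℓ 4 w + Ce * (V * N) := by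
    rw [hσe]
    have : 1 / (4 * M) ≤ 1 := by
      rw [div_le_one (by positivity)]
      have : (16 : ℝ) ≤ M := by
        have q1 := mul_nonneg hS0 hB
        have q2 : 0 ≤ S * (64 * Ca + 8 + 1040 * (S ^ 2 + S * B)) := by positivity
        rw [hM]; linarith [sq_nonneg S]
      linarith
    linarith [mul_le_mul_of_nonneg_left h0 hCe0, mul_le_mul_of_nonneg_right this p4]
  unfold H4
  linarith

end PeriodicEstimates

section Resolvent

/-! ### Approximate solvability of `w - Δw = G` -/

variable {ℓ : ℝ}

/-- Translation. -/
def tr (a : E2) : Module.End ℝ Sm where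
  toFun v := ⟨fun x => v (x + a), v.contDiff.comp (contDiff_id.add contDiff_const)⟩
  map_add' _ _ := rfl
  map_smul' _ _ := rfl

lemma tr_apply (a : E2) (v : Sm) (x : E2) : tr a v x = v (x + a) := rfl

lemma D_tr (i : Fin 2) (a : E2) (v : Sm) : D i (tr a v) = tr a (D i v) := Sm.ext fun x => by
  rw [tr_apply, D_apply', D_apply', ← fderiv_comp_add_right]; rfl

lemma Per.tr {v : Sm} (hv : Per ℓ v) (a : E2) : Per ℓ (tr a v) := fun i x => by
  rw [tr_apply, tr_apply, add_right_comm]; exact hv i (x + a)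

/-- Average over four neighbours. -/
def avg (h : ℝ) : Module.End ℝ Sm :=
  (1 / 4 : ℝ) • (tr (h • ev 0) + tr (-(h • ev 0)) + (tr (h • ev 1) + tr (-(h • ev 1))))

lemma avg_apply (h : ℝ) (v : Sm) (x : E2) : avg h v x = 1 / 4 * (v (x + h • ev 0) +
    v (x - h • ev 0) + (v (x + h • ev 1) + v (x - h • ev 1))) := by
  simp only [sub_eq_add_neg]; rfl

lemma commute_avg (i : Fin 2) (h : ℝ) : Commute (D i : Module.End ℝ Sm) (avg h) := by
  have : ∀ a, Commute (D i : Module.End ℝ Sm) (tr a) := fun a => LinearMap.ext fun v => D_tr i a v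
  exact (((this _).add_right (this _)).add_right ((this _).add_right (this _))).smul_right _

/-- Truncated resolvent of the discrete Laplacian. -/
def res (h θ : ℝ) (N : ℕ) : Module.End ℝ Sm := (1 - θ) • ∑ k ∈ Finset.range N, (θ • avg h) ^ k

lemma commute_res (i : Fin 2) (h θ : ℝ) (N : ℕ) : Commute (D i : Module.End ℝ Sm) (res h θ N) :=
  (Commute.sum_right _ _ _ fun _ _ => ((commute_avg i h).smul_right _).pow_right _).smul_right _

lemma D_res (i : Fin 2) (h θ : ℝ) (N : ℕ) (v : Sm) : D i (res h θ N v) = res h θ N (D i v) :=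
  LinearMap.congr_fun (commute_res i h θ N) v

lemma avg_bound {h K : ℝ} {v : Sm} (hv : ∀ x, |v x| ≤ K) (x : E2) : |avg h v x| ≤ K := by
  rw [avg_apply, abs_le]
  have h1 := abs_le.1 (hv (x + h • ev 0))
  have h2 := abs_le.1 (hv (x - h • ev 0))
  have h3 := abs_le.1 (hv (x + h • ev 1))
  have h4 := abs_le.1 (hv (x - h • ev 1))
  constructor <;> linarith

lemma avg_pow_bound {h θ K : ℝ} (hθ : 0 ≤ θ) {v : Sm} (hv : ∀ x, |v x| ≤ K) (k : ℕ) (x : E2) :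
    |((θ • avg h) ^ k) v x| ≤ θ ^ k * K := by
  induction k generalizing x with
  | zero => simpa using hv x
  | succ k ih =>
    rw [pow_succ', Module.End.mul_apply, LinearMap.smul_apply, Sm.smul_apply, abs_mul,
      abs_of_nonneg hθ, pow_succ', mul_assoc]
    exact mul_le_mul_of_nonneg_left (avg_bound ih x) hθ

lemma res_bound {h θ K : ℝ} (hθ : 0 ≤ θ) (hθ1 : θ < 1) (N : ℕ) {v : Sm} (hv : ∀ x, |v x| ≤ K)
    (x : E2) : |res h θ N v x| ≤ K := by
  have hK : 0 ≤ K := (abs_nonneg _).trans (hv 0)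
  rw [res, LinearMap.smul_apply, Sm.smul_apply, LinearMap.sum_apply, Sm.sum_apply, abs_mul,
    abs_of_pos (by linarith)]
  have : |∑ k ∈ Finset.range N, ((θ • avg h) ^ k) v x| ≤ ∑ k ∈ Finset.range N, θ ^ k * K :=
    (Finset.abs_sum_le_sum_abs _ _).trans (Finset.sum_le_sum fun k _ => avg_pow_bound hθ hv k x)
  refine (mul_le_mul_of_nonneg_left this (by linarith)).trans ?_
  rw [← Finset.sum_mul, ← mul_assoc, mul_neg_geom_sum]
  have := pow_nonneg hθ N
  nlinarith

lemma Per.avg_pow {v : Sm} (hv : Per ℓ v) (h θ : ℝ) (k : ℕ) : Per ℓ (((θ • avg h) ^ k) v) := by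
  induction k with
  | zero => exact hv
  | succ k ih =>
    rw [pow_succ', Module.End.mul_apply]
    exact ((((ih.tr _).add (ih.tr _)).add ((ih.tr _).add (ih.tr _))).smul _).smul _

lemma Per.sum {ι : Type*} (s : Finset ι) {f : ι → Sm} (h : ∀ k ∈ s, Per ℓ (f k)) :
    Per ℓ (∑ k ∈ s, f k : Sm) := by
  intro i x
  rw [Sm.sum_apply, Sm.sum_apply]
  exact Finset.sum_congr rfl fun k hk => h k hk i x

lemma Per.res {v : Sm} (hv : Per ℓ v) (h θ : ℝ) (N : ℕ) : Per ℓ (res h θ N v) := by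
  rw [_root_.res, LinearMap.smul_apply, LinearMap.sum_apply]
  exact (Per.sum _ fun k _ => hv.avg_pow h θ k).smul _

lemma res_eq (h θ : ℝ) (N : ℕ) (v : Sm) :
    res h θ N v - θ • avg h (res h θ N v) = (1 - θ) • (v - ((θ • avg h) ^ N) v) := by
  have := congrArg (fun A => (1 - θ) • A) (mul_neg_geom_sum (θ • avg h) N)
  have := LinearMap.congr_fun this v
  simp only [LinearMap.smul_apply, Module.End.mul_apply, LinearMap.sub_apply,
    Module.End.one_apply] at this
  rw [← this, res]
  simp only [LinearMap.smul_apply, map_smul, smul_sub, smul_comm θ (1 - θ)]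

lemma norm_le_of_deriv {g g' : ℝ → ℝ} {h K : ℝ} (hd : ∀ t, HasDerivAt g (g' t) t)
    (h0 : g 0 = 0) (hb : ∀ t ∈ Set.Icc 0 h, |g' t| ≤ K) : ∀ t ∈ Set.Icc 0 h, |g t| ≤ K * t := by
  intro t ht
  have := norm_image_sub_le_of_norm_deriv_le_segment' (f := g) (f' := g') (a := 0) (b := h)
    (C := K) (fun x _ => (hd x).hasDerivWithinAt)
    (fun x hx => hb x ⟨hx.1, hx.2.le⟩) t ht
  simpa [h0] using this

lemma second_diff {w : Sm} {h K : ℝ} (hh : 0 ≤ h) (i : Fin 2)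
    (hK : ∀ x, |D i (D i (D i w)) x| ≤ K) (x : E2) :
    |w (x + h • ev i) + w (x - h • ev i) - 2 * w x - h ^ 2 * D i (D i w) x| ≤ 2 * K * h ^ 3 := by
  have hK0 : 0 ≤ K := (abs_nonneg _).trans (hK 0)
  have dneg : ∀ (v : Sm) (t : ℝ), HasDerivAt (fun t : ℝ => v (x - t • ev i))
      (-D i v (x - t • ev i)) t := by
    intro v t
    have e : ∀ t : ℝ, x - t • ev i = x + (-t) • ev i := fun t => by rw [neg_smul, sub_eq_add_neg]
    simp only [e]
    have := (v.hasDerivAt_line x i (-t)).comp t (hasDerivAt_neg t)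
    simpa [Function.comp_def] using this
  have s3 : ∀ t ∈ Set.Icc 0 h, |D i (D i w) (x + t • ev i) + D i (D i w) (x - t • ev i) -
      2 * D i (D i w) x| ≤ 2 * K * t := by
    refine norm_le_of_deriv (g' := fun t => D i (D i (D i w)) (x + t • ev i) +
      -D i (D i (D i w)) (x - t • ev i)) (fun t => ?_) (by simp; ring) fun t _ => ?_
    · exact (((D i (D i w)).hasDerivAt_line x i t).add (dneg _ t)).sub_const _
    · have a := abs_le.1 (hK (x + t • ev i))
      have b := abs_le.1 (hK (x - t • ev i))
      rw [abs_le]; constructor <;> linarith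
  have s2 : ∀ t ∈ Set.Icc 0 h, |D i w (x + t • ev i) - D i w (x - t • ev i) -
      2 * t * D i (D i w) x| ≤ 2 * K * h * t := by
    refine norm_le_of_deriv (g' := fun t => D i (D i w) (x + t • ev i) + D i (D i w) (x - t • ev i)
      - 2 * D i (D i w) x) (fun t => ?_) (by simp) fun t ht => (s3 t ht).trans ?_
    · have := (((D i w).hasDerivAt_line x i t).sub (dneg (D i w) t)).sub
        (((hasDerivAt_id t).const_mul 2).mul_const (D i (D i w) x))
      exact this.congr_deriv (by ring)
    · exact mul_le_mul_of_nonneg_left ht.2 (by positivity)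
  have s1 : ∀ t ∈ Set.Icc 0 h, |w (x + t • ev i) + w (x - t • ev i) - 2 * w x -
      t ^ 2 * D i (D i w) x| ≤ 2 * K * h * h * t := by
    refine norm_le_of_deriv (g' := fun t => D i w (x + t • ev i) - D i w (x - t • ev i)
      - 2 * t * D i (D i w) x) (fun t => ?_) (by simp; ring) fun t ht => (s2 t ht).trans ?_
    · have := ((((w).hasDerivAt_line x i t).add (dneg w t)).sub_const (2 * w x)).sub
        (((hasDerivAt_id t).pow 2).mul_const (D i (D i w) x))
      exact this.congr_deriv (by simp; ring)
    · exact mul_le_mul_of_nonneg_left ht.2 (by positivity)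
  have := s1 h ⟨hh, le_rfl⟩
  linarith

lemma dd_D_le (k : ℕ) (v : Sm) (x : E2) (i : Fin 2) : dd k (D i v) x ≤ dd (k + 1) v x := by
  have h0 := dd_nonneg k (D 0 v) x
  have h1 := dd_nonneg k (D 1 v) x
  fin_cases i <;> simp only [dd_succ k v, Sm.add_apply, Fin.zero_eta, Fin.mk_one] <;> linarith

/-- Residual of the discrete resolvent. -/
def resid (h θ : ℝ) (N : ℕ) (v : Sm) : Sm := v - (res h θ N v - Lap (res h θ N v))

lemma D_resid (i : Fin 2) (h θ : ℝ) (N : ℕ) (v : Sm) :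
    D i (resid h θ N v) = resid h θ N (D i v) := by
  simp only [resid, map_sub, D_Lap, D_res]

lemma resid_bound {h K : ℝ} (hh : 0 < h) (N : ℕ) {v : Sm} (h0 : ∀ x, dd 0 v x ≤ K ^ 2)
    (h3 : ∀ x, dd 3 v x ≤ K ^ 2) (hK : 0 ≤ K) (x : E2) :
    dd 0 (resid h (4 / (4 + h ^ 2)) N v) x ≤ (((4 / (4 + h ^ 2)) ^ N + 4 * h) * K) ^ 2 := by
  obtain ⟨θ, hθ⟩ : ∃ θ, θ = 4 / (4 + h ^ 2) := ⟨_, rfl⟩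
  have hh2 : 0 < h ^ 2 := by positivity
  have hθ0 : 0 ≤ θ := hθ ▸ by positivity
  have hθ1 : θ < 1 := by rw [hθ, div_lt_one (by positivity)]; linarith
  have hθh : θ * (4 + h ^ 2) = 4 := by rw [hθ]; field_simp
  rw [← hθ]
  have b0 : ∀ x, |v x| ≤ K := fun x => by
    have := h0 x; rw [dd_zero, Sm.pow_apply] at this; exact abs_le_of_sq_le_sq this hK
  have b3 : ∀ i x, |D i (D i (D i v)) x| ≤ K := fun i x => by
    have : dd 0 (D i (D i (D i v))) x ≤ K ^ 2 :=
      (((dd_D_le 0 _ x i).trans (dd_D_le 1 _ x i)).trans (dd_D_le 2 _ x i)).trans (h3 x)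
    rw [dd_zero, Sm.pow_apply] at this; exact abs_le_of_sq_le_sq this hK
  obtain ⟨w, hw⟩ : ∃ w, w = res h θ N v := ⟨_, rfl⟩
  have w3 : ∀ i x, |D i (D i (D i w)) x| ≤ K := fun i x => by
    rw [hw]; simp only [D_res]; exact res_bound hθ0 hθ1 N (b3 i) x
  have e := congrArg (fun g : Sm => g x) (res_eq h θ N v)
  simp only [Sm.sub_apply, Sm.smul_apply, ← hw, avg_apply] at e
  have eN := avg_pow_bound (h := h) hθ0 b0 N x
  have d0 := second_diff hh.le 0 (w3 0) x
  have d1 := second_diff hh.le 1 (w3 1) x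
  rw [dd_zero, Sm.pow_apply, resid, ← hw]
  simp only [Sm.sub_apply, Lap_def, Sm.add_apply]
  generalize ((θ • avg h) ^ N) v x = p at *
  generalize w (x + h • ev 0) + w (x - h • ev 0) = q0 at *
  generalize w (x + h • ev 1) + w (x - h • ev 1) = q1 at *
  generalize D 0 (D 0 w) x = l0 at *
  generalize D 1 (D 1 w) x = l1 at *
  have key : v x - (w x - (l0 + l1)) = p - ((q0 - 2 * w x - h ^ 2 * l0) +
      (q1 - 2 * w x - h ^ 2 * l1)) / h ^ 2 := by
    have h1 : (1 - θ) ≠ 0 := by linarith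
    have : h ^ 2 = 4 * (1 - θ) / θ := by
      have : θ ≠ 0 := by rintro rfl; norm_num at hθh
      field_simp; linarith
    have e' : v x - p = (w x - θ * (1 / 4 * (q0 + q1))) / (1 - θ) := by
      rw [e]; field_simp
    have hθne : θ ≠ 0 := by rintro rfl; norm_num at hθh
    rw [sub_eq_iff_eq_add] at e'
    rw [e', this]; field_simp; ring
  rw [key]
  refine sq_le_sq' ?_ ?_
  all_goals
    have a0 := abs_le.1 d0
    have a1 := abs_le.1 d1
    have ap := abs_le.1 eN
    have c1 : ((q0 - 2 * w x - h ^ 2 * l0) + (q1 - 2 * w x - h ^ 2 * l1)) / h ^ 2 ≤ 4 * h * K := by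
      rw [div_le_iff₀ hh2]; linarith
    have c2 : -(4 * h * K) ≤ ((q0 - 2 * w x - h ^ 2 * l0) + (q1 - 2 * w x - h ^ 2 * l1)) / h ^ 2 := by
      rw [le_div_iff₀ hh2]; linarith
    linarith

end Resolvent

section Linearization

/-! ### Approximate solvability of the linearised equation -/

variable {ℓ : ℝ}

lemma dd_resid_le {h K : ℝ} (hh : 0 < h) (hK : 0 ≤ K) (N k : ℕ) {v : Sm}
    (hv : ∀ j ≤ k + 3, ∀ x, dd j v x ≤ K ^ 2) (x : E2) :
    dd k (resid h (4 / (4 + h ^ 2)) N v) x ≤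
      2 ^ k * (((4 / (4 + h ^ 2)) ^ N + 4 * h) * K) ^ 2 := by
  induction k generalizing v with
  | zero => rw [pow_zero, one_mul]
            exact resid_bound hh N (hv 0 (by omega)) (hv 3 (by omega)) hK x
  | succ k ih =>
    rw [dd_succ, Sm.add_apply, D_resid, D_resid, pow_succ 2 k]
    have := ih (v := D 0 v) fun j hj x => (dd_D_le j v x 0).trans (hv (j + 1) (by omega) x)
    have := ih (v := D 1 v) fun j hj x => (dd_D_le j v x 1).trans (hv (j + 1) (by omega) x)
    linarith

lemma Per.exists_bound (hℓ : 0 < ℓ) {v : Sm} (hv : Per ℓ v) (n : ℕ) :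
    ∃ K, 0 ≤ K ∧ ∀ j ≤ n, ∀ x, dd j v x ≤ K ^ 2 := by
  induction n with
  | zero =>
    obtain ⟨x, hx⟩ := (hv.dd 0).exists_max hℓ (dd 0 v).continuous
    refine ⟨√(dd 0 v x), Real.sqrt_nonneg _, fun j hj y => ?_⟩
    rw [Real.sq_sqrt (dd_nonneg 0 v x), Nat.le_zero.1 hj]; exact hx y
  | succ n ih =>
    obtain ⟨K, hK, h⟩ := ih
    obtain ⟨x, hx⟩ := (hv.dd (n + 1)).exists_max hℓ (dd (n + 1) v).continuous
    have h0 := Real.sqrt_nonneg (dd (n + 1) v x)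
    have h1 := Real.sq_sqrt (dd_nonneg (n + 1) v x)
    refine ⟨K + √(dd (n + 1) v x), add_nonneg hK h0, fun j hj y => ?_⟩
    rcases Nat.lt_or_ge n j with hj' | hj'
    · obtain rfl : j = n + 1 := by omega
      nlinarith [hx y]
    · nlinarith [h j hj' y]

lemma exists_sq_mul_le (A : ℝ) {B : ℝ} (hB : 0 < B) : ∃ δ, 0 < δ ∧ δ ^ 2 * A ≤ B := by
  refine ⟨√(B / (|A| + 1)), Real.sqrt_pos.2 (by positivity), ?_⟩
  rw [Real.sq_sqrt (by positivity), div_mul_eq_mul_div, div_le_iff₀ (by positivity)]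
  nlinarith [le_abs_self A, abs_nonneg A]

lemma Lop_zero (lam v w : Sm) : Lop 0 lam v w = w - Lap w := Sm.ext fun x => by
  simp [Lop, Aop, aS]

lemma lin_start (hℓ : 0 < ℓ) (G : Sm) (hG : Per ℓ G) :
    ∃ w : Sm, Per ℓ w ∧ N2 ℓ (G - (w - Lap w)) ≤ 1 / 2 * N2 ℓ G := by
  rcases (N2_nonneg (ℓ := ℓ) G).eq_or_lt with h | hpos
  · refine ⟨0, fun i x => rfl, ?_⟩
    simp [← h]
  obtain ⟨K, hK, hb⟩ := hG.exists_bound hℓ 5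
  obtain ⟨δ, hδ, hδb⟩ := exists_sq_mul_le (7 * K ^ 2 * IS ℓ 1) (half_pos hpos)
  obtain ⟨h, hh⟩ : ∃ h, h = δ / 8 := ⟨_, rfl⟩
  have hh0 : 0 < h := by linarith
  have hθ1 : 4 / (4 + h ^ 2) < 1 := by
    rw [div_lt_one (by positivity)]; linarith [sq_pos_of_pos hh0]
  obtain ⟨N, hN⟩ := exists_pow_lt_of_lt_one (half_pos hδ) hθ1
  refine ⟨res h (4 / (4 + h ^ 2)) N G, hG.res _ _ _, ?_⟩
  change N2 ℓ (resid h (4 / (4 + h ^ 2)) N G) ≤ _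
  have hθN : 0 ≤ (4 / (4 + h ^ 2)) ^ N := by positivity
  have key : ∀ k ≤ 2, En ℓ k (resid h (4 / (4 + h ^ 2)) N G) ≤
      2 ^ k * (δ ^ 2 * K ^ 2) * IS ℓ 1 := fun k hk => by
    refine IS_le_smul fun x => ?_
    refine (dd_resid_le hh0 hK N k (fun j hj => hb j (by omega)) x).trans ?_
    rw [Sm.one_apply, mul_one, mul_pow]
    gcongr
    linarith
  have k0 := key 0 (by norm_num)
  have k1 := key 1 (by norm_num)
  have k2 := key 2 (by norm_num)
  unfold N2 at *
  norm_num at k0 k1 k2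
  linarith

/-- The part of `Lop` proportional to the continuation parameter. -/
def Mop (lam v w : Sm) : Sm := (lam - 1) * w - Tri v v w - (2 : ℝ) • Tri w v v

lemma Lop_sub (s t : ℝ) (lam v w : Sm) : Lop t lam v w = Lop s lam v w + (t - s) • Mop lam v w :=
  Sm.ext fun x => by
    simp [Lop, Aop, aS, cst_apply, Mop]; ring

lemma En_mul_le (hℓ : 0 < ℓ) {a : Sm} (ha : Per ℓ a) :
    ∃ C, 0 ≤ C ∧ ∀ w, N2 ℓ (a * w) ≤ C * N2 ℓ w := by
  obtain ⟨K, hK, hb⟩ := ha.exists_bound hℓ 2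
  have e : ∀ {k w c}, (∀ x, dd k (a * w) x ≤ (c * K ^ 2) * (dd 0 w + dd 1 w + dd 2 w) x) →
      En ℓ k (a * w) ≤ (c * K ^ 2) * N2 ℓ w := fun {k w c} h => by
    refine (IS_le_smul h).trans_eq ?_
    simp only [N2, En, map_add]
  have q : ∀ w, N2 ℓ (a * w) ≤ (1 * K ^ 2) * N2 ℓ w + (2 * K ^ 2) * N2 ℓ w +
      (24 * K ^ 2) * N2 ℓ w := fun w => by
    refine add_le_add (add_le_add (e fun x => ?_) (e fun x => ?_)) (e fun x => ?_)
    all_goals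
      have a0 := hb 0 (by norm_num) x
      have a1 := hb 1 (by norm_num) x
      have a2 := hb 2 (by norm_num) x
      have w0 := dd_nonneg 0 w x
      have w1 := dd_nonneg 1 w x
      have w2 := dd_nonneg 2 w x
      simp only [Sm.add_apply]
    · rw [dd_zero, mul_pow, ← dd_zero a, ← dd_zero w, Sm.mul_apply]
      nlinarith only [mul_le_mul_of_nonneg_right a0 w0, mul_nonneg (sq_nonneg K) w1,
        mul_nonneg (sq_nonneg K) w2]
    · have : dd 1 (a * w) x ≤ 2 * (dd 1 a x * dd 0 w x) + 2 * (dd 0 a x * dd 1 w x) := by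
        simp only [dd_succ, dd_zero, D_mul, Sm.add_apply, Sm.pow_apply, Sm.mul_apply]
        nlinarith only [sq_nonneg (D 0 a x * w x - a x * D 0 w x),
          sq_nonneg (D 1 a x * w x - a x * D 1 w x)]
      nlinarith only [this, mul_le_mul_of_nonneg_right a1 w0, mul_le_mul_of_nonneg_right a0 w1,
        mul_nonneg (sq_nonneg K) w2]
    · refine (dd_two_mul_le a w x).trans ?_
      have : dd 0 a x + dd 1 a x + dd 2 a x ≤ 3 * K ^ 2 := by linarith
      have := mul_le_mul_of_nonneg_right this (add_nonneg (add_nonneg w0 w1) w2)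
      linarith
  exact ⟨27 * K ^ 2, by positivity, fun w => (q w).trans_eq (by ring)⟩

lemma IS_triB_le (hℓ : 0 < ℓ) {X Y Z : Sm} (hX : Per ℓ X) (hY : Per ℓ Y) (hZ : Per ℓ Z) (k : ℕ) :
    ∀ a b c, 1 ≤ a → 1 ≤ b → 2 ≤ c → a + b + c + k ≤ 6 →
      IS ℓ (triB k a b c X Y Z) ≤ 9 ^ k * (cSob ℓ ^ 2 * H4 ℓ X * H4 ℓ Y * H4 ℓ Z) := by
  have hc := (cSob_pos (ℓ := ℓ)).le
  have hx := H4_nonneg (ℓ := ℓ) X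
  have hy := H4_nonneg (ℓ := ℓ) Y
  have hz := H4_nonneg (ℓ := ℓ) Z
  induction k with
  | zero =>
    intro a b c ha hb hc' h
    rw [pow_zero, one_mul, triB]
    have main : ∀ {P Q R : Sm} {p q r : ℕ}, Per ℓ P → Per ℓ Q → p ≤ 2 → q ≤ 2 → r ≤ 4 →
        IS ℓ (dd p P * dd q Q * dd r R) ≤ cSob ℓ * H4 ℓ P * (cSob ℓ * H4 ℓ Q) * H4 ℓ R := by
      intro P Q R p q r hP hQ hp hq hr
      have hPn := H4_nonneg (ℓ := ℓ) P
      have hQn := H4_nonneg (ℓ := ℓ) Q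
      refine (IS_le_smul (c := cSob ℓ * H4 ℓ P * (cSob ℓ * H4 ℓ Q)) (g := dd r R)
        fun x => ?_).trans
        (mul_le_mul_of_nonneg_left (En_le_H4 hr R) (by positivity))
      rw [Sm.mul_apply, Sm.mul_apply]
      exact mul_le_mul_of_nonneg_right (mul_le_mul (hP.sup_dd_le_H4 hℓ hp x)
        (hQ.sup_dd_le_H4 hℓ hq x) (dd_nonneg _ _ _) (by positivity)) (dd_nonneg _ _ _)
    by_cases h1 : 3 ≤ a
    · rw [show dd a X * dd b Y * dd c Z = dd b Y * dd c Z * dd a X by ring]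
      exact (main hY hZ (by omega) (by omega) (by omega)).trans_eq (by ring)
    by_cases h2 : 3 ≤ b
    · rw [show dd a X * dd b Y * dd c Z = dd a X * dd c Z * dd b Y by ring]
      exact (main hX hZ (by omega) (by omega) (by omega)).trans_eq (by ring)
    · exact (main hX hY (by omega) (by omega) (by omega)).trans_eq (by ring)
  | succ k ih =>
    intro a b c ha hb hc' h
    rw [triB, map_smul, map_add, map_add, smul_eq_mul, pow_succ]
    have := ih (a + 1) b c (by omega) hb hc' (by omega)
    have := ih a (b + 1) c ha (by omega) hc' (by omega)
    have := ih a b (c + 1) ha hb (by omega) (by omega)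
    linarith

lemma N2_Tri_le (hℓ : 0 < ℓ) {X Y Z : Sm} (hX : Per ℓ X) (hY : Per ℓ Y) (hZ : Per ℓ Z) :
    N2 ℓ (Tri X Y Z) ≤ 91 * cSob ℓ ^ 2 * H4 ℓ X * H4 ℓ Y * H4 ℓ Z := by
  have key : ∀ k ≤ 2, En ℓ k (Tri X Y Z) ≤ 9 ^ k * (cSob ℓ ^ 2 * H4 ℓ X * H4 ℓ Y * H4 ℓ Z) :=
    fun k hk => (IS_mono (dd_Tri_le k X Y Z)).trans
      (IS_triB_le hℓ hX hY hZ k 1 1 2 le_rfl le_rfl le_rfl (by omega))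
  have k0 := key 0 (by norm_num)
  have k1 := key 1 (by norm_num)
  have k2 := key 2 (by norm_num)
  unfold N2
  linarith

lemma N2_le_H4 (w : Sm) : N2 ℓ w ≤ H4 ℓ w := by
  have := En_nonneg (ℓ := ℓ) 3 w; have := En_nonneg (ℓ := ℓ) 4 w
  unfold N2 H4; linarith

lemma N2_Mop_le (hℓ : 0 < ℓ) {lam v : Sm} (hlam : Per ℓ lam) (hv : Per ℓ v) :
    ∃ C, 0 ≤ C ∧ ∀ w : Sm, Per ℓ w → N2 ℓ (Mop lam v w) ≤ C * H4 ℓ w := by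
  obtain ⟨C, hC, h⟩ := En_mul_le hℓ (hlam.sub (Per.const 1) : Per ℓ (lam - 1 : Sm))
  have hc := (cSob_pos (ℓ := ℓ)).le
  have hv0 := H4_nonneg (ℓ := ℓ) v
  refine ⟨4 * C + 4 * (91 * cSob ℓ ^ 2 * H4 ℓ v * H4 ℓ v) + 8 * (91 * cSob ℓ ^ 2 * H4 ℓ v * H4 ℓ v),
    by positivity, fun w hw => ?_⟩
  have h1 := N2_sub_le_two (ℓ := ℓ) ((lam - 1) * w - Tri v v w) ((2 : ℝ) • Tri w v v)
  have h2 := N2_sub_le_two (ℓ := ℓ) ((lam - 1) * w) (Tri v v w)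
  have h3 := (h w).trans (mul_le_mul_of_nonneg_left (N2_le_H4 w) hC)
  have h4 := N2_Tri_le hℓ hv hv hw
  have h5 := N2_Tri_le hℓ hw hv hv
  rw [N2_smul] at h1
  change N2 ℓ ((lam - 1) * w - Tri v v w - (2 : ℝ) • Tri w v v) ≤ _
  linarith

lemma Per.Lop {s : ℝ} {lam v w : Sm} (hlam : Per ℓ lam) (hv : Per ℓ v) (hw : Per ℓ w) :
    Per ℓ (Lop s lam v w) :=
  ((((Per.cst _).add (hlam.smul s)).mul hw).sub (hv.Aop hw s)).sub ((hw.Tri hv hv).smul _)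

/-- Approximate solutions with a fixed relative error. -/
def HalfSolvable (ℓ s : ℝ) (lam v : Sm) : Prop :=
  ∀ G : Sm, Per ℓ G → ∃ w : Sm, Per ℓ w ∧ N2 ℓ (G - Lop s lam v w) ≤ 1 / 2 * N2 ℓ G

lemma HalfSolvable.iterate {s : ℝ} {lam v : Sm} (hlam : Per ℓ lam) (hv : Per ℓ v)
    (h : HalfSolvable ℓ s lam v) (n : ℕ) (G : Sm) (hG : Per ℓ G) :
    ∃ w : Sm, Per ℓ w ∧ N2 ℓ (G - Lop s lam v w) ≤ (1 / 2) ^ n * N2 ℓ G := by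
  induction n with
  | zero => 
    refine ⟨0, fun i x => rfl, ?_⟩
    have : Lop s lam v 0 = 0 := by simpa using Lop_smul s lam v 0 0
    simp [this]
  | succ n ih =>
    obtain ⟨w, hw, hwn⟩ := ih
    obtain ⟨z, hz, hzn⟩ := h (G - Lop s lam v w) (hG.sub (hlam.Lop hv hw))
    refine ⟨w + z, hw.add hz, ?_⟩
    rw [Lop_add, ← sub_sub, pow_succ']
    linarith

lemma HalfSolvable.step {s t c d : ℝ} {lam v : Sm} (hlam : Per ℓ lam) (hv : Per ℓ v)
    (h : HalfSolvable ℓ s lam v) (hc : 0 ≤ c) 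
    (hapr : ∀ w : Sm, Per ℓ w → H4 ℓ w ≤ c * N2 ℓ (Lop s lam v w))
    (hd : 0 ≤ d) (hM : ∀ w : Sm, Per ℓ w → N2 ℓ (Mop lam v w) ≤ d * H4 ℓ w)
    (hts : (t - s) ^ 2 * (18 * d * c) ≤ 1) : HalfSolvable ℓ t lam v := by
  intro G hG
  obtain ⟨w, hw, hwn⟩ := h.iterate hlam hv 3 G hG
  refine ⟨w, hw, ?_⟩
  have h1 : N2 ℓ (Lop s lam v w) ≤ 9 / 4 * N2 ℓ G := by
    have := N2_sub_le_two (ℓ := ℓ) G (G - Lop s lam v w)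
    rw [sub_sub_cancel] at this
    linarith
  have h2 := N2_sub_le_two (ℓ := ℓ) (G - Lop s lam v w) ((t - s) • Mop lam v w)
  rw [N2_smul, sub_sub, ← Lop_sub] at h2
  have h3 := mul_le_mul_of_nonneg_left (hM w hw) (sq_nonneg (t - s))
  have h4 := mul_le_mul_of_nonneg_left ((hapr w hw).trans (mul_le_mul_of_nonneg_left h1 hc))
    (mul_nonneg (sq_nonneg (t - s)) hd)
  have h5 := mul_le_mul_of_nonneg_right hts (N2_nonneg (ℓ := ℓ) G)
  linarith

/-- Approximate solvability of the linearised equation. -/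
lemma lin_solve (hℓ : 0 < ℓ) {c : ℝ} (hc0 : 0 < c) (hc1 : c ≤ 1) {lam : Sm} (hlp : Per ℓ lam)
    (hlam : ∀ x, c ≤ lam x) {v : Sm} (hv : Per ℓ v) {G : Sm} (hG : Per ℓ G) {η : ℝ} (hη : 0 < η) :
    ∃ w : Sm, Per ℓ w ∧ N2 ℓ (G - Lop 1 lam v w) ≤ η := by
  obtain ⟨C, hC, hap⟩ := lin_apriori hℓ hc0 hc1 hlp hlam (H4 ℓ v)
  obtain ⟨d, hd, hM⟩ := N2_Mop_le hℓ hlp hv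
  obtain ⟨n, hn⟩ := exists_nat_gt (18 * d * C + 1)
  have hn1 : (1 : ℝ) < n := by linarith [mul_nonneg (mul_nonneg (by norm_num : (0:ℝ) ≤ 18) hd) hC]
  have hn0 : (0 : ℝ) < n := by linarith
  have key : ∀ k : ℕ, k ≤ n → HalfSolvable ℓ (k / n) lam v := by
    intro k
    induction k with
    | zero => 
      intro _ G hG
      obtain ⟨w, hw, h⟩ := lin_start hℓ G hG
      refine ⟨w, hw, ?_⟩
      simpa [Lop_zero] using h
    | succ k ih =>
      intro hk
      have hk' : (k : ℝ) ≤ n := by exact_mod_cast (by omega : k ≤ n)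
      refine (ih (by omega)).step hlp hv hC (fun w hw => hap (k / n) (by positivity)
        ((div_le_one hn0).2 hk') v w hv hw le_rfl) hd hM ?_
      have : (((k + 1 : ℕ) : ℝ) / n - k / n) = 1 / n := by push_cast; ring
      rw [this, div_pow, one_pow, div_mul_eq_mul_div, one_mul, div_le_one (by positivity)]
      nlinarith
  have h1 := key n le_rfl
  rw [div_self hn0.ne'] at h1
  obtain ⟨m, hm⟩ := exists_pow_lt_of_lt_one (show 0 < η / (N2 ℓ G + 1) from
    div_pos hη (by linarith [N2_nonneg (ℓ := ℓ) G])) (by norm_num : (1 / 2 : ℝ) < 1)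
  obtain ⟨w, hw, h⟩ := h1.iterate hlp hv m G hG
  refine ⟨w, hw, h.trans ?_⟩
  have := N2_nonneg (ℓ := ℓ) G
  rw [lt_div_iff₀ (by linarith)] at hm
  have : (0 : ℝ) ≤ (1 / 2) ^ m := by positivity
  linarith

end Linearization

/-! ### The two-point gradient estimate -/

lemma E2.norm_sq (x : E2) : ‖x‖ ^ 2 = x 0 ^ 2 + x 1 ^ 2 := by
  rw [EuclideanSpace.real_norm_sq_eq, Fin.sum_univ_two]

lemma line_second (v : Sm) (x y a b : E2) {c1 c2 : ℝ}
    (h : ∀ᶠ t : ℝ in nhds 0, v (x + t • a) - v (y + t • b) - (c1 * t + c2 / 2 * t ^ 2) ≤ v x - v y) :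
    Dp a v x - Dp b v y = c1 ∧ Dp a (Dp a v) x - Dp b (Dp b v) y ≤ c2 := by
  have hmax : IsLocalMax (fun t : ℝ => v (x + t • a) - v (y + t • b) - (c1 * t + c2 / 2 * t ^ 2)) 0 :=
    h.mono fun t ht => by simpa using ht
  have d1 : ∀ t : ℝ, HasDerivAt (fun t : ℝ => v (x + t • a) - v (y + t • b) -
      (c1 * t + c2 / 2 * t ^ 2)) (Dp a v (x + t • a) - Dp b v (y + t • b) - (c1 + c2 * t)) t := by
    intro t
    have := ((v.hasDerivAt_dir x a t).sub (v.hasDerivAt_dir y b t)).sub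
      (((hasDerivAt_id t).const_mul c1).add (((hasDerivAt_id t).pow 2).const_mul (c2 / 2)))
    exact this.congr_deriv (by simp; ring)
  have d2 : HasDerivAt (fun t : ℝ => Dp a v (x + t • a) - Dp b v (y + t • b) - (c1 + c2 * t))
      (Dp a (Dp a v) x - Dp b (Dp b v) y - c2) 0 := by
    have := (((Dp a v).hasDerivAt_dir x a 0).sub ((Dp b v).hasDerivAt_dir y b 0)).sub
      (((hasDerivAt_id (0 : ℝ)).const_mul c2).const_add c1)
    exact this.congr_deriv (by simp)
  constructor
  · have := hmax.hasDerivAt_eq_zero (d1 0)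
    simp at this; linarith
  · linarith [second_deriv_nonpos (Filter.Eventually.of_forall d1) d2 hmax]

/-- The two-point functional. -/
def tpF (v : Sm) (x0 : E2) (s k K : ℝ) (x y : E2) : ℝ :=
  v x - v y - (s * ‖x - y‖ - k / 2 * ‖x - y‖ ^ 2) - K / 8 * ‖x + y - (2 : ℝ) • x0‖ ^ 2

lemma tpF_local {v : Sm} {x0 x y : E2} {s k K F ε : ℝ} (hs : 0 < s) 
    (hK : 0 ≤ K) (hε : 0 ≤ ε) (hxy : x ≠ y) (hkL : k * ‖x - y‖ ≤ s / 2) (hk : 0 < k)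
    {R : ℝ} (hm : ‖x + y - (2 : ℝ) • x0‖ ≤ 2 * R)
    (hloc : ∀ a b : E2, ∀ᶠ t : ℝ in nhds 0,
      tpF v x0 s k K (x + t • a) (y + t • b) ≤ tpF v x0 s k K x y)
    (hFx : |Tri v v v x + ε * Lap v x| ≤ F) (hFy : |Tri v v v y + ε * Lap v y| ≤ F) :
    s ^ 2 * k ≤ 2 * F + K ^ 3 * R ^ 2 / 4 + 2 * ε * K := by
  obtain ⟨L, hL⟩ : ∃ L, L = ‖x - y‖ := ⟨_, rfl⟩
  have hL0 : 0 < L := hL ▸ norm_pos_iff.2 (sub_ne_zero.2 hxy)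
  have hL2 : L ^ 2 = (x 0 - y 0) ^ 2 + (x 1 - y 1) ^ 2 := by rw [hL, E2.norm_sq]; simp
  obtain ⟨d, hd⟩ : ∃ d : Fin 2 → ℝ, ∀ i, d i = x i - y i := ⟨_, fun i => rfl⟩
  obtain ⟨m, hmd⟩ : ∃ m : Fin 2 → ℝ, ∀ i, m i = x i + y i - 2 * x0 i := ⟨_, fun i => rfl⟩
  obtain ⟨μ, hμ⟩ : ∃ μ, μ = s / L - k := ⟨_, rfl⟩
  rw [← hL] at hkL
  have hμL : μ * L = s - k * L := by rw [hμ]; field_simp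
  have hN : ∀ a b : E2, ∀ t : ℝ, ‖x + t • a - (y + t • b)‖ ^ 2 =
      (d 0 + t * (a 0 - b 0)) ^ 2 + (d 1 + t * (a 1 - b 1)) ^ 2 := fun a b t => by
    rw [E2.norm_sq]; simp [hd]; ring
  have hM : ∀ a b : E2, ∀ t : ℝ, ‖x + t • a + (y + t • b) - (2 : ℝ) • x0‖ ^ 2 =
      (m 0 + t * (a 0 + b 0)) ^ 2 + (m 1 + t * (a 1 + b 1)) ^ 2 := fun a b t => by
    rw [E2.norm_sq]; simp [hmd]; ring
  have hM0 : ‖x + y - (2 : ℝ) • x0‖ ^ 2 = m 0 ^ 2 + m 1 ^ 2 := by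
    rw [E2.norm_sq]; simp [hmd]
  simp only [← hd] at hL2
  have tang : ∀ a b : E2, ∀ᶠ t : ℝ in nhds 0, v (x + t • a) - v (y + t • b) -
      ((μ * (d 0 * (a 0 - b 0) + d 1 * (a 1 - b 1)) +
        K / 4 * (m 0 * (a 0 + b 0) + m 1 * (a 1 + b 1))) * t +
        (μ * ((a 0 - b 0) ^ 2 + (a 1 - b 1) ^ 2) +
          K / 4 * ((a 0 + b 0) ^ 2 + (a 1 + b 1) ^ 2)) / 2 * t ^ 2) ≤ v x - v y := by
    intro a b
    filter_upwards [hloc a b] with t ht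
    have n1 := hN a b t
    unfold tpF at ht
    rw [hM, hM0, ← hL] at ht
    obtain ⟨n, hn⟩ : ∃ n, n = ‖x + t • a - (y + t • b)‖ := ⟨_, rfl⟩
    rw [← hn] at ht n1
    have h1 : s * n ≤ s / L / 2 * (n ^ 2 + L ^ 2) := by
      rw [div_div, div_mul_eq_mul_div, le_div_iff₀ (by positivity)]
      nlinarith only [mul_nonneg hs.le (sq_nonneg (n - L))]
    have h2 : s * L = s / L / 2 * (L ^ 2 + L ^ 2) := by field_simp; ring
    have h3 : s / L = μ + k := by rw [hμ]; ring
    rw [h3] at h1 h2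
    rw [n1] at h1 ht
    rw [hL2] at h1 h2 ht
    linarith
  have gx : ∀ i, D i v x = μ * d i + K / 4 * m i := fun i => by
    have := (line_second v x y (ev i) 0 (tang (ev i) 0)).1
    fin_cases i <;> simp [Dp_apply] at this ⊢ <;> linarith
  have gy : ∀ i, D i v y = μ * d i - K / 4 * m i := fun i => by
    have := (line_second v x y 0 (ev i) (tang 0 (ev i))).1
    fin_cases i <;> simp [Dp_apply] at this ⊢ <;> linarith
  have hlap : Lap v x - Lap v y ≤ 2 * K := by
    have h0 := (line_second v x y (ev 0) (ev 0) (tang (ev 0) (ev 0))).2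
    have h1 := (line_second v x y (ev 1) (ev 1) (tang (ev 1) (ev 1))).2
    rw [Dp_Dp_apply, Dp_Dp_apply] at h0 h1
    simp at h0 h1
    rw [Lap_def, Sm.add_apply, Sm.add_apply]; linarith
  obtain ⟨a, ha⟩ : ∃ a : E2, a = pt (D 0 v x) (D 1 v x) := ⟨_, rfl⟩
  obtain ⟨b, hb⟩ : ∃ b : E2, b = pt (D 0 v y) (D 1 v y) := ⟨_, rfl⟩
  have ha0 : a 0 = μ * d 0 + K / 4 * m 0 := by rw [ha, pt_zero, gx]
  have ha1 : a 1 = μ * d 1 + K / 4 * m 1 := by rw [ha, pt_one, gx]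
  have hb0 : (-b) 0 = -(μ * d 0 - K / 4 * m 0) := by rw [PiLp.neg_apply, hb, pt_zero, gy]
  have hb1 : (-b) 1 = -(μ * d 1 - K / 4 * m 1) := by rw [PiLp.neg_apply, hb, pt_one, gy]
  have hinf : Tri v v v x - Tri v v v y ≤ -4 * k * (L * μ) ^ 2 + K ^ 3 / 16 * (m 0 ^ 2 + m 1 ^ 2) := by
    have key : ∀ᶠ t : ℝ in nhds 0, v (x + t • a) - v (y + t • (-b)) -
        ((2 * μ * L * (s - k * L) + K ^ 2 / 8 * (m 0 ^ 2 + m 1 ^ 2)) * t +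
        (-4 * k * (L * μ) ^ 2 + K ^ 3 / 16 * (m 0 ^ 2 + m 1 ^ 2)) / 2 * t ^ 2) ≤ v x - v y := by
      have pos : ∀ᶠ t : ℝ in nhds 0, 0 < 1 + 2 * t * μ := by
        have : ContinuousAt (fun t : ℝ => 1 + 2 * t * μ) 0 := by fun_prop
        exact this.eventually (lt_mem_nhds (by simp))
      filter_upwards [hloc a (-b), pos] with t ht htp
      have n1 := hN a (-b) t
      unfold tpF at ht
      rw [hM, hM0, ← hL] at ht
      obtain ⟨n, hn⟩ : ∃ n, n = ‖x + t • a - (y + t • (-b))‖ := ⟨_, rfl⟩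
      have hn0 : 0 ≤ n := hn ▸ norm_nonneg _
      rw [← hn] at ht n1
      rw [ha0, ha1, hb0, hb1] at ht n1
      have h1 : n = L * (1 + 2 * t * μ) := by
        rw [← sq_eq_sq₀ hn0 (by positivity), n1, mul_pow, hL2]; ring
      rw [h1] at ht
      linarith
    have := (line_second v x y a (-b) key).2
    rw [ha, ← Tri_self_eq] at this
    have e : Tri v v v y = Dp (-b) (Dp (-b) v) y := by
      rw [Tri_self_eq, ← hb, Dp_Dp_apply, Dp_Dp_apply]; simp
    rw [e]; exact this
  have h4 : s / 2 ≤ L * μ := by linarith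
  have h5 : (s / 2) ^ 2 ≤ (L * μ) ^ 2 := pow_le_pow_left₀ (by linarith) h4 2
  have h6 : m 0 ^ 2 + m 1 ^ 2 ≤ 4 * R ^ 2 := by
    rw [← hM0]; nlinarith [norm_nonneg (x + y - (2 : ℝ) • x0)]
  have h7 := mul_le_mul_of_nonneg_left h5 hk.le
  have h8 := mul_le_mul_of_nonneg_left h6 (pow_nonneg hK 3)
  have h9 := mul_le_mul_of_nonneg_left hlap hε
  have := (abs_le.1 hFx).1
  have := (abs_le.1 hFy).2
  linarith

lemma two_point {v : Sm} {x0 : E2} {s k K F ε r R : ℝ} (hs : 0 < s) (hk : 0 < k) (hK : 0 ≤ K)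
    (hε : 0 ≤ ε) (hr : 0 < r) (hR : 0 < R) (hkr : k * r ≤ s / 2)
    (hF : ∀ x, ‖x - x0‖ ≤ R + r → |Tri v v v x + ε * Lap v x| ≤ F)
    (hb1 : ∀ x y, ‖x - x0‖ ≤ R + r → ‖y - x0‖ ≤ R + r → ‖x - y‖ = r →
      v x - v y ≤ s * r - k / 2 * r ^ 2 + K / 8 * ‖x + y - (2 : ℝ) • x0‖ ^ 2)
    (hb2 : ∀ x y, ‖x - x0‖ ≤ R + r → ‖y - x0‖ ≤ R + r → ‖x - y‖ ≤ r → ‖x + y - (2 : ℝ) • x0‖ = 2 * R →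
      v x - v y ≤ s * ‖x - y‖ - k / 2 * ‖x - y‖ ^ 2 + K / 2 * R ^ 2)
    (hlt : 2 * F + K ^ 3 * R ^ 2 / 4 + 2 * ε * K < s ^ 2 * k) :
    dd 1 v x0 ≤ s ^ 2 := by
  have hball : ∀ x y : E2, ‖x - y‖ ≤ r → ‖x + y - (2 : ℝ) • x0‖ ≤ 2 * R →
      ‖x - x0‖ ≤ R + r ∧ ‖y - x0‖ ≤ R + r := by
    intro x y h1 h2
    have e1 : x - x0 = (1 / 2 : ℝ) • ((x + y - (2 : ℝ) • x0) + (x - y)) := by module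
    have e2 : y - x0 = (1 / 2 : ℝ) • ((x + y - (2 : ℝ) • x0) - (x - y)) := by module
    rw [e1, e2, norm_smul, norm_smul]
    norm_num
    have := norm_add_le (x + y - (2 : ℝ) • x0) (x - y)
    have := norm_sub_le (x + y - (2 : ℝ) • x0) (x - y)
    constructor <;> linarith
  have main : ∀ x y : E2, ‖x - y‖ ≤ r → ‖x + y - (2 : ℝ) • x0‖ ≤ 2 * R → tpF v x0 s k K x y ≤ 0 := by
    have hcont : Continuous fun p : E2 × E2 => tpF v x0 s k K p.1 p.2 := by
      unfold tpF
      have h1 := v.continuous.comp (continuous_fst (X := E2) (Y := E2))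
      have h2 := v.continuous.comp (continuous_snd (X := E2) (Y := E2))
      exact ((h1.sub h2).sub (by fun_prop)).sub (by fun_prop)
    obtain ⟨S, hS⟩ : ∃ S : Set (E2 × E2), S = {p | ‖p.1 - p.2‖ ≤ r} ∩
        {p | ‖p.1 + p.2 - (2 : ℝ) • x0‖ ≤ 2 * R} :=
      ⟨_, rfl⟩
    have hScl : IsClosed S := by
      rw [hS]
      exact (isClosed_le (by fun_prop) continuous_const).inter
        (isClosed_le (by fun_prop) continuous_const)
    have hSc : IsCompact S := by
      refine ((isCompact_closedBall x0 (R + r)).prod (isCompact_closedBall x0 (R + r))).of_isClosed_subset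
        hScl fun p hp => ?_
      rw [hS] at hp
      have := hball p.1 p.2 hp.1 hp.2
      simp only [Set.mem_prod, mem_closedBall, dist_eq_norm]; exact this
    have hSne : S.Nonempty := ⟨(x0, x0), by
      rw [hS]; constructor
      · simpa using hr.le
      · change ‖x0 + x0 - (2 : ℝ) • x0‖ ≤ 2 * R
        rw [← two_smul ℝ x0]; simp [hR.le]⟩
    obtain ⟨⟨x, y⟩, hxy, hmax⟩ := hSc.exists_isMaxOn hSne hcont.continuousOn
    have hmax' : ∀ x' y' : E2, ‖x' - y'‖ ≤ r → ‖x' + y' - (2 : ℝ) • x0‖ ≤ 2 * R →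
        tpF v x0 s k K x' y' ≤ tpF v x0 s k K x y := fun x' y' h1 h2 =>
      hmax (show (x', y') ∈ S by rw [hS]; exact ⟨h1, h2⟩)
    suffices tpF v x0 s k K x y ≤ 0 from fun x' y' h1 h2 => (hmax' x' y' h1 h2).trans this
    rw [hS] at hxy
    obtain ⟨h1, h2⟩ := hxy
    change ‖x - y‖ ≤ r at h1
    change ‖x + y - (2 : ℝ) • x0‖ ≤ 2 * R at h2
    obtain ⟨bx, by'⟩ := hball x y h1 h2
    have hnn := norm_nonneg (x - y)
    by_cases hxe : x = y
    · subst hxe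
      unfold tpF
      simp only [sub_self, norm_zero]
      have := mul_nonneg (by linarith : 0 ≤ K / 8) (sq_nonneg ‖x + x - (2 : ℝ) • x0‖)
      linarith
    rcases h1.eq_or_lt with h1 | h1
    · have := hb1 x y bx by' h1
      unfold tpF; rw [h1]; linarith
    have hkn : k * ‖x - y‖ ≤ s / 2 := (mul_le_mul_of_nonneg_left h1.le hk.le).trans hkr
    rcases h2.eq_or_lt with h2 | h2
    · have := hb2 x y bx by' h1.le h2
      unfold tpF; rw [h2]
      linarith
    exfalso
    refine absurd (tpF_local hs hK hε hxe hkn hk h2.le (fun a b => ?_) (hF x bx) (hF y by'))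
      (not_le.2 hlt)
    have c1 : ∀ᶠ t : ℝ in nhds 0, ‖x + t • a - (y + t • b)‖ < r := by
      have : ContinuousAt (fun t : ℝ => ‖x + t • a - (y + t • b)‖) 0 := by fun_prop
      exact this.eventually (gt_mem_nhds (by simpa using h1))
    have c2 : ∀ᶠ t : ℝ in nhds 0, ‖x + t • a + (y + t • b) - (2 : ℝ) • x0‖ < 2 * R := by
      have : ContinuousAt (fun t : ℝ => ‖x + t • a + (y + t • b) - (2 : ℝ) • x0‖) 0 := by fun_prop
      exact this.eventually (gt_mem_nhds (by simpa using h2))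
    filter_upwards [c1, c2] with t ht1 ht2 using hmax' _ _ ht1.le ht2.le
  have hdir : ∀ e : E2, ‖e‖ = 1 → Dp e v x0 ≤ s := by
    intro e he
    have hd := ((v.hasDerivAt_dir x0 e 0).sub
      ((v.hasDerivAt_dir x0 (-e) 0))).sub ((hasDerivAt_id (0 : ℝ)).const_mul (2 * s))
    by_contra! hcon
    have hneg : Dp (-e) v x0 = -Dp e v x0 := by simp [Dp_apply]; ring
    have hpos : 0 < Dp e v (x0 + (0 : ℝ) • e) - Dp (-e) v (x0 + (0 : ℝ) • -e) - 2 * s * 1 := by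
      simp only [zero_smul, add_zero, hneg]; linarith
    have := hd.hasDerivWithinAt (s := Set.Ici 0)
    obtain ⟨t, ht0, htr, ht⟩ : ∃ t : ℝ, 0 < t ∧ 2 * t ≤ r ∧
        0 < v (x0 + t • e) - v (x0 + t • -e) - 2 * s * t := by
      have hev := hd.tendsto_slope_zero_right.eventually (lt_mem_nhds hpos)
      have hev2 : ∀ᶠ t : ℝ in nhdsWithin 0 (Set.Ioi 0), t < r / 2 :=
        mem_nhdsWithin_of_mem_nhds (gt_mem_nhds (by linarith))
      obtain ⟨t, h1, h2, h3⟩ := (hev.and (hev2.and self_mem_nhdsWithin)).exists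
      refine ⟨t, h3, by linarith, ?_⟩
      have h3' : 0 < t := h3
      simp only [smul_eq_mul] at h1
      have := (mul_pos_iff_of_pos_left (inv_pos.2 h3')).1 h1
      simpa using this
    have e1 : x0 + t • e - (x0 + t • -e) = (2 * t) • e := by module
    have e2 : x0 + t • e + (x0 + t • -e) - (2 : ℝ) • x0 = 0 := by module
    have n1 : ‖x0 + t • e - (x0 + t • -e)‖ = 2 * t := by
      rw [e1, norm_smul, he, mul_one, Real.norm_of_nonneg (by linarith)]
    have := main (x0 + t • e) (x0 + t • -e) (by rw [n1]; exact htr) (by rw [e2]; simp [hR.le])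
    unfold tpF at this
    rw [n1, e2, norm_zero] at this
    linarith [mul_nonneg hk.le (sq_nonneg t)]
  have e0 : dd 1 v x0 = D 0 v x0 ^ 2 + D 1 v x0 ^ 2 := by
    simp only [dd_succ, dd_zero, Sm.add_apply, Sm.pow_apply]
  rw [e0]
  obtain ⟨p, hp⟩ : ∃ p : E2, p = pt (D 0 v x0) (D 1 v x0) := ⟨_, rfl⟩
  have hpn : ‖p‖ ^ 2 = D 0 v x0 ^ 2 + D 1 v x0 ^ 2 := by rw [E2.norm_sq, hp, pt_zero, pt_one]
  rw [← hpn]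
  rcases eq_or_ne p 0 with h0 | h0
  · rw [h0, norm_zero, zero_pow two_ne_zero]; positivity
  have hpp := norm_pos_iff.2 h0
  have := hdir (‖p‖⁻¹ • p) (by rw [norm_smul, norm_inv, norm_norm, inv_mul_cancel₀ hpp.ne'])
  have e3 : Dp (‖p‖⁻¹ • p) v x0 = ‖p‖ := by
    rw [Dp_apply, PiLp.smul_apply, PiLp.smul_apply, smul_eq_mul, smul_eq_mul]
    have a0 : p 0 = D 0 v x0 := by rw [hp, pt_zero]
    have a1 : p 1 = D 1 v x0 := by rw [hp, pt_one]
    rw [a0, a1, mul_assoc, mul_assoc, ← mul_add, ← pow_two, ← pow_two, ← hpn]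
    field_simp
  rw [e3] at this
  exact pow_le_pow_left₀ hpp.le this 2

/-- Interior Lipschitz bound from a bound on `v` and on the right-hand side. -/
lemma lipschitz_bound {V F R : ℝ} (hV : 0 ≤ V) (hF0 : 0 ≤ F) (hR : 0 < R) :
    ∃ M, 0 < M ∧ ∀ ε, 0 ≤ ε → ε ≤ 1 → ∀ (v : Sm) (x0 : E2),
      (∀ x, ‖x - x0‖ ≤ 2 * R → |v x| ≤ V ∧ |Tri v v v x + ε * Lap v x| ≤ F) →
      dd 1 v x0 ≤ M ^ 2 := by
  obtain ⟨K, hK⟩ : ∃ K, K = 4 * V / R ^ 2 := ⟨_, rfl⟩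
  have hK0 : 0 ≤ K := hK ▸ by positivity
  have hKR : K * R ^ 2 = 4 * V := by rw [hK]; field_simp
  obtain ⟨A, hA⟩ : ∃ A, A = 2 * R * (2 * F + K ^ 3 * R ^ 2 / 4 + 2 * K) := ⟨_, rfl⟩
  have hA0 : 0 ≤ A := hA ▸ by positivity
  obtain ⟨s, hs⟩ : ∃ s, s = A + 1 + 4 * V / R := ⟨_, rfl⟩
  have hs1 : 1 ≤ s := by rw [hs]; linarith [show 0 ≤ 4 * V / R by positivity]
  have hsA : A < s := by rw [hs]; linarith [show 0 ≤ 4 * V / R by positivity]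
  have hsV : 4 * V ≤ s * R := by
    have : 4 * V = (4 * V / R) * R := by field_simp
    rw [this]; exact mul_le_mul_of_nonneg_right (by rw [hs]; linarith) hR.le
  refine ⟨s, by linarith, fun ε hε hε1 v x0 h => ?_⟩
  have hosc : ∀ x y, ‖x - x0‖ ≤ R + R → ‖y - x0‖ ≤ R + R → v x - v y ≤ 2 * V := fun x y hx hy => by
    have a := (abs_le.1 (h x (by linarith)).1).2
    have b := (abs_le.1 (h y (by linarith)).1).1
    linarith
  refine two_point (s := s) (k := s / (2 * R)) (K := K) (F := F) (ε := ε) (r := R) (R := R)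
    (by linarith) (div_pos (by linarith) (by linarith)) hK0 hε hR hR (by field_simp; exact le_rfl)
    (fun x hx => (h x (by linarith)).2) (fun x y hx hy hxy => ?_) (fun x y hx hy hxy _ => ?_) ?_
  · have := hosc x y hx hy
    have e : s / (2 * R) / 2 * R ^ 2 = s * R / 4 := by field_simp; ring
    rw [e]
    linarith [mul_nonneg (by linarith : 0 ≤ K / 8) (sq_nonneg ‖x + y - (2 : ℝ) • x0‖)]
  · have := hosc x y hx hy
    have e : s / (2 * R) / 2 * ‖x - y‖ ^ 2 ≤ s * ‖x - y‖ := by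
      have h1 : s / (2 * R) / 2 * ‖x - y‖ ≤ s / (2 * R) / 2 * R :=
        mul_le_mul_of_nonneg_left (by assumption) (by positivity)
      have h2 : s / (2 * R) / 2 * R = s / 4 := by field_simp; norm_num
      have h3 := mul_le_mul_of_nonneg_right h1 (norm_nonneg (x - y))
      rw [h2] at h3
      linarith [mul_nonneg (by linarith : 0 ≤ s) (norm_nonneg (x - y))]
    linarith
  · have e : s ^ 2 * (s / (2 * R)) = s ^ 3 / (2 * R) := by ring
    rw [e, lt_div_iff₀ (by linarith)]
    have h3 : s ≤ s ^ 3 := by nlinarith [sq_nonneg (s - 1), sq_nonneg (s+1)]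
    have : ε * K ≤ K := mul_le_of_le_one_left hK0 hε1
    have := mul_le_mul_of_nonneg_right this hR.le
    linarith

/-! ### Integration over a compact set -/

section Compact

variable {K : TopologicalSpace.Compacts E2}

lemma integrableOn_compacts {g : E2 → ℝ} (hg : Continuous g) : IntegrableOn g (K : Set E2) :=
  hg.continuousOn.integrableOn_compact K.isCompact

/-- Integration of smooth functions over a compact set. -/
def JS (K : TopologicalSpace.Compacts E2) : Sm →ₗ[ℝ] ℝ where
  toFun v := ∫ x in (K : Set E2), v x
  map_add' v w := integral_add (integrableOn_compacts v.continuous)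
    (integrableOn_compacts w.continuous)
  map_smul' c _ := integral_const_mul c _

lemma JS_def (v : Sm) : JS K v = ∫ x in (K : Set E2), v x := rfl

lemma JS_mono {v w : Sm} (h : ∀ x ∈ K, v x ≤ w x) : JS K v ≤ JS K w :=
  setIntegral_mono_on (integrableOn_compacts v.continuous) (integrableOn_compacts w.continuous)
    K.isCompact.isClosed.measurableSet h

lemma JS_nonneg {v : Sm} (h : ∀ x, 0 ≤ v x) : 0 ≤ JS K v := integral_nonneg h

lemma JS_eq_integral {v : Sm} (h : ∀ x ∉ K, v x = 0) : JS K v = ∫ x, v x :=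
  setIntegral_eq_integral_of_forall_compl_eq_zero h

lemma JS_congr {K' : TopologicalSpace.Compacts E2} {v : Sm} (h : ∀ x ∉ K, v x = 0)
    (h' : ∀ x ∉ K', v x = 0) : JS K v = JS K' v := by
  rw [JS_eq_integral h, JS_eq_integral h']

lemma D_eq_zero_of_notMem {w : Sm} (hw : ∀ x ∉ K, w x = 0) (i : Fin 2) : ∀ x ∉ K, D i w x = 0 := by
  intro x hx
  have : (w : E2 → ℝ) =ᶠ[nhds x] fun _ => 0 := by
    filter_upwards [K.isCompact.isClosed.isOpen_compl.mem_nhds hx] with y hy using hw y hy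
  rw [D_apply', this.fderiv_eq]
  simp

lemma hasCompactSupport_of_notMem {w : E2 → ℝ} (hw : ∀ x ∉ K, w x = 0) : HasCompactSupport w :=
  HasCompactSupport.intro K.isCompact hw

lemma JS_D {w : Sm} (hw : ∀ x ∉ K, w x = 0) (i : Fin 2) : JS K (D i w) = 0 := by
  have h1 : Integrable (w : E2 → ℝ) :=
    w.continuous.integrable_of_hasCompactSupport (hasCompactSupport_of_notMem hw)
  have h2 : Integrable (D i w : E2 → ℝ) := (D i w).continuous.integrable_of_hasCompactSupport
      (hasCompactSupport_of_notMem (D_eq_zero_of_notMem hw i))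
  have := integral_mul_fderiv_eq_neg_fderiv_mul_of_integrable (𝕜 := ℝ) (μ := (volume : Measure E2))
    (f := fun _ : E2 => (1 : ℝ)) (g := w) (v := ev i) (by simp)
    (by simp only [one_mul]; exact h2) (by simpa using h1)
    (fun _ _ => differentiableAt_const _) (fun x _ => w.differentiable x)
  rw [JS_eq_integral (D_eq_zero_of_notMem hw i)]
  simp only [one_mul] at this
  exact this.trans (by simp)

lemma JS_ibp {v w : Sm} (h : ∀ x ∉ K, v x * w x = 0) (i : Fin 2) :
    JS K (v * D i w) = -JS K (D i v * w) := by
  have := JS_D (w := v * w) h i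
  rw [D_mul, map_add] at this
  linarith

/-- Local energy bound for solutions of the nonlinear elliptic equation. -/
lemma small_energy {φ v : Sm} (hφ : ∀ x ∉ K, φ x = 0) {T F : ℝ} (hT : ∀ x ∈ K, 2 + dd 1 v x ≤ T)
    (hF : ∀ x ∈ K, |Aop 1 v v x| ≤ F) :
    JS K (φ ^ 2 * dd 2 v) ≤ 16 * T ^ 3 * JS K (dd 1 φ) + 2 * T * F ^ 2 * JS K (φ ^ 2) := by
  set Φ : Sm := D 0 (φ ^ 2 * (D 0 v * D 1 (D 1 v))) - D 1 (φ ^ 2 * (D 0 v * D 0 (D 1 v))) with hΦ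
  have hJΦ : JS K Φ = 0 := by
    rw [hΦ, map_sub, JS_D (fun x hx => by simp [hφ x hx]), JS_D (fun x hx => by simp [hφ x hx]),
      sub_zero]
  have key : JS K (φ ^ 2 * dd 2 v) ≤ JS K ((-(4 * T)) • Φ + (16 * T ^ 3) • dd 1 φ +
      (2 * T * F ^ 2) • φ ^ 2) := by
    refine JS_mono fun x hx => ?_
    have hT' := hT x hx
    have h1 := elliptic_dd_two zero_le_one le_rfl v v x hT'
    have h2 : (Aop 1 v v x) ^ 2 ≤ F ^ 2 := sq_le_sq' (by linarith [neg_abs_le (Aop 1 v v x), hF x hx])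
      ((le_abs_self _).trans (hF x hx))
    have hT0 : 0 ≤ T := by linarith [dd_nonneg 1 v x]
    simp only [hΦ, dd_one, dd_two, D_mul, D_sq, D_comm10, Sm.add_apply, Sm.sub_apply, Sm.mul_apply,
      Sm.smul_apply, Sm.pow_apply, Sm.two_apply] at *
    generalize D 0 v x = p at *
    generalize D 1 v x = q at *
    generalize D 0 (D 0 v) x = a at *
    generalize D 0 (D 1 v) x = b at *
    generalize D 1 (D 1 v) x = c at *
    generalize D 0 (D 1 (D 1 v)) x = t at *
    generalize φ x = z at *
    generalize D 0 φ x = z0 at *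
    generalize D 1 φ x = z1 at *
    generalize Aop 1 v v x = A at *
    have h3 : z ^ 2 * (a ^ 2 + 2 * b ^ 2 + c ^ 2) ≤ z ^ 2 * (2 * T * (b ^ 2 - a * c) + T * A ^ 2) :=
      mul_le_mul_of_nonneg_left h1 (sq_nonneg z)
    have h4 : z ^ 2 * (T * A ^ 2) ≤ z ^ 2 * (T * F ^ 2) :=
      mul_le_mul_of_nonneg_left (mul_le_mul_of_nonneg_left h2 hT0) (sq_nonneg z)
    have h5 : 2 * (4 * T * z * p * (z0 * c - z1 * b)) ≤ z ^ 2 * (b ^ 2 + c ^ 2) +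
        16 * T ^ 2 * p ^ 2 * (z0 ^ 2 + z1 ^ 2) := by
      nlinarith only [sq_nonneg (z * c - 4 * T * p * z0), sq_nonneg (z * b + 4 * T * p * z1)]
    have h6 : T ^ 2 * (z0 ^ 2 + z1 ^ 2) * (p ^ 2) ≤ T ^ 2 * (z0 ^ 2 + z1 ^ 2) * T :=
      mul_le_mul_of_nonneg_left (by nlinarith only [hT', sq_nonneg q]) (by positivity)
    have h7 : 0 ≤ z ^ 2 * b ^ 2 := by positivity
    have h8 : 0 ≤ z ^ 2 * a ^ 2 := by positivity
    nlinarith only [h3, h4, h5, h6, h7, h8]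
  rw [map_add, map_add, map_smul, map_smul, map_smul, hJΦ] at key
  simpa using key

end Compact

section Compact

variable {K : TopologicalSpace.Compacts E2}

lemma norm_fderiv_sq_le (v : Sm) (x : E2) : ‖fderiv ℝ v x‖ ^ 2 ≤ dd 1 v x := by
  have h : ‖fderiv ℝ v x‖ ≤ Real.sqrt (dd 1 v x) := by
    refine ContinuousLinearMap.opNorm_le_bound _ (Real.sqrt_nonneg _) fun p => ?_
    rw [fderiv_eq_Dp, Dp_apply, Real.norm_eq_abs]
    refine Real.abs_le_sqrt (y := dd 1 v x * ‖p‖ ^ 2) ?_ |>.trans_eq ?_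
    · rw [E2.norm_sq, dd_one]
      simp only [Sm.add_apply, Sm.pow_apply]
      nlinarith only [sq_nonneg (p 0 * D 1 v x - p 1 * D 0 v x)]
    · rw [Real.sqrt_mul (dd_nonneg 1 v x), Real.sqrt_sq (norm_nonneg p)]
  calc ‖fderiv ℝ v x‖ ^ 2 ≤ Real.sqrt (dd 1 v x) ^ 2 := by gcongr
    _ = dd 1 v x := Real.sq_sqrt (dd_nonneg 1 v x)

/-- Ladyzhenskaya's inequality in the plane. -/
lemma ladyzhenskaya : ∃ C : ℝ, 0 ≤ C ∧ ∀ (K : TopologicalSpace.Compacts E2) (w : Sm),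
    (∀ x ∉ K, w x = 0) → JS K (w ^ 4) ≤ C * (JS K (w ^ 2) * JS K (dd 1 w)) := by
  refine ⟨4 * (lintegralPowLePowLIntegralFDerivConst (volume : Measure E2) 2 : ℝ), by positivity,
    fun K w hw => ?_⟩
  have hw2 : ∀ x ∉ K, (w ^ 2 : Sm) x = 0 := fun x hx => by simp [hw x hx]
  have hw4 : ∀ x ∉ K, (w ^ 4 : Sm) x = 0 := fun x hx => by simp [hw x hx]
  have hd : ∀ x ∉ K, (dd 1 w) x = 0 := fun x hx => by
    rw [dd_one]; simp [D_eq_zero_of_notMem hw _ x hx]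
  have hcs : ∀ {v : E2 → ℝ}, (∀ x ∉ K, v x = 0) → HasCompactSupport v :=
    fun h => hasCompactSupport_of_notMem h
  have hp : Real.HolderConjugate (Module.finrank ℝ E2) 2 := by
    simp [E2, Real.HolderConjugate.two_two]
  have h1 := lintegral_pow_le_pow_lintegral_fderiv (volume : Measure E2) (u := (w ^ 2 : Sm).1)
    ((w ^ 2 : Sm).contDiff.of_le (by simp)) (hcs hw2) hp
  have i4 : Integrable (w ^ 4 : Sm).1 := (w ^ 4).continuous.integrable_of_hasCompactSupport (hcs hw4)
  have cF : Continuous (fderiv ℝ (w ^ 2 : Sm).1) :=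
    (w ^ 2 : Sm).contDiff.continuous_fderiv (by simp)
  have iF : Integrable (fderiv ℝ (w ^ 2 : Sm).1) :=
    cF.integrable_of_hasCompactSupport ((hcs hw2).fderiv (𝕜 := ℝ))
  set X := ∫ x, ‖fderiv ℝ (w ^ 2 : Sm).1 x‖ with hX
  have e1 : ∫⁻ x, ‖(w ^ 2 : Sm).1 x‖ₑ ^ (2 : ℝ) = ENNReal.ofReal (JS K (w ^ 4)) := by
    rw [JS_eq_integral hw4, ← integral_congr_ae (f := fun x => ‖(w ^ 4 : Sm) x‖) (Filter.Eventually.of_forall fun x => by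
      simp [Even.pow_abs (show Even 4 by decide)]), ofReal_integral_norm_eq_lintegral_enorm i4]
    refine lintegral_congr fun x => ?_
    rw [ENNReal.rpow_two, ← enorm_pow]
    congr 1
    simp only [Sm.pow_apply]; ring
  have e2 : ∫⁻ x, ‖fderiv ℝ (w ^ 2 : Sm).1 x‖ₑ = ENNReal.ofReal X :=
    (ofReal_integral_norm_eq_lintegral_enorm iF).symm
  have hX0 : 0 ≤ X := integral_nonneg fun x => norm_nonneg _
  rw [e1, e2, ENNReal.rpow_two, ← ENNReal.ofReal_pow hX0, ← ENNReal.ofReal_coe_nnreal,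
    ← ENNReal.ofReal_mul (by positivity), ENNReal.ofReal_le_ofReal_iff (by positivity)] at h1
  have h2 : ∀ t : ℝ, 0 ≤ JS K (w ^ 2) * (t * t) + (-X) * t + JS K (dd 1 w) := by
    intro t
    have : t * X ≤ JS K ((t ^ 2) • w ^ 2 + dd 1 w) := by
      rw [JS_eq_integral (fun x hx => by simp [hw x hx, hd x hx]), hX, ← integral_const_mul]
      refine integral_mono (iF.norm.const_mul t) (Continuous.integrable_of_hasCompactSupport
        (Sm.continuous _) (hcs fun x hx => by simp [hw x hx, hd x hx])) fun x => ?_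
      have h3 := norm_fderiv_sq_le (w ^ 2) x
      have h4 : dd 1 (w ^ 2) x = 4 * w x ^ 2 * dd 1 w x := by
        rw [dd_one, dd_one]; simp; ring
      rw [h4] at h3
      refine le_trans (le_abs_self _) (abs_le_of_sq_le_sq ?_ ?_)
      · simp only [Sm.add_apply, Sm.smul_apply, Sm.pow_apply]
        nlinarith only [mul_le_mul_of_nonneg_left h3 (sq_nonneg t), sq_nonneg (t ^ 2 * w x ^ 2 - dd 1 w x)]
      · have := dd_nonneg 1 w x
        simp only [Sm.add_apply, Sm.smul_apply, Sm.pow_apply]; positivity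
    rw [map_add, map_smul, smul_eq_mul] at this
    linarith
  have h3 := discrim_le_zero h2
  rw [discrim] at h3
  calc _ ≤ _ := h1
    _ ≤ _ * (4 * (JS K (w ^ 2) * JS K (dd 1 w))) :=
      mul_le_mul_of_nonneg_left (by linarith) (by positivity)
    _ = _ := by ring

end Compact

/-! ### Cutoff functions of small energy -/

/-- Dilation of a smooth function. -/
def dil (c : ℝ) (v : Sm) : Sm := ⟨fun x => v (c • x), v.contDiff.comp (contDiff_const_smul c)⟩

@[simp] lemma dil_apply (c : ℝ) (v : Sm) (x : E2) : dil c v x = v (c • x) := rfl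

@[simp] lemma D_dil (c : ℝ) (v : Sm) (i : Fin 2) : D i (dil c v) = c • dil c (D i v) := by
  refine Sm.ext fun x => ?_
  have h : HasFDerivAt (dil c v) ((fderiv ℝ v (c • x)).comp (c • ContinuousLinearMap.id ℝ E2)) x :=
    (v.hasFDerivAt (c • x)).comp x ((hasFDerivAt_id x).const_smul c)
  rw [D_apply', h.fderiv]
  simp [D_apply']

/-- A closed ball as a compact set. -/
def cball (x : E2) (r : ℝ) : TopologicalSpace.Compacts E2 :=
  ⟨closedBall x r, isCompact_closedBall x r⟩

@[simp] lemma mem_cball {x y : E2} {r : ℝ} : y ∈ cball x r ↔ dist y x ≤ r := Iff.rfl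

lemma exists_bump {a b : ℝ} (ha : 0 < a) (hab : a < b) : ∃ ψ : Sm, (∀ x, 0 ≤ ψ x) ∧
    (∀ x, ψ x ≤ 1) ∧ (∀ x, ‖x‖ ≤ a → ψ x = 1) ∧ (∀ x, b ≤ ‖x‖ → ψ x = 0) := by
  let f : ContDiffBump (0 : E2) := ⟨a, b, ha, hab⟩
  refine ⟨⟨f, f.contDiff⟩, fun x => f.nonneg, fun x => f.le_one, fun x hx => ?_, fun x hx => ?_⟩
  · exact f.one_of_mem_closedBall (by simpa using hx)
  · exact f.zero_of_le_dist (by simpa using hx)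

lemma integral_dil {c : ℝ} (hc : 0 ≤ c) (v : Sm) : ∫ x, dil c v x = (c ^ 2)⁻¹ * ∫ x, v x := by
  have := Measure.integral_comp_smul_of_nonneg (volume : Measure E2) v c (hR := hc)
  simpa [E2] using this

/-- Points have zero capacity in the plane. -/
lemma exists_cap {η : ℝ} (hη : 0 < η) : ∃ ρ, 0 < ρ ∧ ρ ≤ 1 ∧ ∃ φ : Sm, (∀ x ∉ cball 0 1, φ x = 0) ∧
    (∀ x, ‖x‖ ≤ ρ → φ x = 1) ∧ JS (cball 0 1) (φ ^ 2) ≤ η ∧ JS (cball 0 1) (dd 1 φ) ≤ η := by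
  obtain ⟨ψ, h0, h1, hin, hout⟩ := exists_bump (a := 5 / 4) (b := 3 / 2) (by norm_num) (by norm_num)
  have hD : ∀ i x, D i ψ x ≠ 0 → 5 / 4 ≤ ‖x‖ ∧ ‖x‖ ≤ 3 / 2 := by
    intro i x hx
    constructor
    · by_contra! h
      refine hx ?_
      have : (ψ : E2 → ℝ) =ᶠ[nhds x] fun _ => 1 := by
        filter_upwards [isOpen_lt continuous_norm continuous_const |>.mem_nhds h] with y hy
          using hin y (le_of_lt hy)
      rw [D_apply', this.fderiv_eq]; simp
    · by_contra! h
      refine hx ?_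
      have : (ψ : E2 → ℝ) =ᶠ[nhds x] fun _ => 0 := by
        filter_upwards [isOpen_lt continuous_const continuous_norm |>.mem_nhds h] with y hy
          using hout y (le_of_lt hy)
      rw [D_apply', this.fderiv_eq]; simp
  set A := ∫ x, (ψ ^ 2 : Sm) x with hA
  set B := ∫ x, (dd 1 ψ) x with hB
  have hA0 : 0 ≤ A := integral_nonneg fun x => by simp; positivity
  have hB0 : 0 ≤ B := integral_nonneg fun x => dd_nonneg 1 ψ x
  obtain ⟨n, hn⟩ := exists_nat_gt ((A + B) / η + 1)
  have hAB : 0 ≤ (A + B) / η := by positivity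
  have hn1 : (1 : ℝ) < n := by linarith
  have hn0 : (0 : ℝ) < n := by linarith
  have hnη : A + B ≤ n * η := by
    have : (A + B) / η ≤ n := by linarith
    rwa [div_le_iff₀ hη] at this
  set c : ℕ → ℝ := fun j => 2 ^ (n + j) with hc
  have hc0 : ∀ j, 0 < c j := fun j => by positivity
  have hcn : ∀ j, (n : ℝ) ≤ c j := fun j => by
    have h1 : (n : ℝ) < 2 ^ n := by exact_mod_cast Nat.lt_two_pow_self
    have h2 : (2 : ℝ) ^ n ≤ 2 ^ (n + j) := pow_le_pow_right₀ (by norm_num) (by omega)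
    simp only [hc]; linarith
  set φ : Sm := (n : ℝ)⁻¹ • ∑ j ∈ Finset.range n, dil (c j) ψ with hφ
  have hz : ∀ j ∈ Finset.range n, ∀ x ∉ cball 0 1, dil (c j) ψ x = 0 := by
    intro j hj x hx
    have hx' : 1 < ‖x‖ := by simpa using hx
    refine hout _ ?_
    rw [norm_smul, Real.norm_of_nonneg (hc0 j).le]
    have h2 : (2 : ℝ) ≤ c j := by
      simp only [hc]
      calc (2 : ℝ) = 2 ^ 1 := by norm_num
        _ ≤ _ := pow_le_pow_right₀ (by norm_num) (by
          have := Finset.mem_range.1 hj; omega)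
    nlinarith
  have hI : ∀ j, ∫ x, dil (c j) (ψ ^ 2) x = (c j ^ 2)⁻¹ * A := fun j => integral_dil (hc0 j).le _
  have hI1 : ∀ j, ∫ x, dil (c j) (dd 1 ψ) x = (c j ^ 2)⁻¹ * B := fun j => integral_dil (hc0 j).le _
  refine ⟨((2 : ℝ) ^ (2 * n))⁻¹, by positivity, inv_le_one_of_one_le₀ (one_le_pow₀ (by norm_num)), φ,
    fun x hx => ?_, fun x hx => ?_, ?_, ?_⟩
  · simp only [hφ, Sm.smul_apply, Sm.sum_apply]
    rw [Finset.sum_eq_zero fun j hj => hz j hj x hx, mul_zero]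
  · simp only [hφ, Sm.smul_apply, Sm.sum_apply]
    rw [Finset.sum_congr rfl (g := fun _ => (1 : ℝ)) fun j hj => ?_]
    · simp; field_simp
    · refine hin _ ?_
      rw [norm_smul, Real.norm_of_nonneg (hc0 j).le]
      have : c j ≤ 2 ^ (2 * n) := pow_le_pow_right₀ (by norm_num) (by
          have := Finset.mem_range.1 hj; omega)
      calc c j * ‖x‖ ≤ 2 ^ (2 * n) * ((2 : ℝ) ^ (2 * n))⁻¹ := by gcongr
        _ = 1 := mul_inv_cancel₀ (by positivity)
        _ ≤ 5 / 4 := by norm_num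
  · have h : JS (cball 0 1) (φ ^ 2) ≤ JS (cball 0 1)
        ((n : ℝ)⁻¹ • ∑ j ∈ Finset.range n, dil (c j) (ψ ^ 2)) := by
      refine JS_mono fun x _ => ?_
      simp only [hφ, Sm.smul_apply, Sm.sum_apply, Sm.pow_apply, dil_apply, mul_pow]
      have := sq_sum_le_card_mul_sum_sq (s := Finset.range n) (f := fun j => ψ (c j • x))
      rw [Finset.card_range] at this
      calc _ ≤ ((n : ℝ)⁻¹) ^ 2 * (n * ∑ j ∈ Finset.range n, ψ (c j • x) ^ 2) := by gcongr
        _ = _ := by field_simp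
    refine h.trans ?_
    rw [map_smul, map_sum, smul_eq_mul]
    have h2 : ∀ j ∈ Finset.range n, JS (cball 0 1) (dil (c j) (ψ ^ 2)) ≤ η := by
      intro j hj
      rw [JS_eq_integral fun x hx => by
        have := hz j hj x hx
        rw [dil_apply] at this
        simp [this], hI]
      have : (n : ℝ) ≤ c j ^ 2 := by nlinarith [hcn j]
      rw [inv_mul_le_iff₀ (by positivity)]
      nlinarith
    calc _ ≤ (n : ℝ)⁻¹ * ∑ j ∈ Finset.range n, η := by
          gcongr with j hj; exact h2 j hj
      _ = η := by simp; field_simp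
  · have h : dd 1 φ = ((n : ℝ)⁻¹ ^ 2) • ∑ j ∈ Finset.range n, (c j ^ 2) • dil (c j) (dd 1 ψ) := by
      refine Sm.ext fun x => ?_
      have horth : ∀ i, (∑ j ∈ Finset.range n, c j * D i ψ (c j • x)) ^ 2 =
          ∑ j ∈ Finset.range n, c j ^ 2 * D i ψ (c j • x) ^ 2 := by
        intro i
        rw [sq, Finset.sum_mul_sum]
        refine Finset.sum_congr rfl fun j hj => ?_
        rw [Finset.sum_eq_single_of_mem j hj fun k hk hkj => ?_]
        · ring
        · by_contra hne
          have hne1 : D i ψ (c j • x) ≠ 0 := fun h => hne (by rw [h]; ring)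
          have hne2 : D i ψ (c k • x) ≠ 0 := fun h => hne (by rw [h]; ring)
          have b1 := hD i _ hne1
          have b2 := hD i _ hne2
          rw [norm_smul, Real.norm_of_nonneg (hc0 _).le] at b1 b2
          have hlt : ∀ {a b : ℕ}, a < b → c a * ‖x‖ ≥ 5 / 4 → c b * ‖x‖ ≤ 3 / 2 → False := by
            intro a b hab h1 h2
            have : 2 * c a ≤ c b := by
              simp only [hc]
              rw [← pow_succ']
              exact pow_le_pow_right₀ (by norm_num) (by omega)
            nlinarith [norm_nonneg x]
          rcases lt_or_gt_of_ne hkj with h | h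
          · exact hlt h b2.1 b1.2
          · exact hlt h b1.1 b2.2
      rw [dd_one]
      simp only [hφ, map_smul, map_sum, D_dil, Sm.add_apply, Sm.smul_apply, Sm.sum_apply,
        Sm.pow_apply, dil_apply, mul_pow, horth, dd_one, mul_add, Finset.sum_add_distrib]
    rw [h, map_smul, map_sum, smul_eq_mul]
    have h2 : ∀ j ∈ Finset.range n, JS (cball 0 1) ((c j ^ 2) • dil (c j) (dd 1 ψ)) = B := by
      intro j hj
      rw [map_smul, smul_eq_mul, JS_eq_integral fun x hx => ?_, hI1]
      · field_simp [(hc0 j).ne']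
      · have h3 := fun i => D_eq_zero_of_notMem (hz j hj) i x hx
        simp only [D_dil, Sm.smul_apply, mul_eq_zero, (hc0 j).ne', false_or, dil_apply] at h3
        simp [dd_one, h3]
    rw [Finset.sum_congr rfl h2]
    simp only [Finset.sum_const, Finset.card_range, nsmul_eq_mul]
    rw [inv_pow, inv_mul_le_iff₀ (by positivity)]
    nlinarith

/-! ### The quadratic term of the second derivatives -/

section Torus

variable {ℓ : ℝ}

lemma dd_tr (y : E2) (k : ℕ) (v : Sm) : dd k (tr y v) = tr y (dd k v) := by
  induction k generalizing v with
  | zero => exact Sm.ext fun x => by simp [dd_zero, tr_apply]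
  | succ k ih =>
    rw [dd_succ, dd_succ, map_add, ← ih, ← ih, D_tr, D_tr]

lemma Tri_tr (y : E2) (X Y Z : Sm) : Tri (tr y X) (tr y Y) (tr y Z) = tr y (Tri X Y Z) := by
  refine Sm.ext fun x => ?_
  simp [Tri, D_tr, tr_apply]

lemma Aop_tr (y : E2) (s : ℝ) (v w : Sm) : Aop s (tr y v) (tr y w) = tr y (Aop s v w) := by
  refine Sm.ext fun x => ?_
  simp [Aop, Tri_tr, D_tr, tr_apply, Lap_def]

/-- Averaging over translations decouples a product. -/
lemma average_translates (hℓ : 0 ≤ ℓ) {K : TopologicalSpace.Compacts E2} (a : Sm) {b : Sm}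
    (hb : Per ℓ b) : IntegrableOn (fun y => JS K (a * tr y b)) (cell ℓ) ∧
      I ℓ (fun y => JS K (a * tr y b)) = JS K a * IS ℓ b := by
  have hc : Continuous fun p : E2 × E2 => a p.2 * b (p.2 + p.1) :=
    (a.continuous.comp continuous_snd).mul (b.continuous.comp (continuous_snd.add continuous_fst))
  have hInt : Integrable (Function.uncurry fun y x : E2 => a x * b (x + y))
      ((volume.restrict (cell ℓ)).prod (volume.restrict (K : Set E2))) := by
    rw [Measure.prod_restrict]
    exact hc.continuousOn.integrableOn_compact (isCompact_cell.prod K.isCompact)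
  have e : ∀ y, JS K (a * tr y b) = ∫ x in (K : Set E2), a x * b (x + y) := fun y => by
    simp [JS_def, tr_apply]
  simp only [e]
  refine ⟨hInt.integral_prod_left, ?_⟩
  unfold I
  rw [integral_integral_swap hInt, JS_def, ← integral_mul_const]
  refine integral_congr_ae (Filter.Eventually.of_forall fun x => ?_)
  simp only
  rw [integral_const_mul]
  congr 1
  exact hb.I_translate hℓ b.continuous x

/-- The square of the Hessian is controlled by a small multiple of the third derivatives. -/
lemma hessian_sq_le (hℓ : 0 < ℓ) {κ T : ℝ} (hκ : 0 < κ) (hT0 : 0 ≤ T) (F : ℝ) :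
    ∃ C, 0 ≤ C ∧ ∀ v : Sm, Per ℓ v → (∀ x, 2 + dd 1 v x ≤ T) → (∀ x, |Aop 1 v v x| ≤ F) →
      IS ℓ (dd 2 v ^ 2) ≤ κ * En ℓ 3 v + C * En ℓ 2 v := by
  obtain ⟨ψ, h0, h1, hin, hout⟩ := exists_bump (a := 1 / 2) (b := 1) (by norm_num) (by norm_num)
  obtain ⟨L, hL0, hL⟩ := ladyzhenskaya
  have hψK : ∀ x ∉ cball 0 1, ψ x = 0 := fun x hx => hout x (by
    have : 1 < ‖x‖ := by simpa using hx
    exact this.le)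
  obtain ⟨A, hA⟩ : ∃ A, A = ∫ x, (ψ ^ 2 : Sm) x := ⟨_, rfl⟩
  obtain ⟨B, hB⟩ : ∃ B, B = ∫ x, (ψ ^ 4 : Sm) x := ⟨_, rfl⟩
  have hA0 : 0 ≤ A := hA ▸ integral_nonneg fun x => by simp; positivity
  have hB0 : 0 < B := by
    rw [hB]
    refine (ψ ^ 4).continuous.integral_pos_of_hasCompactSupport_nonneg_nonzero (x := 0)
      (hasCompactSupport_of_notMem (K := cball 0 1) fun x hx => by simp [hψK x hx])
      (fun x => by simp; positivity) ?_
    simp [hin 0 (by simp)]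
  obtain ⟨N, hN⟩ : ∃ N, N = 16 * T ^ 3 + 2 * T * F ^ 2 := ⟨_, rfl⟩
  have hN0 : 0 ≤ N := by rw [hN]; positivity
  obtain ⟨η, hη0, hη⟩ : ∃ η > 0, 8 * L * (N * η) * A ≤ κ * B := by
    refine ⟨κ * B / (8 * L * N * A + 1), by positivity, ?_⟩
    calc 8 * L * (N * (κ * B / (8 * L * N * A + 1))) * A
        = κ * B * ((8 * L * N * A) / (8 * L * N * A + 1)) := by ring
      _ ≤ κ * B * 1 := by
        refine mul_le_mul_of_nonneg_left (div_le_one_of_le₀ (by linarith) (by positivity))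
          (by positivity)
      _ = _ := mul_one _
  obtain ⟨ρ, hρ0, hρ1, φ, hφK, hφ1, hφ2, hφ3⟩ := exists_cap hη0
  obtain ⟨ζ, hζ⟩ : ∃ ζ, ζ = dil ρ⁻¹ ψ := ⟨_, rfl⟩
  have hζout : ∀ x, ρ ≤ ‖x‖ → ζ x = 0 := fun x hx => by
    rw [hζ, dil_apply]
    refine hout _ ?_
    rw [norm_smul, Real.norm_of_nonneg (by positivity), ← div_eq_inv_mul, le_div_iff₀ hρ0]
    linarith
  have hζK : ∀ x ∉ cball 0 1, ζ x = 0 := fun x hx => hζout x (by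
    have : 1 < ‖x‖ := by simpa using hx
    linarith)
  have hζsq : ∀ x, ζ x ^ 2 ≤ φ x ^ 2 := fun x => by
    rcases le_total ‖x‖ ρ with h | h
    · rw [hφ1 x h, hζ, dil_apply]
      exact pow_le_pow_left₀ (h0 _) (h1 _) 2
    · rw [hζout x h]; nlinarith only [sq_nonneg (φ x)]
  have eA : JS (cball 0 1) (ζ ^ 2) = ρ ^ 2 * A := by
    rw [JS_eq_integral fun x hx => by simp [hζK x hx], hA]
    have := integral_dil (c := ρ⁻¹) (by positivity) (ψ ^ 2)
    rw [hζ]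
    refine (Eq.trans ?_ this).trans (by simp)
    rfl
  have eB : JS (cball 0 1) (ζ ^ 4) = ρ ^ 2 * B := by
    rw [JS_eq_integral fun x hx => by simp [hζK x hx], hB]
    have := integral_dil (c := ρ⁻¹) (by positivity) (ψ ^ 4)
    rw [hζ]
    refine (Eq.trans ?_ this).trans (by simp)
    rfl
  obtain ⟨Q, hQ⟩ : ∃ Q, Q = JS (cball 0 1) (dd 1 ζ) := ⟨_, rfl⟩
  have hQ0 : 0 ≤ Q := hQ ▸ JS_nonneg (dd_nonneg 1 ζ)
  refine ⟨8 * L * (N * η) * Q / (ρ ^ 2 * B), by positivity, fun v hv hvT hvF => ?_⟩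
  have main : ∀ g : Sm, Per ℓ g → (∀ x, g x ^ 2 ≤ dd 2 v x) →
      ρ ^ 2 * B * IS ℓ (g ^ 4) ≤ L * (N * η) * (2 * (ρ ^ 2 * A) * En ℓ 1 g + 2 * Q * En ℓ 0 g) := by
    intro g hg hgv
    have hy : ∀ y : E2, JS (cball 0 1) (ζ ^ 4 * tr y (g ^ 4)) ≤
        L * (N * η) * (2 * JS (cball 0 1) (ζ ^ 2 * tr y (dd 1 g)) +
          2 * JS (cball 0 1) (dd 1 ζ * tr y (g ^ 2))) := by
      intro y
      have hw := hL (cball 0 1) (ζ * tr y g) fun x hx => by simp [hζK x hx]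
      have e4 : (ζ * tr y g) ^ 4 = ζ ^ 4 * tr y (g ^ 4) := Sm.ext fun x => by
        simp [tr_apply, mul_pow]
      have s1 : JS (cball 0 1) ((ζ * tr y g) ^ 2) ≤ N * η := by
        have hE := small_energy (v := tr y v) (T := T) (F := F) hφK
          (fun x _ => by rw [dd_tr, tr_apply]; exact hvT _)
          (fun x _ => by rw [Aop_tr, tr_apply]; exact hvF _)
        calc JS (cball 0 1) ((ζ * tr y g) ^ 2) ≤ JS (cball 0 1) (φ ^ 2 * dd 2 (tr y v)) := by
              refine JS_mono fun x _ => ?_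
              simp only [dd_tr, Sm.pow_apply, Sm.mul_apply, tr_apply, mul_pow]
              exact mul_le_mul (hζsq x) (hgv _) (sq_nonneg _) (sq_nonneg _)
          _ ≤ _ := hE
          _ ≤ 16 * T ^ 3 * η + 2 * T * F ^ 2 * η := by gcongr
          _ = N * η := by rw [hN]; ring
      have s2 : JS (cball 0 1) (dd 1 (ζ * tr y g)) ≤
          2 * JS (cball 0 1) (ζ ^ 2 * tr y (dd 1 g)) +
            2 * JS (cball 0 1) (dd 1 ζ * tr y (g ^ 2)) := by
        have := JS_mono (K := cball 0 1) (v := dd 1 (ζ * tr y g))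
          (w := (2 : ℝ) • (ζ ^ 2 * tr y (dd 1 g)) + (2 : ℝ) • (dd 1 ζ * tr y (g ^ 2))) fun x _ => by
            rw [← dd_tr]
            simp only [dd_one, D_mul, Sm.add_apply, Sm.smul_apply, Sm.mul_apply, Sm.pow_apply,
              tr_apply]
            nlinarith only [sq_nonneg (ζ x * D 0 (tr y g) x - D 0 ζ x * g (x + y)),
              sq_nonneg (ζ x * D 1 (tr y g) x - D 1 ζ x * g (x + y))]
        simpa only [map_add, map_smul, smul_eq_mul] using this
      rw [e4] at hw
      have s0 : 0 ≤ JS (cball 0 1) (dd 1 (ζ * tr y g)) := JS_nonneg (dd_nonneg 1 _)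
      calc _ ≤ _ := hw
        _ ≤ L * ((N * η) * (2 * JS (cball 0 1) (ζ ^ 2 * tr y (dd 1 g)) +
            2 * JS (cball 0 1) (dd 1 ζ * tr y (g ^ 2)))) :=
          mul_le_mul_of_nonneg_left (mul_le_mul s1 s2 s0 (by positivity)) hL0
        _ = _ := by ring
    obtain ⟨i1, j1⟩ := average_translates hℓ.le (K := cball 0 1) (ζ ^ 4) (b := g ^ 4) (Per.pow hg 4)
    obtain ⟨i2, j2⟩ := average_translates hℓ.le (K := cball 0 1) (ζ ^ 2) (b := dd 1 g) (Per.dd hg 1)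
    obtain ⟨i3, j3⟩ := average_translates hℓ.le (K := cball 0 1) (dd 1 ζ) (b := g ^ 2) (Per.pow hg 2)
    have hm := setIntegral_mono i1 (((i2.const_mul 2).add (i3.const_mul 2)).const_mul (L * (N * η))) hy
    simp only [Pi.add_apply] at hm
    rw [integral_const_mul, integral_add (i2.const_mul 2) (i3.const_mul 2), integral_const_mul,
      integral_const_mul] at hm
    unfold I at j1 j2 j3
    rw [j1, j2, j3, eA, eB, ← hQ] at hm
    rw [En, En, dd_zero]
    linarith
  have m0 := main (D 0 (D 0 v)) ((hv.D 0).D 0) fun x => by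
    rw [dd_two]; simp only [Sm.add_apply, Sm.pow_apply, Sm.mul_apply, Sm.two_apply]
    nlinarith only [sq_nonneg (D 0 (D 1 v) x), sq_nonneg (D 1 (D 1 v) x)]
  have m1 := main (D 0 (D 1 v)) ((hv.D 1).D 0) fun x => by
    rw [dd_two]; simp only [Sm.add_apply, Sm.pow_apply, Sm.mul_apply, Sm.two_apply]
    nlinarith only [sq_nonneg (D 0 (D 0 v) x), sq_nonneg (D 1 (D 1 v) x), sq_nonneg (D 0 (D 1 v) x)]
  have m2 := main (D 1 (D 1 v)) ((hv.D 1).D 1) fun x => by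
    rw [dd_two]; simp only [Sm.add_apply, Sm.pow_apply, Sm.mul_apply, Sm.two_apply]
    nlinarith only [sq_nonneg (D 0 (D 1 v) x), sq_nonneg (D 0 (D 0 v) x)]
  have e3 : En ℓ 3 v = En ℓ 1 (D 0 (D 0 v)) + 2 * En ℓ 1 (D 0 (D 1 v)) + En ℓ 1 (D 1 (D 1 v)) := by
    rw [En_succ 2, En_succ 1, En_succ 1, D_comm 1 0]; ring
  have e2 : En ℓ 2 v = En ℓ 0 (D 0 (D 0 v)) + 2 * En ℓ 0 (D 0 (D 1 v)) + En ℓ 0 (D 1 (D 1 v)) := by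
    rw [En_succ 1, En_succ 0, En_succ 0, D_comm 1 0]; ring
  have hsq : IS ℓ (dd 2 v ^ 2) ≤ 4 * (IS ℓ (D 0 (D 0 v) ^ 4) + 2 * IS ℓ (D 0 (D 1 v) ^ 4) +
      IS ℓ (D 1 (D 1 v) ^ 4)) := by
    have := IS_mono (ℓ := ℓ) (v := dd 2 v ^ 2) (w := (4 : ℝ) • (D 0 (D 0 v) ^ 4 +
      (2 : ℝ) • D 0 (D 1 v) ^ 4 + D 1 (D 1 v) ^ 4)) fun x => by
        rw [dd_two]
        simp only [Sm.add_apply, Sm.pow_apply, Sm.mul_apply, Sm.two_apply, Sm.smul_apply]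
        nlinarith only [sq_nonneg (D 0 (D 0 v) x ^ 2 - D 0 (D 1 v) x ^ 2),
          sq_nonneg (D 0 (D 0 v) x ^ 2 - D 1 (D 1 v) x ^ 2),
          sq_nonneg (D 0 (D 1 v) x ^ 2 - D 1 (D 1 v) x ^ 2)]
    simpa only [map_add, map_smul, smul_eq_mul] using this
  have hE3 : 0 ≤ En ℓ 3 v := En_nonneg 3 v
  have fin : ρ ^ 2 * B * IS ℓ (dd 2 v ^ 2) ≤
      ρ ^ 2 * (8 * L * (N * η) * A) * En ℓ 3 v + 8 * L * (N * η) * Q * En ℓ 2 v := by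
    have := mul_le_mul_of_nonneg_left hsq (by positivity : 0 ≤ ρ ^ 2 * B)
    rw [e3, e2]
    nlinarith only [this, m0, m1, m2]
  have hfin2 : ρ ^ 2 * (8 * L * (N * η) * A) * En ℓ 3 v ≤ ρ ^ 2 * (κ * B) * En ℓ 3 v := by gcongr
  have hp : 0 < ρ ^ 2 * B := by positivity
  have hr : ρ ^ 2 * B * (κ * En ℓ 3 v + 8 * L * (N * η) * Q / (ρ ^ 2 * B) * En ℓ 2 v) =
      ρ ^ 2 * (κ * B) * En ℓ 3 v + 8 * L * (N * η) * Q * En ℓ 2 v := by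
    field_simp
  refine le_of_mul_le_mul_left ?_ hp
  rw [hr]; linarith

end Torus

/-! ### The nonlinear equation on the torus -/

section Torus

variable {ℓ : ℝ}

/-- The nonlinear operator `λ v - Δ v - Δ_∞ v`. -/
def Nop (lam v : Sm) : Sm := lam * v - Lap v - Tri v v v

lemma Per.Nop {lam v : Sm} (hlam : Per ℓ lam) (hv : Per ℓ v) : Per ℓ (Nop lam v) :=
  ((hlam.mul hv).sub hv.Lap).sub (hv.Tri hv hv)

lemma Nop_neg (lam v : Sm) : Nop lam (-v) = -Nop lam v := Sm.ext fun x => by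
  simp [Nop, Tri]; ring

lemma Nop_max {c K : ℝ} (hℓ : 0 < ℓ) (hc0 : 0 < c) {lam : Sm} (hlam : ∀ x, c ≤ lam x) {v : Sm}
    (hv : Per ℓ v) (hK : 0 ≤ K) (h : ∀ x, Nop lam v x ≤ K) (x : E2) : v x ≤ K / c := by
  obtain ⟨y, hy⟩ := hv.exists_max hℓ v.continuous
  rw [le_div_iff₀ hc0]
  have h1 := h y
  have l := v.Lap_nonpos hy
  have t := v.Tri_nonpos hy v
  simp only [Nop, Sm.sub_apply, Sm.mul_apply] at h1
  by_cases hvy : v y ≤ 0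
  · nlinarith [hy x]
  · nlinarith [hy x, hlam y]

lemma Nop_sup {c K : ℝ} (hℓ : 0 < ℓ) (hc0 : 0 < c) {lam : Sm} (hlam : ∀ x, c ≤ lam x) {v : Sm}
    (hv : Per ℓ v) (hK : 0 ≤ K) (h : ∀ x, |Nop lam v x| ≤ K) (x : E2) : |v x| ≤ K / c := by
  refine abs_le'.2 ⟨Nop_max hℓ hc0 hlam hv hK (fun x => (abs_le.1 (h x)).2) x, ?_⟩
  refine Nop_max (v := -v) hℓ hc0 hlam (fun i x => congrArg Neg.neg (hv i x)) hK (fun x => ?_) x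
  rw [Nop_neg, Sm.neg_apply]; linarith [(abs_le.1 (h x)).1]

lemma Per.third_energy (hℓ : 0 ≤ ℓ) {v : Sm} (hv : Per ℓ v) {M : ℝ} (hM : ∀ x, dd 1 v x ≤ M ^ 2) :
    En ℓ 3 v ≤ (2 + M ^ 2) * (2 * En ℓ 1 (Aop 1 v v) + 8 * M ^ 2 * IS ℓ (dd 2 v ^ 2)) := by
  have hT : ∀ x, 2 + dd 1 v x ≤ 2 + M ^ 2 := fun x => by linarith [hM x]
  have e : ∀ k, Aop 1 v (D k v) = D k (Aop 1 v v) - (2 : ℝ) • Tri (D k v) v v := fun k => by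
    simp only [Aop, map_add, D_Tri, D_Lap, Tri_symm v (D k v), one_smul, two_smul]; abel
  have hk : ∀ k : Fin 2, En ℓ 2 (D k v) ≤
      (2 + M ^ 2) * IS ℓ ((2 : ℝ) • (D k (Aop 1 v v)) ^ 2 + (8 * M ^ 2) • (dd 1 (D k v) * dd 2 v)) := by
    intro k
    refine ((hv.D k).elliptic hℓ zero_le_one le_rfl hT).trans ?_
    refine mul_le_mul_of_nonneg_left (IS_mono fun x => ?_) (by positivity)
    rw [e]
    have ht := Tri_sq_le (D k v) v v x
    have : dd 1 (D k v) x * dd 1 v x * dd 2 v x ≤ dd 1 (D k v) x * M ^ 2 * dd 2 v x := by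
      have := dd_nonneg 1 (D k v) x; have := dd_nonneg 2 v x; have := hM x
      gcongr
    simp only [Sm.pow_apply, Sm.add_apply, Sm.sub_apply, Sm.smul_apply, Sm.mul_apply]
    nlinarith only [ht, this, sq_nonneg (D k (Aop 1 v v) x + 2 * Tri (D k v) v v x)]
  have h0 := hk 0
  have h1 := hk 1
  have e2 : IS ℓ (dd 2 v ^ 2) = IS ℓ (dd 1 (D 0 v) * dd 2 v) + IS ℓ (dd 1 (D 1 v) * dd 2 v) := by
    rw [← map_add, ← add_mul, ← dd_succ, sq]
  rw [En_succ, e2]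
  rw [show En ℓ 1 (Aop 1 v v) = IS ℓ (D 0 (Aop 1 v v) ^ 2) + IS ℓ (D 1 (Aop 1 v v) ^ 2) by
    rw [En, dd_one, map_add]]
  simp only [map_add, map_smul, smul_eq_mul] at h0 h1
  linarith

/-- A priori bound for the nonlinear equation. -/
lemma nonlin_apriori (hℓ : 0 < ℓ) {c : ℝ} (hc0 : 0 < c) {lam : Sm} (hlp : Per ℓ lam)
    (hlam : ∀ x, c ≤ lam x) {B : ℝ} (hB : 0 ≤ B) : ∃ C, 0 ≤ C ∧ ∀ v : Sm, Per ℓ v →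
      N2 ℓ (Nop lam v) ≤ B → H4 ℓ v ≤ C := by
  have hcS := cSob_pos (ℓ := ℓ)
  obtain ⟨K, hK0, hK⟩ := hlp.exists_bound hℓ 0
  obtain ⟨CL, hCL0, hCL⟩ := En_mul_le hℓ hlp
  obtain ⟨G0, hG0⟩ : ∃ G0, G0 = Real.sqrt (cSob ℓ * B) := ⟨_, rfl⟩
  have hG00 : 0 ≤ G0 := hG0 ▸ Real.sqrt_nonneg _
  obtain ⟨V, hV⟩ : ∃ V, V = G0 / c := ⟨_, rfl⟩
  have hV0 : 0 ≤ V := hV ▸ by positivity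
  obtain ⟨F, hF⟩ : ∃ F, F = G0 + K * V := ⟨_, rfl⟩
  have hF0 : 0 ≤ F := hF ▸ by positivity
  obtain ⟨M, hM0, hM⟩ := lipschitz_bound hV0 hF0 one_pos
  obtain ⟨T, hT⟩ : ∃ T, T = 2 + M ^ 2 := ⟨_, rfl⟩
  have hT0 : 0 < T := hT ▸ by positivity
  obtain ⟨κ, hκ0, hκ⟩ : ∃ κ, 0 < κ ∧ T * (8 * M ^ 2 * κ) = 1 / 2 :=
    ⟨1 / (16 * T * M ^ 2), by positivity, by field_simp; norm_num⟩
  obtain ⟨C1, hC10, hC1⟩ := hessian_sq_le hℓ hκ0 hT0.le F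
  obtain ⟨J, hJ⟩ : ∃ J, J = IS ℓ (1 : Sm) := ⟨_, rfl⟩
  have hJ0 : 0 ≤ J := hJ ▸ IS_nonneg fun x => by simp
  -- bounds for the successive energies
  obtain ⟨b0, hb0⟩ : ∃ b, b = V ^ 2 * J := ⟨_, rfl⟩
  obtain ⟨b2, hb2⟩ : ∃ b, b = T * (F ^ 2 * J) := ⟨_, rfl⟩
  obtain ⟨b1, hb1⟩ : ∃ b, b = b2 + b0 := ⟨_, rfl⟩
  have hb00 : 0 ≤ b0 := hb0 ▸ by positivity
  have hb20 : 0 ≤ b2 := hb2 ▸ by positivity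
  have hb10 : 0 ≤ b1 := hb1 ▸ by positivity
  obtain ⟨bA, hbA⟩ : ∃ b, b = 2 * (CL * (b0 + b1 + b2)) + 2 * B := ⟨_, rfl⟩
  have hbA0 : 0 ≤ bA := hbA ▸ by positivity
  obtain ⟨b3, hb3⟩ : ∃ b, b = 2 * (T * (2 * bA + 8 * M ^ 2 * (C1 * b2))) := ⟨_, rfl⟩
  have hb30 : 0 ≤ b3 := hb3 ▸ by positivity
  obtain ⟨P, hP⟩ : ∃ P, P = 2 * M ^ 2 * b3 + (κ * b3 + C1 * b2) := ⟨_, rfl⟩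
  have hP0 : 0 ≤ P := hP ▸ by positivity
  obtain ⟨σ, hσ0, hσ⟩ : ∃ σ, 0 < σ ∧ T * (320 * (σ * P)) ≤ 1 / 2 := by
    refine ⟨1 / (640 * T * (P + 1)), by positivity, ?_⟩
    rw [show T * (320 * (1 / (640 * T * (P + 1)) * P)) = 1 / 2 * (P / (P + 1)) by field_simp; ring]
    have : P / (P + 1) ≤ 1 := div_le_one_of_le₀ (by linarith) (by positivity)
    linarith
  obtain ⟨CE, hCE0, hCE⟩ := ehrling hℓ hσ0
  obtain ⟨b4, hb4⟩ : ∃ b, b = 2 * (T * (2 * bA + 320 * (CE * b0 * P))) := ⟨_, rfl⟩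
  have hb40 : 0 ≤ b4 := hb4 ▸ by positivity
  refine ⟨b0 + b1 + b2 + b3 + b4, by positivity, fun v hv hN => ?_⟩
  have hG : ∀ x, |Nop lam v x| ≤ G0 := fun x => by
    rw [hG0]
    refine Real.abs_le_sqrt (((hlp.Nop hv).sup_sq_le_N2 hℓ x).trans ?_)
    gcongr
  have hvV : ∀ x, |v x| ≤ V := fun x => hV ▸ Nop_sup hℓ hc0 hlam hv hG00 hG x
  have hA : Aop 1 v v = lam * v - Nop lam v := by simp only [Aop, Nop, one_smul]; abel
  have hlK : ∀ x, |lam x| ≤ K := fun x => abs_le_of_sq_le_sq (by simpa [dd_zero] using hK 0 le_rfl x) hK0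
  have hAF : ∀ x, |Aop 1 v v x| ≤ F := fun x => by
    rw [hA, hF, Sm.sub_apply, Sm.mul_apply]
    refine (abs_sub _ _).trans ?_
    rw [abs_mul, add_comm]
    exact add_le_add (hG x) (mul_le_mul (hlK x) (hvV x) (abs_nonneg _) hK0)
  have hvM : ∀ x, dd 1 v x ≤ M ^ 2 := fun x => hM 1 zero_le_one le_rfl v x fun y _ => ⟨hvV y, by
    have := hAF y
    simp only [Aop, one_smul, Sm.add_apply] at this
    rw [one_mul, add_comm]; exact this⟩
  have hvT : ∀ x, 2 + dd 1 v x ≤ T := fun x => by rw [hT]; linarith [hvM x]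
  have E0 : En ℓ 0 v ≤ b0 := by
    rw [hb0, hJ, En_zero]
    refine IS_le_smul fun x => ?_
    simp only [Sm.pow_apply, Sm.one_apply, mul_one]
    exact sq_le_sq' (abs_le.1 (hvV x)).1 (abs_le.1 (hvV x)).2
  have E2' : En ℓ 2 v ≤ b2 := by
    rw [hb2, hJ]
    refine (hv.elliptic hℓ.le zero_le_one le_rfl hvT).trans (mul_le_mul_of_nonneg_left ?_ hT0.le)
    refine IS_le_smul fun x => ?_
    simp only [Sm.pow_apply, Sm.one_apply, mul_one]
    exact sq_le_sq' (abs_le.1 (hAF x)).1 (abs_le.1 (hAF x)).2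
  have E1 : En ℓ 1 v ≤ b1 := by
    have := hv.En_interp hℓ.le one_pos 0
    rw [inv_one] at this
    rw [hb1]; linarith
  have hN2v : N2 ℓ v ≤ b0 + b1 + b2 := by unfold N2; linarith
  have hA2 : N2 ℓ (Aop 1 v v) ≤ bA := by
    rw [hA, hbA]
    refine (N2_sub_le_two _ _).trans ?_
    have := (hCL v).trans (mul_le_mul_of_nonneg_left hN2v hCL0)
    linarith
  have hA0n := En_nonneg (ℓ := ℓ) 0 (Aop 1 v v)
  have hA1n := En_nonneg (ℓ := ℓ) 1 (Aop 1 v v)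
  have hA2n := En_nonneg (ℓ := ℓ) 2 (Aop 1 v v)
  have hA1 : En ℓ 1 (Aop 1 v v) ≤ bA := by unfold N2 at hA2; linarith
  have hA2' : En ℓ 2 (Aop 1 v v) ≤ bA := by unfold N2 at hA2; linarith
  have hq := hC1 v hv hvT hAF
  have hE30 := En_nonneg (ℓ := ℓ) 3 v
  have E3 : En ℓ 3 v ≤ b3 := by
    have h := hv.third_energy hℓ.le hvM
    rw [← hT] at h
    have h2 : T * (2 * En ℓ 1 (Aop 1 v v) + 8 * M ^ 2 * IS ℓ (dd 2 v ^ 2)) ≤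
        T * (2 * bA + 8 * M ^ 2 * (κ * En ℓ 3 v + C1 * b2)) := by
      have := mul_le_mul_of_nonneg_left E2' hC10
      gcongr
      linarith
    have h3 : T * (2 * bA + 8 * M ^ 2 * (κ * En ℓ 3 v + C1 * b2)) =
        T * (8 * M ^ 2 * κ) * En ℓ 3 v + T * (2 * bA + 8 * M ^ 2 * (C1 * b2)) := by ring
    rw [h3, hκ] at h2
    rw [hb3]; linarith
  have E4 : En ℓ 4 v ≤ b4 := by
    have h := hv.reg_four hℓ.le zero_le_one le_rfl hv hvT
    obtain ⟨S, hS⟩ : ∃ S, S = σ * En ℓ 4 v + CE * b0 := ⟨_, rfl⟩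
    have hE40 := En_nonneg (ℓ := ℓ) 4 v
    have hS0 : 0 ≤ S := hS ▸ by positivity
    have hsup : ∀ x, dd 2 v x ≤ S := fun x => by
      have := (hCE v hv).2 x
      have := mul_le_mul_of_nonneg_left E0 hCE0
      have := dd_nonneg 1 v x
      rw [hS]; linarith
    have hI : IS ℓ (dd 3 v * dd 1 v * dd 2 v + dd 2 v * dd 2 v * dd 2 v + dd 2 v * dd 1 v * dd 3 v) ≤
        (2 * M ^ 2 * S) * IS ℓ (dd 3 v) + S * IS ℓ (dd 2 v ^ 2) := by
      refine IS_le_smul_add fun x => ?_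
      have n1 := dd_nonneg 1 v x
      have n2 := dd_nonneg 2 v x
      have n3 := dd_nonneg 3 v x
      have p1 : dd 3 v x * (dd 1 v x * dd 2 v x) ≤ dd 3 v x * (M ^ 2 * S) :=
        mul_le_mul_of_nonneg_left (mul_le_mul (hvM x) (hsup x) n2 (by positivity)) n3
      have p2 : dd 2 v x ^ 2 * dd 2 v x ≤ dd 2 v x ^ 2 * S :=
        mul_le_mul_of_nonneg_left (hsup x) (sq_nonneg _)
      simp only [Sm.add_apply, Sm.mul_apply, Sm.pow_apply]
      linarith
    have hI2 : IS ℓ (dd 3 v * dd 1 v * dd 2 v + dd 2 v * dd 2 v * dd 2 v + dd 2 v * dd 1 v * dd 3 v) ≤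
        S * P := by
      refine hI.trans ?_
      have e3 : IS ℓ (dd 3 v) ≤ b3 := E3
      have h1 := mul_le_mul_of_nonneg_left e3 (by positivity : 0 ≤ 2 * M ^ 2 * S)
      have h2 : IS ℓ (dd 2 v ^ 2) ≤ κ * b3 + C1 * b2 := by
        have := mul_le_mul_of_nonneg_left E2' hC10
        have := mul_le_mul_of_nonneg_left E3 hκ0.le
        linarith
      have h3 := mul_le_mul_of_nonneg_left h2 hS0
      rw [hP]; linarith
    have h2 : T * (2 * En ℓ 2 (Aop 1 v v) + 320 * IS ℓ (dd 3 v * dd 1 v * dd 2 v +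
        dd 2 v * dd 2 v * dd 2 v + dd 2 v * dd 1 v * dd 3 v)) ≤ T * (2 * bA + 320 * (S * P)) := by
      gcongr
    have h3 : T * (2 * bA + 320 * (S * P)) = T * (320 * (σ * P)) * En ℓ 4 v +
        T * (2 * bA + 320 * (CE * b0 * P)) := by rw [hS]; ring
    have h4 := mul_le_mul_of_nonneg_right hσ hE40
    rw [hb4]; linarith
  unfold H4; linarith

end Torus

/-! ### Existence of almost solutions by an Euler scheme -/

section Existence

variable {ℓ : ℝ}

lemma Nop_add_smul (lam v w : Sm) (τ : ℝ) : Nop lam (v + τ • w) =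
    Nop lam v + τ • Lop 1 lam v w
      - τ ^ 2 • ((2 : ℝ) • Tri w v w + Tri w w v + τ • Tri w w w) := Sm.ext fun x => by
  have e : Tri v w v x = Tri w v v x := congrArg (fun z : Sm => z x) (Tri_symm v w v)
  have e' : Tri v w w x = Tri w v w x := congrArg (fun z : Sm => z x) (Tri_symm v w w)
  simp only [Nop, Lop, Aop, map_add, map_smul, Tri_add₁, Tri_add₂, Tri_add₃, Tri_smul₁, Tri_smul₂,
    Tri_smul₃, Sm.add_apply, Sm.sub_apply, Sm.smul_apply, Sm.mul_apply, aS_apply, e, e']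
  ring

lemma Nop_zero (lam : Sm) : Nop lam 0 = 0 := Sm.ext fun x => by simp [Nop, Tri]

lemma euler_error (hℓ : 0 < ℓ) {v w : Sm} (hv : Per ℓ v) (hw : Per ℓ w) {τ a b : ℝ} (hτ0 : 0 ≤ τ)
    (hτ1 : τ ≤ 1) (ha : H4 ℓ v ≤ a) (hb : H4 ℓ w ≤ b) :
    N2 ℓ ((2 : ℝ) • Tri w v w + Tri w w v + τ • Tri w w w)
      ≤ 91 * cSob ℓ ^ 2 * (20 * a * b ^ 2 + 2 * b ^ 3) := by
  have hc := cSob_pos (ℓ := ℓ)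
  have a0 := (H4_nonneg (ℓ := ℓ) v).trans ha
  have b0 := (H4_nonneg (ℓ := ℓ) w).trans hb
  have hv0 := H4_nonneg (ℓ := ℓ) v
  have hw0 := H4_nonneg (ℓ := ℓ) w
  have t1 : N2 ℓ (Tri w v w) ≤ 91 * cSob ℓ ^ 2 * b * a * b :=
    (N2_Tri_le hℓ hw hv hw).trans (by gcongr)
  have t2 : N2 ℓ (Tri w w v) ≤ 91 * cSob ℓ ^ 2 * b * b * a :=
    (N2_Tri_le hℓ hw hw hv).trans (by gcongr)
  have t3 : N2 ℓ (Tri w w w) ≤ 91 * cSob ℓ ^ 2 * b * b * b :=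
    (N2_Tri_le hℓ hw hw hw).trans (by gcongr)
  have n1 := N2_add_le_two (ℓ := ℓ) ((2 : ℝ) • Tri w v w + Tri w w v) (τ • Tri w w w)
  have n2 := N2_add_le_two (ℓ := ℓ) ((2 : ℝ) • Tri w v w) (Tri w w v)
  rw [N2_smul] at n1 n2
  have hτ2 : τ ^ 2 ≤ 1 := pow_le_one₀ hτ0 hτ1
  have := mul_le_mul hτ2 t3 (N2_nonneg _) zero_le_one
  linarith

lemma nonlin_solve_N2 (hℓ : 0 < ℓ) {c : ℝ} (hc0 : 0 < c) (hc1 : c ≤ 1) {lam : Sm}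
    (hlp : Per ℓ lam) (hlam : ∀ x, c ≤ lam x) {g : Sm} (hg : Per ℓ g) {η : ℝ} (hη : 0 < η) :
    ∃ v : Sm, Per ℓ v ∧ N2 ℓ (Nop lam v - g) ≤ η := by
  have hcS := cSob_pos (ℓ := ℓ)
  have hg0 := N2_nonneg (ℓ := ℓ) g
  obtain ⟨a, ha0, ha⟩ := nonlin_apriori hℓ hc0 hlp hlam
    (by positivity : 0 ≤ 2 * N2 ℓ g + 2)
  obtain ⟨C, hC0, hC⟩ := lin_apriori hℓ hc0 hc1 hlp hlam a
  obtain ⟨b, hb⟩ : ∃ b, b = C * (2 * N2 ℓ g + 2) := ⟨_, rfl⟩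
  have hb0 : 0 ≤ b := hb ▸ by positivity
  obtain ⟨q, hq⟩ : ∃ q, q = 91 * cSob ℓ ^ 2 * (20 * a * b ^ 2 + 2 * b ^ 3) := ⟨_, rfl⟩
  have hq0 : 0 ≤ q := hq ▸ by positivity
  obtain ⟨p, hp⟩ : ∃ p, p = 2 + 2 * q := ⟨_, rfl⟩
  have hp0 : 0 ≤ p := hp ▸ by positivity
  obtain ⟨n, hn⟩ := exists_nat_gt (max 1 (p / min 1 η))
  have hn1 : (1 : ℝ) < n := (le_max_left _ _).trans_lt hn
  have hm : 0 < min 1 η := lt_min one_pos hη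
  have hn2 : p ≤ n * min 1 η := ((div_le_iff₀ hm).1 ((le_max_right _ _).trans hn.le))
  obtain ⟨τ, hτ⟩ : ∃ τ : ℝ, τ = 1 / n := ⟨_, rfl⟩
  have hn0 : (0 : ℝ) < n := by linarith
  have hτ0 : 0 < τ := hτ ▸ by positivity
  have hτn : n * τ = 1 := by rw [hτ]; field_simp
  have hτ1 : τ ≤ 1 := by nlinarith
  have small : ∀ k : ℕ, k ≤ n → (k : ℝ) ^ 2 * (p * τ ^ 4) ≤ min 1 η := fun k hk => by
    have hk' : (k : ℝ) ≤ n := by exact_mod_cast hk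
    calc (k : ℝ) ^ 2 * (p * τ ^ 4) ≤ (n : ℝ) ^ 2 * ((n * min 1 η) * τ ^ 4) := by gcongr
      _ = (n * τ) ^ 3 * (τ * min 1 η) := by ring
      _ ≤ 1 ^ 3 * (1 * min 1 η) := by rw [hτn]; gcongr
      _ = min 1 η := by ring
  have main : ∀ k : ℕ, k ≤ n → ∃ v : Sm, Per ℓ v ∧
      N2 ℓ (Nop lam v - ((k : ℝ) * τ) • g) ≤ (k : ℝ) ^ 2 * (p * τ ^ 4) := by
    intro k
    induction k with
    | zero =>
      refine fun _ => ⟨0, fun i x => rfl, ?_⟩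
      rw [Nop_zero]
      simpa using (N2_smul (ℓ := ℓ) 0 (0 : Sm)).le
    | succ k ih =>
      intro hk
      obtain ⟨v, hv, hρ⟩ := ih (by omega)
      obtain ⟨ρ, hρd⟩ : ∃ ρ : Sm, ρ = Nop lam v - ((k : ℝ) * τ) • g := ⟨_, rfl⟩
      rw [← hρd] at hρ
      have hkτ : (k : ℝ) * τ ≤ 1 := by
        have : (k : ℝ) ≤ n := by exact_mod_cast (by omega : k ≤ n)
        nlinarith
      have hkτ0 : 0 ≤ (k : ℝ) * τ := by positivity
      have hHv : H4 ℓ v ≤ a := by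
        refine ha v hv ?_
        have e : Nop lam v = ((k : ℝ) * τ) • g + ρ := by rw [hρd]; abel
        rw [e]
        have h1 := N2_add_le_two (ℓ := ℓ) (((k : ℝ) * τ) • g) ρ
        rw [N2_smul] at h1
        have h2 := (hρ.trans (small k (by omega))).trans (min_le_left _ _)
        have h3 := mul_le_mul_of_nonneg_right (pow_le_one₀ hkτ0 hkτ : ((k : ℝ) * τ) ^ 2 ≤ 1) hg0
        linarith
      obtain ⟨w, hw, hr⟩ := lin_solve hℓ hc0 hc1 hlp hlam hv hg (by positivity : 0 < τ ^ 2)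
      obtain ⟨r, hrd⟩ : ∃ r : Sm, r = g - Lop 1 lam v w := ⟨_, rfl⟩
      rw [← hrd] at hr
      have hHw : H4 ℓ w ≤ b := by
        refine (hC 1 zero_le_one le_rfl v w hv hw hHv).trans ?_
        rw [hb]
        refine mul_le_mul_of_nonneg_left ?_ hC0
        have e : Lop 1 lam v w = g - r := by rw [hrd]; abel
        rw [e]
        have h1 := N2_sub_le_two (ℓ := ℓ) g r
        have : τ ^ 2 ≤ 1 := pow_le_one₀ hτ0.le hτ1
        linarith
      obtain ⟨Q, hQ⟩ : ∃ Q : Sm, Q = (2 : ℝ) • Tri w v w + Tri w w v + τ • Tri w w w := ⟨_, rfl⟩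
      have hQq : N2 ℓ Q ≤ q := by rw [hQ, hq]; exact euler_error hℓ hv hw hτ0.le hτ1 hHv hHw
      refine ⟨v + τ • w, hv.add (hw.smul τ), ?_⟩
      obtain ⟨e, he⟩ : ∃ e : Sm, e = (-τ) • r + (-τ ^ 2) • Q := ⟨_, rfl⟩
      have hE : N2 ℓ e ≤ p * τ ^ 4 := by
        have h1 := N2_add_le_two (ℓ := ℓ) ((-τ) • r) ((-τ ^ 2) • Q)
        rw [N2_smul, N2_smul, ← he] at h1
        have h2 := mul_le_mul_of_nonneg_left hr (sq_nonneg τ)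
        have h3 := mul_le_mul_of_nonneg_left hQq (sq_nonneg (τ ^ 2))
        rw [hp]; nlinarith only [h1, h2, h3]
      have hsum : Nop lam (v + τ • w) - (((k + 1 : ℕ) : ℝ) * τ) • g = ρ + e := by
        rw [Nop_add_smul, hρd, he, hrd, hQ]
        refine Sm.ext fun x => ?_
        simp only [Sm.add_apply, Sm.sub_apply, Sm.smul_apply]
        push_cast; ring
      rw [hsum]
      rcases Nat.eq_zero_or_pos k with rfl | hk0
      · have h0 : N2 ℓ ρ = 0 := le_antisymm (by simpa using hρ) (N2_nonneg _)
        have h1 : ∀ θ : ℝ, 0 < θ → N2 ℓ (ρ + e) ≤ (1 + θ) * N2 ℓ e := fun θ hθ => by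
          have := N2_add_le (ℓ := ℓ) (inv_pos.2 hθ) ρ e
          rwa [h0, mul_zero, zero_add, inv_inv] at this
        have h2 : N2 ℓ (ρ + e) ≤ N2 ℓ e := by
          refine le_of_forall_pos_le_add fun d hd => ?_
          have he0 := N2_nonneg (ℓ := ℓ) e
          have := h1 (d / (N2 ℓ e + 1)) (by positivity)
          have h3 : d / (N2 ℓ e + 1) * N2 ℓ e ≤ d := by
            rw [div_mul_eq_mul_div, div_le_iff₀ (by positivity)]; nlinarith
          linarith
        simpa using h2.trans hE
      · have hk' : (0 : ℝ) < k := by exact_mod_cast hk0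
        have h1 := N2_add_le (ℓ := ℓ) (inv_pos.2 hk') ρ e
        rw [inv_inv] at h1
        have h2 := mul_le_mul_of_nonneg_left hρ (by positivity : 0 ≤ 1 + (k : ℝ)⁻¹)
        have h3 := mul_le_mul_of_nonneg_left hE (by positivity : 0 ≤ 1 + (k : ℝ))
        have h4 : (1 + (k : ℝ)⁻¹) * ((k : ℝ) ^ 2 * (p * τ ^ 4)) = ((k : ℝ) ^ 2 + k) * (p * τ ^ 4) := by
          field_simp
        push_cast
        nlinarith only [h1, h2, h3, h4]
  obtain ⟨v, hv, h⟩ := main n le_rfl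
  refine ⟨v, hv, ?_⟩
  rw [hτn, one_smul] at h
  exact (h.trans (small n le_rfl)).trans (min_le_right _ _)

lemma nonlin_solve (hℓ : 0 < ℓ) {c : ℝ} (hc0 : 0 < c) {lam : Sm}
    (hlp : Per ℓ lam) (hlam : ∀ x, c ≤ lam x) {g : Sm} (hg : Per ℓ g) {η : ℝ} (hη : 0 < η) :
    ∃ v : Sm, Per ℓ v ∧ ∀ x, |Nop lam v x - g x| ≤ η := by
  have hcS := cSob_pos (ℓ := ℓ)
  obtain ⟨v, hv, h⟩ := nonlin_solve_N2 hℓ (lt_min hc0 one_pos) (min_le_right _ _) hlp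
    (fun x => (min_le_left c 1).trans (hlam x)) hg (by positivity : 0 < η ^ 2 / cSob ℓ)
  refine ⟨v, hv, fun x => abs_le_of_sq_le_sq ?_ hη.le⟩
  have h1 := ((hlp.Nop hv).sub hg).sup_sq_le_N2 hℓ x
  rw [le_div_iff₀ hcS] at h
  rw [Sm.sub_apply] at h1
  linarith

/-- Almost solutions of `λ v - ε Δ v - Δ_∞ v = g` on the torus. -/
lemma exists_almost_solution (hℓ : 0 < ℓ) {c : ℝ} (hc0 : 0 < c) {lam : Sm}
    (hlp : Per ℓ lam) (hlam : ∀ x, c ≤ lam x) {g : Sm} (hg : Per ℓ g) {ε η : ℝ} (hε : 0 < ε)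
    (hη : 0 < η) :
    ∃ v : Sm, Per ℓ v ∧ ∀ x, |lam x * v x - ε * Lap v x - Tri v v v x - g x| ≤ η := by
  obtain ⟨s, hs⟩ : ∃ s, s = Real.sqrt ε := ⟨_, rfl⟩
  have hs0 : 0 < s := hs ▸ Real.sqrt_pos.2 hε
  have hs2 : ε = s ^ 2 := by rw [hs, Real.sq_sqrt hε.le]
  obtain ⟨w, hw, h⟩ := nonlin_solve hℓ (by positivity : 0 < c / ε) (hlp.smul (1 / ε))
    (fun x => by rw [Sm.smul_apply, div_mul_eq_mul_div, one_mul]; gcongr; exact hlam x)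
    (hg.smul (1 / s ^ 3)) (by positivity : 0 < η / s ^ 3)
  refine ⟨s • w, hw.smul s, fun x => ?_⟩
  have h1 := h x
  have e : lam x * (s • w) x - ε * Lap (s • w) x - Tri (s • w) (s • w) (s • w) x - g x
      = s ^ 3 * (Nop ((1 / ε) • lam) w x - ((1 / s ^ 3) • g : Sm) x) := by
    simp only [Nop, map_smul, Tri_smul₁, Tri_smul₂, Tri_smul₃, Sm.sub_apply, Sm.smul_apply,
      Sm.mul_apply, hs2]
    field_simp
  rw [e, abs_mul, abs_of_pos (by positivity : 0 < s ^ 3)]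
  rwa [le_div_iff₀' (by positivity)] at h1

end Existence

/-! ### Cutoffs, mollification and periodization -/

lemma exists_cutoff {A B : Set E2} (hA : IsClosed A) (hB : IsClosed B) (h : Disjoint A B) :
    ∃ χ : Sm, (∀ x, 0 ≤ χ x) ∧ (∀ x, χ x ≤ 1) ∧ (∀ x, x ∈ A ↔ χ x = 0) ∧ ∀ x ∈ B, χ x = 1 := by
  obtain ⟨f, hf, hr, h0, h1⟩ := exists_contMDiff_zero_iff_one_iff_of_isClosed (n := (⊤ : ℕ∞))
    (modelWithCornersSelf ℝ E2) hA hB h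
  have hr' : ∀ x, f x ∈ Set.Icc 0 1 := fun x => hr ⟨x, rfl⟩
  exact ⟨⟨f, contMDiff_iff_contDiff.1 hf⟩, fun x => (hr' x).1, fun x => (hr' x).2, h0,
    fun x hx => (h1 x).1 hx⟩

/-- Smooth approximations by averages of translates. -/
lemma exists_mollification {h : E2 → ℝ} (hc : Continuous h) {R d e : ℝ} (hd : 0 < d) (he : 0 < e)
    (hR : ∀ x, R ≤ ‖x‖ → h x = 0) : ∃ w : Sm, (∀ x, R + d ≤ ‖x‖ → w x = 0) ∧
      (∀ x, |w x - h x| ≤ e) ∧ ∀ (ψ : Sm) (c : ℝ), HasCompactSupport ψ →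
        (∀ z, ‖z‖ ≤ d → |∫ x, h x * ψ (x + z)| ≤ c) → |∫ x, w x * ψ x| ≤ c := by
  have hcs : HasCompactSupport h := HasCompactSupport.intro (isCompact_closedBall (0 : E2) R)
    fun x hx => hR x (by simpa using (not_le.1 (by simpa using hx)).le)
  have huc : UniformContinuous h := hc.uniformContinuous_of_tendsto_cocompact
    (hcs.is_zero_at_infty)
  obtain ⟨s, hs0, hs⟩ := Metric.uniformContinuous_iff.1 huc e he
  obtain ⟨t, ht⟩ : ∃ t, t = min s d := ⟨_, rfl⟩
  have ht0 : 0 < t := ht ▸ lt_min hs0 hd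
  let φ : ContDiffBump (0 : E2) := ⟨t / 2, t, by linarith, by linarith⟩
  obtain ⟨ρ, hρ⟩ : ∃ ρ : E2 → ℝ, ρ = φ.normed volume := ⟨_, rfl⟩
  have ρ0 : ∀ x, 0 ≤ ρ x := fun x => hρ ▸ φ.nonneg_normed x
  have ρ1 : ∫ x, ρ x = 1 := hρ ▸ φ.integral_normed
  have ρs : ∀ x, t ≤ ‖x‖ → ρ x = 0 := fun x hx => by
    have := φ.support_normed_eq (μ := volume)
    rw [hρ]
    by_contra hne
    have h2 : x ∈ Function.support (φ.normed volume) := hne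
    rw [this] at h2
    exact absurd (mem_ball_zero_iff.1 h2) (not_lt.2 hx)
  have ρc : Continuous ρ := hρ ▸ φ.continuous_normed
  have ρcs : HasCompactSupport ρ := hρ ▸ φ.hasCompactSupport_normed
  have hw : ContDiff ℝ (⊤ : ℕ∞) (convolution ρ h (ContinuousLinearMap.lsmul ℝ ℝ) volume) := by
    refine ρcs.contDiff_convolution_left _ ?_ hc.locallyIntegrable
    exact hρ ▸ φ.contDiff_normed
  have hwv : ∀ x, convolution ρ h (ContinuousLinearMap.lsmul ℝ ℝ) volume x
      = ∫ z, ρ z * h (x - z) := fun x => rfl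
  refine ⟨⟨_, hw⟩, fun x hx => ?_, fun x => ?_, fun ψ c hψ hb => ?_⟩
  · refine (hwv x).trans ?_
    refine integral_eq_zero_of_ae (Filter.Eventually.of_forall fun z => ?_)
    by_cases hz : t ≤ ‖z‖
    · simp [ρs z hz]
    · have : R ≤ ‖x - z‖ := by
        have h1 := norm_sub_norm_le x z
        have : t ≤ d := ht ▸ min_le_right _ _
        linarith [not_le.1 hz]
      simp [hR _ this]
  · have := φ.dist_normed_convolution_le (μ := volume) (x₀ := x) (g := h) (ε := e)
      hc.aestronglyMeasurable (fun y hy => (hs ((mem_ball.1 hy).trans_le (ht.trans_le (min_le_left _ _)))).le)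
    rw [← hρ, Real.dist_eq] at this
    exact this
  · change |∫ x, convolution ρ h (ContinuousLinearMap.lsmul ℝ ℝ) volume x * ψ x| ≤ c
    simp only [hwv, ← integral_mul_const]
    have hInt : Integrable (Function.uncurry fun x z : E2 => ρ z * h (x - z) * ψ x)
        (volume.prod volume) := by
      refine Continuous.integrable_of_hasCompactSupport ?_ ?_
      · have := ψ.continuous
        unfold Function.uncurry
        fun_prop
      · refine HasCompactSupport.intro (hψ.isCompact.prod ρcs.isCompact) fun p hp => ?_
        by_cases h1 : p.1 ∈ tsupport ψ
        · have h2 : p.2 ∉ tsupport ρ := fun h2 => hp ⟨h1, h2⟩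
          simp [Function.uncurry, image_eq_zero_of_notMem_tsupport h2]
        · simp [Function.uncurry, image_eq_zero_of_notMem_tsupport h1]
    rw [integral_integral_swap hInt]
    have e1 : ∀ z, ∫ x, ρ z * h (x - z) * ψ x = ρ z * ∫ x, h x * ψ (x + z) := fun z => by
      rw [← integral_const_mul, ← integral_sub_right_eq_self (fun x => ρ z * (h x * ψ (x + z))) z]
      simp [mul_assoc]
    simp only [e1]
    have e2 : ∀ z, ‖ρ z * ∫ x, h x * ψ (x + z)‖ ≤ ρ z * c := fun z => by
      rw [norm_mul, Real.norm_of_nonneg (ρ0 z)]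
      by_cases hz : t ≤ ‖z‖
      · simp [ρs z hz]
      · exact mul_le_mul_of_nonneg_left (hb z ((not_le.1 hz).le.trans (ht ▸ min_le_right _ _))) (ρ0 z)
    have := norm_integral_le_of_norm_le (μ := (volume : Measure E2))
      ((ρc.integrable_of_hasCompactSupport ρcs).mul_const c)
      (Filter.Eventually.of_forall e2)
    rwa [integral_mul_const, ρ1, one_mul] at this

section Periodization

variable {ℓ : ℝ}

/-- Lattice vectors. -/
def lat (ℓ : ℝ) (z : ℤ × ℤ) : E2 := (z.1 * ℓ) • ev 0 + (z.2 * ℓ) • ev 1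

@[simp] lemma lat_zero (z : ℤ × ℤ) : lat ℓ z 0 = z.1 * ℓ := by simp [lat]
@[simp] lemma lat_one (z : ℤ × ℤ) : lat ℓ z 1 = z.2 * ℓ := by simp [lat]

lemma Per.add_lat {v : E2 → ℝ} (hv : Per ℓ v) (x : E2) (z : ℤ × ℤ) : v (x + lat ℓ z) = v x := by
  rw [lat, ← add_assoc, hv.zsmul, hv.zsmul]

/-- Periodization. -/
def perz (ℓ : ℝ) (h : E2 → ℝ) (x : E2) : ℝ := ∑ᶠ z : ℤ × ℤ, h (x + lat ℓ z)

lemma Per.perz (h : E2 → ℝ) : Per ℓ (perz ℓ h) := by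
  intro i x
  have key : ∀ a : ℤ × ℤ, lat ℓ a = ℓ • ev i → _root_.perz ℓ h (x + ℓ • ev i) = _root_.perz ℓ h x := by
    intro a ha
    rw [← ha]
    unfold _root_.perz
    rw [← finsum_comp_equiv (Equiv.addLeft a) (f := fun z => h (x + lat ℓ z))]
    refine finsum_congr fun z => ?_
    congr 1
    exact E2.ext (by simp; ring) (by simp; ring)
  fin_cases i
  · exact key (1, 0) (by simp [lat])
  · exact key (0, 1) (by simp [lat])

lemma abs_coord_le (x : E2) (i : Fin 2) : |x i| ≤ ‖x‖ := by
  simpa using EuclideanSpace.norm_eq x ▸ Real.abs_le_sqrt (by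
    simp only [Fin.sum_univ_two, Real.norm_eq_abs, sq_abs]
    fin_cases i <;> simp <;> positivity)

variable {h : E2 → ℝ} {R : ℝ}

lemma perz_eq_sum (hℓ : 0 < ℓ) (hR : ∀ x, R ≤ ‖x‖ → h x = 0) (x₀ : E2) : ∃ s : Finset (ℤ × ℤ),
    ∀ x ∈ ball x₀ 1, perz ℓ h x = ∑ z ∈ s, h (x + lat ℓ z) := by
  obtain ⟨N, hN⟩ := exists_nat_gt ((R + ‖x₀‖ + 1) / ℓ)
  rw [div_lt_iff₀ hℓ] at hN
  refine ⟨Finset.Icc (-(N : ℤ)) N ×ˢ Finset.Icc (-(N : ℤ)) N, fun x hx => ?_⟩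
  refine finsum_eq_sum_of_support_subset _ fun z hz => ?_
  have hz' : ‖x + lat ℓ z‖ < R := by
    by_contra hcon; exact hz (hR _ (not_lt.1 hcon))
  have hx' : ‖x‖ ≤ ‖x₀‖ + 1 := by
    have := norm_sub_norm_le x x₀
    have h2 := mem_ball.1 hx
    rw [dist_eq_norm] at h2; linarith
  have hl : ‖lat ℓ z‖ < N * ℓ := by
    have := norm_sub_norm_le (lat ℓ z) (-x)
    rw [norm_neg, sub_neg_eq_add, add_comm (lat ℓ z)] at this
    linarith
  have hk : ∀ k : ℤ, |(k : ℝ) * ℓ| ≤ ‖lat ℓ z‖ → -(N : ℤ) ≤ k ∧ k ≤ N := fun k hk => by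
    have h3 := abs_le.1 (hk.trans hl.le)
    have h4 : (k : ℝ) ≤ N := le_of_mul_le_mul_right h3.2 hℓ
    have h5 : -(N : ℝ) ≤ k := le_of_mul_le_mul_right (by linarith) hℓ
    exact ⟨by exact_mod_cast h5, by exact_mod_cast h4⟩
  have h0 := hk z.1 (by simpa using abs_coord_le (lat ℓ z) 0)
  have h1 := hk z.2 (by simpa using abs_coord_le (lat ℓ z) 1)
  exact Finset.mem_product.2 ⟨Finset.mem_Icc.2 h0, Finset.mem_Icc.2 h1⟩

lemma continuous_perz (hℓ : 0 < ℓ) (hc : Continuous h) (hR : ∀ x, R ≤ ‖x‖ → h x = 0) :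
    Continuous (perz ℓ h) := by
  refine continuous_iff_continuousAt.2 fun x₀ => ?_
  obtain ⟨s, hs⟩ := perz_eq_sum hℓ hR x₀
  refine ContinuousAt.congr (f := fun x => ∑ z ∈ s, h (x + lat ℓ z)) (by fun_prop) ?_
  filter_upwards [ball_mem_nhds x₀ one_pos] with x hx using (hs x hx).symm

lemma contDiff_perz (hℓ : 0 < ℓ) (hc : ContDiff ℝ (⊤ : ℕ∞) h) (hR : ∀ x, R ≤ ‖x‖ → h x = 0) :
    ContDiff ℝ (⊤ : ℕ∞) (perz ℓ h) := by
  refine contDiff_iff_contDiffAt.2 fun x₀ => ?_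
  obtain ⟨s, hs⟩ := perz_eq_sum hℓ hR x₀
  have : ContDiff ℝ (⊤ : ℕ∞) fun x => ∑ z ∈ s, h (x + lat ℓ z) :=
    ContDiff.sum fun z _ => hc.comp (contDiff_id.add contDiff_const)
  refine this.contDiffAt.congr_of_eventuallyEq ?_
  filter_upwards [ball_mem_nhds x₀ one_pos] with x hx using hs x hx

lemma perz_eq (hR : ∀ x, R ≤ ‖x‖ → h x = 0) (hRℓ : 2 * R ≤ ℓ) {x : E2}
    (hx : ∀ i, |x i| ≤ ℓ / 2) : perz ℓ h x = h x := by
  unfold perz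
  rw [finsum_eq_single _ (0 : ℤ × ℤ)]
  · congr 1
    exact E2.ext (by simp) (by simp)
  · intro z hz
    refine hR _ ?_
    have key : ∀ (i : Fin 2) (k : ℤ), k ≠ 0 → lat ℓ z i = k * ℓ → R ≤ ‖x + lat ℓ z‖ := by
      intro i k hk hl
      refine le_trans ?_ (abs_coord_le _ i)
      have h0 : 0 ≤ ℓ := by linarith [abs_nonneg (x i), hx i]
      rw [PiLp.add_apply, hl]
      have h1 := abs_sub_abs_le_abs_sub ((k : ℝ) * ℓ) (-x i)
      rw [abs_neg, sub_neg_eq_add, abs_mul, abs_of_nonneg h0] at h1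
      have h2 : (1 : ℝ) ≤ |(k : ℝ)| := by exact_mod_cast Int.one_le_abs hk
      have h3 := mul_le_mul_of_nonneg_right h2 h0
      rw [add_comm (x i)]
      linarith [hx i]
    by_cases h0 : z.1 = 0
    · refine key 1 z.2 (fun h1 => hz (Prod.ext h0 h1)) (by simp)
    · exact key 0 z.1 h0 (by simp)

lemma exists_centered_rep (hℓ : 0 < ℓ) (x : E2) : ∃ z, ∀ i, |(x + lat ℓ z) i| ≤ ℓ / 2 := by
  obtain ⟨y, hy, m, n, h⟩ := Per.exists_rep hℓ (x + (ℓ / 2) • ev 0 + (ℓ / 2) • ev 1)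
  refine ⟨(m, n), fun i => ?_⟩
  have h0 := hy i
  rw [h] at h0
  rw [abs_le]
  fin_cases i
  · have h1 : 0 ≤ x 0 + ℓ / 2 + m * ℓ ∧ x 0 + ℓ / 2 + m * ℓ ≤ ℓ := by simpa using h0
    constructor <;> simp <;> linarith
  · have h1 : 0 ≤ x 1 + ℓ / 2 + n * ℓ ∧ x 1 + ℓ / 2 + n * ℓ ≤ ℓ := by simpa using h0
    constructor <;> simp <;> linarith

/-- The centered closed cell. -/
def cbox (ℓ : ℝ) : Set E2 := {x | ∀ i, |x i| ≤ ℓ / 2}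

lemma isCompact_cbox : IsCompact (cbox ℓ) := by
  refine (isCompact_closedBall (0 : E2) ℓ).of_isClosed_subset ?_ fun x hx => ?_
  · have : cbox ℓ = ⋂ i, {x : E2 | |x i| ≤ ℓ / 2} := by ext x; simp [cbox]
    rw [this]
    exact isClosed_iInter fun i => isClosed_le (by fun_prop) continuous_const
  · rw [mem_closedBall_zero_iff, E2.eq_sum x]
    refine (norm_add_le _ _).trans ?_
    have h0 := hx 0
    have h1 := hx 1
    simp only [norm_smul, ev, PiLp.norm_single, norm_one, mul_one, Real.norm_eq_abs]
    linarith

/-- Periodization of a smooth function. -/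
lemma exists_perz (hℓ : 0 < ℓ) (hRℓ : 2 * R ≤ ℓ) {w : Sm} (hR : ∀ x, R ≤ ‖x‖ → w x = 0) :
    ∃ W : Sm, Per ℓ W ∧ ∀ x ∈ cbox ℓ, W x = w x :=
  ⟨⟨_, contDiff_perz hℓ w.contDiff hR⟩, Per.perz _, fun _ hx => perz_eq hR hRℓ hx⟩

lemma Per.forall_of_cbox (hℓ : 0 < ℓ) {v w : E2 → ℝ} (hv : Per ℓ v) (hw : Per ℓ w) {P : ℝ → ℝ → Prop}
    (h : ∀ x ∈ cbox ℓ, P (v x) (w x)) (x : E2) : P (v x) (w x) := by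
  obtain ⟨z, hz⟩ := exists_centered_rep hℓ x
  have := h _ hz
  rwa [hv.add_lat, hw.add_lat] at this

end Periodization

/-! ### Comparison with viscosity solutions by doubling of variables -/

section Comparison

/-- Coordinate functions. -/
def co (i : Fin 2) : Sm := ⟨fun x => x i, by
  have : ContDiff ℝ (⊤ : ℕ∞) fun x : E2 => x i := by fun_prop
  exact this⟩

@[simp] lemma co_apply (i : Fin 2) (x : E2) : co i x = x i := rfl

lemma D_co (i j : Fin 2) : D j (co i) = cst (if i = j then 1 else 0) := Sm.ext fun x => by
  have h : HasFDerivAt (co i : E2 → ℝ) (EuclideanSpace.proj i : E2 →L[ℝ] ℝ) x :=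
    (EuclideanSpace.proj i : E2 →L[ℝ] ℝ).hasFDerivAt
  rw [D_apply', h.fderiv, cst_apply]
  simp [ev]

/-- `|x - a|²`. -/
def sqDist (a : E2) : Sm := (co 0 - cst (a 0)) ^ 2 + (co 1 - cst (a 1)) ^ 2

lemma sqDist_apply (a x : E2) : sqDist a x = ‖a - x‖ ^ 2 := by
  rw [E2.norm_sq]; simp [sqDist, cst_apply]; ring

lemma D_sqDist (a : E2) (i : Fin 2) : D i (sqDist a) = (2 : ℝ) • (co i - cst (a i)) := Sm.ext fun x => by
  fin_cases i <;>
  simp [sqDist, D_sq, D_co, D_cst, cst_apply]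

lemma D_D_sqDist (a : E2) (i j : Fin 2) : D j (D i (sqDist a)) = cst (if i = j then 2 else 0) :=
  Sm.ext fun x => by
    rw [D_sqDist, map_smul, map_sub, D_co, D_cst]
    split_ifs <;> simp [cst_apply]

lemma exists_doubling {U : E2 → ℝ} (hU : Continuous U) {v : Sm} {S : Set E2} (hS : IsCompact S)
    (hS0 : S.Nonempty) (hrep : ∀ y, ∃ p, y + p ∈ S ∧ (∀ x, U (x + p) = U x) ∧ ∀ x, v (x + p) = v x)
    {B δ : ℝ} (hB : ∀ x, |U x| ≤ B) (hδ : 0 < δ) : ∃ x0 : E2, ∃ y0 ∈ S, ‖x0 - y0‖ ^ 2 ≤ 4 * δ * B ∧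
      ∀ x y, U x - v y - ‖x - y‖ ^ 2 / (2 * δ) ≤ U x0 - v y0 - ‖x0 - y0‖ ^ 2 / (2 * δ) := by
  have hB0 : 0 ≤ B := (abs_nonneg _).trans (hB 0)
  have hc : Continuous fun p : E2 × E2 => U (p.1 + p.2) - v p.1 - ‖p.2‖ ^ 2 / (2 * δ) := by
    have := v.continuous
    fun_prop
  obtain ⟨⟨y0, h0⟩, hm, hmax⟩ := (hS.prod (isCompact_closedBall (0 : E2) (Real.sqrt (4 * δ * B)))).exists_isMaxOn
    (hS0.prod ⟨0, by simp⟩) hc.continuousOn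
  have hm2 : ∀ h : E2, ‖h‖ ≤ Real.sqrt (4 * δ * B) ↔ ‖h‖ ^ 2 ≤ 4 * δ * B := fun h =>
    Real.le_sqrt (norm_nonneg h) (by positivity)
  have hmem : y0 ∈ S ∧ ‖h0‖ ^ 2 ≤ 4 * δ * B := ⟨hm.1, (hm2 h0).1 (by simpa using hm.2)⟩
  have key : ∀ y h, ‖h‖ ^ 2 ≤ 4 * δ * B → U (y + h) - v y - ‖h‖ ^ 2 / (2 * δ) ≤
      U (y0 + h0) - v y0 - ‖h0‖ ^ 2 / (2 * δ) := by
    intro y h hh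
    obtain ⟨p, hp, hUp, hvp⟩ := hrep y
    have h1 : (y + p, h) ∈ S ×ˢ closedBall (0 : E2) (Real.sqrt (4 * δ * B)) :=
      ⟨hp, by simpa using (hm2 h).2 hh⟩
    have h2 := hmax h1
    simp only [Set.mem_ofPred_eq] at h2
    rwa [hvp, add_right_comm, hUp] at h2
  refine ⟨y0 + h0, y0, hmem.1, by simpa using hmem.2, fun x y => ?_⟩
  rw [add_sub_cancel_left]
  by_cases hh : ‖x - y‖ ^ 2 ≤ 4 * δ * B
  · simpa using key y (x - y) hh
  · have h1 := key y 0 (by simp; positivity)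
    have h2 : 2 * B ≤ ‖x - y‖ ^ 2 / (2 * δ) := by
      rw [le_div_iff₀ (by positivity)]; linarith
    have h3 := (abs_le.1 (hB x)).2
    have h4 := (abs_le.1 (hB y)).1
    simp at h1
    linarith

/-- One-sided comparison of a viscosity subsolution and an almost solution. -/
lemma sub_le_of_subsolution {U : E2 → ℝ} (hU : Continuous U) {v W F lam : Sm} {S : Set E2}
    (hS : IsCompact S) (hS0 : S.Nonempty)
    (hrep : ∀ y, ∃ p, y + p ∈ S ∧ (∀ x, U (x + p) = U x) ∧ ∀ x, v (x + p) = v x)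
    {B δ ρ ε r e η μ Λ B' : ℝ} (hB : ∀ x, |U x| ≤ B) (hδ : 0 < δ) (hρ0 : 0 ≤ ρ) (hρ : 4 * δ * B ≤ ρ ^ 2)
    (hε : 0 ≤ ε) (he : 0 ≤ e)
    (heq : ∀ y, |lam y * (v y - W y) - ε * Lap v y - Tri v v v y - F y| ≤ r)
    (hUW : ∀ x, |U x - W x| ≤ e) (hW : ∀ x y, ‖x - y‖ ≤ ρ → |W x - W y| ≤ e)
    (hμ : 0 < μ) (hlam : ∀ y, μ ≤ lam y) (hF : ∀ y, |F y| ≤ B')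
    (hin : ∀ y ∈ S, Λ ≤ lam y ∨ ∀ (x : E2) (φ : E2 → ℝ), ‖x - y‖ ≤ ρ → ContDiff ℝ 2 φ →
      IsLocalMax (fun z => U z - φ z) x → -infLap φ x ≤ F y + η)
    (h1 : 2 * ε / δ + r + η ≤ μ * e) (h2 : B' + r + 2 * ε / δ + ρ ^ 2 / δ ^ 3 ≤ Λ * e) (x : E2) :
    U x - v x ≤ 3 * e := by
  obtain ⟨x0, y0, hy0, hd, hmax⟩ := exists_doubling hU hS hS0 hrep hB hδ
  have hd' : ‖x0 - y0‖ ≤ ρ := abs_le_of_sq_le_sq' (hd.trans hρ) hρ0 |>.2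
  have hw : ∀ y, (-v - (1 / (2 * δ)) • sqDist x0 : Sm) y ≤ (-v - (1 / (2 * δ)) • sqDist x0 : Sm) y0 := by
    intro y
    have := hmax x0 y
    simp only [Sm.sub_apply, Sm.neg_apply, Sm.smul_apply, sqDist_apply]
    rw [one_div_mul_eq_div, one_div_mul_eq_div]
    linarith
  have hDv : ∀ i, D i v y0 = (x0 i - y0 i) / δ := fun i => by
    have h := Sm.D_eq_zero hw i
    rw [map_sub, map_neg, map_smul, D_sqDist] at h
    simp only [Sm.sub_apply, Sm.neg_apply, Sm.smul_apply, co_apply, cst_apply] at h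
    field_simp at h ⊢
    linarith
  have hL := Sm.Lap_nonpos hw
  have hT := Sm.Tri_nonpos hw v
  have hLs : Lap (sqDist x0) y0 = 4 := by
    simp only [Lap_def, Sm.add_apply, D_D_sqDist, cst_apply]; norm_num
  have hTs : Tri v v (sqDist x0) y0 = 2 * (‖x0 - y0‖ ^ 2 / δ ^ 2) := by
    simp only [Tri, Sm.add_apply, Sm.mul_apply, D_D_sqDist, cst_apply, hDv, E2.norm_sq]
    simp; ring
  have hL' : -(2 * ε / δ) ≤ ε * Lap v y0 := by
    rw [map_sub, map_neg, map_smul] at hL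
    simp only [Sm.sub_apply, Sm.neg_apply, Sm.smul_apply, hLs] at hL
    have : -(2 / δ) ≤ Lap v y0 := by
      have e1 : 1 / (2 * δ) * 4 = 2 / δ := by field_simp; norm_num
      rw [e1] at hL; linarith
    have := mul_le_mul_of_nonneg_left this hε
    have e2 : ε * -(2 / δ) = -(2 * ε / δ) := by ring
    linarith
  have hT' : -(ρ ^ 2 / δ ^ 3) ≤ Tri v v v y0 := by
    have e0 : Tri v v (-v - (1 / (2 * δ)) • sqDist x0) y0
        = -Tri v v v y0 - 1 / (2 * δ) * Tri v v (sqDist x0) y0 := by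
      simp [Tri]; ring
    rw [e0, hTs] at hT
    have e1 : 1 / (2 * δ) * (2 * (‖x0 - y0‖ ^ 2 / δ ^ 2)) = ‖x0 - y0‖ ^ 2 / δ ^ 3 := by
      field_simp
    rw [e1] at hT
    have : ‖x0 - y0‖ ^ 2 / δ ^ 3 ≤ ρ ^ 2 / δ ^ 3 := by gcongr
    linarith
  have hq := (abs_le.1 (heq y0)).1
  have hvW : -e ≤ v y0 - W y0 := by
    by_contra hcon
    push Not at hcon
    rcases hin y0 hy0 with hΛ | hsub
    · have hΛ0 : lam y0 * (v y0 - W y0) ≤ lam y0 * -e :=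
        mul_le_mul_of_nonneg_left hcon.le (hμ.le.trans (hlam y0))
      have hΛ1 : lam y0 * (v y0 - W y0) < lam y0 * -e :=
        mul_lt_mul_of_pos_left hcon (hμ.trans_le (hlam y0))
      have := mul_le_mul_of_nonneg_right hΛ he
      have := (abs_le.1 (hF y0)).1
      linarith
    · have hs := hsub x0 (tr (y0 - x0) v) hd' ((tr (y0 - x0) v).contDiff.of_le (by
        exact WithTop.coe_le_coe.2 le_top)) (Filter.Eventually.of_forall fun z => by
          have := hmax z (z + (y0 - x0))
          simp only [tr_apply]
          rw [show z - (z + (y0 - x0)) = x0 - y0 by abel] at this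
          rw [show x0 + (y0 - x0) = y0 by abel]
          linarith)
      rw [infLap_eq, Tri_tr, tr_apply, show x0 + (y0 - x0) = y0 by abel] at hs
      have hΛ1 : lam y0 * (v y0 - W y0) < lam y0 * -e :=
        mul_lt_mul_of_pos_left hcon (hμ.trans_le (hlam y0))
      have := mul_le_mul_of_nonneg_right (hlam y0) he
      linarith
  have hx := hmax x x
  have hz : 0 ≤ ‖x0 - y0‖ ^ 2 / (2 * δ) := by positivity
  simp only [sub_self, norm_zero] at hx
  have a1 := (abs_le.1 (hUW x0)).2
  have a2 := (abs_le.1 (hW x0 y0 hd')).2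
  norm_num at hx
  linarith

end Comparison

/-! ### Smooth approximation of viscosity solutions -/

section Approximation

variable {ℓ : ℝ}

lemma Per.exists_abs_le (hℓ : 0 < ℓ) {v : E2 → ℝ} (hv : Per ℓ v) (hc : Continuous v) :
    ∃ B, 0 ≤ B ∧ ∀ x, |v x| ≤ B := by
  obtain ⟨B, hB⟩ := isCompact_cbox (ℓ := ℓ).exists_bound_of_continuousOn hc.continuousOn
  refine ⟨|B|, abs_nonneg B, fun x => ?_⟩
  obtain ⟨z, hz⟩ := exists_centered_rep hℓ x
  have := hB _ hz
  rw [hv.add_lat] at this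
  exact this.trans (le_abs_self B)

lemma Sm.abs_sub_le {v : Sm} {L : ℝ} (hL : 0 ≤ L) (h : ∀ x, dd 1 v x ≤ L ^ 2) (x y : E2) :
    |v x - v y| ≤ L * ‖x - y‖ := by
  have h1 : ∀ z ∈ (Set.univ : Set E2), ‖fderiv ℝ v z‖ ≤ L := fun z _ =>
    (abs_le_of_sq_le_sq' ((norm_fderiv_sq_le v z).trans (h z)) hL).2
  simpa using convex_univ.norm_image_sub_le_of_norm_fderiv_le
    (fun z _ => v.differentiable.differentiableAt) h1 (Set.mem_univ y) (Set.mem_univ x)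

lemma infLap_neg (φ : E2 → ℝ) (x : E2) : infLap (fun z => -φ z) x = -infLap φ x := by
  have h : ∀ i (ψ : E2 → ℝ), pd i (fun z => -ψ z) = fun z => -pd i ψ z := fun i ψ => by
    funext z; simp [pd, fderiv_fun_neg]
  simp only [infLap, pd2, h, Fin.sum_univ_two]
  ring

lemma exists_approx_torus (hℓ : 0 < ℓ) {U : E2 → ℝ} (hU : Continuous U) (hUp : Per ℓ U) {W F χ : Sm}
    (hWp : Per ℓ W) (hFp : Per ℓ F) (hχp : Per ℓ χ) (hχ1 : ∀ x, χ x ≤ 1)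
    {ρ η μ e ε₀ : ℝ} (hρ : 0 < ρ) (he : 0 < e) (hUW : ∀ x, |U x - W x| ≤ e)
    (hW : ∀ x y, ‖x - y‖ ≤ ρ → |W x - W y| ≤ e) (hμ : 0 < μ) (hη : η ≤ μ * e / 2)
    (hin : ∀ y ∈ cbox ℓ, χ y ≠ 0 → ∀ (x : E2) (φ : E2 → ℝ), ‖x - y‖ ≤ ρ → ContDiff ℝ 2 φ →
      (IsLocalMax (fun z => U z - φ z) x → -infLap φ x ≤ F y + η) ∧
      (IsLocalMin (fun z => U z - φ z) x → F y - η ≤ -infLap φ x)) (hε₀ : 0 < ε₀) :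
    ∃ ε, 0 < ε ∧ ε ≤ ε₀ ∧ ∃ v : Sm, (∀ x, |v x - U x| ≤ 3 * e) ∧
      ∀ x, χ x = 1 → |Tri v v v x + ε * Lap v x + (F x - μ * (v x - W x))| ≤ ε := by
  obtain ⟨B, hB0, hB⟩ := hUp.exists_abs_le hℓ hU
  obtain ⟨B', hB'0, hB'⟩ := hFp.exists_abs_le hℓ F.continuous
  obtain ⟨δ, hδ⟩ : ∃ δ, δ = ρ ^ 2 / (4 * (B + 1)) := ⟨_, rfl⟩
  have hδ0 : 0 < δ := by rw [hδ]; positivity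
  have hδB : 4 * δ * B ≤ ρ ^ 2 := by
    rw [hδ, show 4 * (ρ ^ 2 / (4 * (B + 1))) * B = ρ ^ 2 * (B / (B + 1)) by field_simp]
    exact mul_le_of_le_one_right (by positivity) ((div_le_one (by positivity)).2 (by linarith))
  obtain ⟨ε, hε⟩ : ∃ ε, ε = min ε₀ (min (μ * e * δ / 8) (μ * e / 4)) := ⟨_, rfl⟩
  have hε0 : 0 < ε := by rw [hε]; positivity
  have hε1 : ε ≤ ε₀ := hε ▸ min_le_left _ _
  have hε2 : 2 * ε / δ ≤ μ * e / 4 := by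
    have : ε ≤ μ * e * δ / 8 := hε ▸ (min_le_right _ _).trans (min_le_left _ _)
    rw [div_le_iff₀ hδ0]; linarith
  have hε3 : ε ≤ μ * e / 4 := hε ▸ (min_le_right _ _).trans (min_le_right _ _)
  obtain ⟨Λ, hΛ⟩ : ∃ Λ, Λ = (B' + ε + 2 * ε / δ + ρ ^ 2 / δ ^ 3) / e := ⟨_, rfl⟩
  have hΛ0 : 0 ≤ Λ := by rw [hΛ]; positivity
  have hΛe : B' + ε + 2 * ε / δ + ρ ^ 2 / δ ^ 3 ≤ Λ * e := by
    rw [hΛ, div_mul_cancel₀ _ he.ne']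
  obtain ⟨lam, hlam⟩ : ∃ lam : Sm, lam = cst μ + Λ • (1 - χ) := ⟨_, rfl⟩
  have hlx : ∀ x, lam x = μ + Λ * (1 - χ x) := fun x => by
    simp [hlam, cst_apply]
  have hlam0 : ∀ x, μ ≤ lam x := fun x => by
    rw [hlx]; have := mul_nonneg hΛ0 (sub_nonneg.2 (hχ1 x)); linarith
  have hlp : Per ℓ lam := fun i x => by rw [hlx, hlx, hχp]
  have hgp : Per ℓ (lam * W + F : Sm) := (hlp.mul hWp).add hFp
  obtain ⟨v, hvp, hv⟩ := exists_almost_solution hℓ hμ hlp hlam0 hgp hε0 hε0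
  have heq : ∀ y, |lam y * (v y - W y) - ε * Lap v y - Tri v v v y - F y| ≤ ε := fun y => by
    have := hv y
    rw [Sm.add_apply, Sm.mul_apply] at this
    rwa [show lam y * (v y - W y) - ε * Lap v y - Tri v v v y - F y = lam y * v y - ε * Lap v y -
      Tri v v v y - (lam y * W y + F y) by ring]
  have hne : (cbox ℓ).Nonempty := ⟨0, fun i => by simp; positivity⟩
  have hc1 : 2 * ε / δ + ε + η ≤ μ * e := by linarith
  refine ⟨ε, hε0, hε1, v, fun x => abs_le.2 ⟨?_, ?_⟩, fun x hx => ?_⟩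
  · have := sub_le_of_subsolution hU isCompact_cbox hne (fun y => ?_) hB hδ0 hρ.le hδB hε0.le he.le
      heq hUW hW hμ hlam0 hB' (Λ := Λ) (η := η) (fun y hy => ?_) hc1 hΛe x
    · linarith
    · obtain ⟨z, hz⟩ := exists_centered_rep hℓ y
      exact ⟨lat ℓ z, hz, fun x => hUp.add_lat x z, fun x => hvp.add_lat x z⟩
    · by_cases h : χ y = 0
      · left; rw [hlx, h]; linarith
      · exact .inr fun x φ hx hφ hm => (hin y hy h x φ hx hφ).1 hm
  · have := sub_le_of_subsolution (U := fun x => -U x) (v := -v) (W := -W) (F := -F) (lam := lam) hU.neg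
      isCompact_cbox hne (fun y => ?_) (fun x => by simpa using hB x) hδ0 hρ.le hδB hε0.le he.le
      (fun y => ?_) (fun x => ?_) (fun x y h => ?_) hμ hlam0 (fun x => by simpa using hB' x)
      (Λ := Λ) (η := η) (fun y hy => ?_) hc1 hΛe x
    · simp only [Sm.neg_apply] at this; linarith
    · obtain ⟨z, hz⟩ := exists_centered_rep hℓ y
      exact ⟨lat ℓ z, hz, fun x => congrArg Neg.neg (hUp.add_lat x z),
        fun x => congrArg Neg.neg (hvp.add_lat x z)⟩
    · have := heq y
      rw [← abs_neg] at this
      refine (le_of_eq ?_).trans this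
      congr 1
      simp [Tri]; ring
    · rw [← abs_neg]; refine (le_of_eq ?_).trans (hUW x); congr 1; simp; ring
    · rw [← abs_neg]; refine (le_of_eq ?_).trans (hW x y h); congr 1; simp; ring
    · by_cases h : χ y = 0
      · left; rw [hlx, h]; linarith
      · refine .inr fun x φ hx hφ hm => ?_
        have := (hin y hy h x (fun z => -φ z) hx hφ.neg).2 (by
          rw [show (fun z => U z - -φ z) = fun z => -(-U z - φ z) by funext z; ring]
          exact hm.neg)
        rw [infLap_neg] at this
        simp only [Sm.neg_apply]
        linarith
  · have := heq x
    rw [hlx, hx, sub_self, mul_zero, add_zero, ← abs_neg] at this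
    refine (le_of_eq ?_).trans this
    congr 1; ring

end Approximation

section LocalApproximation

lemma continuous_cutoff_mul {Ω C : Set E2} (hΩ : IsOpen Ω) (hC : IsClosed C) (hCΩ : C ⊆ Ω) {χ : Sm}
    (hχ : ∀ x ∉ C, χ x = 0) {u : E2 → ℝ} (hu : ContinuousOn u Ω) : Continuous fun x => χ x * u x := by
  refine continuous_iff_continuousAt.2 fun x => ?_
  by_cases hx : x ∈ Ω
  · exact χ.continuous.continuousAt.mul (hu.continuousAt (hΩ.mem_nhds hx))
  · have h0 : (fun _ => (0 : ℝ)) =ᶠ[nhds x] fun x => χ x * u x := by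
      filter_upwards [hC.isOpen_compl.mem_nhds fun h => hx (hCΩ h)] with y hy
      rw [hχ y hy, zero_mul]
    exact continuousAt_const.congr h0

lemma BVloc.exists_pairing_le {f : E2 → ℝ} {Ω K : Set E2} (hf : BVloc f Ω) (hΩ : IsOpen Ω)
    (hK : IsCompact K) (hKΩ : K ⊆ Ω) : ∃ C, 0 ≤ C ∧ ∀ (X Y : Sm) (b : ℝ), 0 < b →
      (∀ x ∉ K, X x = 0) → (∀ x ∉ K, Y x = 0) → (∀ x, X x ^ 2 + Y x ^ 2 ≤ b ^ 2) →
      |∫ x, f x * (D 0 X + D 1 Y : Sm) x| ≤ C * b := by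
  obtain ⟨U, hU, hKU, hUΩ, hUc⟩ := exists_open_between_and_isCompact_closure hK hΩ hKΩ
  obtain ⟨C, hC⟩ := hf U hU hUc hUΩ
  have key : ∀ (X Y : Sm) (b : ℝ), 0 < b →
      (∀ x ∉ K, X x = 0) → (∀ x ∉ K, Y x = 0) → (∀ x, X x ^ 2 + Y x ^ 2 ≤ b ^ 2) →
      ∫ x, f x * (D 0 X + D 1 Y : Sm) x ≤ C * b := by
    intro X Y b hb hX hY hXY
    obtain ⟨Φ, hΦ⟩ : ∃ Φ : E2 → E2, Φ = fun x => pt (b⁻¹ * X x) (b⁻¹ * Y x) := ⟨_, rfl⟩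
    have hsub : tsupport Φ ⊆ K := closure_minimal (fun x hx => by
      by_contra h
      exact hx (by rw [hΦ]; ext i; fin_cases i <;> simp [hX x h, hY x h])) hK.isClosed
    have hdiv : ∀ x, divg Φ x = b⁻¹ * (D 0 X + D 1 Y : Sm) x := fun x => by
      have e0 : (fun y => Φ y 0) = (b⁻¹ • X : Sm) := by
        funext y; simp [hΦ]
      have e1 : (fun y => Φ y 1) = (b⁻¹ • Y : Sm) := by
        funext y; simp [hΦ]
      rw [divg, Fin.sum_univ_two, e0, e1, ← D_apply, ← D_apply, map_smul, map_smul]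
      simp [mul_add]
    have hmem : ∫ x in U, f x * divg Φ x ∈ bvPairings f U := by
      refine ⟨Φ, ?_, hK.of_isClosed_subset (isClosed_tsupport Φ) hsub, hsub.trans hKU, fun x => ?_, rfl⟩
      · rw [contDiff_euclidean]
        intro i
        have hle : ((1 : ℕ∞) : WithTop ℕ∞) ≤ ((⊤ : ℕ∞) : WithTop ℕ∞) := WithTop.coe_le_coe.2 le_top
        fin_cases i
        · rw [hΦ]; exact (b⁻¹ • X : Sm).contDiff.of_le hle
        · rw [hΦ]; exact (b⁻¹ • Y : Sm).contDiff.of_le hle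
      · refine (abs_le_of_sq_le_sq' (?_ : ‖Φ x‖ ^ 2 ≤ 1 ^ 2) zero_le_one).2
        rw [E2.norm_sq, hΦ]
        simp only [pt_zero, pt_one]
        rw [mul_pow, mul_pow, ← mul_add, inv_pow, one_pow]
        exact (inv_mul_le_one₀ (by positivity)).2 (hXY x)
    have h1 := hC hmem
    have h2 : ∫ x in U, f x * divg Φ x = b⁻¹ * ∫ x, f x * (D 0 X + D 1 Y : Sm) x := by
      rw [← integral_const_mul, setIntegral_eq_integral_of_forall_compl_eq_zero]
      · exact integral_congr_ae (.of_forall fun x => by simp only [hdiv]; ring)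
      · intro x hx
        have hxK : x ∉ (⟨K, hK⟩ : TopologicalSpace.Compacts E2) := fun h => hx (hKU h)
        have d0 := D_eq_zero_of_notMem (K := ⟨K, hK⟩) hX 0 x hxK
        have d1 := D_eq_zero_of_notMem (K := ⟨K, hK⟩) hY 1 x hxK
        rw [hdiv, Sm.add_apply, d0, d1]; ring
    rw [h2, inv_mul_le_iff₀ hb] at h1
    linarith
  refine ⟨|C|, abs_nonneg C, fun X Y b hb hX hY hXY => abs_le'.2 ⟨?_, ?_⟩⟩
  · exact (key X Y b hb hX hY hXY).trans (mul_le_mul_of_nonneg_right (le_abs_self C) hb.le)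
  · have := key (-X) (-Y) b hb (fun x hx => by simp [hX x hx]) (fun x hx => by simp [hY x hx])
      (fun x => by simpa using hXY x)
    refine le_trans (le_of_eq ?_) (this.trans (mul_le_mul_of_nonneg_right (le_abs_self C) hb.le))
    rw [← integral_neg]
    exact integral_congr_ae (.of_forall fun x => by simp; ring)

lemma abs_mul_add_mul_le {p q X Y A b : ℝ} (hb : 0 < b) (h1 : p ^ 2 + q ^ 2 ≤ A) (h2 : X ^ 2 + Y ^ 2 ≤ b ^ 2) :
    |p * X + q * Y| ≤ (A + 1) * b := by
  have hA : 0 ≤ A := (by positivity : 0 ≤ p ^ 2 + q ^ 2).trans h1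
  refine (abs_le_of_sq_le_sq' ?_ (by positivity)).2
  rw [sq_abs]
  calc (p * X + q * Y) ^ 2 ≤ (p ^ 2 + q ^ 2) * (X ^ 2 + Y ^ 2) := by nlinarith [sq_nonneg (p * Y - q * X)]
    _ ≤ A * b ^ 2 := mul_le_mul h1 h2 (by positivity) hA
    _ ≤ ((A + 1) * b) ^ 2 := by
        rw [mul_pow]; exact mul_le_mul_of_nonneg_right (by nlinarith) (by positivity)

/-- Smooth local approximation of a viscosity solution, with uniform Lipschitz and `BV` bounds. -/
lemma exists_local_approx {Ω K : Set E2} {f u : E2 → ℝ} (hΩ : IsOpen Ω) (hK : IsCompact K) (hKΩ : K ⊆ Ω)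
    (hf : BVloc f Ω) (hfc : ContinuousOn f Ω) (huc : ContinuousOn u Ω) (hu : IsViscositySol Ω f u) :
    ∃ M C₀, 0 < M ∧ 0 ≤ C₀ ∧ ∀ e, 0 < e → e ≤ 1 → ∃ ε, 0 < ε ∧ ε ≤ e ∧ ∃ v g : Sm,
      (∀ x ∈ K, |v x - u x| ≤ e) ∧ (∀ x ∈ K, |g x - f x| ≤ e) ∧
      (∀ x ∈ K, |Tri v v v x + ε * Lap v x + g x| ≤ ε) ∧ (∀ x ∈ K, dd 1 v x ≤ M ^ 2) ∧
      ∀ (X Y : Sm) (b : ℝ), 0 < b → (∀ x ∉ K, X x = 0) → (∀ x ∉ K, Y x = 0) →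
        (∀ x, X x ^ 2 + Y x ^ 2 ≤ b ^ 2) → |JS ⟨K, hK⟩ (g * (D 0 X + D 1 Y))| ≤ C₀ * b := by
  obtain ⟨d, hd, hd4⟩ : ∃ d, 0 < d ∧ cthickening (4 * d) K ⊆ Ω := by
    obtain ⟨t, ht, h⟩ := hK.exists_cthickening_subset_open hΩ hKΩ
    exact ⟨t / 4, by positivity, by rwa [mul_div_cancel₀ _ (by norm_num : (4 : ℝ) ≠ 0)]⟩
  have hcomp : ∀ t, IsCompact (cthickening t K) := fun t => hK.cthickening
  -- cutoff functions
  have hdisj : ∀ s t : ℝ, s < t → 0 < t → Disjoint (thickening t K)ᶜ (cthickening s K) := fun s t hst ht =>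
    Set.disjoint_left.2 fun x hx hx' => hx (cthickening_subset_thickening' ht hst K hx')
  obtain ⟨χ, hχ0, hχ1, hχA, hχB⟩ := exists_cutoff (A := (thickening (4 * d) K)ᶜ) (B := cthickening (3 * d) K)
    isOpen_thickening.isClosed_compl isClosed_cthickening (hdisj _ _ (by linarith) (by linarith))
  obtain ⟨ξ, hξ0, hξ1, hξA, hξB⟩ := exists_cutoff (A := (thickening (2 * d) K)ᶜ) (B := cthickening d K)
    isOpen_thickening.isClosed_compl isClosed_cthickening (hdisj _ _ (by linarith) (by linarith))
  have hχ4 : ∀ x ∉ cthickening (4 * d) K, χ x = 0 := fun x hx =>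
    (hχA x).1 fun h => hx (thickening_subset_cthickening _ _ h)
  obtain ⟨R, hR0, hR⟩ : ∃ R, 0 < R ∧ cthickening (4 * d) K ⊆ ball 0 R :=
    (hcomp (4 * d)).isBounded.subset_ball_lt 0 0
  have hχR : ∀ x : E2, R ≤ ‖x‖ → χ x = 0 := fun x hx => hχ4 x fun h => by
    have := hR h; rw [mem_ball_zero_iff] at this; linarith
  have hξR : ∀ x : E2, R ≤ ‖x‖ → ξ x = 0 := fun x hx => (hξA x).1 fun h => by
    have := hR (cthickening_mono (by linarith : 2 * d ≤ 4 * d) K (thickening_subset_cthickening _ _ h))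
    rw [mem_ball_zero_iff] at this; linarith
  obtain ⟨uχ, huχ⟩ : ∃ uχ : E2 → ℝ, uχ = fun x => χ x * u x := ⟨_, rfl⟩
  obtain ⟨fh, hfh⟩ : ∃ fh : E2 → ℝ, fh = fun x => χ x * f x := ⟨_, rfl⟩
  have huχc : Continuous uχ := huχ ▸ continuous_cutoff_mul hΩ isClosed_cthickening hd4 hχ4 huc
  have hfhc : Continuous fh := hfh ▸ continuous_cutoff_mul hΩ isClosed_cthickening hd4 hχ4 hfc
  have huχR : ∀ x : E2, R ≤ ‖x‖ → uχ x = 0 := fun x hx => by rw [huχ]; simp [hχR x hx]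
  have hfhR : ∀ x : E2, R ≤ ‖x‖ → fh x = 0 := fun x hx => by rw [hfh]; simp [hχR x hx]
  have huχ3 : ∀ x ∈ cthickening (3 * d) K, uχ x = u x := fun x hx => by rw [huχ]; simp [hχB x hx]
  have hfh3 : ∀ x ∈ cthickening (3 * d) K, fh x = f x := fun x hx => by rw [hfh]; simp [hχB x hx]
  have hcs : ∀ h : E2 → ℝ, (∀ x : E2, R ≤ ‖x‖ → h x = 0) → HasCompactSupport h := fun h hh =>
    hasCompactSupport_of_notMem (K := cball 0 R) fun x hx => hh x (by
      rw [mem_cball, dist_zero_right] at hx; exact (not_le.1 hx).le)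
  obtain ⟨ℓ, hℓR⟩ : ∃ ℓ, ℓ = 2 * (R + d) := ⟨_, rfl⟩
  have hℓ : 0 < ℓ := by rw [hℓR]; positivity
  have hbox : ∀ x ∈ cthickening (4 * d) K, x ∈ cbox ℓ := fun x hx i => by
    have := hR hx; rw [mem_ball_zero_iff] at this
    rw [hℓR]; linarith [abs_coord_le x i]
  have hmono : ∀ {s t : ℝ}, s ≤ t → cthickening s K ⊆ cthickening t K := fun h => cthickening_mono h K
  have hKsub : ∀ t, K ⊆ cthickening t K := fun t => self_subset_cthickening K
  obtain ⟨U, hU⟩ : ∃ U, U = perz ℓ uχ := ⟨_, rfl⟩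
  have hUp : Per ℓ U := hU ▸ Per.perz uχ
  have hUc : Continuous U := hU ▸ continuous_perz hℓ huχc huχR
  have hUeq : ∀ x ∈ cbox ℓ, U x = uχ x := fun x hx => hU ▸ perz_eq huχR (by rw [hℓR]; linarith) hx
  have hU3 : ∀ x ∈ cthickening (3 * d) K, U x = u x := fun x hx =>
    (hUeq x (hbox x (hmono (by linarith) hx))).trans (huχ3 x hx)
  obtain ⟨χ', hχ'p, hχ'⟩ := exists_perz hℓ (by rw [hℓR]; linarith) hξR
  have hχ'1 : ∀ x, χ' x ≤ 1 := fun x =>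
    Per.forall_of_cbox hℓ hχ'p hχ'p (P := fun a _ => a ≤ 1) (fun x hx => by rw [hχ' x hx]; exact hξ1 x) x
  obtain ⟨B, hB0, hB⟩ := hUp.exists_abs_le hℓ hUc
  obtain ⟨Bf, hBf⟩ := (hcs fh hfhR).exists_bound_of_continuous hfhc
  have hBf0 : 0 ≤ Bf := (norm_nonneg _).trans (hBf 0)
  obtain ⟨M, hM0, hM⟩ := lipschitz_bound (V := B + 1) (F := Bf + 3) (R := d / 2) (by positivity)
    (by positivity) (by positivity)
  obtain ⟨C, hC0, hC⟩ := hf.exists_pairing_le hΩ (hcomp d) ((hmono (by linarith)).trans hd4)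
  refine ⟨M, C + (2 * M ^ 2 + 3) * volume.real K, hM0, by positivity, fun e he he1 => ?_⟩
  obtain ⟨t, ht⟩ : ∃ t, t = e / 8 := ⟨_, rfl⟩
  have ht0 : 0 < t := by rw [ht]; positivity
  obtain ⟨W₀, hW₀R, hW₀, -⟩ := exists_mollification huχc hd ht0 huχR
  obtain ⟨W, hWp, hW⟩ := exists_perz hℓ hℓR.ge hW₀R
  have hUW : ∀ x, |U x - W x| ≤ t := fun x =>
    Per.forall_of_cbox hℓ hUp hWp (P := fun a b => |a - b| ≤ t) (fun x hx => by
      rw [hUeq x hx, hW x hx, abs_sub_comm]; exact hW₀ x) x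
  obtain ⟨L, hL0, hL⟩ := Per.exists_bound hℓ hWp 1
  obtain ⟨μ, hμ⟩ : ∃ μ, μ = 1 / (L + 1) := ⟨_, rfl⟩
  have hμ0 : 0 < μ := by rw [hμ]; positivity
  have hμ1 : μ ≤ 1 := by rw [hμ, div_le_one (by positivity)]; linarith
  have hμL : μ ^ 2 * L ^ 2 ≤ 1 := by
    rw [hμ, one_div, ← mul_pow, inv_mul_eq_div]
    exact pow_le_one₀ (by positivity) ((div_le_one (by positivity)).2 (by linarith))
  obtain ⟨η, hη⟩ : ∃ η, η = μ * t / 2 := ⟨_, rfl⟩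
  have hη0 : 0 < η := by rw [hη]; positivity
  have hηt : η ≤ t := by
    rw [hη]; have := mul_le_mul_of_nonneg_right hμ1 ht0.le; linarith
  obtain ⟨F₀, hF₀R, hF₀, hF₀C⟩ := exists_mollification hfhc hd (half_pos hη0) hfhR
  obtain ⟨F, hFp, hF⟩ := exists_perz hℓ hℓR.ge hF₀R
  obtain ⟨ρ₁, hρ₁, hρf⟩ := Metric.uniformContinuous_iff.1
    ((hcs fh hfhR).uniformContinuous_of_continuous hfhc) (η / 2) (half_pos hη0)
  obtain ⟨ρ, hρ⟩ : ∃ ρ, ρ = min (ρ₁ / 2) (min d (t / (L + 1))) := ⟨_, rfl⟩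
  have hρ0 : 0 < ρ := by rw [hρ]; positivity
  have hρρ : ρ ≤ ρ₁ / 2 := hρ ▸ min_le_left _ _
  have hρd : ρ ≤ d := hρ ▸ (min_le_right _ _).trans (min_le_left _ _)
  have hρt : L * ρ ≤ t := by
    have : ρ ≤ t / (L + 1) := hρ ▸ (min_le_right _ _).trans (min_le_right _ _)
    rw [le_div_iff₀ (by positivity)] at this; linarith
  have hFf : ∀ x ∈ cthickening (4 * d) K, |F x - fh x| ≤ η / 2 := fun x hx => by
    rw [hF x (hbox x hx)]; exact hF₀ x
  have hin : ∀ y ∈ cbox ℓ, χ' y ≠ 0 → ∀ (x : E2) (φ : E2 → ℝ), ‖x - y‖ ≤ ρ → ContDiff ℝ 2 φ →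
      (IsLocalMax (fun z => U z - φ z) x → -infLap φ x ≤ F y + η) ∧
      (IsLocalMin (fun z => U z - φ z) x → F y - η ≤ -infLap φ x) := by
    intro y hy hy0 x φ hxy hφ
    have hyK : y ∈ thickening (2 * d) K := by
      by_contra h; exact hy0 (by rw [hχ' y hy]; exact (hξA y).1 h)
    have hxK : x ∈ thickening (3 * d) K := by
      rw [mem_thickening_iff] at hyK ⊢
      obtain ⟨z, hz, hyz⟩ := hyK
      refine ⟨z, hz, ?_⟩
      have := dist_triangle x y z
      rw [dist_eq_norm x y] at this
      linarith
    have hxc := thickening_subset_cthickening _ _ hxK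
    have hxΩ : x ∈ Ω := hd4 (hmono (by linarith) hxc)
    have hev : (fun z => U z - φ z) =ᶠ[nhds x] fun z => u z - φ z := by
      filter_upwards [isOpen_thickening.mem_nhds hxK] with z hz
      rw [hU3 z (thickening_subset_cthickening _ _ hz)]
    have h1 := hFf y (hmono (by linarith) (thickening_subset_cthickening _ _ hyK))
    have h2 : |fh x - fh y| < η / 2 := by
      have := @hρf x y (by rw [dist_eq_norm]; linarith)
      rwa [Real.dist_eq] at this
    rw [hfh3 x hxc] at h2
    rw [abs_le] at h1; rw [abs_lt] at h2
    refine ⟨fun hm => ?_, fun hm => ?_⟩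
    · have := (hu φ hφ).1 x hxΩ ((Filter.EventuallyEq.isLocalMax_iff hev).1 hm |>.on Ω)
      linarith
    · have := (hu φ hφ).2 x hxΩ ((Filter.EventuallyEq.isLocalMin_iff hev).1 hm |>.on Ω)
      linarith
  obtain ⟨ε, hε0, hεe, v, hvU, hv⟩ := exists_approx_torus hℓ hUc hUp hWp hFp hχ'p hχ'1 hρ0 ht0 hUW
    (fun x y hxy => (Sm.abs_sub_le hL0 (hL 1 le_rfl) x y).trans
      ((mul_le_mul_of_nonneg_left hxy hL0).trans hρt)) hμ0 hη.le hin he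
  have hvW : ∀ x, |μ * (v x - W x)| ≤ 4 * t := fun x => by
    rw [abs_mul, abs_of_pos hμ0]
    have h1 := hvU x
    have h2 := hUW x
    have h3 : |v x - W x| ≤ 4 * t := by rw [abs_le] at *; constructor <;> linarith
    exact (mul_le_of_le_one_left (abs_nonneg _) hμ1).trans h3
  have hvK : ∀ x ∈ cthickening d K, |Tri v v v x + ε * Lap v x + (F x - μ * (v x - W x))| ≤ ε :=
    fun x hx => hv x (by rw [hχ' x (hbox x (hmono (by linarith) hx)), hξB x hx])
  have hLip : ∀ x ∈ K, dd 1 v x ≤ M ^ 2 := fun x₀ hx₀ =>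
    hM ε hε0.le (hεe.trans he1) v x₀ fun x hx => by
      have hxd : x ∈ cthickening d K := mem_cthickening_of_dist_le x x₀ d K hx₀ (by
        rw [dist_eq_norm]; linarith)
      refine ⟨?_, ?_⟩
      · have h1 := hvU x
        have h2 := hB x
        rw [abs_le] at *; constructor <;> linarith
      · have h1 := hvK x hxd
        have h2 := hFf x (hmono (by linarith) hxd)
        have h3 := hBf x
        have h4 := hvW x
        rw [Real.norm_eq_abs] at h3
        rw [abs_le] at *; constructor <;> linarith
  refine ⟨ε, hε0, hεe, v, F - μ • (v - W), fun x hx => ?_, fun x hx => ?_, fun x hx => ?_, hLip, ?_⟩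
  · have := hvU x
    rw [hU3 x (hKsub _ hx)] at this
    linarith
  · have h2 := hFf x (hKsub _ hx)
    have h4 := hvW x
    rw [hfh3 x (hKsub _ hx)] at h2
    simp only [Sm.sub_apply, Sm.smul_apply]
    rw [abs_le] at *; constructor <;> linarith
  · simpa using hvK x (hKsub _ hx)
  · intro X Y b hb hX hY hXY
    have hψ : ∀ x ∉ K, (D 0 X + D 1 Y : Sm) x = 0 := fun x hx => by
      rw [Sm.add_apply, D_eq_zero_of_notMem (K := ⟨K, hK⟩) hX 0 x hx,
        D_eq_zero_of_notMem (K := ⟨K, hK⟩) hY 1 x hx, add_zero]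
    obtain ⟨p, hp⟩ : ∃ p : Sm, p = μ • (v - W) := ⟨_, rfl⟩
    have hpd : ∀ x ∈ K, D 0 p x ^ 2 + D 1 p x ^ 2 ≤ 2 * M ^ 2 + 2 := fun x hx => by
      have h1 := dd_sub_le_two 1 v W x
      have h2 := hLip x hx
      have h3 := hL 1 le_rfl x
      have h4 : D 0 p x ^ 2 + D 1 p x ^ 2 = μ ^ 2 * dd 1 (v - W) x := by
        rw [hp, dd_one]; simp; ring
      have h5 : μ ^ 2 * dd 1 v x ≤ M ^ 2 :=
        (mul_le_of_le_one_left (dd_nonneg _ _ _) (pow_le_one₀ hμ0.le hμ1)).trans h2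
      have h6 := mul_le_mul_of_nonneg_left h3 (sq_nonneg μ)
      have h7 := mul_le_mul_of_nonneg_left h1 (sq_nonneg μ)
      rw [h4]; linarith
    have e1 : JS ⟨K, hK⟩ ((F - p) * (D 0 X + D 1 Y)) =
        JS ⟨K, hK⟩ (F * (D 0 X + D 1 Y)) + JS ⟨K, hK⟩ (D 0 p * X + D 1 p * Y) := by
      have i0 := JS_ibp (K := ⟨K, hK⟩) (v := p) (w := X) (fun x hx => by rw [hX x hx, mul_zero]) 0
      have i1 := JS_ibp (K := ⟨K, hK⟩) (v := p) (w := Y) (fun x hx => by rw [hY x hx, mul_zero]) 1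
      rw [sub_mul, map_sub, mul_add p, map_add _ (p * _), i0, i1, map_add]; ring
    have e2 : |JS ⟨K, hK⟩ (D 0 p * X + D 1 p * Y)| ≤ (2 * M ^ 2 + 3) * volume.real K * b := by
      rw [JS_def, ← Real.norm_eq_abs]
      refine (norm_setIntegral_le_of_norm_le_const (C := (2 * M ^ 2 + 3) * b) hK.measure_lt_top
        fun x hx => ?_).trans (le_of_eq (by ring))
      simpa [show (2 : ℝ) * M ^ 2 + 2 + 1 = 2 * M ^ 2 + 3 by ring] using
        abs_mul_add_mul_le hb (hpd x hx) (hXY x)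
    have e3 : |JS ⟨K, hK⟩ (F * (D 0 X + D 1 Y))| ≤ C * b := by
      rw [JS_eq_integral (fun x hx => by rw [Sm.mul_apply, hψ x hx, mul_zero])]
      have : ∫ x, (F * (D 0 X + D 1 Y) : Sm) x = ∫ x, F₀ x * (D 0 X + D 1 Y : Sm) x :=
        integral_congr_ae (.of_forall fun x => by
          simp only [Sm.mul_apply]
          by_cases hx : x ∈ K
          · rw [hF x (hbox x (hKsub _ hx))]
          · rw [hψ x hx, mul_zero, mul_zero])
      rw [this]
      refine hF₀C _ _ (hasCompactSupport_of_notMem (K := ⟨K, hK⟩) hψ) fun z hz => ?_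
      have htr : ∀ w : Sm, (∀ x ∉ K, w x = 0) → ∀ x ∉ cthickening d K, tr z w x = 0 := fun w hw x hx => by
        rw [tr_apply]
        refine hw _ fun h => hx (mem_cthickening_of_dist_le x _ d K h ?_)
        rw [dist_eq_norm]; simpa using hz
      have := hC (tr z X) (tr z Y) b hb (htr X hX) (htr Y hY) (fun x => by
        simp only [tr_apply]; exact hXY _)
      rw [D_tr, D_tr, ← map_add] at this
      refine le_trans (le_of_eq ?_) this
      congr 1
      refine integral_congr_ae (.of_forall fun x => ?_)
      by_cases hx : x ∈ cthickening d K
      · simp only [hfh3 x (hmono (by linarith) hx), tr_apply]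
      · have := htr _ hψ x hx
        simp only [tr_apply] at this ⊢
        rw [this, mul_zero, mul_zero]
    rw [← hp, e1, add_mul]
    exact (abs_add_le _ _).trans (add_le_add e3 e2)

end LocalApproximation

/-! ### Strong convergence of gradients -/

section GradientConvergence

/-- Gradient bound for a function close to an affine function on a ball. -/
lemma dd_one_le_of_near_affine {v : Sm} {x0 p : E2} {c σ R F ε : ℝ} (hσ : 0 < σ) (hR : 0 < R) (hε : 0 ≤ ε)
    (hεσ : ε ≤ σ ^ 2) (hFR : 2 * F * R ≤ σ ^ 3)
    (hF : ∀ x, ‖x - x0‖ ≤ 2 * R → |Tri v v v x + ε * Lap v x| ≤ F)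
    (hv : ∀ x, ‖x - x0‖ ≤ 2 * R → |v x - c - inner ℝ p (x - x0)| ≤ σ / 10 * R) :
    dd 1 v x0 ≤ (‖p‖ + 3 * σ) ^ 2 := by
  have hosc : ∀ x y, ‖x - x0‖ ≤ R + R → ‖y - x0‖ ≤ R + R → v x - v y ≤ ‖p‖ * ‖x - y‖ + σ / 5 * R :=
    fun x y hx hy => by
      have a := (abs_le.1 (hv x (by linarith))).2
      have b := (abs_le.1 (hv y (by linarith))).1
      have e : inner ℝ p (x - x0) - inner ℝ p (y - x0) = inner ℝ p (x - y) := by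
        rw [← inner_sub_right]; congr 1; abel
      have := real_inner_le_norm p (x - y)
      linarith
  have hp := norm_nonneg p
  refine two_point (s := ‖p‖ + 3 * σ) (k := σ / R) (K := 2 * σ / (5 * R)) (F := F) (ε := ε) (r := R) (R := R)
    (by positivity) (by positivity) (by positivity) hε hR hR (by rw [div_mul_cancel₀ _ hR.ne']; linarith)
    (fun x hx => hF x (by linarith)) (fun x y hx hy hxy => ?_) (fun x y hx hy hxy _ => ?_) ?_
  · have := hosc x y hx hy
    have e : σ / R / 2 * R ^ 2 = σ * R / 2 := by field_simp
    have h0 : 0 ≤ 2 * σ / (5 * R) / 8 * ‖x + y - (2 : ℝ) • x0‖ ^ 2 := by positivity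
    rw [hxy] at this
    rw [e]
    have := mul_pos hσ hR
    linarith
  · have := hosc x y hx hy
    have e1 : σ / R / 2 * ‖x - y‖ ^ 2 ≤ σ * ‖x - y‖ := by
      have h1 : σ / R / 2 * ‖x - y‖ ≤ σ / R / 2 * R := mul_le_mul_of_nonneg_left hxy (by positivity)
      have h2 : σ / R / 2 * R = σ / 2 := by field_simp
      have h3 := mul_le_mul_of_nonneg_right h1 (norm_nonneg (x - y))
      rw [h2] at h3
      linarith [mul_nonneg hσ.le (norm_nonneg (x - y))]
    have e2 : 2 * σ / (5 * R) / 2 * R ^ 2 = σ / 5 * R := by field_simp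
    rw [e2]
    linarith [mul_nonneg hσ.le (norm_nonneg (x - y))]
  · have e1 : (2 * σ / (5 * R)) ^ 3 * R ^ 2 / 4 = 2 / 125 * σ ^ 3 / R := by field_simp; norm_num
    have e2 : 2 * F ≤ σ ^ 3 / R := by rw [le_div_iff₀ hR]; exact hFR
    have e3 : 2 * ε * (2 * σ / (5 * R)) ≤ 4 / 5 * (σ ^ 3 / R) := by
      calc 2 * ε * (2 * σ / (5 * R)) ≤ 2 * σ ^ 2 * (2 * σ / (5 * R)) := by gcongr
        _ = 4 / 5 * (σ ^ 3 / R) := by field_simp; norm_num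
    have e4 : (3 * σ) ^ 2 * (σ / R) ≤ (‖p‖ + 3 * σ) ^ 2 * (σ / R) := by gcongr; linarith
    have e5 : (3 * σ) ^ 2 * (σ / R) = 9 * (σ ^ 3 / R) := by ring
    have e6 : 0 < σ ^ 3 / R := by positivity
    rw [e1, mul_div_assoc]
    linarith

/-- A sequence of smooth approximations of the viscosity solution `u` on `K`. -/
structure Approx (K : TopologicalSpace.Compacts E2) (f u : E2 → ℝ) (M C₀ : ℝ) (ε : ℕ → ℝ) (v g : ℕ → Sm) :
    Prop where
  M_pos : 0 < M
  C₀_nonneg : 0 ≤ C₀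
  pos : ∀ n, 0 < ε n
  le : ∀ n, ε n ≤ 1 / (n + 1)
  close : ∀ n, ∀ x ∈ K, |v n x - u x| ≤ 1 / (n + 1)
  closef : ∀ n, ∀ x ∈ K, |g n x - f x| ≤ 1 / (n + 1)
  eq : ∀ n, ∀ x ∈ K, |Tri (v n) (v n) (v n) x + ε n * Lap (v n) x + g n x| ≤ ε n
  lip : ∀ n, ∀ x ∈ K, dd 1 (v n) x ≤ M ^ 2
  pair : ∀ n, ∀ (X Y : Sm) (b : ℝ), 0 < b → (∀ x ∉ K, X x = 0) → (∀ x ∉ K, Y x = 0) →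
    (∀ x, X x ^ 2 + Y x ^ 2 ≤ b ^ 2) → |JS K (g n * (D 0 X + D 1 Y))| ≤ C₀ * b

lemma exists_approx {Ω : Set E2} (K : TopologicalSpace.Compacts E2) {f u : E2 → ℝ} (hΩ : IsOpen Ω)
    (hKΩ : (K : Set E2) ⊆ Ω) (hf : BVloc f Ω) (hfc : ContinuousOn f Ω) (huc : ContinuousOn u Ω)
    (hu : IsViscositySol Ω f u) : ∃ M C₀ ε v g, Approx K f u M C₀ ε v g := by
  obtain ⟨M, C₀, hM, hC, h⟩ := exists_local_approx hΩ K.isCompact hKΩ hf hfc huc hu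
  have h1 : ∀ n : ℕ, (1 : ℝ) / (n + 1) ≤ 1 := fun n => by
    rw [div_le_one (by positivity)]; linarith [(n.cast_nonneg : (0 : ℝ) ≤ n)]
  choose ε hε hεe v g h2 h3 h4 h5 h6 using fun n : ℕ => h (1 / (n + 1)) (by positivity) (h1 n)
  exact ⟨M, C₀, ε, v, g, hM, hC, hε, hεe, h2, h3, h4, h5, h6⟩

variable {K : TopologicalSpace.Compacts E2} {f u : E2 → ℝ} {M C₀ : ℝ} {ε : ℕ → ℝ} {v g : ℕ → Sm}

lemma Approx.comp (h : Approx K f u M C₀ ε v g) {φ : ℕ → ℕ} (hφ : StrictMono φ) :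
    Approx K f u M C₀ (ε ∘ φ) (v ∘ φ) (g ∘ φ) := by
  have hle : ∀ n, (1 : ℝ) / (φ n + 1) ≤ 1 / (n + 1) := fun n => by
    have : (n : ℝ) ≤ φ n := Nat.cast_le.2 hφ.le_apply
    gcongr
  exact ⟨h.M_pos, h.C₀_nonneg, fun n => h.pos _, fun n => (h.le _).trans (hle n),
    fun n x hx => (h.close _ x hx).trans (hle n), fun n x hx => (h.closef _ x hx).trans (hle n),
    fun n => h.eq _, fun n => h.lip _, fun n => h.pair _⟩

lemma Approx.tendsto_inv : Filter.Tendsto (fun n : ℕ => (1 : ℝ) / (n + 1)) Filter.atTop (nhds 0) :=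
  tendsto_one_div_add_atTop_nhds_zero_nat

lemma Approx.tendsto_ε (h : Approx K f u M C₀ ε v g) : Filter.Tendsto ε Filter.atTop (nhds 0) :=
  squeeze_zero (fun n => (h.pos n).le) h.le Approx.tendsto_inv

lemma Approx.tendsto (h : Approx K f u M C₀ ε v g) {x : E2} (hx : x ∈ K) :
    Filter.Tendsto (fun n => v n x) Filter.atTop (nhds (u x)) :=
  tendsto_iff_dist_tendsto_zero.2 (squeeze_zero (fun _ => dist_nonneg)
    (fun n => by rw [Real.dist_eq]; exact h.close n x hx) Approx.tendsto_inv)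

lemma Approx.tendstof (h : Approx K f u M C₀ ε v g) {x : E2} (hx : x ∈ K) :
    Filter.Tendsto (fun n => g n x) Filter.atTop (nhds (f x)) :=
  tendsto_iff_dist_tendsto_zero.2 (squeeze_zero (fun _ => dist_nonneg)
    (fun n => by rw [Real.dist_eq]; exact h.closef n x hx) Approx.tendsto_inv)

lemma Approx.exists_bound (h : Approx K f u M C₀ ε v g) : ∃ F, 0 ≤ F ∧ ∀ n, ∀ x ∈ K, |g n x| ≤ F ∧
    |u x| ≤ F ∧ |v n x| ≤ F ∧ |Tri (v n) (v n) (v n) x + ε n * Lap (v n) x| ≤ F := by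
  obtain ⟨A, hA⟩ := K.isCompact.exists_bound_of_continuousOn (g 0).continuous.continuousOn
  obtain ⟨B, hB⟩ := K.isCompact.exists_bound_of_continuousOn (v 0).continuous.continuousOn
  have h1 : ∀ n : ℕ, (1 : ℝ) / (n + 1) ≤ 1 := fun n => by
    rw [div_le_one (by positivity)]; linarith [(n.cast_nonneg : (0 : ℝ) ≤ n)]
  refine ⟨|A| + |B| + 3, by positivity, fun n x hx => ?_⟩
  have a1 := hA x hx
  have a2 := hB x hx
  have a3 := h.close n x hx
  have a4 := h.close 0 x hx
  have a5 := h.closef n x hx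
  have a6 := h.closef 0 x hx
  have a7 := h.eq n x hx
  have a8 := h.le n
  have b1 := h1 n
  have b2 := h1 0
  rw [Real.norm_eq_abs] at a1 a2
  have b3 := le_abs_self A
  have b4 := le_abs_self B
  have b5 := abs_nonneg A
  have b6 := abs_nonneg B
  rw [abs_le] at a1 a2 a3 a4 a5 a6 a7
  refine ⟨abs_le.2 ⟨?_, ?_⟩, abs_le.2 ⟨?_, ?_⟩, abs_le.2 ⟨?_, ?_⟩, abs_le.2 ⟨?_, ?_⟩⟩ <;> linarith

lemma Approx.eventually_dd_le (h : Approx K f u M C₀ ε v g) {x p : E2} (hx : x ∈ interior (K : Set E2))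
    (hp : HasGradientAt u p x) {σ : ℝ} (hσ : 0 < σ) :
    ∀ᶠ n in Filter.atTop, dd 1 (v n) x ≤ (‖p‖ + 3 * σ) ^ 2 := by
  obtain ⟨F, hF0, hF⟩ := h.exists_bound
  have hd := (hasGradientAt_iff_isLittleO.1 hp).def (c := σ / 40) (by positivity)
  obtain ⟨ρ, hρ, hball⟩ := Metric.eventually_nhds_iff.1
    (hd.and (mem_interior_iff_mem_nhds.1 hx))
  obtain ⟨R, hR⟩ : ∃ R, R = min (ρ / 4) (σ ^ 3 / (2 * F + 1)) := ⟨_, rfl⟩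
  have hR0 : 0 < R := by rw [hR]; positivity
  have hRρ : R ≤ ρ / 4 := hR ▸ min_le_left _ _
  have hRF : 2 * F * R ≤ σ ^ 3 := by
    have : R ≤ σ ^ 3 / (2 * F + 1) := hR ▸ min_le_right _ _
    rw [le_div_iff₀ (by positivity)] at this; linarith
  filter_upwards [h.tendsto_ε.eventually (ge_mem_nhds (show 0 < σ ^ 2 by positivity)),
    (Approx.tendsto_inv).eventually (ge_mem_nhds (show 0 < σ / 20 * R by positivity))] with n h1 h2
  refine dd_one_le_of_near_affine (c := u x) hσ hR0 (h.pos n).le h1 hRF (fun y hy => ?_) fun y hy => ?_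
  · exact (hF n y (hball (y := y) (by rw [dist_eq_norm]; linarith)).2).2.2.2
  · obtain ⟨b1, b2⟩ := hball (y := y) (by rw [dist_eq_norm]; linarith)
    have b3 := h.close n y b2
    rw [Real.norm_eq_abs] at b1
    have b4 : σ / 40 * ‖y - x‖ ≤ σ / 20 * R := by
      have := mul_le_mul_of_nonneg_left hy (show 0 ≤ σ / 40 by positivity)
      linarith
    rw [abs_le] at b1 b3 ⊢
    constructor <;> linarith

end GradientConvergence

section Limit

variable {K : TopologicalSpace.Compacts E2} {f u : E2 → ℝ} {M C₀ : ℝ} {ε : ℕ → ℝ} {v g : ℕ → Sm}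

lemma continuousOn_of_abs_sub_le {S : Set E2} {w : ℕ → Sm} {h : E2 → ℝ}
    (hw : ∀ n, ∀ x ∈ S, |w n x - h x| ≤ 1 / (n + 1)) : ContinuousOn h S := by
  refine TendstoUniformlyOn.continuousOn (F := fun n => (w n : E2 → ℝ)) (p := Filter.atTop) ?_
    (Filter.Frequently.of_forall fun n => (w n).continuous.continuousOn)
  rw [Metric.tendstoUniformlyOn_iff]
  intro δ hδ
  filter_upwards [Approx.tendsto_inv.eventually (gt_mem_nhds hδ)] with n hn x hx
  rw [dist_comm, Real.dist_eq]
  exact (hw n x hx).trans_lt hn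

lemma Approx.continuousOn (h : Approx K f u M C₀ ε v g) : ContinuousOn u K :=
  continuousOn_of_abs_sub_le h.close

lemma Approx.continuousOnf (h : Approx K f u M C₀ ε v g) : ContinuousOn f K :=
  continuousOn_of_abs_sub_le h.closef

lemma E2.gradient_apply {u : E2 → ℝ} {x : E2} (i : Fin 2) : gradient u x i = pd i u x := by
  have := InnerProductSpace.toDual_symm_apply (𝕜 := ℝ) (x := EuclideanSpace.single i 1)
    (y := fderiv ℝ u x)
  rw [pd, ← this, EuclideanSpace.inner_single_right]
  simp [gradient]

lemma E2.norm_gradient_sq {u : E2 → ℝ} {x : E2} : ‖gradient u x‖ ^ 2 = gradSq u x := by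
  rw [E2.norm_sq, gradSq, E2.gradient_apply, E2.gradient_apply, Fin.sum_univ_two]

lemma measurable_pd (u : E2 → ℝ) (i : Fin 2) : Measurable (pd i u) :=
  measurable_fderiv_apply_const ℝ u _

lemma measurable_gradSq (u : E2 → ℝ) : Measurable (gradSq u) :=
  Finset.measurable_sum _ fun i _ => (measurable_pd u i).pow_const 2

lemma sq_le_dd_one (v : Sm) (i : Fin 2) (x : E2) : D i v x ^ 2 ≤ dd 1 v x := by
  fin_cases i <;> simp [dd_one] <;> positivity

lemma Approx.gradSq_le (h : Approx K f u M C₀ ε v g) {x : E2} (hx : x ∈ interior (K : Set E2)) :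
    gradSq u x ≤ M ^ 2 := by
  obtain ⟨r, hr, hb⟩ := Metric.mem_nhds_iff.1 (mem_interior_iff_mem_nhds.1 hx)
  have hL : LipschitzOnWith ⟨M, h.M_pos.le⟩ u (ball x r) := by
    refine LipschitzOnWith.of_dist_le_mul fun y hy z hz => ?_
    rw [Real.dist_eq, dist_eq_norm]
    refine le_of_tendsto' ((h.tendsto (hb hy)).sub (h.tendsto (hb hz))).abs fun n => ?_
    refine Convex.norm_image_sub_le_of_norm_fderiv_le (𝕜 := ℝ)
      (fun w _ => ((v n).differentiable _)) (fun w hw => ?_) (convex_ball x r) hz hy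
    exact abs_le_of_sq_le_sq' ((norm_fderiv_sq_le (v n) w).trans (h.lip n w (hb hw))) h.M_pos.le |>.2
  have h1 := norm_fderiv_le_of_lipschitzOn ℝ (ball_mem_nhds x hr) hL
  have h2 : ‖gradient u x‖ = ‖fderiv ℝ u x‖ := by
    rw [gradient, LinearIsometryEquiv.norm_map]
  rw [← E2.norm_gradient_sq, h2]
  exact pow_le_pow_left₀ (norm_nonneg _) h1 2

lemma hasFDerivAt_mul_zero {ψ : Sm} {u : E2 → ℝ} {B : ℝ} (hψ : ∀ x ∉ K, ψ x = 0)
    (hB : ∀ x ∈ K, |u x| ≤ B) {x : E2} (hx : x ∉ interior (K : Set E2)) :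
    ψ x = 0 ∧ (∀ i, D i ψ x = 0) ∧ HasFDerivAt (fun y => ψ y * u y) (0 : E2 →L[ℝ] ℝ) x := by
  have hx' : x ∈ closure (K : Set E2)ᶜ := by rwa [closure_compl]
  have h0 : ψ x = 0 := closure_minimal (fun y hy => hψ y hy)
    (isClosed_eq ψ.continuous continuous_const) hx'
  have hD : fderiv ℝ ψ x = 0 := by
    refine closure_minimal (fun y hy => ?_)
      (isClosed_eq (ψ.contDiff.continuous_fderiv (by simp)) continuous_const) hx'
    have : (ψ : E2 → ℝ) =ᶠ[nhds y] fun _ => 0 := by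
      filter_upwards [K.isCompact.isClosed.isOpen_compl.mem_nhds hy] with z hz using hψ z hz
    change fderiv ℝ ψ y = 0
    rw [this.fderiv_eq]
    simp
  refine ⟨h0, fun i => by rw [D_apply', hD]; rfl, ?_⟩
  have h1 : HasFDerivAt ψ (0 : E2 →L[ℝ] ℝ) x := hD ▸ (ψ.differentiable x).hasFDerivAt
  rw [hasFDerivAt_iff_isLittleO] at h1 ⊢
  refine Asymptotics.IsBigO.trans_isLittleO (Asymptotics.IsBigO.of_bound B (Filter.Eventually.of_forall fun y => ?_)) h1
  simp only [h0, zero_mul, sub_zero, _root_.zero_apply, norm_mul]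
  by_cases hy : y ∈ K
  · rw [mul_comm]
    exact mul_le_mul_of_nonneg_right (hB y hy) (norm_nonneg _)
  · simp [hψ y hy]


lemma Approx.exists_lipschitz (h : Approx K f u M C₀ ε v g) {ψ : Sm} (hψ : ∀ x ∉ K, ψ x = 0) :
    ∃ L, LipschitzWith L fun y => ψ y * u y := by
  obtain ⟨F, hF0, hF⟩ := h.exists_bound
  obtain ⟨A, hA⟩ := K.isCompact.exists_bound_of_continuousOn (dd 1 ψ).continuous.continuousOn
  obtain ⟨B, hB⟩ := K.isCompact.exists_bound_of_continuousOn (ψ ^ 2).continuous.continuousOn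
  have hL : 0 ≤ 2 * (|A| * F ^ 2 + |B| * M ^ 2) := by positivity
  obtain ⟨L, hL⟩ : ∃ L, L = √(2 * (|A| * F ^ 2 + |B| * M ^ 2)) := ⟨_, rfl⟩
  have hL0 : 0 ≤ L := hL ▸ Real.sqrt_nonneg _
  have hL2 : L ^ 2 = 2 * (|A| * F ^ 2 + |B| * M ^ 2) := by rw [hL, Real.sq_sqrt (by positivity)]
  have hd : ∀ n x, dd 1 (ψ * v n) x ≤ L ^ 2 := by
    intro n x
    by_cases hx : x ∈ K
    · have h1 := (le_abs_self _).trans ((hA x hx).trans (le_abs_self A))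
      have h2 := (le_abs_self _).trans ((hB x hx).trans (le_abs_self B))
      have h3 := h.lip n x hx
      have h4 := sq_le_sq' (abs_le.1 (hF n x hx).2.2.1).1 (abs_le.1 (hF n x hx).2.2.1).2
      have h5 := mul_le_mul h1 h4 (sq_nonneg _) (abs_nonneg _)
      have h6 := mul_le_mul h2 h3 (dd_nonneg _ _ _) (abs_nonneg _)
      rw [hL2]
      refine le_trans ?_ (mul_le_mul_of_nonneg_left (add_le_add h5 h6) zero_le_two)
      simp only [dd_one, D_mul, Sm.add_apply, Sm.mul_apply, Sm.pow_apply]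
      linarith [sq_nonneg (D 0 ψ x * v n x - ψ x * D 0 (v n) x),
        sq_nonneg (D 1 ψ x * v n x - ψ x * D 1 (v n) x)]
    · have h0 : ∀ y ∉ K, (ψ * v n) y = 0 := fun y hy => by simp [hψ y hy]
      have := fun i => D_eq_zero_of_notMem h0 i x hx
      simp only [dd_one, Sm.add_apply, Sm.pow_apply, this]
      nlinarith only [sq_nonneg L]
  refine ⟨⟨L, hL0⟩, LipschitzWith.of_dist_le_mul fun y z => ?_⟩
  rw [Real.dist_eq, dist_eq_norm]
  have ht : ∀ y, Filter.Tendsto (fun n => (ψ * v n) y) Filter.atTop (nhds (ψ y * u y)) := by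
    intro y
    by_cases hy : y ∈ K
    · exact (h.tendsto hy).const_mul _
    · simp [hψ y hy]
  exact le_of_tendsto' ((ht y).sub (ht z)).abs fun n => Sm.abs_sub_le hL0 (hd n) y z

/-- The gradient of `u`, cut off outside the interior of `K`. -/
def gr (K : TopologicalSpace.Compacts E2) (u : E2 → ℝ) (i : Fin 2) : E2 → ℝ :=
  (interior (K : Set E2)).indicator (pd i u)

lemma measurable_gr (K : TopologicalSpace.Compacts E2) (u : E2 → ℝ) (i : Fin 2) :
    Measurable (gr K u i) := (measurable_pd u i).indicator isOpen_interior.measurableSet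

lemma gr_of_mem {x : E2} (hx : x ∈ interior (K : Set E2)) (i : Fin 2) : gr K u i x = pd i u x :=
  Set.indicator_of_mem hx _

lemma gr_of_notMem {x : E2} (hx : x ∉ interior (K : Set E2)) (i : Fin 2) : gr K u i x = 0 :=
  Set.indicator_of_notMem hx _

lemma Approx.abs_gr_le (h : Approx K f u M C₀ ε v g) (i : Fin 2) (x : E2) : |gr K u i x| ≤ M := by
  by_cases hxK : x ∈ interior (K : Set E2)
  · rw [gr_of_mem hxK]
    refine abs_le_of_sq_le_sq ((h.gradSq_le hxK).trans' ?_) h.M_pos.le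
    rw [gradSq, Fin.sum_univ_two]
    fin_cases i <;> simp <;> positivity
  · simpa [gr_of_notMem hxK] using h.M_pos.le

lemma Approx.integral_pd_mul (h : Approx K f u M C₀ ε v g)
    (hu : ∀ᵐ x, x ∈ interior (K : Set E2) → DifferentiableAt ℝ u x) {ψ : Sm}
    (hψ : ∀ x ∉ K, ψ x = 0) (i : Fin 2) :
    ∫ x in K, ψ x * gr K u i x = -∫ x in K, D i ψ x * u x := by
  obtain ⟨F, hF0, hF⟩ := h.exists_bound
  obtain ⟨L, hL⟩ := h.exists_lipschitz hψ
  have hcs : HasCompactSupport fun y => ψ y * u y :=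
    hasCompactSupport_of_notMem (K := K) fun x hx => by simp [hψ x hx]
  have h1 := LipschitzWith.integral_lineDeriv_mul_eq (μ := volume)
    (LipschitzWith.const (α := E2) (1 : ℝ)) hL hcs (-ev i)
  have hK : MeasurableSet (K : Set E2) := K.isCompact.isClosed.measurableSet
  have h2 : ∫ x, lineDeriv ℝ (fun y => ψ y * u y) x (ev i) = 0 := by
    have : ∀ x w, lineDeriv ℝ (fun _ : E2 => (1 : ℝ)) x w = 0 := by simp [lineDeriv]
    simpa [this] using h1.symm
  have h3 : (fun x => lineDeriv ℝ (fun y => ψ y * u y) x (ev i)) =ᵐ[volume]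
      (K : Set E2).indicator fun x => ψ x * gr K u i x + D i ψ x * u x := by
    filter_upwards [hu] with x hx
    by_cases hxK : x ∈ interior (K : Set E2)
    · have hp : HasFDerivAt (fun y => ψ y * u y) _ x := (ψ.hasFDerivAt x).mul (hx hxK).hasFDerivAt
      rw [(hp.hasLineDerivAt (ev i)).lineDeriv, Set.indicator_of_mem (interior_subset hxK)]
      simp [gr_of_mem hxK, D_apply', pd, ev, mul_comm]
    · obtain ⟨h4, h5, h6⟩ := hasFDerivAt_mul_zero hψ (fun y hy => (hF 0 y hy).2.1) hxK
      rw [(h6.hasLineDerivAt (ev i)).lineDeriv]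
      simp [Set.indicator, h4, h5]
  rw [integral_congr_ae h3, integral_indicator hK, integral_add] at h2
  · linarith
  · exact Integrable.mono' ((integrableOn_compacts ψ.continuous.abs).mul_const M)
      ((ψ.continuous.measurable.mul (measurable_gr K u i)).aestronglyMeasurable)
      (Filter.Eventually.of_forall fun x => by
        rw [norm_mul]
        exact mul_le_mul_of_nonneg_left (h.abs_gr_le i x) (abs_nonneg _))
  · exact ((D i ψ).continuous.continuousOn.mul h.continuousOn).integrableOn_compact K.isCompact

lemma exists_integral_sub_le {φ : E2 → ℝ} (hφ : IntegrableOn φ K) {e : ℝ} (he : 0 < e) :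
    ∃ W : Sm, ∫ x in K, |φ x - W x| ≤ e := by
  obtain ⟨h, h1, h2, h3, h4⟩ := Integrable.exists_hasCompactSupport_integral_sub_le hφ
    (half_pos he)
  obtain ⟨R, hR⟩ := h1.isCompact.isBounded.subset_closedBall 0
  have hV : 0 ≤ volume.real (K : Set E2) := measureReal_nonneg
  obtain ⟨W, -, hW, -⟩ := exists_mollification h3 (R := R + 1) one_pos
    (e := e / 2 / (volume.real (K : Set E2) + 1)) (by positivity) (fun x hx => by
      by_contra hne
      have := hR (subset_tsupport h hne)
      rw [mem_closedBall_zero_iff] at this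
      linarith)
  have hWi : IntegrableOn W (K : Set E2) := integrableOn_compacts W.continuous
  have h5 : ∫ x in K, |h x - W x| ≤ e / 2 := by
    refine (setIntegral_mono_on (h4.sub hWi).abs
      (integrableOn_const (C := e / 2 / (volume.real (K : Set E2) + 1))
        K.isCompact.measure_lt_top.ne) K.isCompact.isClosed.measurableSet fun x _ => ?_).trans ?_
    · exact (abs_sub_comm _ _).trans_le (hW x)
    · rw [setIntegral_const, smul_eq_mul, mul_div_assoc', div_le_iff₀ (by linarith)]
      nlinarith only [he, hV]
  refine ⟨W, ?_⟩
  calc ∫ x in K, |φ x - W x| ≤ ∫ x in K, (|φ x - h x| + |h x - W x|) :=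
        integral_mono (hφ.sub hWi).abs ((hφ.sub h4).abs.add (h4.sub hWi).abs)
          fun x => abs_sub_le _ _ _
    _ = (∫ x in K, |φ x - h x|) + ∫ x in K, |h x - W x| :=
        integral_add (hφ.sub h4).abs (h4.sub hWi).abs
    _ ≤ e := by
        have : ∫ x in K, |φ x - h x| ≤ e / 2 := h2
        linarith

lemma Approx.abs_D_le (h : Approx K f u M C₀ ε v g) (n : ℕ) (i : Fin 2) {x : E2} (hx : x ∈ K) :
    |D i (v n) x| ≤ M :=
  abs_le_of_sq_le_sq ((sq_le_dd_one _ i x).trans (h.lip n x hx)) h.M_pos.le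

lemma Approx.tendsto_weak (h : Approx K f u M C₀ ε v g)
    (hu : ∀ᵐ x, x ∈ interior (K : Set E2) → DifferentiableAt ℝ u x) {ψ : Sm}
    (hψ : ∀ x ∉ K, ψ x = 0) (i : Fin 2) :
    Filter.Tendsto (fun n => ∫ x in K, ψ x * D i (v n) x) Filter.atTop
      (nhds (∫ x in K, ψ x * gr K u i x)) := by
  obtain ⟨F, hF0, hF⟩ := h.exists_bound
  rw [h.integral_pd_mul hu hψ]
  have h1 : ∀ n, ∫ x in K, ψ x * D i (v n) x = -∫ x in K, D i ψ x * v n x := fun n =>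
    JS_ibp (K := K) (v := ψ) (w := v n) (fun x hx => by simp [hψ x hx]) i
  simp only [h1]
  have hK : MeasurableSet (K : Set E2) := K.isCompact.isClosed.measurableSet
  refine (tendsto_integral_of_dominated_convergence (fun x => |D i ψ x| * F)
    (fun n => ((D i ψ).continuous.mul (v n).continuous).aestronglyMeasurable)
    ((integrableOn_compacts (D i ψ).continuous.abs).mul_const F) (fun n => ?_) ?_).neg
  · refine (ae_restrict_mem hK).mono fun x hx => ?_
    exact (norm_mul _ _).trans_le (mul_le_mul_of_nonneg_left (hF n x hx).2.2.1 (abs_nonneg _))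
  · exact (ae_restrict_mem hK).mono fun x hx => (h.tendsto hx).const_mul _

lemma abs_integral_mul_le {a φ : E2 → ℝ} {B : ℝ} (hφ : IntegrableOn φ K) (ha : ∀ x ∈ K, |a x| ≤ B) :
    |∫ x in K, a x * φ x| ≤ B * ∫ x in K, |φ x| := by
  rw [← integral_const_mul, ← Real.norm_eq_abs]
  refine norm_integral_le_of_norm_le (hφ.abs.const_mul B) ((ae_restrict_mem
    K.isCompact.isClosed.measurableSet).mono fun x hx => ?_)
  rw [norm_mul]
  exact mul_le_mul_of_nonneg_right (ha x hx) (abs_nonneg _)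

lemma integrableOn_bdd_mul {a φ : E2 → ℝ} {B : ℝ} (hφ : IntegrableOn φ K) (hm : Measurable a)
    (ha : ∀ x ∈ K, |a x| ≤ B) : IntegrableOn (fun x => a x * φ x) K :=
  Integrable.bdd_mul hφ hm.aestronglyMeasurable
    ((ae_restrict_mem K.isCompact.isClosed.measurableSet).mono ha)

lemma Approx.tendsto_weak' (h : Approx K f u M C₀ ε v g)
    (hu : ∀ᵐ x, x ∈ interior (K : Set E2) → DifferentiableAt ℝ u x) {ψ : Sm}
    (hψ : ∀ x ∉ K, ψ x = 0) (hψ1 : ∀ x, |ψ x| ≤ 1) (i : Fin 2) {φ : E2 → ℝ} (hφ : IntegrableOn φ K) :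
    Filter.Tendsto (fun n => ∫ x in K, ψ x * D i (v n) x * φ x) Filter.atTop
      (nhds (∫ x in K, ψ x * gr K u i x * φ x)) := by
  rw [Metric.tendsto_atTop]
  intro e he
  have hM := h.M_pos
  obtain ⟨W, hW⟩ := exists_integral_sub_le hφ (show 0 < e / (4 * M) by positivity)
  have hWi : IntegrableOn W (K : Set E2) := integrableOn_compacts W.continuous
  obtain ⟨N, hN⟩ := Metric.tendsto_atTop.1 (h.tendsto_weak hu (ψ := ψ * W)
    (fun x hx => by simp [hψ x hx]) i) (e / 2) (half_pos he)
  refine ⟨N, fun n hn => ?_⟩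
  have key : ∀ a : E2 → ℝ, Measurable a → (∀ x ∈ K, |a x| ≤ M) →
      |(∫ x in K, ψ x * a x * φ x) - ∫ x in K, (ψ * W) x * a x| ≤ e / 4 := by
    intro a ham ha
    have hb : ∀ x ∈ K, |ψ x * a x| ≤ M := fun x hx => by
      rw [abs_mul]
      nlinarith only [hψ1 x, ha x hx, abs_nonneg (ψ x), abs_nonneg (a x)]
    have hm : Measurable fun x => ψ x * a x := ψ.continuous.measurable.mul ham
    have e1 : ∫ x in K, (ψ * W) x * a x = ∫ x in K, ψ x * a x * W x :=
      integral_congr_ae (Filter.Eventually.of_forall fun x => by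
        simp only [Sm.mul_apply]; ring)
    rw [e1, ← integral_sub (integrableOn_bdd_mul hφ hm hb) (integrableOn_bdd_mul hWi hm hb)]
    simp only [← mul_sub]
    refine (abs_integral_mul_le (hφ.sub hWi) hb).trans ((mul_le_mul_of_nonneg_left hW hM.le).trans ?_)
    field_simp
    rfl
  have h1 := key (D i (v n)) (D i (v n)).continuous.measurable fun x hx => h.abs_D_le n i hx
  have h2 := key (gr K u i) (measurable_gr K u i) fun x _ => h.abs_gr_le i x
  have h3 := hN n hn
  rw [Real.dist_eq] at h3 ⊢
  rw [abs_lt] at *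
  rw [abs_le] at h1 h2
  constructor <;> linarith [h1.1, h1.2, h2.1, h2.2, h3.1, h3.2]

lemma Approx.tendsto_max (h : Approx K f u M C₀ ε v g) {x : E2} (hx : x ∈ interior (K : Set E2))
    (hu : DifferentiableAt ℝ u x) :
    Filter.Tendsto (fun n => max (dd 1 (v n) x - (gr K u 0 x ^ 2 + gr K u 1 x ^ 2)) 0) Filter.atTop
      (nhds 0) := by
  have hs : gr K u 0 x ^ 2 + gr K u 1 x ^ 2 = ‖gradient u x‖ ^ 2 := by
    rw [E2.norm_gradient_sq, gradSq, Fin.sum_univ_two, gr_of_mem hx, gr_of_mem hx]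
  rw [Metric.tendsto_atTop']
  intro η hη
  obtain ⟨s, hsx⟩ : ∃ s, s = ‖gradient u x‖ := ⟨_, rfl⟩
  have hs0 : 0 ≤ s := hsx ▸ norm_nonneg _
  obtain ⟨σ, hσ⟩ : ∃ σ, σ = min 1 (η / (6 * s + 10)) := ⟨_, rfl⟩
  have hσ0 : 0 < σ := hσ ▸ lt_min one_pos (by positivity)
  have hσ1 : σ ≤ 1 := hσ ▸ min_le_left _ _
  have hσ2 : σ * (6 * s + 10) ≤ η := by
    rw [← le_div_iff₀ (by linarith)]; exact hσ ▸ min_le_right _ _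
  obtain ⟨N, hN⟩ := Filter.eventually_atTop.1 (h.eventually_dd_le hx hu.hasGradientAt hσ0)
  refine ⟨N, fun n hn => ?_⟩
  have h1 := hN n hn.le
  rw [← hsx] at h1
  rw [Real.dist_eq, sub_zero, abs_of_nonneg (le_max_right _ _), hs, ← hsx]
  refine max_lt ?_ hη
  nlinarith only [h1, hσ0, hσ1, hσ2, mul_nonneg hσ0.le (sub_nonneg.2 hσ1)]

lemma Approx.tendsto_strong (h : Approx K f u M C₀ ε v g)
    (hu : ∀ᵐ x, x ∈ interior (K : Set E2) → DifferentiableAt ℝ u x) {ψ : Sm}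
    (hψ : ∀ x ∉ K, ψ x = 0) (hψ0 : ∀ x, 0 ≤ ψ x) (hψ1 : ∀ x, ψ x ≤ 1) :
    Filter.Tendsto (fun n => ∫ x in K, ψ x * ((D 0 (v n) x - gr K u 0 x) ^ 2 +
      (D 1 (v n) x - gr K u 1 x) ^ 2)) Filter.atTop (nhds 0) := by
  obtain ⟨F, hF0, hF⟩ := h.exists_bound
  have hK : MeasurableSet (K : Set E2) := K.isCompact.isClosed.measurableSet
  have hψa : ∀ x, |ψ x| ≤ 1 := fun x => by rw [abs_of_nonneg (hψ0 x)]; exact hψ1 x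
  have hc : ∀ c : ℝ, IntegrableOn (fun _ => c) (K : Set E2) := fun c =>
    integrableOn_const K.isCompact.measure_lt_top.ne
  have hgi : ∀ i, IntegrableOn (gr K u i) (K : Set E2) := fun i =>
    (hc M).mono' (measurable_gr K u i).aestronglyMeasurable
      (Filter.Eventually.of_forall fun x => h.abs_gr_le i x)
  obtain ⟨m, hm⟩ : ∃ m : ℕ → E2 → ℝ, m = fun n x =>
    ψ x * max (dd 1 (v n) x - (gr K u 0 x ^ 2 + gr K u 1 x ^ 2)) 0 := ⟨_, rfl⟩
  have hmm : ∀ n, AEStronglyMeasurable (m n) (volume.restrict (K : Set E2)) := fun n => by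
    rw [hm]
    exact (ψ.continuous.measurable.mul (((dd 1 (v n)).continuous.measurable.sub
      (((measurable_gr K u 0).pow_const 2).add ((measurable_gr K u 1).pow_const 2))).max
      measurable_const)).aestronglyMeasurable
  have hmb : ∀ n, ∀ x ∈ K, |m n x| ≤ M ^ 2 := fun n x hx => by
    have h0 : 0 ≤ max (dd 1 (v n) x - (gr K u 0 x ^ 2 + gr K u 1 x ^ 2)) 0 := le_max_right _ _
    have h1 : max (dd 1 (v n) x - (gr K u 0 x ^ 2 + gr K u 1 x ^ 2)) 0 ≤ M ^ 2 :=
      max_le (by linarith [h.lip n x hx, sq_nonneg (gr K u 0 x), sq_nonneg (gr K u 1 x)])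
        (sq_nonneg _)
    simp only [hm]
    rw [abs_of_nonneg (mul_nonneg (hψ0 x) h0)]
    nlinarith only [h0, h1, hψ0 x, hψ1 x]
  have hmi : ∀ n, IntegrableOn (m n) (K : Set E2) := fun n =>
    (hc (M ^ 2)).mono' (hmm n) ((ae_restrict_mem hK).mono (hmb n))
  have hmt : Filter.Tendsto (fun n => ∫ x in K, m n x) Filter.atTop (nhds 0) := by
    rw [← integral_zero E2 ℝ (μ := volume.restrict (K : Set E2))]
    refine tendsto_integral_of_dominated_convergence (fun _ => M ^ 2) hmm (hc _)
      (fun n => (ae_restrict_mem hK).mono (hmb n)) ?_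
    refine ae_restrict_of_ae (hu.mono fun x hx => ?_)
    simp only [hm]
    by_cases hxK : x ∈ interior (K : Set E2)
    · simpa using (h.tendsto_max hxK (hx hxK)).const_mul (ψ x)
    · simp [(hasFDerivAt_mul_zero hψ (fun y hy => (hF 0 y hy).2.1) hxK).1]
  have hw := fun i => ((h.tendsto_weak' hu hψ hψa i (hgi i)).sub_const
    (∫ x in K, ψ x * gr K u i x * gr K u i x)).const_mul 2
  have hb : ∀ (a : E2 → ℝ), Measurable a → (∀ x ∈ K, |a x| ≤ M) → ∀ i,
      IntegrableOn (fun x => ψ x * a x * gr K u i x) K := fun a ha hab i => by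
    refine integrableOn_bdd_mul (hgi i) (ψ.continuous.measurable.mul ha) (B := M) fun x hx => ?_
    rw [abs_mul]
    nlinarith only [hψa x, hab x hx, abs_nonneg (ψ x), abs_nonneg (a x)]
  have hb1 := fun n i => hb _ (D i (v n)).continuous.measurable (fun x hx => h.abs_D_le n i hx) i
  have hb2 := fun i => hb _ (measurable_gr K u i) (fun x _ => h.abs_gr_le i x) i
  have hlim := (hmt.sub (hw 0)).sub (hw 1)
  simp only [sub_self, mul_zero] at hlim
  refine squeeze_zero (fun n => integral_nonneg fun x => mul_nonneg (hψ0 x) (by positivity))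
    (fun n => ?_) hlim
  have hd : ∀ i, IntegrableOn (fun x => 2 * (ψ x * D i (v n) x * gr K u i x -
      ψ x * gr K u i x * gr K u i x)) K := fun i => ((hb1 n i).sub (hb2 i)).const_mul 2
  have hd' : IntegrableOn (fun x => m n x - 2 * (ψ x * D 0 (v n) x * gr K u 0 x -
      ψ x * gr K u 0 x * gr K u 0 x)) K := (hmi n).sub (hd 0)
  rw [← integral_sub (hb1 n 0) (hb2 0), ← integral_sub (hb1 n 1) (hb2 1), ← integral_const_mul,
    ← integral_const_mul, ← integral_sub (hmi n) (hd 0), ← integral_sub hd' (hd 1)]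
  refine integral_mono_of_nonneg
    (Filter.Eventually.of_forall fun x => mul_nonneg (hψ0 x) (by positivity)) (hd'.sub (hd 1))
    (Filter.Eventually.of_forall fun x => ?_)
  have h1 := mul_le_mul_of_nonneg_left (le_max_left
    (dd 1 (v n) x - (gr K u 0 x ^ 2 + gr K u 1 x ^ 2)) 0) (hψ0 x)
  simp only [hm]
  simp only [dd_one, Sm.add_apply, Sm.pow_apply] at h1 ⊢
  linarith

/-- Along a subsequence the gradients converge almost everywhere. -/
lemma Approx.exists_subseq (h : Approx K f u M C₀ ε v g)
    (hu : ∀ᵐ x, x ∈ interior (K : Set E2) → DifferentiableAt ℝ u x) :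
    ∃ φ : ℕ → ℕ, StrictMono φ ∧ ∀ᵐ x, x ∈ interior (K : Set E2) →
      ∀ i, Filter.Tendsto (fun n => D i (v (φ n)) x) Filter.atTop (nhds (pd i u x)) := by
  obtain ⟨ψ, hψ0, hψ1, hψz, -⟩ := exists_cutoff (A := (interior (K : Set E2))ᶜ) (B := ∅)
    isOpen_interior.isClosed_compl isClosed_empty (Set.disjoint_empty _)
  have hψ : ∀ x ∉ K, ψ x = 0 := fun x hx => (hψz x).1 fun hx' => hx (interior_subset hx')
  obtain ⟨F, hF⟩ : ∃ F : ℕ → E2 → ℝ, F = fun n x => ψ x * ((D 0 (v n) x - gr K u 0 x) ^ 2 +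
      (D 1 (v n) x - gr K u 1 x) ^ 2) := ⟨_, rfl⟩
  have hs : Filter.Tendsto (fun n => ∫ x in K, F n x) Filter.atTop (nhds 0) := by
    rw [hF]; exact h.tendsto_strong hu hψ hψ0 hψ1
  have hF0 : ∀ n x, 0 ≤ F n x := fun n x => by
    rw [hF]; exact mul_nonneg (hψ0 x) (by positivity)
  have hK : MeasurableSet (K : Set E2) := K.isCompact.isClosed.measurableSet
  have hFm : ∀ n, AEStronglyMeasurable (F n) (volume.restrict (K : Set E2)) := fun n => by
    rw [hF]
    exact (ψ.continuous.measurable.mul ((((D 0 (v n)).continuous.measurable.sub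
      (measurable_gr K u 0)).pow_const 2).add (((D 1 (v n)).continuous.measurable.sub
      (measurable_gr K u 1)).pow_const 2))).aestronglyMeasurable
  have hFi : ∀ n, IntegrableOn (F n) (K : Set E2) := fun n => by
    refine (integrableOn_const (C := 8 * M ^ 2) K.isCompact.measure_lt_top.ne).mono' (hFm n)
      ((ae_restrict_mem hK).mono fun x hx => ?_)
    rw [Real.norm_eq_abs, abs_of_nonneg (hF0 n x), hF]
    have h0 := fun i => sq_le_sq' (abs_le.1 (h.abs_D_le n i hx)).1 (abs_le.1 (h.abs_D_le n i hx)).2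
    have h1 := fun i => sq_le_sq' (abs_le.1 (h.abs_gr_le i x)).1 (abs_le.1 (h.abs_gr_le i x)).2
    refine (mul_le_of_le_one_left (by positivity) (hψ1 x)).trans ?_
    linarith [h0 0, h0 1, h1 0, h1 1, sq_nonneg (D 0 (v n) x + gr K u 0 x),
      sq_nonneg (D 1 (v n) x + gr K u 1 x)]
  have hm : TendstoInMeasure (volume.restrict (K : Set E2)) F Filter.atTop fun _ => (0 : ℝ) := by
    refine tendstoInMeasure_of_tendsto_eLpNorm (p := 1) one_ne_zero hFm aestronglyMeasurable_const ?_
    have h1 : ∀ n, eLpNorm (F n - fun _ => (0 : ℝ)) 1 (volume.restrict (K : Set E2)) =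
        ENNReal.ofReal (∫ x in K, F n x) := fun n => by
      have : (F n - fun _ => (0 : ℝ)) = F n := by ext; simp
      rw [this, eLpNorm_one_eq_lintegral_enorm, ← ofReal_integral_norm_eq_lintegral_enorm (hFi n)]
      simp only [Real.norm_eq_abs, abs_of_nonneg (hF0 n _)]
    simp only [h1]
    simpa using ENNReal.tendsto_ofReal hs
  obtain ⟨φ, hφ, hφt⟩ := hm.exists_seq_tendsto_ae
  refine ⟨φ, hφ, ?_⟩
  filter_upwards [(ae_restrict_iff' hK).1 hφt] with x hx hxK i
  have hpos : 0 < ψ x := lt_of_le_of_ne (hψ0 x) fun h0 => (hψz x).2 h0.symm hxK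
  have h1 := (hx (interior_subset hxK)).const_mul (ψ x)⁻¹
  rw [mul_zero] at h1
  rw [tendsto_iff_norm_sub_tendsto_zero]
  have h2 := h1.sqrt
  rw [Real.sqrt_zero] at h2
  refine squeeze_zero (fun n => norm_nonneg _) (fun n => ?_) h2
  refine Real.le_sqrt_of_sq_le ?_
  simp only [hF, Real.norm_eq_abs, sq_abs, inv_mul_cancel_left₀ hpos.ne', gr_of_mem hxK]
  fin_cases i
  · simpa using sq_nonneg _
  · simpa using sq_nonneg _

end Limit

lemma abs_mul_le_add {t x y : ℝ} (ht : 0 < t) : |x * y| ≤ t * x ^ 2 + y ^ 2 / (4 * t) := by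
  have h : y ^ 2 / (4 * t) = t * (y / (2 * t)) ^ 2 := by field_simp; ring
  have h2 : x * y = 2 * t * (x * (y / (2 * t))) := by field_simp
  rw [h, h2, abs_le]
  constructor <;> nlinarith only [ht, mul_nonneg ht.le (sq_nonneg (x - y / (2 * t))),
    mul_nonneg ht.le (sq_nonneg (x + y / (2 * t)))]

/-- The pointwise estimate behind the weighted Hessian bound. -/
lemma hessian_pointwise {κ F N A B δ ε : ℝ} (hκ : 0 < κ) (hκ' : κ ≤ 1 / 2) (hF : 0 ≤ F) (hN : 0 ≤ N)
    (hA : 0 ≤ A) (hB : 0 ≤ B) (hδ : 0 < δ) (hε : ε = δ ^ 2) (hδκ : 16 * δ ≤ κ)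
    {p₀ p₁ a b c k k₀ k₁ k₀₀ k₀₁ k₁₁ ω Ψ dΨ χ dχ g r q h₀ h₁ L X : ℝ}
    (hq : q = p₀ ^ 2 + p₁ ^ 2) (hX : X = -(p₀ * h₀ + p₁ * h₁)) (hg : g = X - ε * L - r) (hr : |r| ≤ ε)
    (hgF : |g| ≤ F) (hω : 0 ≤ ω) (hΨ : Ψ = (q + ε) * ω) (hχ : χ = ω + dΨ) (hdΨ : ω / 2 ≤ dΨ)
    (hdΨ' : dΨ ≤ ω) (hdχ : |dχ| * q ≤ (1 / 2 - κ) * χ) (hdχ' : |dχ| * δ ≤ χ) (hωε : ω * ε ≤ 1)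
    (hωp₀ : ω * |p₀| ≤ A) (hωp₁ : ω * |p₁| ≤ A) (hωQ : ω * (q + δ) ≤ A) (hQN : q + δ ≤ N)
    (hk0 : 0 ≤ k) (hk : k ≤ 1) (hk₀ : |k₀| ≤ B) (hk₁ : |k₁| ≤ B) (hk₀₀ : |k₀₀| ≤ B) (hk₀₁ : |k₀₁| ≤ B)
    (hk₁₁ : |k₁₁| ≤ B) :
    κ / 2 * (ω * (h₀ ^ 2 + h₁ ^ 2) * k ^ 2) + ε * (ω * L ^ 2 * k ^ 2) / 4 ≤
      k ^ 2 * (χ * (h₀ ^ 2 + h₁ ^ 2) + ε * ((ω / 2 + dΨ) * L ^ 2 +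
        ω / 2 * (a ^ 2 + 2 * b ^ 2 + c ^ 2))) + k ^ 2 * χ * r * L + 2 * g * dχ * X * k ^ 2
      - 2 * g * χ * k * (k₀ * p₀ + k₁ * p₁) + Ψ * k * (h₀ * k₀ + h₁ * k₁)
      + (dΨ * (2 * (p₀ * h₀ + p₁ * h₁)) * k * (p₀ * k₀ + p₁ * k₁) + Ψ * (p₀ * k₀ + p₁ * k₁) ^ 2
        + Ψ * k * (h₀ * k₀ + h₁ * k₁ + (k₀₀ * p₀ ^ 2 + 2 * k₀₁ * p₀ * p₁ + k₁₁ * p₁ ^ 2)))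
      + (9 + 8 * F * A * B + (40 / κ) * A * N * B ^ 2 + 4 * A * N * B) := by
  obtain ⟨H, hH⟩ : ∃ H, H = h₀ ^ 2 + h₁ ^ 2 := ⟨_, rfl⟩
  have hH0 : 0 ≤ H := by rw [hH]; positivity
  have hε0 : 0 ≤ ε := by rw [hε]; positivity
  have hq0 : 0 ≤ q := by rw [hq]; positivity
  have hQ0 : 0 ≤ q + δ := by linarith
  have hk2 : k ^ 2 ≤ 1 := pow_le_one₀ hk0 hk
  have hk20 := sq_nonneg k
  have hδ1 : δ ≤ 1 := by linarith
  have hεδ : ε ≤ δ := by rw [hε]; nlinarith only [hδ, hδ1]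
  have hχ2 : χ ≤ 2 * ω := by linarith
  have hχ0 : 0 ≤ χ := by linarith
  have hΨ0 : 0 ≤ Ψ := by rw [hΨ]; exact mul_nonneg (by linarith) hω
  have hΨQ : Ψ ≤ ω * (q + δ) := by
    rw [hΨ, mul_comm]; exact mul_le_mul_of_nonneg_left (by linarith) hω
  have hk₀s : k₀ ^ 2 ≤ B ^ 2 := sq_le_sq' (abs_le.1 hk₀).1 (abs_le.1 hk₀).2
  have hk₁s : k₁ ^ 2 ≤ B ^ 2 := sq_le_sq' (abs_le.1 hk₁).1 (abs_le.1 hk₁).2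
  have hωεk : ω * ε * k ^ 2 ≤ 1 := mul_le_one₀ hωε hk20 hk2
  have hωεk0 : 0 ≤ ω * ε * k ^ 2 := by positivity
  have hωk0 : 0 ≤ ω * k ^ 2 := by positivity
  have e1 : -(ε * (ω * L ^ 2 * k ^ 2) / 8 + 8) ≤ k ^ 2 * χ * r * L := by
    refine (neg_le_neg ?_).trans (neg_abs_le _)
    have h1 : |k ^ 2 * χ * r * L| ≤ k ^ 2 * (2 * ω) * ε * |L| := by
      rw [abs_mul, abs_mul, abs_of_nonneg (mul_nonneg hk20 hχ0)]
      gcongr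
    nlinarith only [h1, mul_nonneg hωεk0 (sq_nonneg (|L| - 8)), sq_abs L, hωεk]
  have hX2 : X ^ 2 ≤ q * H := by
    rw [hX, hq, hH]; nlinarith only [sq_nonneg (p₀ * h₁ - p₁ * h₀)]
  have e2 : -(k ^ 2 * ((1 - κ) * (χ * H)) + ε * (ω * L ^ 2 * k ^ 2) / 8 + 1 / 8) ≤
      2 * g * dχ * X * k ^ 2 := by
    refine (neg_le_neg ?_).trans (neg_abs_le _)
    have h1 : |g * X| ≤ (1 + κ) * X ^ 2 + ε ^ 2 * (1 + L ^ 2) / (2 * κ) := by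
      have h2 : g * X = X ^ 2 - X * (ε * L + r) := by rw [hg]; ring
      have h3 := abs_mul_le_add (x := X) (y := ε * L + r) hκ
      have h4 : (ε * L + r) ^ 2 / (4 * κ) ≤ ε ^ 2 * (1 + L ^ 2) / (2 * κ) := by
        rw [div_le_div_iff₀ (by positivity) (by positivity)]
        have h5 : (ε * L + r) ^ 2 ≤ 2 * (ε ^ 2 * (1 + L ^ 2)) := by
          nlinarith only [sq_nonneg (ε * L - r), sq_le_sq' (abs_le.1 hr).1 (abs_le.1 hr).2]
        nlinarith only [mul_le_mul_of_nonneg_right h5 hκ.le]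
      rw [h2]
      refine (abs_sub _ _).trans ?_
      rw [abs_of_nonneg (sq_nonneg X)]
      linarith
    have h2 : |dχ| * X ^ 2 ≤ (1 / 2 - κ) * χ * H := by
      nlinarith only [mul_le_mul_of_nonneg_left hX2 (abs_nonneg dχ),
        mul_le_mul_of_nonneg_right hdχ hH0]
    have h3 : |dχ| * ε ^ 2 ≤ κ / 8 * (ω * ε) := by
      have h4 : |dχ| * ε ^ 2 = |dχ| * δ * (δ * ε) := by rw [hε]; ring
      have h5 : |dχ| * δ * (δ * ε) ≤ 2 * ω * (δ * ε) :=
        mul_le_mul_of_nonneg_right (hdχ'.trans hχ2) (by positivity)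
      nlinarith only [h4, h5, mul_le_mul_of_nonneg_right hδκ (mul_nonneg hω hε0)]
    have h4 : |dχ| * (2 * |g * X|) ≤ (1 - κ) * (χ * H) + ω * ε * (1 + L ^ 2) / 8 := by
      have h5 := mul_le_mul_of_nonneg_left h1 (abs_nonneg dχ)
      have h6 : |dχ| * (ε ^ 2 * (1 + L ^ 2) / (2 * κ)) ≤ ω * ε * (1 + L ^ 2) / 16 := by
        rw [mul_div_assoc', div_le_div_iff₀ (by positivity) (by positivity)]
        nlinarith only [mul_le_mul_of_nonneg_right h3 (show 0 ≤ 1 + L ^ 2 by positivity)]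
      have h7 := mul_le_mul_of_nonneg_left h2 (show 0 ≤ 2 * (1 + κ) by linarith)
      have h8 : 0 ≤ κ ^ 2 * (χ * H) := by positivity
      nlinarith only [h5, h6, h7, h8]
    have h5 := mul_le_mul_of_nonneg_left h4 hk20
    have h6 : |2 * g * dχ * X * k ^ 2| = k ^ 2 * (|dχ| * (2 * |g * X|)) := by
      rw [show 2 * g * dχ * X * k ^ 2 = k ^ 2 * (dχ * (2 * (g * X))) by ring, abs_mul, abs_mul,
        abs_mul, abs_of_nonneg hk20, abs_two]
    rw [h6]
    nlinarith only [h5, hωεk]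
  have e3 : 2 * g * χ * k * (k₀ * p₀ + k₁ * p₁) ≤ 8 * F * A * B := by
    refine (le_abs_self _).trans ?_
    have h1 : |k₀ * p₀ + k₁ * p₁| ≤ B * |p₀| + B * |p₁| := by
      refine (abs_add_le _ _).trans ?_
      rw [abs_mul, abs_mul]
      gcongr
    have h2 : |2 * g * χ * k * (k₀ * p₀ + k₁ * p₁)| ≤ 2 * F * (2 * ω) * 1 * (B * |p₀| + B * |p₁|) := by
      rw [abs_mul, abs_mul, abs_mul, abs_mul, abs_two, abs_of_nonneg hχ0, abs_of_nonneg hk0]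
      gcongr
    have h3 : 0 ≤ 4 * F * B := by positivity
    nlinarith only [h2, mul_le_mul_of_nonneg_left hωp₀ h3, mul_le_mul_of_nonneg_left hωp₁ h3]
  have hωQ2 : ω * (q + δ) ^ 2 ≤ A * N := by
    have := mul_le_mul hωQ hQN hQ0 hA
    linarith
  have hC : (4 / κ) * (ω * (q + δ) ^ 2) * B ^ 2 ≤ (4 / κ) * (A * N) * B ^ 2 := by gcongr
  have hdiv : ∀ y : ℝ, y / (4 * (κ / 8)) = (2 / κ) * y := fun y => by field_simp; ring
  have h40 : 4 / κ = 2 * (2 / κ) := by ring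
  have e4 : -(κ / 8 * (ω * H * k ^ 2) + (4 / κ) * (A * N) * B ^ 2) ≤
      Ψ * k * (h₀ * k₀ + h₁ * k₁) := by
    refine (neg_le_neg ?_).trans (neg_abs_le _)
    have h1 := abs_mul_le_add (x := k * h₀) (y := (q + δ) * k₀) (show 0 < κ / 8 by positivity)
    have h2 := abs_mul_le_add (x := k * h₁) (y := (q + δ) * k₁) (show 0 < κ / 8 by positivity)
    rw [hdiv] at h1 h2
    have h3 : (q + δ) * |k * (h₀ * k₀ + h₁ * k₁)| ≤
        κ / 8 * (H * k ^ 2) + (4 / κ) * (q + δ) ^ 2 * B ^ 2 := by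
      have h4 : (q + δ) * |k * (h₀ * k₀ + h₁ * k₁)| =
          |k * h₀ * ((q + δ) * k₀) + k * h₁ * ((q + δ) * k₁)| := by
        rw [← abs_of_nonneg hQ0, ← abs_mul, abs_of_nonneg hQ0]
        congr 1; ring
      rw [h4]
      refine (abs_add_le _ _).trans ((add_le_add h1 h2).trans ?_)
      have h5 : 0 ≤ (2 / κ) * (q + δ) ^ 2 := by positivity
      rw [hH, h40]
      nlinarith only [mul_le_mul_of_nonneg_left hk₀s h5, mul_le_mul_of_nonneg_left hk₁s h5]
    have h4 : |Ψ * k * (h₀ * k₀ + h₁ * k₁)| ≤ ω * ((q + δ) * |k * (h₀ * k₀ + h₁ * k₁)|) := by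
      rw [mul_assoc, abs_mul, abs_of_nonneg hΨ0, ← mul_assoc]
      exact mul_le_mul_of_nonneg_right hΨQ (abs_nonneg _)
    have h5 := mul_le_mul_of_nonneg_left h3 hω
    linarith
  have e5 : -(κ / 4 * (ω * H * k ^ 2) + 2 * ((4 / κ) * (A * N) * B ^ 2)) ≤
      dΨ * (2 * (p₀ * h₀ + p₁ * h₁)) * k * (p₀ * k₀ + p₁ * k₁) := by
    refine (neg_le_neg ?_).trans (neg_abs_le _)
    obtain ⟨y, hy⟩ : ∃ y, y = p₀ * k₀ + p₁ * k₁ := ⟨_, rfl⟩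
    have hy2 : y ^ 2 ≤ 2 * B ^ 2 * q := by
      rw [hy, hq]
      nlinarith only [sq_nonneg (p₀ * k₁ - p₁ * k₀), mul_le_mul_of_nonneg_left hk₀s (sq_nonneg p₀),
        mul_le_mul_of_nonneg_left hk₁s (sq_nonneg p₀), mul_le_mul_of_nonneg_left hk₀s (sq_nonneg p₁),
        mul_le_mul_of_nonneg_left hk₁s (sq_nonneg p₁)]
    have h1 := abs_mul_le_add (x := k * h₀) (y := p₀ * y) (show 0 < κ / 8 by positivity)
    have h2 := abs_mul_le_add (x := k * h₁) (y := p₁ * y) (show 0 < κ / 8 by positivity)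
    rw [hdiv] at h1 h2
    have h3 : |k * h₀ * (p₀ * y) + k * h₁ * (p₁ * y)| ≤
        κ / 8 * (H * k ^ 2) + (4 / κ) * (q + δ) ^ 2 * B ^ 2 := by
      refine (abs_add_le _ _).trans ((add_le_add h1 h2).trans ?_)
      have h5 : (2 / κ) * (p₀ * y) ^ 2 + (2 / κ) * (p₁ * y) ^ 2 = (2 / κ) * q * y ^ 2 := by
        rw [hq]; ring
      have h6 : (2 / κ) * q * y ^ 2 ≤ (2 / κ) * q * (2 * B ^ 2 * q) := by gcongr
      have h7 : (4 / κ) * q ^ 2 * B ^ 2 ≤ (4 / κ) * (q + δ) ^ 2 * B ^ 2 := by gcongr; linarith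
      rw [h40] at h7 ⊢
      rw [hH]
      nlinarith only [h5, h6, h7]
    have h4 : |dΨ * (2 * (p₀ * h₀ + p₁ * h₁)) * k * (p₀ * k₀ + p₁ * k₁)| ≤
        2 * ω * |k * h₀ * (p₀ * y) + k * h₁ * (p₁ * y)| := by
      rw [← hy, show dΨ * (2 * (p₀ * h₀ + p₁ * h₁)) * k * y =
        2 * dΨ * (k * h₀ * (p₀ * y) + k * h₁ * (p₁ * y)) by ring, abs_mul,
        abs_of_nonneg (by linarith : 0 ≤ 2 * dΨ)]
      gcongr
    have h5 := mul_le_mul_of_nonneg_left h3 hω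
    linarith
  have e6 : 0 ≤ Ψ * (p₀ * k₀ + p₁ * k₁) ^ 2 := by positivity
  have e7 : -(2 * A * N * B) ≤ Ψ * k * (k₀₀ * p₀ ^ 2 + 2 * k₀₁ * p₀ * p₁ + k₁₁ * p₁ ^ 2) := by
    refine (neg_le_neg ?_).trans (neg_abs_le _)
    have h1 : |k₀₀ * p₀ ^ 2 + 2 * k₀₁ * p₀ * p₁ + k₁₁ * p₁ ^ 2| ≤ 2 * N * B := by
      have h2 : |k₀₀ * p₀ ^ 2 + 2 * k₀₁ * p₀ * p₁ + k₁₁ * p₁ ^ 2| ≤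
          B * p₀ ^ 2 + B * (2 * (|p₀| * |p₁|)) + B * p₁ ^ 2 := by
        refine (abs_add_three _ _ _).trans ?_
        rw [abs_mul, abs_mul k₁₁, mul_assoc, mul_assoc, abs_mul, abs_mul, abs_mul, abs_two,
          abs_of_nonneg (sq_nonneg p₀), abs_of_nonneg (sq_nonneg p₁)]
        have h9 : 2 * (|k₀₁| * (|p₀| * |p₁|)) ≤ B * (2 * (|p₀| * |p₁|)) := by
          nlinarith only [mul_le_mul_of_nonneg_right hk₀₁ (mul_nonneg (abs_nonneg p₀) (abs_nonneg p₁))]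
        gcongr
      have h3 : q * B ≤ N * B := mul_le_mul_of_nonneg_right (by linarith) hB
      have h5 : 2 * (|p₀| * |p₁|) ≤ q := by
        nlinarith only [hq, sq_nonneg (|p₀| - |p₁|), sq_abs p₀, sq_abs p₁]
      have h6 : B * p₀ ^ 2 + B * p₁ ^ 2 = q * B := by rw [hq]; ring
      linarith [mul_le_mul_of_nonneg_left h5 hB]
    rw [abs_mul, abs_of_nonneg (mul_nonneg hΨ0 hk0)]
    have h2 : Ψ * k ≤ A := by nlinarith only [hΨQ, hωQ, hΨ0, hk]
    calc _ ≤ A * (2 * N * B) := mul_le_mul h2 h1 (abs_nonneg _) hA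
      _ = _ := by ring
  have f1 : κ * (ω * H * k ^ 2) ≤ κ * (k ^ 2 * (χ * H)) := by
    have : ω ≤ χ := by linarith
    have := mul_le_mul_of_nonneg_right this (mul_nonneg hH0 hk20)
    nlinarith only [mul_le_mul_of_nonneg_left this hκ.le]
  have f2 : ε * (ω * L ^ 2 * k ^ 2) ≤ k ^ 2 * (ε * ((ω / 2 + dΨ) * L ^ 2 +
        ω / 2 * (a ^ 2 + 2 * b ^ 2 + c ^ 2))) := by
    have h1 : 0 ≤ ω / 2 * (a ^ 2 + 2 * b ^ 2 + c ^ 2) := by positivity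
    have h2 : ω * L ^ 2 ≤ (ω / 2 + dΨ) * L ^ 2 :=
      mul_le_mul_of_nonneg_right (by linarith) (sq_nonneg L)
    nlinarith only [mul_le_mul_of_nonneg_left (add_le_add h2 h1) (mul_nonneg hk20 hε0)]
  have f3 : 0 ≤ ε * (ω * L ^ 2 * k ^ 2) := by positivity
  have f4 : 0 ≤ A * N * B := by positivity
  have f5 : 4 * ((4 / κ) * (A * N) * B ^ 2) ≤ 40 / κ * A * N * B ^ 2 := by
    have : 0 ≤ 1 / κ * (A * N) * B ^ 2 := by positivity
    have h1 : 4 * ((4 / κ) * (A * N) * B ^ 2) = 16 * (1 / κ * (A * N) * B ^ 2) := by ring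
    have h2 : 40 / κ * A * N * B ^ 2 = 40 * (1 / κ * (A * N) * B ^ 2) := by ring
    rw [h1, h2]; linarith
  rw [← hH]
  linarith

section WeightedHessian

/-! ### Powers of positive smooth functions -/

/-- A real power of a positive smooth function. -/
def rp (Q : Sm) (hQ : ∀ x, 0 < Q x) (s : ℝ) : Sm :=
  ⟨fun x => Q x ^ s, Q.contDiff.rpow_const_of_ne fun x => (hQ x).ne'⟩

@[simp] lemma rp_apply (Q : Sm) (hQ : ∀ x, 0 < Q x) (s : ℝ) (x : E2) : rp Q hQ s x = Q x ^ s := rfl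

lemma D_rp (Q : Sm) (hQ : ∀ x, 0 < Q x) (s : ℝ) (i : Fin 2) :
    D i (rp Q hQ s) = cst s * rp Q hQ (s - 1) * D i Q := by
  refine Sm.ext fun x => ?_
  have h := (Q.hasFDerivAt x).rpow_const (p := s) (Or.inl (hQ x).ne')
  rw [D_apply']
  refine (congrArg (fun L : E2 →L[ℝ] ℝ => L (ev i)) h.fderiv).trans ?_
  simp [D_apply']

/-- The divergence identity behind the weighted Hessian bound. -/
lemma hessian_identity (v g φ ω Ψ dΨ χ dχ : Sm) (ε : ℝ) (hΨ : Ψ = (dd 1 v + cst ε) * ω)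
    (hχ : χ = ω + dΨ) (hDΨ : ∀ i, D i Ψ = dΨ * D i (dd 1 v))
    (hDχ : ∀ i, D i χ = dχ * D i (dd 1 v)) (x : E2)
    {p₀ p₁ a b c k k₀ k₁ k₀₀ k₀₁ k₁₁ r h₀ h₁ L X : ℝ} (hp₀ : p₀ = D 0 v x) (hp₁ : p₁ = D 1 v x)
    (ha : a = D 0 (D 0 v) x) (hb : b = D 0 (D 1 v) x) (hc : c = D 1 (D 1 v) x) (hk : k = φ x)
    (hk₀ : k₀ = D 0 φ x) (hk₁ : k₁ = D 1 φ x) (hk₀₀ : k₀₀ = D 0 (D 0 φ) x)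
    (hk₀₁ : k₀₁ = D 0 (D 1 φ) x) (hk₁₁ : k₁₁ = D 1 (D 1 φ) x) (hh₀ : h₀ = a * p₀ + b * p₁)
    (hh₁ : h₁ = b * p₀ + c * p₁) (hL : L = a + c) (hX : X = -(p₀ * h₀ + p₁ * h₁))
    (hg : g x = X - ε * L - r) :
    -((1 / 2) * D 0 (Ψ * φ ^ 2 * (D 1 (D 1 v) * D 0 v - D 0 (D 1 v) * D 1 v)) x +
      (1 / 2) * D 1 (Ψ * φ ^ 2 * (D 0 (D 0 v) * D 1 v - D 0 (D 1 v) * D 0 v)) x) -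
      g x * (D 0 (χ * φ ^ 2 * D 0 v) x + D 1 (χ * φ ^ 2 * D 1 v) x) +
      (D 0 (Ψ * φ * (D 0 v * D 0 φ + D 1 v * D 1 φ) * D 0 v) x +
       D 1 (Ψ * φ * (D 0 v * D 0 φ + D 1 v * D 1 φ) * D 1 v) x) =
      k ^ 2 * (χ x * (h₀ ^ 2 + h₁ ^ 2) + ε * ((ω x / 2 + dΨ x) * L ^ 2 +
        ω x / 2 * (a ^ 2 + 2 * b ^ 2 + c ^ 2))) + k ^ 2 * χ x * r * L + 2 * g x * dχ x * X * k ^ 2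
      - 2 * g x * χ x * k * (k₀ * p₀ + k₁ * p₁) + Ψ x * k * (h₀ * k₀ + h₁ * k₁)
      + (dΨ x * (2 * (p₀ * h₀ + p₁ * h₁)) * k * (p₀ * k₀ + p₁ * k₁) + Ψ x * (p₀ * k₀ + p₁ * k₁) ^ 2
        + Ψ x * k * (h₀ * k₀ + h₁ * k₁ + (k₀₀ * p₀ ^ 2 + 2 * k₀₁ * p₀ * p₁ + k₁₁ * p₁ ^ 2))) := by
  have e0 : D 0 (dd 1 v) x = 2 * (a * p₀ + b * p₁) := by
    simp [dd_one, pow_two, D_mul]; rw [ha, hb, hp₀, hp₁]; ring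
  have e1 : D 1 (dd 1 v) x = 2 * (b * p₀ + c * p₁) := by
    simp [dd_one, pow_two, D_mul]; rw [hc, hb, hp₀, hp₁]; ring
  have hr : r = X - ε * L - g x := by linarith
  have hωΨ : Ψ x = (p₀ ^ 2 + p₁ ^ 2 + ε) * ω x := by rw [hΨ, hp₀, hp₁]; simp [dd_one, cst_apply]
  have hχx : χ x = ω x + dΨ x := by rw [hχ]; simp
  simp only [pow_two, D_mul, map_add, map_sub, hDΨ, hDχ, D_comm10, Sm.add_apply, Sm.mul_apply,
    Sm.sub_apply, e0, e1, ← hp₀, ← hp₁, ← ha, ← hb, ← hc, ← hk, ← hk₀, ← hk₁, ← hk₀₀, ← hk₀₁, ← hk₁₁,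
    hωΨ, hχx]
  rw [hr, hX, hL, hh₀, hh₁]
  ring

/-- Bounds on the weight functions occurring in the weighted Hessian bound. -/
lemma weight_bounds {s q δ ε N : ℝ} (hs : -(1 / 2) < s) (hs0 : s < 0) (hq : 0 ≤ q) (hδ : 0 < δ)
    (hδ1 : δ ≤ 1) (hε : ε = δ ^ 2) (hN : 1 ≤ N) (hQN : q + δ ≤ N) {ω dΨ χ dχ : ℝ}
    (hω : ω = (q + δ) ^ s) (hdΨ : dΨ = ω + (q + ε) * (s * (q + δ) ^ (s - 1))) (hχ : χ = ω + dΨ)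
    (hdχ : dχ = 3 * (s * (q + δ) ^ (s - 1)) + (q + ε) * (s * ((s - 1) * (q + δ) ^ (s - 1 - 1)))) :
    0 ≤ ω ∧ ω / 2 ≤ dΨ ∧ dΨ ≤ ω ∧ |dχ| * q ≤ (1 / 2 - (1 / 2 + s)) * χ ∧ |dχ| * δ ≤ χ ∧ ω * ε ≤ 1 ∧
      ω * (q + δ) ≤ N ∧ ∀ p : ℝ, p ^ 2 ≤ q → ω * |p| ≤ N := by
  obtain ⟨Q, hQ⟩ : ∃ Q, Q = q + δ := ⟨_, rfl⟩
  have hQ0 : 0 < Q := by linarith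
  have hε0 : 0 ≤ ε := by rw [hε]; positivity
  have hεδ : ε ≤ δ := by rw [hε]; nlinarith only [hδ, hδ1]
  rw [← hQ] at hω hdΨ hdχ hQN ⊢
  obtain ⟨P, hP⟩ : ∃ P, P = Q ^ (s - 1 - 1) := ⟨_, rfl⟩
  have hP0 : 0 < P := hP ▸ Real.rpow_pos_of_pos hQ0 _
  have e1 : Q ^ (s - 1) = P * Q := by
    rw [hP, ← Real.rpow_add_one hQ0.ne']; ring_nf
  have e2 : ω = P * Q ^ 2 := by
    rw [pow_two, ← mul_assoc, ← e1, ← Real.rpow_add_one hQ0.ne', hω]; ring_nf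
  have hω0 : 0 ≤ ω := by rw [e2]; positivity
  rw [e1] at hdΨ hdχ
  rw [← hP] at hdχ
  have hqε : 0 ≤ q + ε := by linarith
  have hqQ : q + ε ≤ Q := by linarith
  have hPQ : 0 < P * Q := by positivity
  have b1 : ω / 2 ≤ dΨ := by
    rw [hdΨ, e2]
    nlinarith only [mul_nonneg (mul_nonneg hPQ.le (sub_nonneg.2 hqQ)) (neg_nonneg.2 hs0.le),
      mul_nonneg (mul_nonneg hPQ.le hQ0.le) (by linarith : 0 ≤ 1 / 2 + s)]
  have b2 : dΨ ≤ ω := by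
    rw [hdΨ]
    nlinarith only [mul_nonneg (mul_nonneg hPQ.le hqε) (neg_nonneg.2 hs0.le)]
  have hdχ2 : dχ = -(-s * (P * (3 * Q + (s - 1) * (q + ε)))) := by rw [hdχ]; ring
  have hY : 0 ≤ 3 * Q + (s - 1) * (q + ε) := by
    nlinarith only [hqQ, hQ0, hs, mul_nonneg hqε (by linarith : 0 ≤ s + 1 / 2)]
  have habs : |dχ| = -s * (P * (3 * Q + (s - 1) * (q + ε))) := by
    rw [hdχ2, abs_neg, abs_of_nonneg]
    exact mul_nonneg (by linarith) (mul_nonneg hP0.le hY)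
  have hχ2 : χ = P * (Q * (2 * Q + s * (q + ε))) := by rw [hχ, hdΨ, e2]; ring
  have b3 : |dχ| * q ≤ (1 / 2 - (1 / 2 + s)) * χ := by
    have h1 : (3 * Q + (s - 1) * (q + ε)) * q ≤ Q * (2 * Q + s * (q + ε)) := by
      rw [hQ]
      nlinarith only [mul_nonneg (mul_nonneg hq hδ.le) (by linarith : 0 ≤ 1 + s),
        mul_nonneg hq hε0, mul_nonneg hδ.le (sub_nonneg.2 hεδ),
        mul_nonneg (mul_nonneg hδ.le hε0) (by linarith : 0 ≤ 1 + s), mul_nonneg hδ.le hδ.le]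
    rw [habs, hχ2]
    nlinarith only [mul_le_mul_of_nonneg_left h1 (mul_nonneg (neg_nonneg.2 hs0.le) hP0.le)]
  have b4 : |dχ| * δ ≤ χ := by
    rw [habs, hχ2]
    have h1 : -s * ((3 * Q + (s - 1) * (q + ε)) * δ) ≤ Q * (2 * Q + s * (q + ε)) := by
      have h2 : 3 * Q + (s - 1) * (q + ε) ≤ 3 * Q := by
        nlinarith only [mul_nonneg hqε (by linarith : 0 ≤ 1 - s)]
      have h3 : (3 * Q + (s - 1) * (q + ε)) * δ ≤ 3 * Q * Q :=
        mul_le_mul h2 (by linarith) hδ.le (by linarith)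
      have h4 := mul_le_mul_of_nonneg_left h3 (by linarith : 0 ≤ -s)
      nlinarith only [h4, mul_nonneg (mul_nonneg hQ0.le (sub_nonneg.2 hqQ)) (neg_nonneg.2 hs0.le),
        mul_nonneg (mul_nonneg hQ0.le hQ0.le) (by linarith : 0 ≤ 1 / 2 + s)]
    nlinarith only [mul_le_mul_of_nonneg_left h1 hP0.le]
  have b5 : ω * ε ≤ 1 := by
    have h1 : ω ≤ δ ^ s := by
      rw [hω]; exact Real.rpow_le_rpow_of_nonpos hδ (by linarith) hs0.le
    have h2 : δ ^ s * ε = δ ^ (s + 2) := by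
      rw [hε, Real.rpow_add hδ, Real.rpow_two]
    calc ω * ε ≤ δ ^ s * ε := mul_le_mul_of_nonneg_right h1 hε0
      _ ≤ 1 := by rw [h2]; exact Real.rpow_le_one hδ.le hδ1 (by linarith)
  have hpow : ∀ t : ℝ, 0 ≤ t → t ≤ 1 → Q ^ t ≤ N := fun t h0 h1 =>
    (Real.rpow_le_rpow hQ0.le hQN h0).trans
      ((Real.rpow_le_rpow_of_exponent_le hN h1).trans (by rw [Real.rpow_one]))
  refine ⟨hω0, b1, b2, b3, b4, b5, ?_, fun p hp => ?_⟩
  · rw [hω, ← Real.rpow_add_one hQ0.ne']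
    exact hpow _ (by linarith) (by linarith)
  · have h1 : |p| ≤ Q ^ (1 / 2 : ℝ) := by
      rw [← Real.sqrt_eq_rpow]; exact Real.abs_le_sqrt (by linarith)
    calc ω * |p| ≤ ω * Q ^ (1 / 2 : ℝ) := mul_le_mul_of_nonneg_left h1 hω0
      _ = Q ^ (s + 1 / 2) := by rw [hω, ← Real.rpow_add hQ0]
      _ ≤ N := hpow _ (by linarith) (by linarith)

variable {K : TopologicalSpace.Compacts E2} {f u : E2 → ℝ} {M C₀ : ℝ} {ε : ℕ → ℝ} {v g : ℕ → Sm}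

lemma Sm.exists_abs_le (K : TopologicalSpace.Compacts E2) (w : Sm) : ∃ B, 0 ≤ B ∧ ∀ x ∈ K, |w x| ≤ B := by
  obtain ⟨B, hB⟩ := K.isCompact.exists_bound_of_continuousOn w.continuous.continuousOn
  exact ⟨max B 0, le_max_right _ _, fun x hx => (hB x hx).trans (le_max_left _ _)⟩

/-- The weighted Hessian bound, uniform along the approximation. -/
theorem Approx.weighted (h : Approx K f u M C₀ ε v g) {s : ℝ} (hs : -(1 / 2) < s) (hs0 : s < 0)
    (φ : Sm) (h0 : ∀ x, 0 ≤ φ x) (h1 : ∀ x, φ x ≤ 1) (hφ : ∀ x ∉ K, φ x = 0) :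
    ∃ C, ∀ (n : ℕ) (δ : ℝ), 0 < δ → ε n = δ ^ 2 → 16 * δ ≤ 1 / 2 + s →
      ∀ hQ : ∀ x, 0 < (dd 1 (v n) + cst δ : Sm) x,
        JS K (rp (dd 1 (v n) + cst δ) hQ s * dd 1 (dd 1 (v n)) * φ ^ 2) ≤ C ∧
        ε n * JS K (rp (dd 1 (v n) + cst δ) hQ s * Lap (v n) ^ 2 * φ ^ 2) ≤ C := by
  obtain ⟨F, hF, hFb⟩ := h.exists_bound
  obtain ⟨B1, hB1, hb1⟩ := Sm.exists_abs_le K (D 0 φ)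
  obtain ⟨B2, hB2, hb2⟩ := Sm.exists_abs_le K (D 1 φ)
  obtain ⟨B3, hB3, hb3⟩ := Sm.exists_abs_le K (D 0 (D 0 φ))
  obtain ⟨B4, hB4, hb4⟩ := Sm.exists_abs_le K (D 0 (D 1 φ))
  obtain ⟨B5, hB5, hb5⟩ := Sm.exists_abs_le K (D 1 (D 1 φ))
  obtain ⟨B, hB⟩ : ∃ B, B = B1 + B2 + B3 + B4 + B5 := ⟨_, rfl⟩
  obtain ⟨κ, hκ⟩ : ∃ κ, κ = 1 / 2 + s := ⟨_, rfl⟩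
  have hκ0 : 0 < κ := by linarith
  obtain ⟨N, hN⟩ : ∃ N, N = M ^ 2 + 1 := ⟨_, rfl⟩
  have hN1 : 1 ≤ N := by rw [hN]; linarith [sq_nonneg M]
  obtain ⟨c, hc⟩ : ∃ c, c = 9 + 8 * F * N * B + (40 / κ) * N * N * B ^ 2 + 4 * N * N * B := ⟨_, rfl⟩
  obtain ⟨C', hC'⟩ : ∃ C', C' = C₀ * (3 * N) + |JS K (cst c)| := ⟨_, rfl⟩
  have hC'0 : 0 ≤ C' := by rw [hC']; have := h.C₀_nonneg; positivity
  refine ⟨8 / κ * C' + 4 * C', fun n δ hδ hε hδκ hQ => ?_⟩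
  obtain ⟨w, hw⟩ : ∃ w, w = v n := ⟨_, rfl⟩
  have hlip := h.lip n
  have heq := h.eq n
  have hpair := h.pair n
  rw [← hw] at hQ hlip heq
  obtain ⟨e, he⟩ : ∃ e, e = ε n := ⟨_, rfl⟩
  obtain ⟨G, hG⟩ : ∃ G, G = g n := ⟨_, rfl⟩
  have hGF : ∀ x ∈ K, |G x| ≤ F := fun x hx => hG ▸ (hFb n x hx).1
  simp only [← hw]
  rw [← he] at heq hε ⊢
  rw [← hG] at heq hpair
  clear hFb
  obtain ⟨Q, hQd⟩ : ∃ Q, Q = dd 1 w + cst δ := ⟨_, rfl⟩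
  simp only [← hQd] at hQ ⊢
  have hQx : ∀ x, Q x = dd 1 w x + δ := fun x => by rw [hQd]; simp [cst_apply]
  have hDQ : ∀ i, D i Q = D i (dd 1 w) := fun i => by rw [hQd, map_add, D_cst, add_zero]
  obtain ⟨ω, hω⟩ : ∃ ω, ω = rp Q hQ s := ⟨_, rfl⟩
  obtain ⟨ω1, hω1⟩ : ∃ ω1, ω1 = cst s * rp Q hQ (s - 1) := ⟨_, rfl⟩
  obtain ⟨ω2, hω2⟩ : ∃ ω2, ω2 = cst s * (cst (s - 1) * rp Q hQ (s - 1 - 1)) := ⟨_, rfl⟩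
  have hDω : ∀ i, D i ω = ω1 * D i (dd 1 w) := fun i => by rw [hω, D_rp, hDQ, hω1]
  have hDω1 : ∀ i, D i ω1 = ω2 * D i (dd 1 w) := fun i => by
    rw [hω1, D_mul, D_cst, D_rp, hDQ, hω2]; ring
  obtain ⟨dΨ, hdΨ⟩ : ∃ dΨ, dΨ = ω + (dd 1 w + cst e) * ω1 := ⟨_, rfl⟩
  obtain ⟨Ψ, hΨ⟩ : ∃ Ψ, Ψ = (dd 1 w + cst e) * ω := ⟨_, rfl⟩
  obtain ⟨χ, hχ⟩ : ∃ χ, χ = ω + dΨ := ⟨_, rfl⟩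
  obtain ⟨dχ, hdχ⟩ : ∃ dχ, dχ = (ω1 + ω1 + ω1) + (dd 1 w + cst e) * ω2 := ⟨_, rfl⟩
  have hDΨ : ∀ i, D i Ψ = dΨ * D i (dd 1 w) := fun i => by
    rw [hΨ, D_mul, map_add, D_cst, hDω, hdΨ]; ring
  have hDχ : ∀ i, D i χ = dχ * D i (dd 1 w) := fun i => by
    rw [hχ, hdΨ, map_add, map_add, D_mul, map_add, D_cst, hDω, hDω1, hdχ]; ring
  have hδ1 : δ ≤ 1 := by linarith
  have hwt : ∀ x ∈ K, _ := fun x hx => weight_bounds (q := dd 1 w x) hs hs0 (dd_nonneg 1 w x) hδ hδ1 hε hN1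
    (by linarith [hlip x hx]) (ω := ω x) (dΨ := dΨ x) (χ := χ x) (dχ := dχ x)
    (by rw [hω, rp_apply, hQx]) (by rw [hdΨ, hω1, ← hQx]; simp [cst_apply])
    (by rw [hχ]; simp) (by rw [hdχ, hω1, hω2, ← hQx]; simp [cst_apply]; ring)
  obtain ⟨Z0, hZ0⟩ : ∃ Z, Z = Ψ * φ ^ 2 * (D 1 (D 1 w) * D 0 w - D 0 (D 1 w) * D 1 w) := ⟨_, rfl⟩
  obtain ⟨Z1, hZ1⟩ : ∃ Z, Z = Ψ * φ ^ 2 * (D 0 (D 0 w) * D 1 w - D 0 (D 1 w) * D 0 w) := ⟨_, rfl⟩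
  obtain ⟨Y0, hY0⟩ : ∃ Z, Z = χ * φ ^ 2 * D 0 w := ⟨_, rfl⟩
  obtain ⟨Y1, hY1⟩ : ∃ Z, Z = χ * φ ^ 2 * D 1 w := ⟨_, rfl⟩
  obtain ⟨V0, hV0⟩ : ∃ Z, Z = Ψ * φ * (D 0 w * D 0 φ + D 1 w * D 1 φ) * D 0 w := ⟨_, rfl⟩
  obtain ⟨V1, hV1⟩ : ∃ Z, Z = Ψ * φ * (D 0 w * D 0 φ + D 1 w * D 1 φ) * D 1 w := ⟨_, rfl⟩
  have hp2 : ∀ x, dd 1 w x = D 0 w x ^ 2 + D 1 w x ^ 2 := fun x => by rw [dd_one]; simp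
  have hmain : ∀ x ∈ K, (cst (κ / 8) * (ω * dd 1 (dd 1 w) * φ ^ 2) +
      cst (1 / 4) * (cst e * (ω * Lap w ^ 2 * φ ^ 2)) : Sm) x ≤
      (-(cst (1 / 2) * D 0 Z0 + cst (1 / 2) * D 1 Z1) - G * (D 0 Y0 + D 1 Y1) +
      (D 0 V0 + D 1 V1) + cst c : Sm) x := by
    intro x hx
    obtain ⟨w1, w2, w3, w4, w5, w6, w7, w8⟩ := hwt x hx
    have hB' : ∀ {y b : ℝ}, |y| ≤ b → b ≤ B → |y| ≤ B := fun h1 h2 => h1.trans h2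
    obtain ⟨r, hr⟩ : ∃ r, r = -(Tri w w w x + e * Lap w x + G x) := ⟨_, rfl⟩
    have hT : Tri w w w x = D 0 w x * (D 0 (D 0 w) x * D 0 w x + D 0 (D 1 w) x * D 1 w x) +
        D 1 w x * (D 0 (D 1 w) x * D 0 w x + D 1 (D 1 w) x * D 1 w x) := by
      simp [Tri]; ring
    have hL : Lap w x = D 0 (D 0 w) x + D 1 (D 1 w) x := by simp [Lap_def]
    have hgx : G x = -(D 0 w x * (D 0 (D 0 w) x * D 0 w x + D 0 (D 1 w) x * D 1 w x) +
        D 1 w x * (D 0 (D 1 w) x * D 0 w x + D 1 (D 1 w) x * D 1 w x)) -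
        e * (D 0 (D 0 w) x + D 1 (D 1 w) x) - r := by rw [hr, hT, hL]; ring
    have hid := hessian_identity w G φ ω Ψ dΨ χ dχ e hΨ hχ hDΨ hDχ x rfl rfl rfl rfl rfl rfl rfl rfl
      rfl rfl rfl rfl rfl rfl rfl hgx
    have hpt := hessian_pointwise (κ := κ) (F := F) (N := N) (A := N) (B := B) (δ := δ) (ε := e)
      (p₀ := D 0 w x) (p₁ := D 1 w x) (a := D 0 (D 0 w) x) (b := D 0 (D 1 w) x) (c := D 1 (D 1 w) x)
      (k := φ x) (k₀ := D 0 φ x) (k₁ := D 1 φ x) (k₀₀ := D 0 (D 0 φ) x) (k₀₁ := D 0 (D 1 φ) x)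
      (k₁₁ := D 1 (D 1 φ) x) (ω := ω x) (Ψ := Ψ x) (dΨ := dΨ x) (χ := χ x) (dχ := dχ x) (g := G x)
      (L := D 0 (D 0 w) x + D 1 (D 1 w) x)
      (r := r) (q := dd 1 w x) hκ0 (by linarith) hF (by linarith) (by linarith) (by linarith) hδ hε
      (by linarith) (hp2 x) rfl hgx (by rw [hr, abs_neg]; exact heq x hx) (hGF x hx) w1
      (by rw [hΨ]; simp [cst_apply]) (by rw [hχ]; simp) w2 w3 (by rw [hκ]; exact w4) w5 w6
      (w8 _ (by rw [hp2 x]; linarith [sq_nonneg (D 1 w x)]))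
      (w8 _ (by rw [hp2 x]; linarith [sq_nonneg (D 0 w x)])) w7 (by linarith [hlip x hx]) (h0 x) (h1 x)
      (hB' (hb1 x hx) (by linarith)) (hB' (hb2 x hx) (by linarith)) (hB' (hb3 x hx) (by linarith))
      (hB' (hb4 x hx) (by linarith)) (hB' (hb5 x hx) (by linarith))
    rw [← hid, ← hZ0, ← hZ1, ← hY0, ← hY1, ← hV0, ← hV1, ← hc] at hpt
    have e0 : D 0 (dd 1 w) x = 2 * (D 0 (D 0 w) x * D 0 w x + D 0 (D 1 w) x * D 1 w x) := by
      simp [dd_one, pow_two, D_mul]; ring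
    have e1 : D 1 (dd 1 w) x = 2 * (D 0 (D 1 w) x * D 0 w x + D 1 (D 1 w) x * D 1 w x) := by
      simp [dd_one, pow_two, D_mul]; ring
    have e2 : dd 1 (dd 1 w) x = D 0 (dd 1 w) x ^ 2 + D 1 (dd 1 w) x ^ 2 := by rw [dd_one (dd 1 w)]; simp
    simp only [Sm.add_apply, Sm.sub_apply, Sm.neg_apply, Sm.mul_apply, Sm.pow_apply, cst_apply]
    rw [e2, e0, e1, hL]
    refine le_trans (le_of_eq ?_) hpt
    ring
  have hInt := JS_mono hmain
  have hZ0' : JS K (D 0 Z0) = 0 := JS_D (fun x hx => by rw [hZ0]; simp [hφ x hx]) 0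
  have hZ1' : JS K (D 1 Z1) = 0 := JS_D (fun x hx => by rw [hZ1]; simp [hφ x hx]) 1
  have hV0' : JS K (D 0 V0) = 0 := JS_D (fun x hx => by rw [hV0]; simp [hφ x hx]) 0
  have hV1' : JS K (D 1 V1) = 0 := JS_D (fun x hx => by rw [hV1]; simp [hφ x hx]) 1
  have hY : |JS K (G * (D 0 Y0 + D 1 Y1))| ≤ C₀ * (3 * N) := by
    refine hpair Y0 Y1 (3 * N) (by linarith) (fun x hx => by rw [hY0]; simp [hφ x hx])
      (fun x hx => by rw [hY1]; simp [hφ x hx]) fun x => ?_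
    have hY0x : Y0 x = χ x * φ x ^ 2 * D 0 w x := by rw [hY0]; simp
    have hY1x : Y1 x = χ x * φ x ^ 2 * D 1 w x := by rw [hY1]; simp
    by_cases hx : x ∈ K
    · obtain ⟨w1, w2, w3, w4, w5, w6, w7, w8⟩ := hwt x hx
      have hχx : χ x = ω x + dΨ x := by rw [hχ]; simp
      have hφ2 : φ x ^ 2 ≤ 1 := pow_le_one₀ (h0 x) (h1 x)
      have hb : ∀ y : ℝ, y ^ 2 ≤ dd 1 w x → (χ x * φ x ^ 2 * y) ^ 2 ≤ (2 * N) ^ 2 := fun y hy => by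
        have : |χ x * φ x ^ 2 * y| ≤ 2 * N := by
          rw [abs_mul, abs_of_nonneg (mul_nonneg (by linarith) (sq_nonneg _))]
          have h3 : χ x * φ x ^ 2 ≤ 2 * ω x := by nlinarith only [w1, w2, w3, hχx, hφ2, sq_nonneg (φ x)]
          linarith [mul_le_mul_of_nonneg_right h3 (abs_nonneg y), w8 y hy]
        exact sq_le_sq' (abs_le.1 this).1 (abs_le.1 this).2
      rw [hY0x, hY1x]
      have h3 := hb (D 0 w x) (by rw [hp2 x]; linarith [sq_nonneg (D 1 w x)])
      have h4 := hb (D 1 w x) (by rw [hp2 x]; linarith [sq_nonneg (D 0 w x)])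
      nlinarith only [h3, h4, sq_nonneg N]
    · rw [hY0x, hY1x, hφ x hx]
      norm_num
      positivity
  have hsm : ∀ (a : ℝ) (y : Sm), JS K (cst a * y) = a * JS K y := fun a y => by
    rw [← smul_eq_cst, map_smul, smul_eq_mul]
  simp only [map_add, map_sub, map_neg, hsm, hZ0', hZ1', hV0', hV1'] at hInt
  have h2 : 0 ≤ JS K (ω * dd 1 (dd 1 w) * φ ^ 2) := JS_nonneg fun x => by
    have : 0 ≤ ω x := by rw [hω]; exact Real.rpow_nonneg (hQ x).le _
    have h3 := dd_nonneg 1 (dd 1 w) x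
    simp only [Sm.mul_apply, Sm.pow_apply]
    positivity
  have h3 : 0 ≤ e * JS K (ω * Lap w ^ 2 * φ ^ 2) := mul_nonneg (by rw [hε]; positivity) <|
    JS_nonneg fun x => by
      have : 0 ≤ ω x := by rw [hω]; exact Real.rpow_nonneg (hQ x).le _
      simp only [Sm.mul_apply, Sm.pow_apply]
      positivity
  rw [← hω]
  have hfin : κ / 8 * JS K (ω * dd 1 (dd 1 w) * φ ^ 2) + 1 / 4 * (e * JS K (ω * Lap w ^ 2 * φ ^ 2)) ≤ C' := by
    rw [hC']
    have := (abs_le.1 hY).1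
    have := le_abs_self (JS K (cst c))
    linarith
  have h8 : 0 ≤ 8 / κ * C' := by positivity
  constructor
  · have : JS K (ω * dd 1 (dd 1 w) * φ ^ 2) ≤ 8 / κ * C' := by
      rw [div_mul_eq_mul_div, le_div_iff₀ hκ0]; linarith
    linarith
  · have := mul_nonneg hκ0.le h2
    linarith

end WeightedHessian

section UniformBounds

/-! ### Consequences of the weighted Hessian bound -/

/-- The regularized squared gradient. -/
def rq (e : ℝ) (v : Sm) : Sm := dd 1 v + cst (Real.sqrt e)

lemma rq_apply (e : ℝ) (v : Sm) (x : E2) : rq e v x = dd 1 v x + Real.sqrt e := by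
  simp [rq, cst_apply]

lemma rq_pos {e : ℝ} (he : 0 < e) (v : Sm) (x : E2) : 0 < rq e v x := by
  rw [rq_apply]; exact add_pos_of_nonneg_of_pos (dd_nonneg 1 v x) (Real.sqrt_pos.2 he)

lemma D_rq (e : ℝ) (v : Sm) (i : Fin 2) : D i (rq e v) = D i (dd 1 v) := by
  rw [rq, map_add, D_cst, add_zero]

lemma two_mul_Tri_self (v : Sm) (x : E2) :
    2 * Tri v v v x = D 0 (dd 1 v) x * D 0 v x + D 1 (dd 1 v) x * D 1 v x := by
  simp [Tri, dd_one, pow_two, D_mul]; ring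

lemma Tri_self_sq_le (v : Sm) (x : E2) : Tri v v v x ^ 2 ≤ dd 1 (dd 1 v) x * dd 1 v x / 4 := by
  have h1 : ∀ w : Sm, dd 1 w x = D 0 w x ^ 2 + D 1 w x ^ 2 := fun w => by rw [dd_one]; simp
  have h2 := two_mul_Tri_self v x
  have h3 : Tri v v v x ^ 2 = (D 0 (dd 1 v) x * D 0 v x + D 1 (dd 1 v) x * D 1 v x) ^ 2 / 4 := by
    rw [← h2]; ring
  rw [h3, h1 (dd 1 v), h1 v]
  nlinarith only [sq_nonneg (D 0 (dd 1 v) x * D 1 v x - D 1 (dd 1 v) x * D 0 v x)]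

/-- Pointwise control of a negative power of the regularized gradient. -/
lemma rpow_rq_le {e s m γ : ℝ} (he : 0 < e) (he1 : e ≤ 1) (hs : -(1 / 2) < s) (hs0 : s < 0) (v : Sm)
    (x : E2) (hm : 0 < m) (hγ : m ≤ |γ|) (h : |Tri v v v x + e * Lap v x + γ| ≤ e) :
    rq e v x ^ (s - 1) ≤ 3 / m ^ 2 * (rq e v x ^ s * dd 1 (dd 1 v) x +
      e * (rq e v x ^ s * Lap v x ^ 2) + 1) := by
  obtain ⟨δ, hδ⟩ : ∃ δ, δ = Real.sqrt e := ⟨_, rfl⟩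
  have hδ0 : 0 < δ := hδ ▸ Real.sqrt_pos.2 he
  have hδ2 : δ ^ 2 = e := by rw [hδ, Real.sq_sqrt he.le]
  have hδ1 : δ ≤ 1 := by nlinarith only [hδ2, he1, hδ0]
  obtain ⟨Q, hQ⟩ : ∃ Q, Q = rq e v x := ⟨_, rfl⟩
  have hQe : Q = dd 1 v x + δ := by rw [hQ, rq_apply, hδ]
  have hq := dd_nonneg 1 v x
  have hQ0 : 0 < Q := hQ ▸ rq_pos he v x
  rw [← hQ]
  obtain ⟨P, hP⟩ : ∃ P, P = Q ^ (s - 1) := ⟨_, rfl⟩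
  have hP0 : 0 < P := hP ▸ Real.rpow_pos_of_pos hQ0 _
  have hPQ : Q ^ s = P * Q := by
    rw [hP, ← Real.rpow_add_one hQ0.ne']; ring_nf
  rw [hPQ, ← hP]
  obtain ⟨T, hT⟩ : ∃ T, T = Tri v v v x := ⟨_, rfl⟩
  obtain ⟨L, hL⟩ : ∃ L, L = Lap v x := ⟨_, rfl⟩
  obtain ⟨r, hr⟩ : ∃ r, r = T + e * L + γ := ⟨_, rfl⟩
  have hT2 := Tri_self_sq_le v x
  rw [← hT, ← hL, ← hr] at h
  rw [← hT] at hT2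
  rw [← hL]
  obtain ⟨H, hH⟩ : ∃ H, H = dd 1 (dd 1 v) x := ⟨_, rfl⟩
  have hH0 : 0 ≤ H := hH ▸ dd_nonneg 1 _ x
  rw [← hH] at hT2 ⊢
  have hγ2 : m ^ 2 ≤ 3 * (T ^ 2 + (e * L) ^ 2 + r ^ 2) := by
    have h1 : m ^ 2 ≤ γ ^ 2 := by rw [← sq_abs γ]; exact pow_le_pow_left₀ hm.le hγ 2
    have h2 : γ = r - T - e * L := by rw [hr]; ring
    rw [h2] at h1
    nlinarith only [h1, sq_nonneg (r + T), sq_nonneg (r + e * L), sq_nonneg (T - e * L)]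
  have h1 : P * T ^ 2 ≤ P * Q * H := by
    have : T ^ 2 ≤ Q * H := by
      have : dd 1 v x ≤ Q := by linarith
      nlinarith only [hT2, mul_le_mul_of_nonneg_left this hH0, mul_nonneg hH0 hQ0.le]
    nlinarith only [mul_le_mul_of_nonneg_left this hP0.le]
  have h2 : P * (e * L) ^ 2 ≤ e * (P * Q * L ^ 2) := by
    have h3 : e ≤ Q := by nlinarith only [hδ2, hδ1, hδ0, hQe, hq]
    have h4 : 0 ≤ P * e * L ^ 2 := by positivity
    nlinarith only [mul_le_mul_of_nonneg_left h3 h4]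
  have h3 : P * r ^ 2 ≤ 1 := by
    have h4 : P ≤ δ ^ (s - 1) := by
      rw [hP]; exact Real.rpow_le_rpow_of_nonpos hδ0 (by linarith) (by linarith)
    have h5 : r ^ 2 ≤ e ^ 2 := sq_le_sq' (abs_le.1 h).1 (abs_le.1 h).2
    calc P * r ^ 2 ≤ δ ^ (s - 1) * e ^ 2 := mul_le_mul h4 h5 (sq_nonneg _) (by positivity)
      _ = δ ^ (s - 1) * δ ^ (4 : ℝ) := by
        rw [← hδ2, ← pow_mul]; norm_num
      _ = δ ^ (s - 1 + 4) := (Real.rpow_add hδ0 _ _).symm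
      _ ≤ 1 := Real.rpow_le_one hδ0.le hδ1 (by linarith)
  rw [div_mul_eq_mul_div, le_div_iff₀ (by positivity)]
  nlinarith only [mul_le_mul_of_nonneg_left hγ2 hP0.le, h1, h2, h3]

variable {K K' : TopologicalSpace.Compacts E2} {f u : E2 → ℝ} {M C₀ : ℝ} {ε : ℕ → ℝ} {v g : ℕ → Sm}

lemma JS_le_of_cutoff {w φ : Sm} (hw : ∀ x, 0 ≤ w x) (hK : (K' : Set E2) ⊆ K)
    (hφ : ∀ x ∈ K', φ x = 1) : JS K' w ≤ JS K (w * φ ^ 2) := by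
  have h1 : JS K' w = ∫ x in (K' : Set E2), (w * φ ^ 2 : Sm) x :=
    setIntegral_congr_fun K'.isCompact.isClosed.measurableSet fun x hx => by simp [hφ x hx]
  rw [h1]
  refine setIntegral_mono_set (integrableOn_compacts (w * φ ^ 2).continuous) (.of_forall fun x => ?_)
    hK.eventuallyLE
  simp only [Sm.mul_apply, Sm.pow_apply]
  exact mul_nonneg (hw x) (sq_nonneg _)

/-- The bounds that hold eventually along an approximating sequence. -/
lemma Approx.eventually_bounds (h : Approx K f u M C₀ ε v g) {s m : ℝ} (hs : -(1 / 2) < s) (hs0 : s < 0)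
    (hK : (K' : Set E2) ⊆ interior K) (hm : 0 < m) (hfm : ∀ x ∈ K, m ≤ |f x|) :
    ∃ C, ∀ᶠ n in Filter.atTop,
      JS K' (rp (rq (ε n) (v n)) (rq_pos (h.pos n) _) s * dd 1 (dd 1 (v n))) ≤ C ∧
      ε n * JS K' (rp (rq (ε n) (v n)) (rq_pos (h.pos n) _) s * Lap (v n) ^ 2) ≤ C ∧
      JS K' (rp (rq (ε n) (v n)) (rq_pos (h.pos n) _) (s - 1)) ≤ C := by
  have hKK : (K' : Set E2) ⊆ K := hK.trans interior_subset
  obtain ⟨φ, h0, h1, hφ, hφ1⟩ := exists_cutoff (A := (interior (K : Set E2))ᶜ) (B := K')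
    isOpen_interior.isClosed_compl K'.isCompact.isClosed
    (Set.disjoint_left.2 fun x hx hx' => hx (hK hx'))
  have hφ0 : ∀ x ∉ K, φ x = 0 := fun x hx => (hφ x).1 fun hx' => hx (interior_subset hx')
  obtain ⟨C, hC⟩ := h.weighted hs hs0 φ h0 h1 hφ0
  have hδ : Filter.Tendsto (fun n => 16 * Real.sqrt (ε n)) Filter.atTop (nhds 0) := by
    have := (h.tendsto_ε.sqrt).const_mul 16
    simpa using this
  refine ⟨max C (3 / (m / 2) ^ 2 * (C + C + |JS K' 1|)), ?_⟩
  filter_upwards [hδ.eventually_le_const (show (0 : ℝ) < 1 / 2 + s by linarith),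
    (h.tendsto_ε).eventually_le_const zero_lt_one, Approx.tendsto_inv.eventually_le_const (show 0 < m / 2 by linarith)] with n hn hn1 hn2
  have hQ := rq_pos (h.pos n) (v n)
  obtain ⟨c1, c2⟩ := hC n (Real.sqrt (ε n)) (Real.sqrt_pos.2 (h.pos n))
    (Real.sq_sqrt (h.pos n).le).symm hn hQ
  have hpos : ∀ t x, 0 ≤ rp (rq (ε n) (v n)) hQ t x := fun t x => Real.rpow_nonneg (hQ x).le _
  have d1 : JS K' (rp (rq (ε n) (v n)) hQ s * dd 1 (dd 1 (v n))) ≤ C :=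
    (JS_le_of_cutoff (fun x => by
      rw [Sm.mul_apply]; exact mul_nonneg (hpos s x) (dd_nonneg _ _ _)) hKK hφ1).trans c1
  have d2 : ε n * JS K' (rp (rq (ε n) (v n)) hQ s * Lap (v n) ^ 2) ≤ C :=
    (mul_le_mul_of_nonneg_left (JS_le_of_cutoff (fun x => by
      rw [Sm.mul_apply, Sm.pow_apply]; exact mul_nonneg (hpos s x) (sq_nonneg _)) hKK hφ1)
        (h.pos n).le).trans c2
  refine ⟨d1.trans (le_max_left _ _), d2.trans (le_max_left _ _), le_max_of_le_right ?_⟩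
  have hsm : ∀ (a : ℝ) (y : Sm), JS K' (cst a * y) = a * JS K' y := fun a y => by
    rw [← smul_eq_cst, map_smul, smul_eq_mul]
  have h3 : JS K' (rp (rq (ε n) (v n)) hQ (s - 1)) ≤ JS K' (cst (3 / (m / 2) ^ 2) *
      (rp (rq (ε n) (v n)) hQ s * dd 1 (dd 1 (v n)) +
        cst (ε n) * (rp (rq (ε n) (v n)) hQ s * Lap (v n) ^ 2) + 1)) := by
    refine JS_mono fun x hx => ?_
    have hx' := hKK hx
    have hγ : m / 2 ≤ |g n x| := by
      have h4 := h.closef n x hx'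
      have h5 := abs_sub_abs_le_abs_sub (f x) (g n x)
      rw [abs_sub_comm] at h4
      linarith [hfm x hx']
    have := rpow_rq_le (h.pos n) hn1 hs hs0 (v n) x (by linarith) hγ (h.eq n x hx')
    simpa [cst_apply] using this
  refine h3.trans ?_
  rw [hsm, map_add, map_add, hsm]
  refine mul_le_mul_of_nonneg_left ?_ (by positivity)
  linarith [le_abs_self (JS K' 1)]

end UniformBounds

/-! ### Weak limits in `L²` -/

/-- Bounded sequences in `L²` have weak limits along a nonprincipal ultrafilter. -/
lemma exists_weak_limit {μ : Measure E2} {X : ℕ → E2 → ℝ} (hX : ∀ n, MemLp (X n) 2 μ) {C : ℝ}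
    (hC : ∀ n, ∫ x, X n x ^ 2 ∂μ ≤ C) : ∃ G : E2 → ℝ, Measurable G ∧ MemLp G 2 μ ∧
      ∀ y, MemLp y 2 μ → Filter.Tendsto (fun n => ∫ x, X n x * y x ∂μ) (Filter.hyperfilter ℕ)
        (nhds (∫ x, G x * y x ∂μ)) := by
  have hinner : ∀ {a b : E2 → ℝ} (ha : MemLp a 2 μ) (hb : MemLp b 2 μ),
      inner ℝ (ha.toLp a) (hb.toLp b) = ∫ x, a x * b x ∂μ := fun {a b} ha hb => by
    rw [L2.inner_def]
    refine integral_congr_ae ?_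
    filter_upwards [ha.coeFn_toLp, hb.coeFn_toLp] with x h1 h2
    rw [h1, h2]
    simp [mul_comm]
  let D (n : ℕ) : WeakDual ℝ (Lp ℝ 2 μ) :=
    StrongDual.toWeakDual (InnerProductSpace.toDual ℝ (Lp ℝ 2 μ) ((hX n).toLp (X n)))
  have hball : ∀ n, D n ∈ WeakDual.toStrongDual ⁻¹' closedBall (0 : StrongDual ℝ (Lp ℝ 2 μ)) (Real.sqrt C) := by
    intro n
    have h1 : ‖(hX n).toLp (X n)‖ ≤ Real.sqrt C := by
      refine Real.le_sqrt_of_sq_le ?_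
      rw [← real_inner_self_eq_norm_sq, hinner]
      simpa only [pow_two] using hC n
    rw [Set.mem_preimage, mem_closedBall_zero_iff]
    exact ((InnerProductSpace.toDual ℝ (Lp ℝ 2 μ)).norm_map _).trans_le h1
  obtain ⟨ℓ, -, hℓ⟩ := (WeakDual.isCompact_closedBall (𝕜 := ℝ) (0 : StrongDual ℝ (Lp ℝ 2 μ))
    (Real.sqrt C)).ultrafilter_le_nhds ((Filter.hyperfilter ℕ).map D)
    (by
      rw [Ultrafilter.coe_map, Filter.le_principal_iff]
      exact Filter.mem_map.2 (Filter.Eventually.of_forall hball))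
  obtain ⟨G, hG⟩ : ∃ G, G = (InnerProductSpace.toDual ℝ (Lp ℝ 2 μ)).symm (WeakDual.toStrongDual ℓ) := ⟨_, rfl⟩
  obtain ⟨G', hG', hGG⟩ := (Lp.memLp G).aestronglyMeasurable
  have hGm : MemLp G' 2 μ := (memLp_congr_ae hGG).1 (Lp.memLp G)
  refine ⟨G', hG'.measurable, hGm, fun y hy => ?_⟩
  have h1 : Filter.Tendsto (fun n => D n (hy.toLp y)) (Filter.hyperfilter ℕ) (nhds (ℓ (hy.toLp y))) :=
    ((WeakDual.eval_continuous (hy.toLp y)).tendsto ℓ).comp hℓ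
  have h2 : ℓ (hy.toLp y) = ∫ x, G' x * y x ∂μ := by
    have : hGm.toLp G' = G := (Lp.toLp_coeFn G (Lp.memLp G) ▸ (MemLp.toLp_eq_toLp_iff hGm (Lp.memLp G)).2 hGG.symm)
    rw [← hinner hGm hy, this, hG, InnerProductSpace.toDual_symm_apply]
    rfl
  rw [h2] at h1
  refine h1.congr fun n => ?_
  exact hinner (hX n) hy

/-- Products of weakly and boundedly a.e. convergent sequences. -/
lemma tendsto_weak_mul {μ : Measure E2} [IsFiniteMeasure μ] {X : ℕ → E2 → ℝ} {G : E2 → ℝ}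
    (hX : ∀ n, MemLp (X n) 2 μ) {C : ℝ} (hC : ∀ n, ∫ x, X n x ^ 2 ∂μ ≤ C)
    (hG : ∀ y, MemLp y 2 μ → Filter.Tendsto (fun n => ∫ x, X n x * y x ∂μ) (Filter.hyperfilter ℕ)
      (nhds (∫ x, G x * y x ∂μ))) {w : ℕ → E2 → ℝ} {z : E2 → ℝ} {B : ℝ}
    (hw : ∀ n, AEStronglyMeasurable (w n) μ) (hz : AEStronglyMeasurable z μ)
    (hwB : ∀ n, ∀ᵐ x ∂μ, |w n x| ≤ B)
    (hzB : ∀ᵐ x ∂μ, |z x| ≤ B) (hlim : ∀ᵐ x ∂μ, Filter.Tendsto (fun n => w n x) Filter.atTop (nhds (z x))) :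
    Filter.Tendsto (fun n => ∫ x, X n x * w n x ∂μ) (Filter.hyperfilter ℕ) (nhds (∫ x, G x * z x ∂μ)) := by
  have hmem : ∀ {a : E2 → ℝ}, AEStronglyMeasurable a μ → (∀ᵐ x ∂μ, |a x| ≤ B) → MemLp a 2 μ :=
    fun ha hb => MemLp.of_bound ha B hb
  have hwm := fun n => hmem (hw n) (hwB n)
  have hzm := hmem hz hzB
  have hsq : ∀ n, Integrable (fun x => (w n x - z x) ^ 2) μ := fun n => ((hwm n).sub hzm).integrable_sq
  have h0 : Filter.Tendsto (fun n => ∫ x, (w n x - z x) ^ 2 ∂μ) Filter.atTop (nhds 0) := by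
    have := tendsto_integral_of_dominated_convergence (μ := μ) (F := fun n x => (w n x - z x) ^ 2)
      (f := fun _ => (0 : ℝ)) (fun _ => (2 * B) ^ 2) (fun n => (hsq n).aestronglyMeasurable)
      (integrable_const _) (fun n => by
        filter_upwards [hwB n, hzB] with x h1 h2
        rw [Real.norm_eq_abs, abs_of_nonneg (sq_nonneg _), ← sq_abs]
        refine pow_le_pow_left₀ (abs_nonneg _) ?_ 2
        exact (abs_sub _ _).trans (by linarith))
      (by
        filter_upwards [hlim] with x hx
        simpa using (hx.sub_const (z x)).pow 2)
    simpa using this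
  have h1 : Filter.Tendsto (fun n => ∫ x, X n x * (w n x - z x) ∂μ) Filter.atTop (nhds 0) := by
    have hC0 : 0 ≤ C := (integral_nonneg fun x => sq_nonneg _).trans (hC 0)
    rw [Metric.tendsto_atTop]
    intro e he
    obtain ⟨t, ht⟩ : ∃ t, t = e / (2 * (C + 1)) := ⟨_, rfl⟩
    have ht0 : 0 < t := by rw [ht]; positivity
    obtain ⟨n₀, hn₀⟩ := Metric.tendsto_atTop.1 h0 (4 * t * (e / 2)) (by positivity)
    refine ⟨n₀, fun n hn => ?_⟩
    have h2 := hn₀ n hn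
    rw [Real.dist_eq, sub_zero, abs_of_nonneg (integral_nonneg fun x => sq_nonneg _)] at h2
    rw [Real.dist_eq, sub_zero]
    have h3 : |∫ x, X n x * (w n x - z x) ∂μ| ≤
        ∫ x, (t * X n x ^ 2 + (1 / (4 * t)) * (w n x - z x) ^ 2) ∂μ := by
      refine (abs_integral_le_integral_abs).trans (integral_mono ?_ ?_ fun x => ?_)
      · exact ((hX n).integrable_mul ((hwm n).sub hzm)).abs
      · exact ((hX n).integrable_sq.const_mul t).add ((hsq n).const_mul _)
      · refine (abs_mul_le_add ht0).trans (le_of_eq ?_); ring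
    rw [integral_add ((hX n).integrable_sq.const_mul t) ((hsq n).const_mul _), integral_const_mul,
      integral_const_mul] at h3
    have h4 : t * ∫ x, X n x ^ 2 ∂μ ≤ t * C := mul_le_mul_of_nonneg_left (hC n) ht0.le
    have h5 : t * C ≤ e / 2 := by
      have : t * (C + 1) = e / 2 := by rw [ht]; field_simp
      nlinarith only [this, ht0]
    have h6 : (1 / (4 * t)) * ∫ x, (w n x - z x) ^ 2 ∂μ < e / 2 := by
      rw [div_mul_eq_mul_div, div_lt_iff₀ (by positivity)]; linarith
    linarith
  have h2 := (hG z hzm).add (h1.mono_left Nat.hyperfilter_le_atTop)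
  rw [add_zero] at h2
  refine h2.congr fun n => ?_
  refine (integral_add ((hX n).integrable_mul hzm) ((hX n).integrable_mul ((hwm n).sub hzm))).symm.trans
    (integral_congr_ae (.of_forall fun x => ?_))
  simp only [Pi.sub_apply, Pi.mul_apply]
  ring

/-! ### Passing to the limit -/

/-- Negative powers and Fatou's lemma: a uniform bound forces positivity of the limit. -/
lemma integrable_rpow_of_tendsto {μ : Measure E2} {Q : ℕ → E2 → ℝ} {q : E2 → ℝ} {t C : ℝ} (ht : t < 0)
    (hQ : ∀ n x, 0 < Q n x) (hQm : ∀ n, Measurable (Q n)) (hqm : Measurable q)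
    (hInt : ∀ n, Integrable (fun x => Q n x ^ t) μ) (hC : ∀ n, ∫ x, Q n x ^ t ∂μ ≤ C)
    (hlim : ∀ᵐ x ∂μ, Filter.Tendsto (fun n => Q n x) Filter.atTop (nhds (q x))) :
    (∀ᵐ x ∂μ, 0 < q x) ∧ Integrable (fun x => q x ^ t) μ := by
  obtain ⟨F, hF⟩ : ∃ F : ℕ → E2 → ℝ≥0∞, F = fun n x => ENNReal.ofReal (Q n x ^ t) := ⟨_, rfl⟩
  have hFm : ∀ n, Measurable (F n) := fun n => by
    rw [hF]; exact ((hQm n).pow_const t).ennreal_ofReal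
  have hFC : ∀ n, ∫⁻ x, F n x ∂μ ≤ ENNReal.ofReal C := fun n => by
    rw [hF, ← ofReal_integral_eq_lintegral_ofReal (hInt n) (.of_forall fun x => (Real.rpow_pos_of_pos (hQ n x) t).le)]
    exact ENNReal.ofReal_le_ofReal (hC n)
  have hfatou : ∫⁻ x, Filter.liminf (fun n => F n x) Filter.atTop ∂μ ≤ ENNReal.ofReal C :=
    (lintegral_liminf_le hFm).trans ((Filter.liminf_le_liminf (.of_forall hFC)).trans (by simp))
  have htop := ae_lt_top (Measurable.liminf hFm) (hfatou.trans_lt ENNReal.ofReal_lt_top).ne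
  have hpos : ∀ᵐ x ∂μ, 0 < q x := by
    filter_upwards [hlim, htop] with x hx hfin
    refine (ge_of_tendsto' hx fun n => (hQ n x).le).lt_of_ne fun h0 => ?_
    rw [← h0] at hx
    have h1 : Filter.Tendsto (fun n => Q n x) Filter.atTop (nhdsWithin 0 (Set.Ioi 0)) :=
      tendsto_nhdsWithin_iff.2 ⟨hx, .of_forall fun n => hQ n x⟩
    have h2 := ENNReal.tendsto_ofReal_atTop.comp ((tendsto_rpow_neg_nhdsGT_zero ht).comp h1)
    have h3 : Filter.liminf (fun n => F n x) Filter.atTop = ⊤ := by rw [hF]; exact h2.liminf_eq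
    exact hfin.ne h3
  refine ⟨hpos, (hqm.pow_const t).aestronglyMeasurable, ?_⟩
  rw [hasFiniteIntegral_iff_norm]
  refine lt_of_le_of_lt (le_of_eq_of_le (lintegral_congr_ae ?_) hfatou) ENNReal.ofReal_lt_top
  filter_upwards [hlim, hpos] with x hx hq
  have h1 := (ENNReal.continuous_ofReal.tendsto _).comp (hx.rpow_const (p := t) (Or.inl hq.ne'))
  have h3 : Filter.liminf (fun n => F n x) Filter.atTop = ENNReal.ofReal (q x ^ t) := by
    rw [hF]; exact h1.liminf_eq
  rw [h3, Real.norm_of_nonneg (Real.rpow_pos_of_pos hq t).le]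

lemma rpow_le_mul_rpow {q N t t' : ℝ} (hq : 0 < q) (hqN : q ≤ N) (htt : t ≤ t') :
    q ^ t' ≤ N ^ (t' - t) * q ^ t := by
  have h1 : q ^ t' = q ^ (t' - t) * q ^ t := by rw [← Real.rpow_add hq]; ring_nf
  rw [h1]
  exact mul_le_mul_of_nonneg_right (Real.rpow_le_rpow hq.le hqN (by linarith)) (Real.rpow_nonneg hq.le _)

lemma integrable_rpow_of_le {μ : Measure E2} {q : E2 → ℝ} {N t t' : ℝ} (htt : t ≤ t') (hqm : Measurable q)
    (hq : ∀ᵐ x ∂μ, 0 < q x) (hN : ∀ᵐ x ∂μ, q x ≤ N) (hi : Integrable (fun x => q x ^ t) μ) :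
    Integrable (fun x => q x ^ t') μ := by
  refine (hi.const_mul (N ^ (t' - t))).mono' (hqm.pow_const t').aestronglyMeasurable ?_
  filter_upwards [hq, hN] with x h1 h2
  rw [Real.norm_of_nonneg (Real.rpow_nonneg h1.le _)]
  exact rpow_le_mul_rpow h1 h2 htt

/-- Weak limit of a scalar identity. -/
lemma weak_identity {μ : Measure E2} [IsFiniteMeasure μ] {X w : Fin 2 → ℕ → E2 → ℝ} {G z : Fin 2 → E2 → ℝ}
    {b e : ℕ → E2 → ℝ} {β : E2 → ℝ} {B C : ℝ}
    (hX : ∀ i n, MemLp (X i n) 2 μ) (hC : ∀ i n, ∫ x, X i n x ^ 2 ∂μ ≤ C) (hGm : ∀ i, MemLp (G i) 2 μ)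
    (hG : ∀ i y, MemLp y 2 μ → Filter.Tendsto (fun n => ∫ x, X i n x * y x ∂μ) (Filter.hyperfilter ℕ)
      (nhds (∫ x, G i x * y x ∂μ)))
    (hw : ∀ i n, Measurable (w i n)) (hz : ∀ i, Measurable (z i))
    (hwB : ∀ i n, ∀ᵐ x ∂μ, |w i n x| ≤ B) (hzB : ∀ i, ∀ᵐ x ∂μ, |z i x| ≤ B)
    (hwz : ∀ i, ∀ᵐ x ∂μ, Filter.Tendsto (fun n => w i n x) Filter.atTop (nhds (z i x)))
    (hb : ∀ n, Measurable (b n)) (hβ : AEStronglyMeasurable β μ)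
    (hbB : ∀ n, ∀ᵐ x ∂μ, |b n x| ≤ B) (hβB : ∀ᵐ x ∂μ, |β x| ≤ B)
    (hbβ : ∀ᵐ x ∂μ, Filter.Tendsto (fun n => b n x) Filter.atTop (nhds (β x)))
    (he : ∀ n, Integrable (e n) μ)
    (he0 : Filter.Tendsto (fun n => ∫ x, |e n x| ∂μ) Filter.atTop (nhds 0))
    (heq : ∀ n, ∀ᵐ x ∂μ, X 0 n x * w 0 n x + X 1 n x * w 1 n x = b n x + e n x) :
    ∀ᵐ x ∂μ, G 0 x * z 0 x + G 1 x * z 1 x = β x := by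
  have hzm : ∀ i, MemLp (z i) 2 μ := fun i => MemLp.of_bound (hz i).aestronglyMeasurable B (hzB i)
  have hwm : ∀ i n, MemLp (w i n) 2 μ := fun i n => MemLp.of_bound (hw i n).aestronglyMeasurable B (hwB i n)
  have hbi : ∀ n, Integrable (b n) μ := fun n => Integrable.of_bound (hb n).aestronglyMeasurable B (hbB n)
  have hβi : Integrable β μ := Integrable.of_bound hβ B hβB
  have hGz : ∀ i, Integrable (fun x => G i x * z i x) μ := fun i => (hGm i).integrable_mul (hzm i)
  have hXw : ∀ i n, Integrable (fun x => X i n x * w i n x) μ := fun i n => (hX i n).integrable_mul (hwm i n)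
  have hle := Nat.hyperfilter_le_atTop
  suffices h : ∀ᵐ x ∂μ, (G 0 x * z 0 x + G 1 x * z 1 x) - β x = 0 from h.mono fun x hx => sub_eq_zero.1 hx
  refine Integrable.ae_eq_zero_of_forall_setIntegral_eq_zero (((hGz 0).add (hGz 1)).sub hβi) fun S hS _ => ?_
  have hset : ∀ i, Filter.Tendsto (fun n => ∫ x in S, X i n x * w i n x ∂μ) (Filter.hyperfilter ℕ)
      (nhds (∫ x in S, G i x * z i x ∂μ)) := fun i => by
    have hind : ∀ a c : E2 → ℝ, ∫ x, a x * S.indicator c x ∂μ = ∫ x in S, a x * c x ∂μ := fun a c => by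
      rw [← integral_indicator hS]
      refine integral_congr_ae (.of_forall fun x => ?_)
      by_cases hx : x ∈ S <;> simp [hx]
    have hindB : ∀ c : E2 → ℝ, (∀ᵐ x ∂μ, |c x| ≤ B) → ∀ᵐ x ∂μ, |S.indicator c x| ≤ B := fun c hc =>
      hc.mono fun x hx => by
        by_cases hxS : x ∈ S
        · rwa [Set.indicator_of_mem hxS]
        · rw [Set.indicator_of_notMem hxS, abs_zero]; exact (abs_nonneg _).trans hx
    have := tendsto_weak_mul (hX i) (hC i) (hG i) (w := fun n => S.indicator (w i n)) (z := S.indicator (z i))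
      (fun n => ((hw i n).indicator hS).aestronglyMeasurable) ((hz i).indicator hS).aestronglyMeasurable
      (fun n => hindB _ (hwB i n)) (hindB _ (hzB i))
      ((hwz i).mono fun x hx => by
        by_cases hxS : x ∈ S
        · simpa [hxS] using hx
        · simp [hxS])
    simpa only [hind] using this
  have hbl : Filter.Tendsto (fun n => ∫ x in S, b n x ∂μ) Filter.atTop (nhds (∫ x in S, β x ∂μ)) :=
    tendsto_integral_of_dominated_convergence (fun _ => B) (fun n => (hb n).aestronglyMeasurable)
      (integrable_const _) (fun n => ae_restrict_of_ae (hbB n)) (ae_restrict_of_ae hbβ)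
  have hel : Filter.Tendsto (fun n => ∫ x in S, e n x ∂μ) Filter.atTop (nhds 0) :=
    squeeze_zero_norm (fun n => (norm_integral_le_integral_norm _).trans
      (setIntegral_le_integral (he n).abs (.of_forall fun x => abs_nonneg _))) he0
  have h1 := ((hset 0).add (hset 1))
  have h2 := (hbl.add hel).mono_left hle
  have h3 : ∀ n, ∫ x in S, X 0 n x * w 0 n x ∂μ + ∫ x in S, X 1 n x * w 1 n x ∂μ =
      ∫ x in S, b n x ∂μ + ∫ x in S, e n x ∂μ := fun n => by
    rw [← integral_add (hXw 0 n).integrableOn (hXw 1 n).integrableOn,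
      ← integral_add (hbi n).integrableOn (he n).integrableOn]
    exact integral_congr_ae (ae_restrict_of_ae (heq n))
  simp only [h3] at h1
  have h4 := tendsto_nhds_unique h1 h2
  rw [integral_sub, integral_add (hGz 0).integrableOn (hGz 1).integrableOn, h4]
  · ring
  · exact ((hGz 0).add (hGz 1)).integrableOn
  · exact hβi.integrableOn

section LocalResult

lemma rpow_le_of_cauchy {α q f p₀ p₁ G₀ G₁ : ℝ} (hα : 1 ≤ α) (hq : 0 < q) (hf : 0 < |f|) (hp : p₀ ^ 2 + p₁ ^ 2 = q)
    (h : G₀ * (q * p₀) + G₁ * (q * p₁) = -α * (q ^ (α / 2) * f)) :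
    q ^ (α - 3) ≤ 1 / α * (1 / f ^ 2) * (G₀ ^ 2 + G₁ ^ 2) := by
  have hα0 : 0 < α := by linarith
  have hf2 : 0 < f ^ 2 := by rw [← sq_abs]; positivity
  have e1 : (q ^ (α / 2)) ^ 2 = q ^ (α - 3) * q ^ 3 := by
    rw [← Real.rpow_natCast (q ^ (α / 2)), ← Real.rpow_natCast q, ← Real.rpow_mul hq.le, ← Real.rpow_add hq]
    congr 1; push_cast; ring
  obtain ⟨R, hR⟩ : ∃ R, R = q ^ (α - 3) := ⟨_, rfl⟩
  have hR0 : 0 < R := hR ▸ Real.rpow_pos_of_pos hq _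
  rw [← hR] at e1 ⊢
  have e2 : α ^ 2 * (R * q ^ 3) * f ^ 2 = q ^ 2 * (G₀ * p₀ + G₁ * p₁) ^ 2 := by
    rw [← e1]
    have : (G₀ * (q * p₀) + G₁ * (q * p₁)) ^ 2 = (-α * (q ^ (α / 2) * f)) ^ 2 := by rw [h]
    linear_combination -this
  have e3 : (G₀ * p₀ + G₁ * p₁) ^ 2 ≤ (G₀ ^ 2 + G₁ ^ 2) * q := by
    rw [← hp]; nlinarith only [sq_nonneg (G₀ * p₁ - G₁ * p₀)]
  have e4 : q ^ 3 * (α ^ 2 * R * f ^ 2) ≤ q ^ 3 * (G₀ ^ 2 + G₁ ^ 2) := by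
    have := mul_le_mul_of_nonneg_left e3 (sq_nonneg q)
    calc q ^ 3 * (α ^ 2 * R * f ^ 2) = α ^ 2 * (R * q ^ 3) * f ^ 2 := by ring
      _ ≤ q ^ 2 * ((G₀ ^ 2 + G₁ ^ 2) * q) := by rw [e2]; exact this
      _ = _ := by ring
  have e5 := le_of_mul_le_mul_left e4 (by positivity)
  have e6 : α * R * f ^ 2 ≤ α ^ 2 * R * f ^ 2 := by
    have := mul_le_mul_of_nonneg_left hα (by positivity : 0 ≤ α * R * f ^ 2)
    calc α * R * f ^ 2 = α * R * f ^ 2 * 1 := by ring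
      _ ≤ α * R * f ^ 2 * α := this
      _ = _ := by ring
  rw [one_div_mul_one_div, one_div_mul_eq_div, le_div_iff₀ (by positivity)]
  linarith

variable {K K' : TopologicalSpace.Compacts E2} {f u : E2 → ℝ} {M C₀ : ℝ} {ε : ℕ → ℝ} {v g : ℕ → Sm}

lemma Approx.eps_le_one (h : Approx K f u M C₀ ε v g) (n : ℕ) : ε n ≤ 1 := by
  refine (h.le n).trans ?_
  rw [div_le_one (by positivity)]; linarith [(n.cast_nonneg : (0 : ℝ) ≤ n)]

lemma Approx.rq_le (h : Approx K f u M C₀ ε v g) (n : ℕ) {x : E2} (hx : x ∈ K) :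
    rq (ε n) (v n) x ≤ M ^ 2 + 1 := by
  rw [rq_apply]
  exact add_le_add (h.lip n x hx) (Real.sqrt_le_one.2 (h.eps_le_one n))

lemma Approx.tendsto_rq (h : Approx K f u M C₀ ε v g) {x : E2}
    (hx : ∀ i, Filter.Tendsto (fun n => D i (v n) x) Filter.atTop (nhds (pd i u x))) :
    Filter.Tendsto (fun n => rq (ε n) (v n) x) Filter.atTop (nhds (gradSq u x)) := by
  have h1 := (((hx 0).pow 2).add ((hx 1).pow 2)).add h.tendsto_ε.sqrt
  simp only [Real.sqrt_zero, add_zero] at h1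
  rw [gradSq, Fin.sum_univ_two]
  refine h1.congr fun n => ?_
  simp [rq_apply, dd_one]

/-- Pointwise bound for the square of the gradient of `Q ^ (α / 2)`. -/
lemma D_rp_sq_le {e α s N : ℝ} (he : 0 < e) (v : Sm) (x : E2) (hN : rq e v x ≤ N) (hsα : s + 2 ≤ α) (i : Fin 2) :
    (D i (rp (rq e v) (rq_pos he v) (α / 2)) x) ^ 2 ≤
      α ^ 2 / 4 * N ^ (α - 2 - s) * (rq e v x ^ s * dd 1 (dd 1 v) x) := by
  have hQ := rq_pos he v x
  have h1 : (D i (rp (rq e v) (rq_pos he v) (α / 2)) x) ^ 2 =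
      α ^ 2 / 4 * rq e v x ^ (α - 2) * (D i (dd 1 v) x) ^ 2 := by
    have : (rq e v x ^ (α / 2 - 1)) ^ 2 = rq e v x ^ (α - 2) := by
      rw [← Real.rpow_natCast (rq e v x ^ (α / 2 - 1)), ← Real.rpow_mul hQ.le]
      congr 1; push_cast; ring
    rw [D_rp, D_rq, Sm.mul_apply, Sm.mul_apply, cst_apply, rp_apply, mul_pow, mul_pow, this]
    ring
  have h2 := rpow_le_mul_rpow (t := s) (t' := α - 2) hQ hN (by linarith)
  have h3 := sq_le_dd_one (dd 1 v) i x
  have h4 : 0 ≤ N ^ (α - 2 - s) * rq e v x ^ s := (Real.rpow_nonneg hQ.le _).trans h2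
  rw [h1]
  calc α ^ 2 / 4 * rq e v x ^ (α - 2) * (D i (dd 1 v) x) ^ 2
      ≤ α ^ 2 / 4 * (N ^ (α - 2 - s) * rq e v x ^ s) * dd 1 (dd 1 v) x := by gcongr
    _ = _ := by ring

/-- The scalar identity satisfied by the gradient of `Q ^ (α / 2)`. -/
lemma D_rp_mul_D {e : ℝ} (he : 0 < e) (α : ℝ) (v : Sm) (x : E2) :
    D 0 (rp (rq e v) (rq_pos he v) (α / 2)) x * (rq e v x * D 0 v x) +
      D 1 (rp (rq e v) (rq_pos he v) (α / 2)) x * (rq e v x * D 1 v x) =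
      α * (rq e v x ^ (α / 2) * Tri v v v x) := by
  have hQ := rq_pos he v x
  have h1 : rq e v x ^ (α / 2) = rq e v x ^ (α / 2 - 1) * rq e v x := by
    rw [Real.rpow_sub_one hQ.ne', div_mul_cancel₀ _ hQ.ne']
  have h2 := two_mul_Tri_self v x
  simp only [D_rp, D_rq, Sm.mul_apply, cst_apply, rp_apply, h1]
  linear_combination -(α / 2 * rq e v x ^ (α / 2 - 1) * rq e v x) * h2

/-- The error term in the scalar identity is small. -/
lemma abs_error_le {e α s N : ℝ} (he : 0 < e) (he1 : e ≤ 1) (hα : 0 ≤ α) (hs : s ≤ α) (hN1 : 1 ≤ N) (v : Sm) (x : E2) (hN : rq e v x ≤ N) {γ : ℝ}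
    (h : |Tri v v v x + e * Lap v x + γ| ≤ e) :
    |rq e v x ^ (α / 2) * (Tri v v v x + γ)| ≤
      Real.sqrt e * (N ^ (α / 2) + N ^ ((α - s) / 2) * (1 + e * (rq e v x ^ s * Lap v x ^ 2))) := by
  have hQ := rq_pos he v x
  obtain ⟨Q, hQe⟩ : ∃ Q, Q = rq e v x := ⟨_, rfl⟩
  rw [← hQe] at hQ hN ⊢
  obtain ⟨δ, hδ⟩ : ∃ δ, δ = Real.sqrt e := ⟨_, rfl⟩
  have hδ0 : 0 ≤ δ := hδ ▸ Real.sqrt_nonneg e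
  have hδe : e = δ ^ 2 := by rw [hδ, Real.sq_sqrt he.le]
  have hδ1 : δ ≤ 1 := by rw [hδ]; exact Real.sqrt_le_one.2 he1
  rw [← hδ]
  obtain ⟨L, hL⟩ : ∃ L, L = Lap v x := ⟨_, rfl⟩
  obtain ⟨T, hT⟩ : ∃ T, T = Tri v v v x := ⟨_, rfl⟩
  rw [← hL, ← hT] at h ⊢
  have e1 : Q ^ (α / 2) = Q ^ ((α - s) / 2) * Q ^ (s / 2) := by
    rw [← Real.rpow_add hQ]; congr 1; ring
  have e2 : Q ^ s = (Q ^ (s / 2)) ^ 2 := by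
    rw [← Real.rpow_natCast (Q ^ (s / 2)), ← Real.rpow_mul hQ.le]; congr 1; push_cast; ring
  have e3 : Q ^ ((α - s) / 2) ≤ N ^ ((α - s) / 2) := Real.rpow_le_rpow hQ.le hN (by linarith)
  have e4 : Q ^ (α / 2) ≤ N ^ (α / 2) := Real.rpow_le_rpow hQ.le hN (by linarith)
  have p1 : 0 ≤ Q ^ (α / 2) := Real.rpow_nonneg hQ.le _
  have p2 : 0 ≤ Q ^ ((α - s) / 2) := Real.rpow_nonneg hQ.le _
  have p3 : 0 ≤ Q ^ (s / 2) := Real.rpow_nonneg hQ.le _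
  have a1 : |T + γ| ≤ e + e * |L| := by
    have : T + γ = (T + e * L + γ) - e * L := by ring
    rw [this]
    refine (abs_sub _ _).trans (add_le_add h ?_)
    rw [abs_mul, abs_of_pos he]
  have a2 : δ * (Q ^ (s / 2) * |L|) ≤ 1 + e * (Q ^ s * L ^ 2) := by
    rw [e2, hδe, ← sq_abs L]
    nlinarith only [sq_nonneg (δ * (Q ^ (s / 2) * |L|) - 1), sq_nonneg (δ * (Q ^ (s / 2) * |L|))]
  have a3 : e ≤ δ := by
    rw [hδe, pow_two]; exact mul_le_of_le_one_left hδ0 hδ1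
  rw [abs_mul, abs_of_nonneg p1]
  calc Q ^ (α / 2) * |T + γ| ≤ Q ^ (α / 2) * (e + e * |L|) := mul_le_mul_of_nonneg_left a1 p1
    _ = Q ^ (α / 2) * e + δ * (Q ^ ((α - s) / 2) * (δ * (Q ^ (s / 2) * |L|))) := by rw [mul_add, e1, hδe]; ring
    _ ≤ N ^ (α / 2) * δ + δ * (N ^ ((α - s) / 2) * (1 + e * (Q ^ s * L ^ 2))) := by gcongr
    _ = _ := by ring

end LocalResult

section Core

variable {K K' : TopologicalSpace.Compacts E2} {f u : E2 → ℝ} {M C₀ : ℝ} {ε : ℕ → ℝ} {v g : ℕ → Sm}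

/-- The conclusion of the theorem on a compact set. -/
structure LocalResult (f u : E2 → ℝ) (α : ℝ) (K : TopologicalSpace.Compacts E2) (G : Fin 2 → E2 → ℝ) : Prop where
  meas : ∀ i, Measurable (G i)
  sq : ∀ i, IntegrableOn (fun x => G i x ^ 2) K
  int : IntegrableOn (fun x => gradSq u x ^ (α - 3)) K
  bdd : ∃ N, ∀ x ∈ K, gradSq u x ≤ N
  weak : ∀ ψ : Sm, (∀ x ∉ K, ψ x = 0) → ∀ i,
    ∫ x in (K : Set E2), gradSq u x ^ (α / 2) * D i ψ x = -∫ x in (K : Set E2), G i x * ψ x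
  le : ∀ᵐ x ∂volume.restrict (K : Set E2),
    gradSq u x ^ (α - 3) ≤ 1 / α * (1 / f x ^ 2) * (G 0 x ^ 2 + G 1 x ^ 2)

lemma gradSq_nonneg (u : E2 → ℝ) (x : E2) : 0 ≤ gradSq u x :=
  Finset.sum_nonneg fun _ _ => sq_nonneg _

lemma pd_sq_le_gradSq (u : E2 → ℝ) (i : Fin 2) (x : E2) : pd i u x ^ 2 ≤ gradSq u x :=
  Finset.single_le_sum (f := fun i => pd i u x ^ 2) (fun _ _ => sq_nonneg _) (Finset.mem_univ i)

theorem Approx.core (h : Approx K f u M C₀ ε v g) (hK : (K' : Set E2) ⊆ interior K)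
    (hlim : ∀ᵐ x, x ∈ interior (K : Set E2) →
      ∀ i, Filter.Tendsto (fun n => D i (v n) x) Filter.atTop (nhds (pd i u x)))
    {α s m C : ℝ} (hα : 3 / 2 < α) (hs0 : s < 0) (hsα : s + 2 ≤ α) (hm : 0 < m)
    (hfm : ∀ x ∈ K, m ≤ |f x|)
    (hC1 : ∀ n, JS K' (rp (rq (ε n) (v n)) (rq_pos (h.pos n) _) s * dd 1 (dd 1 (v n))) ≤ C)
    (hC2 : ∀ n, ε n * JS K' (rp (rq (ε n) (v n)) (rq_pos (h.pos n) _) s * Lap (v n) ^ 2) ≤ C)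
    (hC3 : ∀ n, JS K' (rp (rq (ε n) (v n)) (rq_pos (h.pos n) _) (s - 1)) ≤ C) :
    ∃ G, LocalResult f u α K' G := by
  have hKK : (K' : Set E2) ⊆ K := hK.trans interior_subset
  have hmeas : MeasurableSet (K' : Set E2) := K'.isCompact.isClosed.measurableSet
  have hae : ∀ {P : E2 → Prop}, (∀ x ∈ K', P x) → ∀ᵐ x ∂volume.restrict (K' : Set E2), P x :=
    fun hP => (ae_restrict_mem hmeas).mono hP
  have : IsFiniteMeasure (volume.restrict (K' : Set E2)) :=
    ⟨by rw [Measure.restrict_apply_univ]; exact K'.isCompact.measure_lt_top⟩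
  have hlim' : ∀ᵐ x ∂volume.restrict (K' : Set E2), ∀ i,
      Filter.Tendsto (fun n => D i (v n) x) Filter.atTop (nhds (pd i u x)) := by
    filter_upwards [ae_restrict_of_ae hlim, ae_restrict_mem hmeas] with x h1 h2 using h1 (hK h2)
  obtain ⟨N, hN⟩ : ∃ N, N = M ^ 2 + 1 := ⟨_, rfl⟩
  have hN1 : 1 ≤ N := by rw [hN]; linarith [sq_nonneg M]
  have hQpos := fun n => rq_pos (h.pos n) (v n)
  have hQN : ∀ n, ∀ x ∈ K', rq (ε n) (v n) x ≤ N := fun n x hx => hN ▸ h.rq_le n (hKK hx)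
  have hQlim : ∀ᵐ x ∂volume.restrict (K' : Set E2),
      Filter.Tendsto (fun n => rq (ε n) (v n) x) Filter.atTop (nhds (gradSq u x)) :=
    hlim'.mono fun x hx => h.tendsto_rq hx
  have hqN : ∀ x ∈ K', gradSq u x ≤ N := fun x hx => (h.gradSq_le (hK hx)).trans (by linarith)
  have hqm := measurable_gradSq u
  have hInt : ∀ w : Sm, Integrable w (volume.restrict (K' : Set E2)) := fun w => integrableOn_compacts w.continuous
  obtain ⟨hqpos, hqint⟩ := integrable_rpow_of_tendsto (μ := volume.restrict (K' : Set E2))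
    (Q := fun n => rq (ε n) (v n)) (t := s - 1) (C := C) (by linarith)
    hQpos (fun n => (rq (ε n) (v n)).continuous.measurable) hqm
    (fun n => hInt (rp _ (hQpos n) (s - 1))) hC3 hQlim
  have hqα := integrable_rpow_of_le (t' := α - 3) (by linarith) hqm hqpos (hae hqN) hqint
  -- the gradients of `Q ^ (α / 2)`
  obtain ⟨X, hX⟩ : ∃ X : Fin 2 → ℕ → Sm, X = fun i n => D i (rp (rq (ε n) (v n)) (hQpos n) (α / 2)) := ⟨_, rfl⟩
  have hXmem : ∀ i n, MemLp (X i n) 2 (volume.restrict (K' : Set E2)) := fun i n =>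
    (memLp_two_iff_integrable_sq (X i n).continuous.aestronglyMeasurable).2 (hInt (X i n ^ 2))
  obtain ⟨B, hB⟩ : ∃ B, B = α ^ 2 / 4 * N ^ (α - 2 - s) * C := ⟨_, rfl⟩
  have hXB : ∀ i n, ∫ x in (K' : Set E2), X i n x ^ 2 ≤ B := fun i n => by
    have h1 : JS K' (X i n ^ 2) ≤ JS K' (cst (α ^ 2 / 4 * N ^ (α - 2 - s)) *
        (rp (rq (ε n) (v n)) (hQpos n) s * dd 1 (dd 1 (v n)))) := JS_mono fun x hx => by
      rw [hX, Sm.pow_apply, Sm.mul_apply, Sm.mul_apply, cst_apply, rp_apply]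
      exact D_rp_sq_le (h.pos n) (v n) x (hQN n x hx) hsα i
    rw [← smul_eq_cst, map_smul, smul_eq_mul] at h1
    rw [hB]
    exact h1.trans (mul_le_mul_of_nonneg_left (hC1 n) (by positivity))
  choose G hGm hGL hG using fun i => exists_weak_limit (hXmem i) (hXB i)
  refine ⟨G, hGm, fun i => (hGL i).integrable_sq, hqα, ⟨N, hqN⟩, fun ψ hψ i => ?_, ?_⟩
  · -- weak gradient
    have h1 : Filter.Tendsto (fun n => ∫ x in (K' : Set E2), rq (ε n) (v n) x ^ (α / 2) * D i ψ x) Filter.atTop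
        (nhds (∫ x in (K' : Set E2), gradSq u x ^ (α / 2) * D i ψ x)) := by
      refine tendsto_integral_of_dominated_convergence (fun x => N ^ (α / 2) * |D i ψ x|)
        (fun n => (hInt (rp _ (hQpos n) (α / 2) * D i ψ)).aestronglyMeasurable) ((hInt (D i ψ)).abs.const_mul _)
        (fun n => hae fun x hx => ?_) ?_
      · rw [Real.norm_eq_abs, abs_mul, abs_of_nonneg (Real.rpow_nonneg (hQpos n x).le _)]
        exact mul_le_mul_of_nonneg_right (Real.rpow_le_rpow (hQpos n x).le (hQN n x hx) (by linarith)) (abs_nonneg _)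
      · filter_upwards [hQlim] with x hx
        exact (hx.rpow_const (Or.inr (by linarith))).mul_const _
    have hψL : MemLp ψ 2 (volume.restrict (K' : Set E2)) :=
      (memLp_two_iff_integrable_sq ψ.continuous.aestronglyMeasurable).2 (hInt (ψ ^ 2))
    have h2 := (hG i ψ hψL).neg
    refine tendsto_nhds_unique (h1.mono_left Nat.hyperfilter_le_atTop) (h2.congr fun n => ?_)
    have := JS_ibp (K := K') (v := rp _ (hQpos n) (α / 2)) (w := ψ) (fun x hx => by rw [hψ x hx, mul_zero]) i
    rw [hX]
    exact this.symm
  · -- the scalar identity in the limit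
    obtain ⟨F, hF0, hF⟩ := h.exists_bound
    have hfF : ∀ x ∈ K', |f x| ≤ F := fun x hx =>
      le_of_tendsto' (h.tendstof (hKK hx)).abs fun n => (hF n x (hKK hx)).1
    have hM := h.M_pos
    have hpM : ∀ i, ∀ x ∈ K', |pd i u x| ≤ M := fun i x hx =>
      abs_le_of_sq_le_sq ((pd_sq_le_gradSq u i x).trans (h.gradSq_le (hK hx))) hM.le
    have hNα : 0 ≤ N ^ (α / 2) := Real.rpow_nonneg (by linarith) _
    obtain ⟨A, hA⟩ : ∃ A, A = N * M + α * (N ^ (α / 2) * F) := ⟨_, rfl⟩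
    have hA1 : N * M ≤ A := by rw [hA]; have : 0 ≤ α * (N ^ (α / 2) * F) := by positivity
                               linarith
    have hA2 : α * (N ^ (α / 2) * F) ≤ A := by rw [hA]; have : 0 ≤ N * M := by positivity
                                               linarith
    have hbound : ∀ {Q y : ℝ}, 0 ≤ Q → Q ≤ N → |y| ≤ F → |-α * (Q ^ (α / 2) * y)| ≤ A := fun {Q y} h0 h1 h2 => by
      rw [abs_mul, abs_neg, abs_of_pos (by linarith : 0 < α), abs_mul, abs_of_nonneg (Real.rpow_nonneg h0 _)]
      refine le_trans ?_ hA2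
      have := Real.rpow_le_rpow h0 h1 (by linarith : 0 ≤ α / 2)
      gcongr
    have hbound' : ∀ {Q y : ℝ}, 0 ≤ Q → Q ≤ N → |y| ≤ M → |Q * y| ≤ A := fun {Q y} h0 h1 h2 => by
      rw [abs_mul, abs_of_nonneg h0]
      refine le_trans ?_ hA1
      gcongr
    obtain ⟨e, he⟩ : ∃ e : ℕ → Sm, e = fun n => cst α * (rp _ (hQpos n) (α / 2) * (Tri (v n) (v n) (v n) + g n)) := ⟨_, rfl⟩
    have hee : ∀ n, ∫ x in (K' : Set E2), |e n x| ≤ Real.sqrt (ε n) * (α * ((N ^ (α / 2) + N ^ ((α - s) / 2)) *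
        JS K' 1 + N ^ ((α - s) / 2) * C)) := fun n => by
      obtain ⟨W, hW⟩ : ∃ W, W = rp _ (hQpos n) s * Lap (v n) ^ 2 := ⟨_, rfl⟩
      obtain ⟨y, hy⟩ : ∃ y : Sm, y = cst (α * Real.sqrt (ε n)) * (cst (N ^ (α / 2) + N ^ ((α - s) / 2)) * 1 +
        cst (N ^ ((α - s) / 2)) * (cst (ε n) * W)) := ⟨_, rfl⟩
      have h1 : ∫ x in (K' : Set E2), |e n x| ≤ JS K' y := by
        refine setIntegral_mono_on (hInt (e n)).abs (hInt y) hmeas fun x hx => ?_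
        have h2 := abs_error_le (α := α) (s := s) (h.pos n) (h.eps_le_one n) (by linarith) (by linarith) hN1 (v n) x
          (hQN n x hx) (γ := g n x) (h.eq n x (hKK hx))
        rw [he, hy, hW]
        simp only [Sm.mul_apply, Sm.add_apply, cst_apply, rp_apply, Sm.one_apply, Sm.pow_apply]
        rw [abs_mul, abs_of_pos (by linarith : 0 < α)]
        refine (mul_le_mul_of_nonneg_left h2 (by linarith : 0 ≤ α)).trans (le_of_eq ?_)
        ring
      have hsm : ∀ (a : ℝ) (y : Sm), JS K' (cst a * y) = a * JS K' y := fun a y => by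
        rw [← smul_eq_cst, map_smul, smul_eq_mul]
      have h3 := hC2 n
      rw [← hW] at h3
      rw [hy, hsm, map_add, hsm, hsm, hsm] at h1
      refine h1.trans ?_
      have : N ^ ((α - s) / 2) * (ε n * JS K' W) ≤ N ^ ((α - s) / 2) * C := by gcongr
      calc _ ≤ α * Real.sqrt (ε n) * ((N ^ (α / 2) + N ^ ((α - s) / 2)) * JS K' 1 + N ^ ((α - s) / 2) * C) := by gcongr
        _ = _ := by ring
    have he0 : Filter.Tendsto (fun n => ∫ x in (K' : Set E2), |e n x|) Filter.atTop (nhds 0) := by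
      refine squeeze_zero (fun n => integral_nonneg fun x => abs_nonneg _) hee ?_
      have := h.tendsto_ε.sqrt.mul_const (α * ((N ^ (α / 2) + N ^ ((α - s) / 2)) * JS K' 1 + N ^ ((α - s) / 2) * C))
      simpa using this
    have hfmeas : AEStronglyMeasurable f (volume.restrict (K' : Set E2)) :=
      (h.continuousOnf.mono hKK).aestronglyMeasurable hmeas
    have key := weak_identity (μ := volume.restrict (K' : Set E2)) (X := fun i n => X i n)
      (w := fun i n x => rq (ε n) (v n) x * D i (v n) x) (G := G) (z := fun i x => gradSq u x * pd i u x)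
      (b := fun n x => -α * (rq (ε n) (v n) x ^ (α / 2) * g n x)) (e := fun n => e n)
      (β := fun x => -α * (gradSq u x ^ (α / 2) * f x)) (B := A) (C := B) hXmem hXB hGL hG
      (fun i n => (rq (ε n) (v n) * D i (v n)).continuous.measurable)
      (fun i => hqm.mul (measurable_pd u i))
      (fun i n => hae fun x hx => hbound' (hQpos n x).le (hQN n x hx) (h.abs_D_le n i (hKK hx)))
      (fun i => hae fun x hx => hbound' (gradSq_nonneg u x) (hqN x hx) (hpM i x hx))
      (fun i => by filter_upwards [hQlim, hlim'] with x h1 h2 using h1.mul (h2 i))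
      (fun n => (cst (-α) * (rp _ (hQpos n) (α / 2) * g n)).continuous.measurable)
      (((hqm.pow_const _).aestronglyMeasurable.mul hfmeas).const_mul _)
      (fun n => hae fun x hx => hbound (hQpos n x).le (hQN n x hx) (hF n x (hKK hx)).1)
      (hae fun x hx => hbound (gradSq_nonneg u x) (hqN x hx) (hfF x hx))
      (by
        filter_upwards [hQlim, ae_restrict_mem hmeas] with x h1 h2
        exact ((h1.rpow_const (Or.inr (by linarith))).mul (h.tendstof (hKK h2))).const_mul _)
      (fun n => hInt (e n)) he0 (fun n => .of_forall fun x => by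
        have := D_rp_mul_D (h.pos n) α (v n) x
        simp only [hX, he, Sm.mul_apply, Sm.add_apply, cst_apply, rp_apply]
        rw [this]; ring)
    filter_upwards [key, hqpos, ae_restrict_mem hmeas] with x h1 h2 h3
    refine rpow_le_of_cauchy (by linarith) h2 (hm.trans_le (hfm x (hKK h3))) ?_ h1
    rw [gradSq, Fin.sum_univ_two]

end Core

section LocalTheorem

theorem exists_localResult {Ω : Set E2} (hΩ : IsOpen Ω) {f u : E2 → ℝ} (hfBV : BVloc f Ω)
    (hfC : ContinuousOn f Ω) (hfpos : ∀ x ∈ Ω, 0 < |f x|) (huC : ContinuousOn u Ω)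
    (hvisc : IsViscositySol Ω f u) (hu : ∀ᵐ x, x ∈ Ω → DifferentiableAt ℝ u x) {α : ℝ} (hα : 3 / 2 < α)
    (K' : TopologicalSpace.Compacts E2) (hK' : (K' : Set E2) ⊆ Ω) : ∃ G, LocalResult f u α K' G := by
  obtain ⟨K, hKc, hKK, hKΩ⟩ := exists_compact_between K'.isCompact hΩ hK'
  lift K to TopologicalSpace.Compacts E2 using hKc
  obtain ⟨M, C₀, ε, v, g, h⟩ := exists_approx K hΩ hKΩ hfBV hfC huC hvisc
  obtain ⟨φ, hφ, hlim⟩ := h.exists_subseq (hu.mono fun x hx hxK => hx (hKΩ (interior_subset hxK)))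
  obtain ⟨m, hm, hfm⟩ := K.isCompact.exists_forall_le' (hfC.mono hKΩ).abs fun x hx => hfpos x (hKΩ hx)
  obtain ⟨s, hs⟩ : ∃ s, s = min α (7 / 4) - 2 := ⟨_, rfl⟩
  have hs1 : -(1 / 2) < s := by
    have := lt_min hα (by norm_num : (3 : ℝ) / 2 < 7 / 4)
    linarith
  have hs0 : s < 0 := by linarith [min_le_right α (7 / 4)]
  have hsα : s + 2 ≤ α := by linarith [min_le_left α (7 / 4)]
  obtain ⟨C, hC⟩ := (h.comp hφ).eventually_bounds hs1 hs0 hKK hm hfm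
  obtain ⟨n₀, hn₀⟩ := Filter.eventually_atTop.1 hC
  have hshift : StrictMono fun n => n + n₀ := fun a b hab => Nat.add_lt_add_right hab n₀
  refine ((h.comp hφ).comp hshift).core hKK (hlim.mono fun x hx hxK i => ?_) hα hs0 hsα hm hfm
    (fun n => (hn₀ (n + n₀) (Nat.le_add_left _ _)).1) (fun n => (hn₀ (n + n₀) (Nat.le_add_left _ _)).2.1)
    (fun n => (hn₀ (n + n₀) (Nat.le_add_left _ _)).2.2)
  exact (hx hxK i).comp hshift.tendsto_atTop

end LocalTheorem

section Glue

/-- Exhaustion of a bounded open set. -/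
lemma exists_exhaustion {Ω : Set E2} (hΩ : IsOpen Ω) (hb : Bornology.IsBounded Ω) :
    ∃ (V : ℕ → Set E2) (K : ℕ → TopologicalSpace.Compacts E2), (∀ m, IsOpen (V m)) ∧ Monotone V ∧
      (∀ m, V m ⊆ K m) ∧ (∀ m, (K m : Set E2) ⊆ Ω) ∧
      ∀ L ⊆ Ω, IsCompact L → ∃ m, L ⊆ V m := by
  have hne : (Ωᶜ).Nonempty := by
    by_contra h
    rw [Set.not_nonempty_iff_eq_empty, Set.compl_empty_iff] at h
    exact NormedSpace.unbounded_univ ℝ E2 (h ▸ hb)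
  have hcont : Continuous fun x : E2 => infDist x Ωᶜ := continuous_infDist_pt _
  have hpos : ∀ m : ℕ, (0 : ℝ) < 1 / (m + 1) := fun m => by positivity
  have hmem : ∀ x, 0 < infDist x Ωᶜ → x ∈ Ω := fun x hx => by
    by_contra h
    exact hx.ne' (infDist_zero_of_mem h)
  have hsub : ∀ m : ℕ, {x | 1 / ((m : ℝ) + 1) ≤ infDist x Ωᶜ} ⊆ Ω := fun m x hx =>
    hmem x ((hpos m).trans_le hx)
  refine ⟨fun m => {x | 1 / ((m : ℝ) + 1) < infDist x Ωᶜ},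
    fun m => ⟨{x | 1 / ((m : ℝ) + 1) ≤ infDist x Ωᶜ},
      Metric.isCompact_of_isClosed_isBounded (isClosed_le continuous_const hcont) (hb.subset (hsub m))⟩,
    fun m => isOpen_lt continuous_const hcont, fun a b hab x hx => ?_, fun m x hx => le_of_lt (α := ℝ) hx, hsub,
    fun L hL hLc => ?_⟩
  · have hx' : 1 / ((a : ℝ) + 1) < infDist x Ωᶜ := hx
    refine lt_of_le_of_lt (b := 1 / ((a : ℝ) + 1)) ?_ hx'
    have : (a : ℝ) ≤ b := Nat.cast_le.2 hab
    gcongr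
  · obtain ⟨a, ha, hLa⟩ := hLc.exists_forall_le' hcont.continuousOn (a := 0) fun x hx =>
      (hΩ.isClosed_compl.notMem_iff_infDist_pos hne).1 fun h => h (hL hx)
    obtain ⟨m, hm⟩ := exists_nat_one_div_lt ha
    exact ⟨m, fun x hx => hm.trans_le (hLa x hx)⟩

lemma LocalResult.memLp {f u : E2 → ℝ} {α : ℝ} {K : TopologicalSpace.Compacts E2} {G : Fin 2 → E2 → ℝ}
    (h : LocalResult f u α K G) (i : Fin 2) : MemLp (G i) 2 (volume.restrict (K : Set E2)) :=
  (memLp_two_iff_integrable_sq (h.meas i).aestronglyMeasurable).2 (h.sq i)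

lemma LocalResult.integrableOn {f u : E2 → ℝ} {α : ℝ} {K : TopologicalSpace.Compacts E2} {G : Fin 2 → E2 → ℝ}
    (h : LocalResult f u α K G) (i : Fin 2) : IntegrableOn (G i) K := by
  have : IsFiniteMeasure (volume.restrict (K : Set E2)) :=
    ⟨by rw [Measure.restrict_apply_univ]; exact K.isCompact.measure_lt_top⟩
  exact (h.memLp i).integrable one_le_two

lemma LocalResult.weak_integral {f u : E2 → ℝ} {α : ℝ} {K : TopologicalSpace.Compacts E2} {G : Fin 2 → E2 → ℝ}
    (h : LocalResult f u α K G) {ψ : Sm} (hψ : tsupport ψ ⊆ K) (i : Fin 2) :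
    ∫ x, gradSq u x ^ (α / 2) * D i ψ x = -∫ x, G i x * ψ x := by
  have h0 : ∀ x ∉ K, ψ x = 0 := fun x hx => image_eq_zero_of_notMem_tsupport fun h' => hx (hψ h')
  have h1 : ∀ x ∉ K, D i ψ x = 0 := fun x hx => by
    rw [D_apply']
    have : fderiv ℝ ψ x = 0 := image_eq_zero_of_notMem_tsupport fun h' => hx (hψ (tsupport_fderiv_subset ℝ h'))
    rw [this]; rfl
  have h2 := h.weak ψ h0 i
  rwa [setIntegral_eq_integral_of_forall_compl_eq_zero fun x hx => by rw [h1 x hx, mul_zero],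
    setIntegral_eq_integral_of_forall_compl_eq_zero fun x hx => by rw [h0 x hx, mul_zero]] at h2

lemma LocalResult.unique {f u : E2 → ℝ} {α : ℝ} {K K' : TopologicalSpace.Compacts E2} {G G' : Fin 2 → E2 → ℝ}
    (h : LocalResult f u α K G) (h' : LocalResult f u α K' G') {V : Set E2} (hV : IsOpen V) (hVK : V ⊆ K)
    (hVK' : V ⊆ K') (i : Fin 2) : ∀ᵐ x, x ∈ V → G i x = G' i x := by
  have hi := (h.integrableOn i).mono_set hVK
  have hi' := (h'.integrableOn i).mono_set hVK'
  have := hV.ae_eq_zero_of_integral_contDiff_smul_eq_zero (μ := volume) (f := fun x => G i x - G' i x)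
    (hi.sub hi').locallyIntegrableOn fun φ hφ hc hs => by
      obtain ⟨ψ, hψ⟩ : ∃ ψ : Sm, (ψ : E2 → ℝ) = φ := ⟨⟨φ, hφ⟩, rfl⟩
      rw [← hψ] at hs ⊢
      have e1 := h.weak_integral (hs.trans hVK) i
      have e2 := h'.weak_integral (hs.trans hVK') i
      have hz : ∀ x ∉ V, ψ x = 0 := fun x hx => image_eq_zero_of_notMem_tsupport fun h' => hx (hs h')
      have hInt : ∀ {w : E2 → ℝ}, IntegrableOn w V → Integrable fun x => w x * ψ x := fun {w} hw => by
        obtain ⟨B, hB⟩ := ψ.continuous.bounded_above_of_compact_support (hψ ▸ hc)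
        refine (integrableOn_iff_integrable_of_support_subset (s := V) fun x hx => ?_).1
          (hw.mul_bdd (c := B) ψ.continuous.aestronglyMeasurable (.of_forall hB))
        by_contra hxV
        exact hx (by simp [hz x hxV])
      have e3 : ∀ x, ψ x • (G i x - G' i x) = G i x * ψ x - G' i x * ψ x := fun x => by
        rw [smul_eq_mul]; ring
      simp only [e3]
      rw [integral_sub (hInt hi) (hInt hi')]
      linarith
  exact this.mono fun x hx hxV => sub_eq_zero.1 (hx hxV)

/-- The glued gradient. -/
lemma exists_glue {f u : E2 → ℝ} {α : ℝ} {V : ℕ → Set E2} {K : ℕ → TopologicalSpace.Compacts E2}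
    {G : ℕ → Fin 2 → E2 → ℝ} (hV : ∀ m, IsOpen (V m)) (hmono : Monotone V) (hVK : ∀ m, V m ⊆ K m)
    (h : ∀ m, LocalResult f u α (K m) (G m)) :
    ∃ H : E2 → E2, ∀ m, ∀ᵐ x, x ∈ V m → ∀ i, H x i = G m i x := by
  classical
  refine ⟨fun x => WithLp.toLp 2 fun i => if hx : ∃ m, x ∈ V m then G (Nat.find hx) i x else 0, fun m => ?_⟩
  have h1 : ∀ᵐ x, ∀ j : ℕ, j ≤ m → ∀ i, x ∈ V j → G j i x = G m i x := by
    rw [ae_all_iff]; intro j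
    by_cases hj : j ≤ m
    · have : ∀ᵐ x, ∀ i, x ∈ V j → G j i x = G m i x := ae_all_iff.2 fun i =>
        (h j).unique (h m) (hV j) (hVK j) ((hmono hj).trans (hVK m)) i
      exact this.mono fun x hx _ => hx
    · exact .of_forall fun x hx => absurd hx hj
  filter_upwards [h1] with x hx hxm i
  have hex : ∃ m, x ∈ V m := ⟨m, hxm⟩
  simp only [dif_pos hex]
  exact hx _ (Nat.find_min' hex hxm) i (Nat.find_spec hex)

end Glue

/-- For a viscosity solution `u` of `-Δ_∞ u = f` on a bounded domain
`Ω ⊆ ℝ²` with `f ∈ BV_loc(Ω) ∩ C⁰(Ω)`, `|f| > 0`, and `α > 3/2`: `|Du|^{2α-6}` is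
locally integrable on `Ω` and is bounded a.e. by `(1/α) f⁻² |D|Du|^α|²`, where the
weak gradient `D|Du|^α` exists in `L²_loc(Ω;ℝ²)`. -/
theorem statement3 (Ω : Set E2) (hΩo : IsOpen Ω) (hΩb : Bornology.IsBounded Ω)
    (hΩc : IsConnected Ω) (f u : E2 → ℝ)
    (hfBV : BVloc f Ω) (hfC : ContinuousOn f Ω) (hfpos : ∀ x ∈ Ω, 0 < |f x|)
    (huC : ContinuousOn u Ω) (hvisc : IsViscositySol Ω f u)
    (g : E2 → E2) (hg : ∀ᵐ x ∂(volume : Measure E2), x ∈ Ω → HasGradientAt u (g x) x)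
    (α : ℝ) (hα : 3 / 2 < α) :
    (∀ K : Set E2, K ⊆ Ω → IsCompact K →
        IntegrableOn (fun x => ‖g x‖ ^ (2 * α - 6)) K volume) ∧
    ∃ G : E2 → E2, HasWeakGradOn (fun x => ‖g x‖ ^ α) G Ω ∧ MemLpLocOn G 2 Ω ∧
      ∀ᵐ x ∂(volume : Measure E2), x ∈ Ω →
        ‖g x‖ ^ (2 * α - 6) ≤ (1 / α) * (1 / f x ^ 2) * ‖G x‖ ^ 2 := by
  have hsq : ∀ᵐ x, x ∈ Ω → ‖g x‖ ^ (2 : ℝ) = gradSq u x := hg.mono fun x hx hxΩ => by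
    rw [Real.rpow_two, ← E2.norm_gradient_sq, (hx hxΩ).gradient]
  have hpow : ∀ (t t' : ℝ), 2 * t = t' → ∀ᵐ x, x ∈ Ω → ‖g x‖ ^ t' = gradSq u x ^ t := fun t t' ht =>
    hsq.mono fun x hx hxΩ => by rw [← hx hxΩ, ← Real.rpow_mul (norm_nonneg _), ht]
  have hpow1 := hpow (α - 3) (2 * α - 6) (by ring)
  have hpow2 := hpow (α / 2) α (by ring)
  obtain ⟨V, K, hV, hmono, hVK, hKΩ, hex⟩ := exists_exhaustion hΩo hΩb
  choose G hG using fun m => exists_localResult hΩo hfBV hfC hfpos huC hvisc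
    (hg.mono fun x hx hxΩ => (hx hxΩ).differentiableAt) hα (K m) (hKΩ m)
  obtain ⟨H, hH⟩ := exists_glue hV hmono hVK hG
  have hVm : ∀ {m} {L : Set E2}, L ⊆ V m → IsCompact L → ∀ {a b : E2 → ℝ}, (∀ᵐ x, x ∈ V m → a x = b x) →
      IntegrableOn b (K m) → IntegrableOn a L := fun {m L} hL hLc a b hab hb =>
    (hb.mono_set (hL.trans (hVK m))).congr (by
      filter_upwards [ae_restrict_of_ae hab, ae_restrict_mem hLc.isClosed.measurableSet] with x h1 h2
      exact (h1 (hL h2)).symm)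
  have hVΩ : ∀ m, V m ⊆ Ω := fun m => (hVK m).trans (hKΩ m)
  have hnorm : ∀ m, ∀ᵐ x, x ∈ V m → ‖H x‖ ^ 2 = G m 0 x ^ 2 + G m 1 x ^ 2 := fun m =>
    (hH m).mono fun x hx hxV => by rw [E2.norm_sq, hx hxV, hx hxV]
  have hL2 : ∀ L ⊆ Ω, IsCompact L → IntegrableOn (fun x => ‖H x‖ ^ 2) L := fun L hL hLc => by
    obtain ⟨m, hm⟩ := hex L hL hLc
    exact hVm hm hLc (hnorm m) (((hG m).sq 0).add ((hG m).sq 1))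
  refine ⟨fun L hL hLc => ?_, H, ⟨?_, ?_, fun φ hφ hφc hφΩ i => ?_⟩, fun L hL hLc => ?_, ?_⟩
  · obtain ⟨m, hm⟩ := hex L hL hLc
    exact hVm hm hLc (hpow1.mono fun x hx hxV => hx (hVΩ m hxV)) (hG m).int
  · refine (locallyIntegrableOn_iff hΩo.isLocallyClosed).2 fun L hL hLc => ?_
    obtain ⟨m, hm⟩ := hex L hL hLc
    refine hVm hm hLc (hpow2.mono fun x hx hxV => hx (hVΩ m hxV)) ?_
    obtain ⟨N, hN⟩ := (hG m).bdd
    refine IntegrableOn.of_bound (C := N ^ (α / 2)) (K m).isCompact.measure_lt_top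
      ((measurable_gradSq u).pow_const _).aestronglyMeasurable
      ((ae_restrict_mem (K m).isCompact.isClosed.measurableSet).mono fun x hx => ?_)
    rw [Real.norm_of_nonneg (Real.rpow_nonneg (gradSq_nonneg u x) _)]
    exact Real.rpow_le_rpow (gradSq_nonneg u x) (hN x hx) (by linarith)
  · refine (locallyIntegrableOn_iff hΩo.isLocallyClosed).2 fun L hL hLc => ?_
    obtain ⟨m, hm⟩ := hex L hL hLc
    refine hVm (b := fun x => Real.sqrt (G m 0 x ^ 2 + G m 1 x ^ 2)) hm hLc
      ((hnorm m).mono fun x hx hxV => by rw [← hx hxV, Real.sqrt_sq (norm_nonneg _)]) ?_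
    refine Integrable.mono' (((hG m).integrableOn 0).abs.add ((hG m).integrableOn 1).abs)
      (((((hG m).meas 0).pow_const 2).add (((hG m).meas 1).pow_const 2)).sqrt).aestronglyMeasurable
      (.of_forall fun x => ?_)
    rw [Real.norm_of_nonneg (Real.sqrt_nonneg _)]
    refine Real.sqrt_le_iff.2 ⟨add_nonneg (abs_nonneg _) (abs_nonneg _), ?_⟩
    simp only [Pi.add_apply]
    rw [← sq_abs (G m 0 x), ← sq_abs (G m 1 x)]
    nlinarith only [mul_nonneg (abs_nonneg (G m 0 x)) (abs_nonneg (G m 1 x))]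
  · obtain ⟨m, hm⟩ := hex _ hφΩ hφc
    obtain ⟨ψ, hψ⟩ : ∃ ψ : Sm, (ψ : E2 → ℝ) = φ := ⟨⟨φ, hφ⟩, rfl⟩
    rw [← hψ] at hm ⊢
    have h0 : ∀ x ∉ V m, ψ x = 0 := fun x hx => image_eq_zero_of_notMem_tsupport fun h' => hx (hm h')
    have h1 : ∀ x ∉ V m, pd i ψ x = 0 := fun x hx => by
      have : fderiv ℝ ψ x = 0 :=
        image_eq_zero_of_notMem_tsupport fun h' => hx (hm (tsupport_fderiv_subset ℝ h'))
      rw [pd, this]; rfl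
    rw [setIntegral_eq_integral_of_forall_compl_eq_zero fun x hx => by
        rw [h1 x fun h' => hx (hVΩ m h'), mul_zero],
      setIntegral_eq_integral_of_forall_compl_eq_zero fun x hx => by
        rw [h0 x fun h' => hx (hVΩ m h'), mul_zero]]
    have h2 := (hG m).weak_integral (hm.trans (hVK m)) i
    have e1 : ∫ x, ‖g x‖ ^ α * pd i ψ x = ∫ x, gradSq u x ^ (α / 2) * D i ψ x :=
      integral_congr_ae (hpow2.mono fun x hx => by
        by_cases hxV : x ∈ V m
        · simp only [hx (hVΩ m hxV), D_apply]
        · simp only [D_apply, h1 x hxV, mul_zero])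
    have e2 : ∫ x, H x i * ψ x = ∫ x, G m i x * ψ x :=
      integral_congr_ae ((hH m).mono fun x hx => by
        by_cases hxV : x ∈ V m
        · simp only [hx hxV]
        · simp only [h0 x hxV, mul_zero])
    rw [e1, e2, h2]
  · simpa only [Real.rpow_two] using hL2 L hL hLc
  · have h1 : ∀ᵐ x, ∀ m, x ∈ V m → gradSq u x ^ (α - 3) ≤ 1 / α * (1 / f x ^ 2) * ‖H x‖ ^ 2 :=
      ae_all_iff.2 fun m => by
        have := (ae_restrict_iff' (K m).isCompact.isClosed.measurableSet).1 (hG m).le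
        filter_upwards [this, hnorm m] with x h1 h2 hxV
        rw [h2 hxV]
        exact h1 (hVK m hxV)
    filter_upwards [h1, hpow1] with x h2 h3 hxΩ
    obtain ⟨m, hm⟩ := hex {x} (Set.singleton_subset_iff.2 hxΩ) isCompact_singleton
    rw [h3 hxΩ]
    exact h2 m (hm rfl)
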